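/- For every integer k ≥ 2 there exist constants c > 0 and C > 0 (depending only on k) such that for all N ≥ 3 one has ‖μ‖_{U^k([N])} ≤ C·(log log N)^{−c}, where μ is the Möbius function. -/

import Mathlib

open scoped Classical

noncomputable section

/-- The product of conjugated shifts appearing in the Gowers norm over an additive group. -/
def gowersProd {G : Type*} [AddCommGroup G] (k : ℕ) (f : G → ℂ) (n : G) (h : Fin k → G) : ℂ :=
  ∏ ω : Fin k → Bool,
    (⇑(starRingEnd ℂ))^[(Finset.univ.filter fun i => ω i = true).card]
      (f (n + ∑ i, if ω i then h i else 0))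

/-- The unnormalized Gowers norm `‖f‖_{Ũ^k(G)}`. -/
def gowersTildeU {G : Type*} [AddCommGroup G] (k : ℕ) (f : G → ℂ) : ℝ :=
  (∑' nh : G × (Fin k → G), gowersProd k f nh.1 nh.2).re ^ ((1 : ℝ) / 2 ^ k)

/-- The restriction `f·1_{[N]}` of `f : ℤ → ℂ` to `[N] = {n ∈ ℕ : 1 ≤ n ≤ N}`. -/
def truncN (N : ℝ) (f : ℤ → ℂ) : ℤ → ℂ := fun n => if 1 ≤ n ∧ (n : ℝ) ≤ N then f n else 0

/-- The local (normalized) Gowers norm `‖f‖_{U^k([N])}`. -/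
def gowersUN (k : ℕ) (N : ℝ) (f : ℤ → ℂ) : ℝ :=
  gowersTildeU k (truncN N f) / gowersTildeU k (truncN N fun _ => 1)

end

noncomputable section

open Finset ComplexConjugate

/-! ### Additive characters, iterated derivatives and box differences -/

/-- The additive character `t ↦ exp (2πit)`. -/
def ee (t : ℝ) : ℂ := Complex.exp (2 * Real.pi * t * Complex.I)

lemma ee_add (s t : ℝ) : ee (s + t) = ee s * ee t := by
  simp only [ee, ← Complex.exp_add]; congr 1; push_cast; ring

lemma ee_zero : ee 0 = 1 := by simp [ee]

lemma norm_ee (t : ℝ) : ‖ee t‖ = 1 := by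
  have : (2 * Real.pi * t * Complex.I : ℂ) = ((2 * Real.pi * t : ℝ) : ℂ) * Complex.I := by
    push_cast; ring
  rw [ee, this, Complex.norm_exp_ofReal_mul_I]

lemma ee_neg (t : ℝ) : ee (-t) = conj (ee t) := by
  simp only [ee, ← Complex.exp_conj]; congr 1; simp [Complex.conj_ofNat]

lemma ee_int (n : ℤ) : ee n = 1 := by
  rw [ee]
  have : (2 * Real.pi * ((n : ℝ) : ℂ) * Complex.I : ℂ) = n * (2 * Real.pi * Complex.I) := by
    push_cast; ring
  rw [this, Complex.exp_int_mul_two_pi_mul_I]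

lemma ee_add_int (t : ℝ) (n : ℤ) : ee (t + n) = ee t := by rw [ee_add, ee_int, mul_one]

/-- The iterated multiplicative derivative of `f` in the directions `h`. -/
def cubeDeriv {G : Type*} [AddCommGroup G] : (r : ℕ) → (Fin r → G) → (G → ℂ) → G → ℂ
  | 0, _, f, y => f y
  | r + 1, h, f, y =>
    cubeDeriv r (Fin.tail h) f y * conj (cubeDeriv r (Fin.tail h) f (y + h 0))

/-- The alternating sum of `θ` over the box with corner `h` and sides `-k i • γ`. -/
def boxDiff {G : Type*} [AddCommGroup G] (γ : G) :
    (r : ℕ) → (Fin r → ℤ) → ((Fin r → G) → ℝ) → (Fin r → G) → ℝ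
  | 0, _, θ, h => θ h
  | r + 1, k, θ, h => boxDiff γ r (Fin.tail k)
      (fun h' => θ (Fin.cons (h 0) h') - θ (Fin.cons (h 0 - k 0 • γ) h')) (Fin.tail h)

/-- Products of bounded functions that can be removed by `r` applications of Cauchy–Schwarz. -/
def Removable {G : Type*} [AddCommGroup G] (γ : G) :
    (r : ℕ) → (ℤ → (Fin r → G) → ℂ) → Prop
  | 0, B => ∀ w h, B w h = 1
  | r + 1, B => ∃ (B₀ : ℤ → (Fin r → G) → ℂ) (B₁ : G → (Fin r → G) → ℂ),
      Removable γ r B₀ ∧ (∀ y h, ‖B₁ y h‖ ≤ 1) ∧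
      ∀ w h₁ h, B w (Fin.cons h₁ h) = B₀ w h * B₁ (h₁ + w • γ) h

lemma sum_fin_cons {G M : Type*} [Fintype G] [AddCommMonoid M] (r : ℕ) (F : (Fin (r + 1) → G) → M) :
    ∑ h, F h = ∑ h₁, ∑ h, F (Fin.cons h₁ h) := by
  rw [← Fintype.sum_prod_type']
  exact (Fintype.sum_equiv (Fin.consEquiv fun _ => G) _ _ (fun x => rfl)).symm

lemma sum_piFinset_fin_cons {α M : Type*} [AddCommMonoid M] (r : ℕ) (s : Finset α)
    (F : (Fin (r + 1) → α) → M) :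
    ∑ h ∈ Fintype.piFinset (fun _ : Fin (r + 1) => s), F h =
      ∑ h₁ ∈ s, ∑ h ∈ Fintype.piFinset (fun _ : Fin r => s), F (Fin.cons h₁ h) := by
  rw [← Finset.sum_product']
  refine (Finset.sum_bij' (fun x _ => Fin.cons x.1 x.2) (fun h _ => (h 0, Fin.tail h)) ?_ ?_ ?_ ?_ ?_).symm
  · intro x hx
    simp only [Finset.mem_product, Fintype.mem_piFinset] at hx ⊢
    intro i; refine Fin.cases ?_ (fun j => ?_) i
    · simpa using hx.1
    · simpa using hx.2 j
  · intro h hh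
    simp only [Finset.mem_product, Fintype.mem_piFinset] at hh ⊢
    exact ⟨hh 0, fun j => hh j.succ⟩
  · intro x _; simp
  · intro h _; simp
  · intro x _; rfl

section deriv
variable {G : Type*} [AddCommGroup G]

lemma cubeDeriv_mul_conj_shift (r : ℕ) (k : Fin r → G) (F : G → ℂ) (k₁ w : G) :
    cubeDeriv r k (fun w => F w * conj (F (w + k₁))) w =
      cubeDeriv r k F w * conj (cubeDeriv r k F (w + k₁)) := by
  induction r generalizing w with
  | zero => rfl
  | succ r ih =>
    simp only [cubeDeriv, ih, map_mul, Complex.conj_conj]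
    rw [add_right_comm w (k 0) k₁]; ring

lemma cubeDeriv_cons (r : ℕ) (k : Fin r → G) (F : G → ℂ) (k₁ w : G) :
    cubeDeriv (r + 1) (Fin.cons k₁ k) F w =
      cubeDeriv r k F w * conj (cubeDeriv r k F (w + k₁)) := by
  simp [cubeDeriv]

lemma norm_cubeDeriv_le (r : ℕ) (k : Fin r → G) (F : G → ℂ) (hF : ∀ w, ‖F w‖ ≤ 1) (w : G) :
    ‖cubeDeriv r k F w‖ ≤ 1 := by
  induction r generalizing w with
  | zero => exact hF w
  | succ r ih =>
    simp only [cubeDeriv, norm_mul, RCLike.norm_conj]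
    exact mul_le_one₀ (ih _ _) (norm_nonneg _) (ih _ _)

lemma cubeDeriv_eq_zero (r : ℕ) (k : Fin r → G) (F : G → ℂ) (w : G) (hw : F w = 0) :
    cubeDeriv r k F w = 0 := by
  induction r with
  | zero => exact hw
  | succ r ih => simp only [cubeDeriv, ih, zero_mul]

lemma Removable.mul_conj_shift (γ : G) (r : ℕ) (B : ℤ → (Fin r → G) → ℂ) (hB : Removable γ r B)
    (k : ℤ) : Removable γ r (fun w h => B w h * conj (B (w + k) h)) := by
  induction r with
  | zero => intro w h; simp [hB w h, hB (w + k) h]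
  | succ r ih =>
    obtain ⟨B₀, B₁, h₀, h₁, hc⟩ := hB
    refine ⟨_, fun y h => B₁ y h * conj (B₁ (y + k • γ) h), ih B₀ h₀, ?_, ?_⟩
    · intro y h; simp only [norm_mul, RCLike.norm_conj]
      exact mul_le_one₀ (h₁ _ _) (norm_nonneg _) (h₁ _ _)
    · intro w h₁ h
      simp only [hc, map_mul]
      rw [add_smul, add_assoc]; ring

end deriv

/-! ### The elimination inequality -/

lemma sum_pow_le_card_pow_mul {ι : Type*} (s : Finset ι) (a : ι → ℝ) (ha : ∀ i ∈ s, 0 ≤ a i) (m : ℕ) :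
    (∑ i ∈ s, a i) ^ (m + 1) ≤ (s.card : ℝ) ^ m * ∑ i ∈ s, a i ^ (m + 1) :=
  pow_sum_le_card_mul_sum_pow ha m

section elim
variable {G : Type*} [AddCommGroup G] [Fintype G]

/-- One Cauchy–Schwarz step: a factor depending only on `(h₁ + w • γ, h)` is removed. -/
lemma cauchySchwarz_shear (γ : G) {ι : Type*} [Fintype ι] (X : ℕ)
    (A : ℤ → G → ι → ℂ) (hA : ∀ w, w ∉ Ico (0 : ℤ) X → ∀ y i, A w y i = 0)
    (B : G → ι → ℂ) (hB : ∀ y i, ‖B y i‖ ≤ 1) :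
    ‖∑ w ∈ Ico (0 : ℤ) X, ∑ h₁, ∑ i, A w h₁ i * B (h₁ + w • γ) i‖ ^ 2 ≤
      Fintype.card G * Fintype.card ι * ∑ k ∈ Ioo (-X : ℤ) X, ∑ h₁,
        ‖∑ w ∈ Ico (0 : ℤ) X, ∑ i, A w h₁ i * conj (A (w + k) (h₁ - k • γ) i)‖ := by
  have e1 : ∑ w ∈ Ico (0 : ℤ) X, ∑ h₁, ∑ i, A w h₁ i * B (h₁ + w • γ) i =
      ∑ p : G × ι, B p.1 p.2 * ∑ w ∈ Ico (0 : ℤ) X, A w (p.1 - w • γ) p.2 := by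
    rw [Fintype.sum_prod_type]
    simp_rw [mul_sum]
    have : ∀ w ∈ Ico (0 : ℤ) X, ∑ h₁, ∑ i, A w h₁ i * B (h₁ + w • γ) i =
        ∑ y, ∑ i, B y i * A w (y - w • γ) i := by
      intro w _
      refine Fintype.sum_equiv (Equiv.addRight (w • γ)) _ _ fun h₁ => ?_
      refine sum_congr rfl fun i _ => ?_
      simp [mul_comm]
    rw [sum_congr rfl this, sum_comm]
    refine sum_congr rfl fun y _ => sum_comm
  have e2 : ∀ p : G × ι, ((‖∑ w ∈ Ico (0 : ℤ) X, A w (p.1 - w • γ) p.2‖ ^ 2 : ℝ) : ℂ) =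
      ∑ k ∈ Ioo (-X : ℤ) X, ∑ w ∈ Ico (0 : ℤ) X,
        A w (p.1 - w • γ) p.2 * conj (A (w + k) (p.1 - w • γ - k • γ) p.2) := by
    intro p
    rw [Complex.ofReal_pow, ← Complex.mul_conj', map_sum, sum_mul_sum, sum_comm (s := Ioo (-X : ℤ) X)]
    refine sum_congr rfl fun w hw => ?_
    symm
    refine sum_bij_ne_zero (fun k _ _ => w + k) ?_ ?_ ?_ ?_
    · intro k _ hk
      by_contra hh
      exact hk (by rw [hA _ hh]; simp)
    · intro a _ _ b _ _ h; simpa using h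
    · intro w' hw' _
      refine ⟨w' - w, ?_, ?_, by ring⟩
      · simp only [mem_Ioo, mem_Ico] at *; omega
      · rwa [show w + (w' - w) = w' by ring,
          show p.1 - w • γ - (w' - w) • γ = p.1 - w' • γ by rw [sub_smul]; abel]
    · intro k _ _
      rw [show p.1 - (w + k) • γ = p.1 - w • γ - k • γ by rw [add_smul]; abel]
  have e3 : ((∑ p : G × ι, ‖∑ w ∈ Ico (0 : ℤ) X, A w (p.1 - w • γ) p.2‖ ^ 2 : ℝ) : ℂ) =
      ∑ k ∈ Ioo (-X : ℤ) X, ∑ h₁,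
        ∑ w ∈ Ico (0 : ℤ) X, ∑ i, A w h₁ i * conj (A (w + k) (h₁ - k • γ) i) := by
    rw [Complex.ofReal_sum, Fintype.sum_congr _ _ e2, sum_comm]
    refine sum_congr rfl fun k _ => ?_
    rw [sum_comm]
    rw [sum_comm (s := univ) (t := Ico (0 : ℤ) X)]
    refine sum_congr rfl fun w _ => ?_
    rw [Fintype.sum_prod_type]
    exact Fintype.sum_equiv (Equiv.subRight (w • γ)) _ _ fun y => rfl
  have e4 : ∑ p : G × ι, ‖∑ w ∈ Ico (0 : ℤ) X, A w (p.1 - w • γ) p.2‖ ^ 2 ≤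
      ∑ k ∈ Ioo (-X : ℤ) X, ∑ h₁,
        ‖∑ w ∈ Ico (0 : ℤ) X, ∑ i, A w h₁ i * conj (A (w + k) (h₁ - k • γ) i)‖ := by
    have h0 : (0:ℝ) ≤ ∑ p : G × ι, ‖∑ w ∈ Ico (0 : ℤ) X, A w (p.1 - w • γ) p.2‖ ^ 2 := by positivity
    calc _ = ‖((∑ p : G × ι, ‖∑ w ∈ Ico (0 : ℤ) X, A w (p.1 - w • γ) p.2‖ ^ 2 : ℝ) : ℂ)‖ := by
          rw [Complex.norm_real, Real.norm_of_nonneg h0]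
      _ ≤ _ := by
          rw [e3]
          exact (norm_sum_le _ _).trans (sum_le_sum fun k _ => norm_sum_le _ _)
  rw [e1]
  have e5 : ‖∑ p : G × ι, B p.1 p.2 * ∑ w ∈ Ico (0 : ℤ) X, A w (p.1 - w • γ) p.2‖ ≤
      ∑ p : G × ι, ‖∑ w ∈ Ico (0 : ℤ) X, A w (p.1 - w • γ) p.2‖ := by
    refine (norm_sum_le _ _).trans (sum_le_sum fun p _ => ?_)
    rw [norm_mul]
    exact mul_le_of_le_one_left (norm_nonneg _) (hB _ _)
  calc _ ≤ (∑ p : G × ι, ‖∑ w ∈ Ico (0 : ℤ) X, A w (p.1 - w • γ) p.2‖) ^ 2 := by gcongr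
    _ ≤ _ := sq_sum_le_card_mul_sum_sq
    _ ≤ _ := by
        rw [card_univ, Fintype.card_prod]; push_cast
        gcongr

/-- Removal of all the factors of a removable product, leaving an average over boxes. -/
theorem removable_elimination (γ : G) (d : ℤ) (X : ℕ) (r : ℕ) (F : ℤ → ℂ)
    (hF : ∀ w, w ∉ Ico (0 : ℤ) X → F w = 0) (Φ : (Fin r → G) → ℂ) (hΦ : ∀ h, ‖Φ h‖ ≤ 1)
    (θ : (Fin r → G) → ℝ) (B : ℤ → (Fin r → G) → ℂ) (hB : Removable γ r B) :
    ‖∑ w ∈ Ico (0 : ℤ) X, ∑ h, F w * Φ h * ee (d * w * θ h) * B w h‖ ^ 2 ^ r *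
        ((Fintype.card G * X) ^ r * X) ≤
      2 ^ 2 ^ r * (X * (Fintype.card G) ^ r) ^ 2 ^ r *
        ∑ k ∈ Fintype.piFinset (fun _ : Fin r => Ioo (-X : ℤ) X), ∑ h,
          ‖∑ w ∈ Ico (0 : ℤ) X, cubeDeriv r k F w * ee (d * w * boxDiff γ r k θ h)‖ := by
  induction r generalizing F with
  | zero =>
    have hB' : ∀ w h, B w h = 1 := hB
    have : ‖∑ w ∈ Ico (0 : ℤ) X, ∑ h, F w * Φ h * ee (d * w * θ h) * B w h‖ ≤
        ∑ h, ‖∑ w ∈ Ico (0 : ℤ) X, cubeDeriv 0 ![] F w * ee (d * w * boxDiff γ 0 ![] θ h)‖ := by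
      rw [sum_comm]
      refine (norm_sum_le _ _).trans (sum_le_sum fun h _ => ?_)
      simp only [hB', mul_one, cubeDeriv, boxDiff]
      have : ∑ x ∈ Ico (0 : ℤ) X, F x * Φ h * ee (d * x * θ h) =
          Φ h * ∑ x ∈ Ico (0 : ℤ) X, F x * ee (d * x * θ h) := by
        rw [mul_sum]; refine sum_congr rfl fun x _ => by ring
      rw [this, norm_mul]
      exact mul_le_of_le_one_left (norm_nonneg _) (hΦ _)
    simp only [pow_zero, pow_one, one_mul, mul_one]
    have e : Fintype.piFinset (fun _ : Fin 0 => Ioo (-X : ℤ) X) = {![]} := by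
      ext x
      simp only [Fintype.mem_piFinset, IsEmpty.forall_iff, mem_singleton]
      exact iff_of_true trivial (Subsingleton.elim _ _)
    rw [e, sum_singleton]
    have h0 : (0:ℝ) ≤ X := by positivity
    nlinarith [norm_nonneg (∑ w ∈ Ico (0 : ℤ) X, ∑ h, F w * Φ h * ee (d * w * θ h) * B w h),
      mul_le_mul_of_nonneg_right this h0, mul_nonneg (norm_nonneg (∑ w ∈ Ico (0 : ℤ) X, ∑ h, F w * Φ h * ee (d * w * θ h) * B w h)) h0]
  | succ r ih =>
    obtain ⟨B₀, B₁, hB₀, hB₁, hBc⟩ := hB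
    set K : ℝ := (Fintype.card G : ℝ) with hK
    have hK0 : 0 ≤ K := by positivity
    set E := ∑ w ∈ Ico (0 : ℤ) X, ∑ h, F w * Φ h * ee (d * w * θ h) * B w h with hE
    let A : ℤ → G → (Fin r → G) → ℂ := fun w h₁ h =>
      F w * Φ (Fin.cons h₁ h) * ee (d * w * θ (Fin.cons h₁ h)) * B₀ w h
    let E' : ℤ → G → ℂ := fun k h₁ => ∑ w ∈ Ico (0 : ℤ) X, ∑ h : Fin r → G,
      (F w * conj (F (w + k))) * (Φ (Fin.cons h₁ h) * conj (Φ (Fin.cons (h₁ - k • γ) h)) *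
        ee (-(d * k * θ (Fin.cons (h₁ - k • γ) h)))) *
        ee (d * w * (θ (Fin.cons h₁ h) - θ (Fin.cons (h₁ - k • γ) h))) *
        (B₀ w h * conj (B₀ (w + k) h))
    have s1 : ‖E‖ ^ 2 ≤ K ^ (r + 1) * ∑ k ∈ Ioo (-X : ℤ) X, ∑ h₁, ‖E' k h₁‖ := by
      have := cauchySchwarz_shear γ X A (fun w hw y i => by simp [A, hF w hw]) B₁ hB₁
      have e1 : E = ∑ w ∈ Ico (0 : ℤ) X, ∑ h₁, ∑ i, A w h₁ i * B₁ (h₁ + w • γ) i := by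
        rw [hE]
        refine sum_congr rfl fun w _ => ?_
        rw [sum_fin_cons]
        refine sum_congr rfl fun h₁ _ => sum_congr rfl fun h _ => ?_
        rw [hBc]; simp only [A]; ring
      have e2 : ∀ k h₁, ∑ w ∈ Ico (0 : ℤ) X, ∑ i, A w h₁ i * conj (A (w + k) (h₁ - k • γ) i) =
          E' k h₁ := by
        intro k h₁
        refine sum_congr rfl fun w _ => sum_congr rfl fun h _ => ?_
        simp only [A, map_mul, ← ee_neg]
        have : ee (d * w * (θ (Fin.cons h₁ h) - θ (Fin.cons (h₁ - k • γ) h))) *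
          ee (-(d * k * θ (Fin.cons (h₁ - k • γ) h))) = ee (d * w * θ (Fin.cons h₁ h)) *
          ee (-(d * (w + k : ℤ) * θ (Fin.cons (h₁ - k • γ) h))) := by
          rw [← ee_add, ← ee_add]; congr 1; push_cast; ring
        linear_combination (-(F w * (starRingEnd ℂ) (F (w + k))) * (Φ (Fin.cons h₁ h) *
          (starRingEnd ℂ) (Φ (Fin.cons (h₁ - k • γ) h))) *
          (B₀ w h * (starRingEnd ℂ) (B₀ (w + k) h))) * this
      rw [← e1] at this
      simp only [e2] at this
      refine this.trans (le_of_eq ?_)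
      rw [Fintype.card_fun, Fintype.card_fin]; push_cast; rw [← hK]; ring
    have s2 : ∀ k h₁, ‖E' k h₁‖ ^ 2 ^ r * ((K * X) ^ r * X) ≤
        2 ^ 2 ^ r * (X * K ^ r) ^ 2 ^ r *
        ∑ k' ∈ Fintype.piFinset (fun _ : Fin r => Ioo (-X : ℤ) X), ∑ h : Fin r → G,
          ‖∑ w ∈ Ico (0 : ℤ) X, cubeDeriv (r + 1) (Fin.cons k k') F w *
            ee (d * w * boxDiff γ (r + 1) (Fin.cons k k') θ (Fin.cons h₁ h))‖ := by
      intro k h₁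
      have := ih (fun w => F w * conj (F (w + k))) (fun w hw => by simp [hF w hw])
        (fun h => Φ (Fin.cons h₁ h) * conj (Φ (Fin.cons (h₁ - k • γ) h)) *
        ee (-(d * k * θ (Fin.cons (h₁ - k • γ) h)))) (fun h => by
          rw [norm_mul, norm_ee, mul_one, norm_mul, RCLike.norm_conj]
          exact mul_le_one₀ (hΦ _) (norm_nonneg _) (hΦ _))
        (fun h => θ (Fin.cons h₁ h) - θ (Fin.cons (h₁ - k • γ) h)) _ (hB₀.mul_conj_shift γ r B₀ k)
      refine this.trans (le_of_eq ?_)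
      congr 1
      refine sum_congr rfl fun k' _ => sum_congr rfl fun h _ => ?_
      congr 1
      refine sum_congr rfl fun w _ => ?_
      rw [cubeDeriv_mul_conj_shift, cubeDeriv_cons]
      simp [boxDiff]
    set S : ℝ := ∑ k ∈ Fintype.piFinset (fun _ : Fin (r + 1) => Ioo (-X : ℤ) X), ∑ h,
          ‖∑ w ∈ Ico (0 : ℤ) X, cubeDeriv (r + 1) k F w * ee (d * w * boxDiff γ (r + 1) k θ h)‖ with hS
    have s3 : S = ∑ k ∈ Ioo (-X : ℤ) X, ∑ h₁ : G,
        ∑ k' ∈ Fintype.piFinset (fun _ : Fin r => Ioo (-X : ℤ) X), ∑ h : Fin r → G,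
          ‖∑ w ∈ Ico (0 : ℤ) X, cubeDeriv (r + 1) (Fin.cons k k') F w *
            ee (d * w * boxDiff γ (r + 1) (Fin.cons k k') θ (Fin.cons h₁ h))‖ := by
      rw [hS, sum_piFinset_fin_cons]
      refine sum_congr rfl fun k _ => ?_
      rw [sum_comm (s := univ)]
      refine sum_congr rfl fun k' _ => ?_
      rw [sum_fin_cons]
    have s4 : (∑ k ∈ Ioo (-X : ℤ) X, ∑ h₁, ‖E' k h₁‖) ^ 2 ^ r ≤
        (2 * X * K) ^ (2 ^ r - 1) * ∑ k ∈ Ioo (-X : ℤ) X, ∑ h₁, ‖E' k h₁‖ ^ 2 ^ r := by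
      rw [← sum_product', ← sum_product']
      obtain ⟨m, hm⟩ : ∃ m, 2 ^ r = m + 1 := ⟨2 ^ r - 1, by have := Nat.one_le_two_pow (n := r); omega⟩
      rw [hm]
      refine (sum_pow_le_card_pow_mul _ _ (fun i _ => norm_nonneg _) m).trans ?_
      rw [Nat.add_sub_cancel]
      gcongr
      rw [card_product, card_univ]; push_cast
      rw [hK]
      gcongr
      rw [Int.card_Ioo]
      have : ((X : ℤ) - -X - 1).toNat ≤ 2 * X := by omega
      exact_mod_cast this
    calc ‖E‖ ^ 2 ^ (r + 1) * ((K * X) ^ (r + 1) * X)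
        = (‖E‖ ^ 2) ^ 2 ^ r * ((K * X) ^ (r + 1) * X) := by rw [← pow_mul, pow_succ' 2 r]
      _ ≤ (K ^ (r + 1) * ∑ k ∈ Ioo (-X : ℤ) X, ∑ h₁, ‖E' k h₁‖) ^ 2 ^ r *
          ((K * X) ^ (r + 1) * X) := by gcongr
      _ ≤ (K ^ (r + 1)) ^ 2 ^ r * ((2 * X * K) ^ (2 ^ r - 1) *
          ∑ k ∈ Ioo (-X : ℤ) X, ∑ h₁, ‖E' k h₁‖ ^ 2 ^ r) * ((K * X) ^ (r + 1) * X) := by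
          rw [mul_pow]; gcongr
      _ = (K ^ (r + 1)) ^ 2 ^ r * (2 * X * K) ^ (2 ^ r - 1) * (K * X) *
          ∑ k ∈ Ioo (-X : ℤ) X, ∑ h₁, ‖E' k h₁‖ ^ 2 ^ r * ((K * X) ^ r * X) := by
          simp_rw [← sum_mul]; ring
      _ ≤ (K ^ (r + 1)) ^ 2 ^ r * (2 * X * K) ^ (2 ^ r - 1) * (K * X) *
          (2 ^ 2 ^ r * (X * K ^ r) ^ 2 ^ r * S) := by
          rw [s3]; simp_rw [mul_sum (a := 2 ^ 2 ^ r * (X * K ^ r) ^ 2 ^ r)]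
          simp_rw [mul_sum] at s2
          refine mul_le_mul_of_nonneg_left ?_ (by positivity)
          exact sum_le_sum fun k _ => sum_le_sum fun h₁ _ => s2 k h₁
      _ ≤ 2 ^ 2 ^ (r + 1) * (X * K ^ (r + 1)) ^ 2 ^ (r + 1) * S := by
          have hS0 : 0 ≤ S := by rw [hS]; positivity
          rw [← mul_assoc]
          refine mul_le_mul_of_nonneg_right ?_ hS0
          obtain ⟨m, hm⟩ : ∃ m, 2 ^ r = m + 1 := ⟨2 ^ r - 1, by have := Nat.one_le_two_pow (n := r); omega⟩
          have hm2 : 2 ^ (r + 1) = (m + 1) + (m + 1) := by rw [pow_succ]; omega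
          rw [hm2, hm, Nat.add_sub_cancel]
          have : (K ^ (r + 1)) ^ (m + 1) * (2 * X * K) ^ m * (K * X) *
            (2 ^ (m + 1) * (X * K ^ r) ^ (m + 1)) = 2 ^ m * 2 ^ (m + 1) * (X * K ^ (r + 1)) ^ (m + 1 + (m + 1)) := by
            ring
          rw [this]
          gcongr
          rw [← pow_add]
          exact pow_le_pow_right₀ (by norm_num) (by omega)
end elim

/-! ### The inverse theorem for the second Gowers norm on a cyclic group -/

lemma zmod_parseval {Q : ℕ} [NeZero Q] (u : ZMod Q → ℂ) :
    ∑ j : ZMod Q, ‖∑ y, u y * ZMod.stdAddChar (j * y)‖ ^ 2 = Q * ∑ y, ‖u y‖ ^ 2 := by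
  have key : ∀ y z : ZMod Q, ∑ j : ZMod Q, (ZMod.stdAddChar (j * y) : ℂ) *
      conj (ZMod.stdAddChar (j * z) : ℂ) = if y = z then (Q : ℂ) else 0 := by
    intro y z
    have h1 := AddChar.sum_mulShift (R := ZMod Q) (R' := ℂ) (ψ := ZMod.stdAddChar) (y - z)
      (ZMod.isPrimitive_stdAddChar Q)
    simp only [sub_eq_zero, ZMod.card] at h1
    rw [← Nat.cast_zero, ← Nat.cast_ite, ← h1]
    refine sum_congr rfl fun j _ => ?_
    rw [mul_sub, sub_eq_add_neg, AddChar.map_add_eq_mul, AddChar.map_neg_eq_conj]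
  apply Complex.ofReal_injective
  push_cast
  simp_rw [← Complex.mul_conj', map_sum, sum_mul_sum]
  rw [sum_comm, mul_sum]
  refine sum_congr rfl fun y _ => ?_
  rw [sum_comm]
  have : ∀ z ∈ (univ : Finset (ZMod Q)), ∑ j : ZMod Q, u y * ZMod.stdAddChar (j * y) *
      conj (u z * ZMod.stdAddChar (j * z)) = if y = z then (u y * conj (u z)) * (Q : ℂ) else 0 := by
    intro z _
    rw [← mul_ite_zero, ← key, mul_sum]
    refine sum_congr rfl fun j _ => ?_
    rw [map_mul (starRingEnd ℂ)]; ring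
  rw [sum_congr rfl this]
  simp [mul_comm]

lemma exists_large_fourier {Q : ℕ} [NeZero Q] (X : ℕ) (G : ZMod Q → ℂ) (hG : ∀ y, ‖G y‖ ≤ 1)
    (hX : (univ.filter fun y => G y ≠ 0).card ≤ X) :
    ∃ j : ZMod Q, ∑ h, ‖∑ y, G y * conj (G (y + h))‖ ^ 2 ≤
      X ^ 2 * ‖∑ y, G y * ZMod.stdAddChar (j * y)‖ := by
  set a : ZMod Q → ℂ := fun h => ∑ y, G y * conj (G (y + h)) with ha
  set g : ZMod Q → ℂ := fun j => ∑ y, G y * ZMod.stdAddChar (j * y) with hg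
  obtain ⟨j, -, hj⟩ := exists_max_image (univ : Finset (ZMod Q)) (fun j => ‖g j‖) univ_nonempty
  refine ⟨j, ?_⟩
  have hQ : (0 : ℝ) < Q := by have := NeZero.pos Q; positivity
  have h1 : ∀ j, ∑ h, a h * ZMod.stdAddChar (j * h) = ((‖g (-j)‖ ^ 2 : ℝ) : ℂ) := by
    intro j
    rw [Complex.ofReal_pow, ← Complex.mul_conj']
    simp only [ha, hg, map_sum, sum_mul]
    rw [sum_comm]
    refine sum_congr rfl fun y _ => ?_
    rw [mul_sum]
    refine Fintype.sum_equiv (Equiv.addLeft y) _ _ fun h => ?_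
    simp only [Equiv.coe_addLeft, map_mul]
    rw [← AddChar.map_neg_eq_conj]
    rw [show j * h = -j * y + -(-j * (y + h)) by ring, AddChar.map_add_eq_mul]; ring
  have h2 := zmod_parseval a
  have h3 := zmod_parseval G
  simp only [h1, Complex.norm_real, norm_pow, norm_norm] at h2
  have hs : ∑ y, ‖G y‖ ^ 2 ≤ X := by
    calc ∑ y, ‖G y‖ ^ 2 = ∑ y ∈ univ.filter (fun y => G y ≠ 0), ‖G y‖ ^ 2 := by
          rw [sum_filter_of_ne]; intro y _ hy h; simp [h] at hy
      _ ≤ ∑ y ∈ univ.filter (fun y => G y ≠ 0), 1 := by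
          refine sum_le_sum fun y _ => ?_
          exact pow_le_one₀ (norm_nonneg _) (hG y)
      _ ≤ X := by simpa using hX
  have hgX : ‖g j‖ ≤ X := by
    calc ‖g j‖ ≤ ∑ y, ‖G y‖ := by
          refine (norm_sum_le _ _).trans (sum_le_sum fun y _ => ?_)
          rw [norm_mul, ZMod.stdAddChar_apply, Circle.norm_coe, mul_one]
      _ = ∑ y ∈ univ.filter (fun y => G y ≠ 0), ‖G y‖ := by
          rw [sum_filter_of_ne]; intro y _ hy h; simp [h] at hy
      _ ≤ ∑ y ∈ univ.filter (fun y => G y ≠ 0), 1 := sum_le_sum fun y _ => hG y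
      _ ≤ X := by simpa using hX
  have h4 : ∑ x : ZMod Q, (‖g (-x)‖ ^ 2) ^ 2 ≤ ‖g j‖ ^ 2 * (Q * X) := by
    calc ∑ x : ZMod Q, (‖g (-x)‖ ^ 2) ^ 2 = ∑ x : ZMod Q, (‖g x‖ ^ 2) ^ 2 :=
          Fintype.sum_equiv (Equiv.neg _) _ _ fun x => rfl
      _ ≤ ∑ x : ZMod Q, ‖g j‖ ^ 2 * ‖g x‖ ^ 2 := by
          refine sum_le_sum fun x _ => ?_
          rw [sq (‖g x‖ ^ 2)]
          have := hj x (mem_univ _)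
          gcongr
      _ = ‖g j‖ ^ 2 * (Q * ∑ y, ‖G y‖ ^ 2) := by rw [← mul_sum, h3]
      _ ≤ _ := by gcongr
  rw [h2] at h4
  have h5 : ∑ h, ‖a h‖ ^ 2 ≤ ‖g j‖ ^ 2 * X := by
    have : (Q : ℝ) * ∑ h, ‖a h‖ ^ 2 ≤ Q * (‖g j‖ ^ 2 * X) := by linarith
    exact le_of_mul_le_mul_left this hQ
  refine h5.trans ?_
  rw [sq ‖g j‖]
  nlinarith [norm_nonneg (g j), mul_le_mul_of_nonneg_left hgX (mul_nonneg (norm_nonneg (g j)) (Nat.cast_nonneg X))]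

lemma stdAddChar_mul_intCast {Q : ℕ} [NeZero Q] (j : ZMod Q) (n : ℤ) :
    ZMod.stdAddChar (j * (n : ZMod Q)) = ee (n * (j.val / Q : ℝ)) := by
  have : j * (n : ZMod Q) = ((j.val * n : ℤ) : ZMod Q) := by push_cast; simp
  rw [this, ZMod.stdAddChar_coe, ee]
  congr 1; push_cast; ring

/-! ### An almost orthogonality argument -/

lemma norm_ee_sub_one (t : ℝ) : ‖ee t - 1‖ = 2 * |Real.sin (Real.pi * t)| := by
  have : ee t = Complex.exp (Complex.I * ((2 * Real.pi * t : ℝ) : ℂ)) := by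
    rw [ee]; congr 1; push_cast; ring
  rw [this, Complex.norm_exp_I_mul_ofReal_sub_one, norm_mul, Real.norm_eq_abs, Real.norm_eq_abs]
  congr 2
  · norm_num
  · ring_nf

lemma norm_ee_sub_one_le (t : ℝ) : ‖ee t - 1‖ ≤ 2 * Real.pi * |t| := by
  rw [norm_ee_sub_one]
  have := Real.abs_sin_le_abs (x := Real.pi * t)
  rw [abs_mul, abs_of_pos Real.pi_pos] at this
  linarith

lemma abs_sub_round_mul_norm_sum_ee_le (β : ℝ) (Y : ℕ) :
    |β - round β| * ‖∑ w ∈ range Y, ee (β * w)‖ ≤ 1 / 2 := by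
  have h1 : ∀ w : ℕ, ee (β * w) = ee β ^ w := by
    intro w; induction w with
    | zero => simp [ee_zero]
    | succ w ih => rw [pow_succ, ← ih, ← ee_add]; congr 1; push_cast; ring
  have h2 : ‖ee β - 1‖ * ‖∑ w ∈ range Y, ee (β * w)‖ ≤ 2 := by
    rw [← norm_mul]
    simp_rw [h1]
    rw [mul_geom_sum, ← h1]
    calc _ ≤ ‖ee (β * Y)‖ + ‖(1 : ℂ)‖ := norm_sub_le _ _
      _ = 2 := by rw [norm_ee]; norm_num
  have h3 : 4 * |β - round β| ≤ ‖ee β - 1‖ := by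
    have e : ee β = ee (β - round β) := by
      rw [← ee_add_int (β - round β) (round β)]; congr 1; ring
    rw [e, norm_ee_sub_one]
    have hb := abs_sub_round β
    have := Real.mul_abs_le_abs_sin (x := Real.pi * (β - round β)) (by
      rw [abs_mul, abs_of_pos Real.pi_pos]; nlinarith [Real.pi_pos])
    rw [abs_mul, abs_of_pos Real.pi_pos] at this
    have h4 : 2 / Real.pi * (Real.pi * |β - round β|) = 2 * |β - round β| := by
      field_simp
    linarith
  nlinarith [norm_nonneg (∑ w ∈ range Y, ee (β * w)), mul_le_mul_of_nonneg_right h3 (norm_nonneg (∑ w ∈ range Y, ee (β * w)))]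

lemma sum_Ico_filter_le (X : ℕ) (y : ℤ) (g : ℤ → ℂ) :
    ∃ Y : ℕ, ∑ w ∈ Ico (0 : ℤ) X, (if w ≤ y then g w else 0) = ∑ w ∈ range Y, g w := by
  refine ⟨min X (y + 1).toNat, ?_⟩
  rw [← sum_filter]
  refine sum_bij' (fun w _ => w.toNat) (fun w _ => (w : ℤ)) ?_ ?_ ?_ ?_ ?_
  · intro w hw; simp only [mem_filter, mem_Ico, mem_range] at *; omega
  · intro w hw; simp only [mem_filter, mem_Ico, mem_range] at *; omega
  · intro w hw; simp only [mem_filter, mem_Ico] at *; omega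
  · intro w hw; simp
  · intro w hw; simp only [mem_filter, mem_Ico] at *; congr 1; omega

lemma exists_unimodular (z : ℂ) : ∃ c : ℂ, ‖c‖ = 1 ∧ c * z = ‖z‖ := by
  by_cases hz : z = 0
  · exact ⟨1, by simp, by simp [hz]⟩
  · have hn : (‖z‖ : ℂ) ≠ 0 := by simpa using hz
    refine ⟨conj z / ‖z‖, ?_, ?_⟩
    · rw [norm_div, RCLike.norm_conj, Complex.norm_real, norm_norm, div_self (by simpa using hz)]
    · rw [div_mul_eq_mul_div, mul_comm, Complex.mul_conj', div_eq_iff hn]; ring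

/-- If many exponentials correlate with one bounded function, a positive proportion of their
frequencies are close to a single one. -/
theorem exists_popular_frequency {ι : Type*} (I : Finset ι) (g : ℤ → ℂ) (hg : ∀ w, ‖g w‖ ≤ 1)
    (X : ℕ) (hX : 0 < X) (α : ι → ℝ) (y : ι → ℤ) (τ : ℝ) (hτ : 0 < τ)
    (h : ∀ i ∈ I, τ * X ≤ ‖∑ w ∈ Ico (0 : ℤ) X, (if w ≤ y i then g w * ee (α i * w) else 0)‖) :
    ∃ ξ : ℝ, ∃ I' ⊆ I, τ ^ 2 / 2 * I.card ≤ I'.card ∧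
      ∀ i ∈ I', ∃ n : ℤ, |α i - ξ - n| ≤ 1 / (τ ^ 2 * X) := by
  rcases I.eq_empty_or_nonempty with rfl | hI
  · exact ⟨0, ∅, by simp, by simp, by simp⟩
  have hX' : (0 : ℝ) < X := by exact_mod_cast hX
  set S : ι → ℂ := fun i => ∑ w ∈ Ico (0 : ℤ) X, (if w ≤ y i then g w * ee (α i * w) else 0) with hS
  choose c hc1 hc2 using fun i => exists_unimodular (S i)
  let b : ι → ℤ → ℂ := fun i w => c i * (if w ≤ y i then ee (α i * w) else 0)
  let K : ι → ι → ℂ := fun i j => ∑ w ∈ Ico (0 : ℤ) X,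
    (if w ≤ min (y i) (y j) then ee ((α i - α j) * w) else 0)
  have hK : ∀ i j, ‖∑ w ∈ Ico (0 : ℤ) X, b i w * conj (b j w)‖ = ‖K i j‖ := by
    intro i j
    have : ∑ w ∈ Ico (0 : ℤ) X, b i w * conj (b j w) = (c i * conj (c j)) * K i j := by
      simp only [K, mul_sum]
      refine sum_congr rfl fun w _ => ?_
      by_cases h1 : w ≤ y i <;> by_cases h2 : w ≤ y j <;> simp [b, h1, h2]
      rw [sub_mul, sub_eq_add_neg, ee_add, ee_neg]; ring
    rw [this, norm_mul, norm_mul, RCLike.norm_conj, hc1, hc1]; simp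
  have h1 : τ * X * I.card ≤ ∑ w ∈ Ico (0 : ℤ) X, ‖∑ i ∈ I, b i w‖ := by
    calc τ * X * I.card = ∑ i ∈ I, τ * X := by simp [mul_comm]
      _ ≤ ∑ i ∈ I, ‖S i‖ := sum_le_sum h
      _ = ‖∑ i ∈ I, c i * S i‖ := by
          simp_rw [hc2]
          rw [← Complex.ofReal_sum, Complex.norm_real, Real.norm_of_nonneg (by positivity)]
      _ = ‖∑ w ∈ Ico (0 : ℤ) X, g w * ∑ i ∈ I, b i w‖ := by
          congr 1
          simp only [hS, mul_sum]
          rw [sum_comm]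
          refine sum_congr rfl fun w _ => sum_congr rfl fun i _ => ?_
          simp only [b]; split_ifs <;> ring
      _ ≤ ∑ w ∈ Ico (0 : ℤ) X, ‖∑ i ∈ I, b i w‖ := by
          refine (norm_sum_le _ _).trans (sum_le_sum fun w _ => ?_)
          rw [norm_mul]; exact mul_le_of_le_one_left (norm_nonneg _) (hg w)
  have h2 : (τ * X * I.card) ^ 2 ≤ X * ∑ i ∈ I, ∑ j ∈ I, ‖K i j‖ := by
    calc (τ * X * I.card) ^ 2 ≤ (∑ w ∈ Ico (0 : ℤ) X, ‖∑ i ∈ I, b i w‖) ^ 2 := by gcongr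
      _ ≤ _ := sq_sum_le_card_mul_sum_sq
      _ = X * ∑ w ∈ Ico (0 : ℤ) X, ‖∑ i ∈ I, b i w‖ ^ 2 := by simp
      _ = X * ‖((∑ w ∈ Ico (0 : ℤ) X, ‖∑ i ∈ I, b i w‖ ^ 2 : ℝ) : ℂ)‖ := by
          rw [Complex.norm_real, Real.norm_of_nonneg (by positivity)]
      _ = X * ‖∑ i ∈ I, ∑ j ∈ I, ∑ w ∈ Ico (0 : ℤ) X, b i w * conj (b j w)‖ := by
          congr 2
          push_cast
          simp_rw [← Complex.mul_conj', map_sum, sum_mul_sum]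
          rw [sum_comm]
          refine sum_congr rfl fun i _ => ?_
          rw [sum_comm]
      _ ≤ _ := by
          gcongr
          refine (norm_sum_le _ _).trans (sum_le_sum fun i _ => ?_)
          refine (norm_sum_le _ _).trans (sum_le_sum fun j _ => ?_)
          rw [hK]
  have hIc : (0 : ℝ) < I.card := by exact_mod_cast hI.card_pos
  obtain ⟨i, hi, hi2⟩ : ∃ i ∈ I, τ ^ 2 * X * I.card ≤ ∑ j ∈ I, ‖K i j‖ := by
    refine exists_le_of_sum_le hI ?_
    rw [sum_const, nsmul_eq_mul]
    have : X * (I.card * (τ ^ 2 * X * I.card)) ≤ X * ∑ i ∈ I, ∑ j ∈ I, ‖K i j‖ := by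
      refine le_trans (le_of_eq ?_) h2; ring
    exact le_of_mul_le_mul_left this hX'
  have hKX : ∀ i j, ‖K i j‖ ≤ X := by
    intro i j
    calc ‖K i j‖ ≤ ∑ w ∈ Ico (0 : ℤ) X, (1 : ℝ) := by
          refine (norm_sum_le _ _).trans (sum_le_sum fun w _ => ?_)
          split_ifs
          · rw [norm_ee]
          · simp
      _ = X := by simp
  refine ⟨α i, I.filter (fun j => τ ^ 2 * X / 2 ≤ ‖K j i‖), filter_subset _ _, ?_, ?_⟩
  · have hsymm : ∀ j, ‖K i j‖ = ‖K j i‖ := by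
      intro j
      rw [← hK, ← hK, ← RCLike.norm_conj, map_sum]
      congr 1
      refine sum_congr rfl fun w _ => ?_
      rw [map_mul, Complex.conj_conj, mul_comm]
    have : ∑ j ∈ I, ‖K i j‖ ≤ (I.filter (fun j => τ ^ 2 * X / 2 ≤ ‖K j i‖)).card * X +
        I.card * (τ ^ 2 * X / 2) := by
      rw [← sum_filter_add_sum_filter_not I (fun j => τ ^ 2 * X / 2 ≤ ‖K j i‖)]
      refine add_le_add ?_ ?_
      · rw [← nsmul_eq_mul]; exact sum_le_card_nsmul _ _ _ fun j _ => hKX i j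
      · calc _ ≤ (I.filter (fun j => ¬ τ ^ 2 * X / 2 ≤ ‖K j i‖)).card • (τ ^ 2 * X / 2) := by
              refine sum_le_card_nsmul _ _ _ fun j hj => ?_
              rw [hsymm]; exact (not_le.mp (mem_filter.mp hj).2).le
          _ ≤ _ := by
              rw [nsmul_eq_mul]; gcongr; exact filter_subset _ _
    have h5 : X * (τ ^ 2 / 2 * I.card) ≤ X * ((I.filter (fun j => τ ^ 2 * X / 2 ≤ ‖K j i‖)).card : ℝ) := by
      nlinarith
    exact le_of_mul_le_mul_left h5 hX'
  · intro j hj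
    have hj2 := (mem_filter.mp hj).2
    refine ⟨round (α j - α i), ?_⟩
    obtain ⟨Y, hY⟩ := sum_Ico_filter_le X (min (y j) (y i)) (fun w => ee ((α j - α i) * w))
    have h3 := abs_sub_round_mul_norm_sum_ee_le (α j - α i) Y
    have h4 : K j i = ∑ w ∈ range Y, ee ((α j - α i) * w) := by
      simp only [K]; rw [hY]; simp
    rw [← h4] at h3
    rw [le_div_iff₀ (by positivity)]
    nlinarith [abs_nonneg (α j - α i - round (α j - α i)), mul_le_mul_of_nonneg_left hj2 (abs_nonneg (α j - α i - round (α j - α i)))]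

/-! ### Cubes in dense sets and alternating sums over them -/

section cubes
variable {V : Type*} [AddCommGroup V]

/-- All vertices of the cube with base point `y` and edges `ts j • (v j, 1)` lie in `B`. -/
def InCube (B : Finset (V × ℕ)) : (n : ℕ) → (Fin n → V) → (Fin n → ℕ) → V × ℕ → Prop
  | 0, _, _, y => y ∈ B
  | n + 1, v, ts, y => InCube B n (Fin.tail v) (Fin.tail ts) y ∧
      InCube B n (Fin.tail v) (Fin.tail ts) (y.1 + ts 0 • v 0, y.2 + ts 0)

/-- The alternating sum of `φ` over the vertices of a cube. -/
def cubeAlt (φ : V × ℕ → ℝ) : (n : ℕ) → (Fin n → V) → (Fin n → ℕ) → V × ℕ → ℝ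
  | 0, _, _, y => φ y
  | n + 1, v, ts, y => cubeAlt φ n (Fin.tail v) (Fin.tail ts) y -
      cubeAlt φ n (Fin.tail v) (Fin.tail ts) (y.1 + ts 0 • v 0, y.2 + ts 0)

lemma InCube.mem (B : Finset (V × ℕ)) (n : ℕ) (v : Fin n → V) (ts : Fin n → ℕ) (y : V × ℕ)
    (h : InCube B n v ts y) : y ∈ B := by
  induction n with
  | zero => exact h
  | succ n ih => exact ih _ _ h.1

lemma inCube_filter_shift (B : Finset (V × ℕ)) (u : V) (t n : ℕ) (v : Fin n → V) (ts : Fin n → ℕ)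
    (y : V × ℕ) :
    InCube (B.filter fun y => (y.1 + t • u, y.2 + t) ∈ B) n v ts y ↔
      InCube B n v ts y ∧ InCube B n v ts (y.1 + t • u, y.2 + t) := by
  induction n generalizing y with
  | zero => simp [InCube]
  | succ n ih =>
    simp only [InCube, ih]
    rw [show y.1 + t • u + ts 0 • v 0 = y.1 + ts 0 • v 0 + t • u by abel,
      show y.2 + t + ts 0 = y.2 + ts 0 + t by ring]
    tauto

lemma sum_card_filter_shift_ge [Fintype V] (B : Finset (V × ℕ)) (τ : ℕ)
    (hB : ∀ y ∈ B, y.2 < τ) (u : V) :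
    (B.card : ℝ) ^ 2 ≤ 2 * Fintype.card V *
      ∑ t ∈ range τ, ((B.filter fun y => (y.1 + t • u, y.2 + t) ∈ B).card : ℝ) := by
  let lab : V × ℕ → V := fun y => y.1 - y.2 • u
  have h1 : (B.card : ℝ) ^ 2 ≤ Fintype.card V * ∑ l : V, ((B.filter fun y => lab y = l).card : ℝ) ^ 2 := by
    have : (B.card : ℝ) = ∑ l : V, ((B.filter fun y => lab y = l).card : ℝ) := by
      rw [← Nat.cast_sum, card_eq_sum_card_fiberwise (f := lab) (t := univ) (by intro y _; simp)]
    rw [this, ← card_univ]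
    exact sq_sum_le_card_mul_sum_sq
  have h2 : ∑ l : V, ((B.filter fun y => lab y = l).card : ℝ) ^ 2 =
      (((B ×ˢ B).filter fun p => lab p.1 = lab p.2).card : ℝ) := by
    rw [card_eq_sum_card_fiberwise (f := fun p => lab p.1) (t := univ) (by intro y _; simp)]
    push_cast
    refine sum_congr rfl fun l _ => ?_
    rw [sq, ← Nat.cast_mul, ← card_product]
    congr 2
    ext p; simp only [mem_product, mem_filter]; constructor
    · rintro ⟨⟨a, b⟩, c, d⟩; exact ⟨⟨⟨a, c⟩, b.trans d.symm⟩, b⟩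
    · rintro ⟨⟨⟨a, c⟩, e⟩, b⟩; exact ⟨⟨a, b⟩, c, e.symm.trans b⟩
  set P := (B ×ˢ B).filter fun p => lab p.1 = lab p.2 ∧ p.1.2 ≤ p.2.2 with hP
  have h3 : (((B ×ˢ B).filter fun p => lab p.1 = lab p.2).card : ℝ) ≤ 2 * P.card := by
    have : (B ×ˢ B).filter (fun p => lab p.1 = lab p.2) ⊆ P ∪ P.image Prod.swap := by
      intro p hp
      simp only [mem_filter, mem_product, hP, mem_union, mem_image, Prod.exists, Prod.swap] at hp ⊢
      rcases le_total p.1.2 p.2.2 with h | h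
      · exact Or.inl ⟨hp.1, hp.2, h⟩
      · exact Or.inr ⟨p.2.1, p.2.2, p.1.1, p.1.2, ⟨⟨hp.1.2, hp.1.1⟩, hp.2.symm, h⟩, rfl⟩
    have := (card_le_card this).trans (card_union_le _ _)
    have h' := card_image_le (s := P) (f := Prod.swap)
    have : ((B ×ˢ B).filter (fun p => lab p.1 = lab p.2)).card ≤ 2 * P.card := by omega
    exact_mod_cast this
  have h4 : (P.card : ℝ) ≤ ∑ t ∈ range τ, ((B.filter fun y => (y.1 + t • u, y.2 + t) ∈ B).card : ℝ) := by
    rw [card_eq_sum_card_fiberwise (f := fun p => p.2.2 - p.1.2) (t := range τ)]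
    · push_cast
      refine sum_le_sum fun t _ => ?_
      rw [Nat.cast_le]
      refine card_le_card_of_injOn (fun p => p.1) ?_ ?_
      · intro p hp
        simp only [hP, coe_filter, mem_filter, mem_product, Set.mem_ofPred_eq, lab] at hp ⊢
        obtain ⟨⟨⟨a, b⟩, c, d⟩, e⟩ := hp
        refine ⟨a, ?_⟩
        convert b using 1
        have e2 : p.2.2 = p.1.2 + t := by omega
        ext1
        · simp only
          rw [e2, add_smul] at c
          rw [sub_eq_sub_iff_add_eq_add] at c
          have : p.1.1 + t • u + p.1.2 • u = p.2.1 + p.1.2 • u := by rw [← c]; abel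
          exact add_right_cancel this
        · exact e2.symm
      · intro p hp q hq hpq
        simp only [hP, coe_filter, mem_filter, mem_product, Set.mem_ofPred_eq, lab] at hp hq hpq
        obtain ⟨⟨⟨a, b⟩, c, d⟩, e⟩ := hp
        obtain ⟨⟨⟨a', b'⟩, c', d'⟩, e'⟩ := hq
        have e2 : p.2.2 = q.2.2 := by rw [hpq] at e d; omega
        have e3 : p.2.1 = q.2.1 := by
          rw [hpq, c', e2] at c
          exact (sub_left_injective c).symm
        exact Prod.ext hpq (Prod.ext e3 e2)
    · intro p hp
      simp only [hP, coe_filter, mem_product, Set.mem_ofPred_eq] at hp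
      have := hB _ hp.1.2
      simp only [coe_range, Set.mem_Iio]; omega
  calc (B.card : ℝ) ^ 2 ≤ Fintype.card V * (2 * P.card) := by
        refine h1.trans ?_; rw [h2]; gcongr
    _ ≤ Fintype.card V * (2 * ∑ t ∈ range τ, ((B.filter fun y => (y.1 + t • u, y.2 + t) ∈ B).card : ℝ)) := by gcongr
    _ = _ := by ring

/-- A dense set contains many cubes with prescribed edge directions. -/
theorem sum_card_inCube_ge [Fintype V] (τ : ℕ) (hτ : 0 < τ) (n : ℕ) (v : Fin n → V)
    (B : Finset (V × ℕ)) (hB : ∀ y ∈ B, y.2 < τ) :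
    2 * (τ : ℝ) ^ (n + 1) * Fintype.card V * (B.card / (2 * Fintype.card V * τ)) ^ 2 ^ n ≤
      ∑ ts ∈ Fintype.piFinset (fun _ : Fin n => range τ), ((B.filter (InCube B n v ts)).card : ℝ) := by
  have hτ' : (0 : ℝ) < τ := by exact_mod_cast hτ
  have hV : (0 : ℝ) < Fintype.card V := by
    have : 0 < Fintype.card V := Fintype.card_pos
    exact_mod_cast this
  induction n generalizing B with
  | zero =>
    have e : Fintype.piFinset (fun _ : Fin 0 => range τ) = {![]} := by
      ext x
      simp only [Fintype.mem_piFinset, IsEmpty.forall_iff, mem_singleton]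
      exact iff_of_true trivial (Subsingleton.elim _ _)
    rw [e, sum_singleton]
    have : B.filter (InCube B 0 v ![]) = B := by
      apply filter_true_of_mem; intro y hy; exact hy
    rw [this]
    apply le_of_eq
    rw [pow_zero, pow_one, pow_one]; field_simp
  | succ n ih =>
    rw [sum_piFinset_fin_cons]
    let Bt : ℕ → Finset (V × ℕ) := fun t => B.filter fun y => (y.1 + t • v 0, y.2 + t) ∈ B
    have h1 : ∀ t ∈ range τ, 2 * (τ : ℝ) ^ (n + 1) * Fintype.card V *
        ((Bt t).card / (2 * Fintype.card V * τ)) ^ 2 ^ n ≤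
        ∑ ts ∈ Fintype.piFinset (fun _ : Fin n => range τ),
          ((B.filter (InCube B (n + 1) v (Fin.cons t ts))).card : ℝ) := by
      intro t _
      refine (ih (Fin.tail v) (Bt t) (fun y hy => hB y (mem_filter.mp hy).1)).trans (sum_le_sum fun ts _ => ?_)
      rw [Nat.cast_le]
      apply card_le_card
      intro y hy
      rw [mem_filter] at hy ⊢
      refine ⟨(mem_filter.mp hy.1).1, ?_⟩
      have := (inCube_filter_shift B (v 0) t n (Fin.tail v) ts y).mp hy.2
      simpa [InCube] using this
    refine le_trans ?_ (sum_le_sum h1)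
    rw [← mul_sum]
    have h2 := sum_card_filter_shift_ge B τ hB (v 0)
    set a : ℕ → ℝ := fun t => (Bt t).card / (2 * Fintype.card V * τ) with ha
    have h3 : τ * (B.card / (2 * Fintype.card V * τ) : ℝ) ^ 2 ≤ ∑ t ∈ range τ, a t := by
      simp only [ha]; rw [← sum_div, le_div_iff₀ (by positivity)]
      have : (τ : ℝ) * (B.card / (2 * Fintype.card V * τ)) ^ 2 * (2 * Fintype.card V * τ) =
        B.card ^ 2 / (2 * Fintype.card V) := by field_simp
      rw [this, div_le_iff₀ (by positivity)]
      linarith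
    obtain ⟨m, hm⟩ : ∃ m, 2 ^ n = m + 1 := ⟨2 ^ n - 1, by have := Nat.one_le_two_pow (n := n); omega⟩
    have h4 := sum_pow_le_card_pow_mul (range τ) a (fun t _ => by positivity) m
    rw [card_range, ← hm] at h4
    have h5 : (τ : ℝ) ^ m * (τ * (B.card / (2 * Fintype.card V * τ) : ℝ) ^ 2 ^ (n + 1)) ≤
        τ ^ m * ∑ t ∈ range τ, a t ^ 2 ^ n := by
      refine le_trans ?_ h4
      calc _ = (τ * (B.card / (2 * Fintype.card V * τ) : ℝ) ^ 2) ^ 2 ^ n := by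
            rw [mul_pow, ← pow_mul, ← pow_succ' 2 n, hm]; ring
        _ ≤ _ := by gcongr
    have h6 := le_of_mul_le_mul_left h5 (by positivity)
    calc _ = 2 * (τ : ℝ) ^ (n + 1) * Fintype.card V * (τ * (B.card / (2 * Fintype.card V * τ) : ℝ) ^ 2 ^ (n + 1)) := by
          ring
      _ ≤ _ := by gcongr

lemma cubeAlt_sum {ι : Type*} (s : Finset ι) (φ : ι → V × ℕ → ℝ) (n : ℕ) (v : Fin n → V)
    (ts : Fin n → ℕ) (y : V × ℕ) :
    cubeAlt (fun y => ∑ i ∈ s, φ i y) n v ts y = ∑ i ∈ s, cubeAlt (φ i) n v ts y := by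
  induction n generalizing y with
  | zero => rfl
  | succ n ih => simp only [cubeAlt, ih, sum_sub_distrib]

lemma cubeAlt_shift_invariant (φ : V × ℕ → ℝ) (u : V)
    (hφ : ∀ y t, φ (y.1 + t • u, y.2 + t) = φ y) (n : ℕ) (v : Fin n → V)
    (ts : Fin n → ℕ) (y : V × ℕ) (t : ℕ) :
    cubeAlt φ n v ts (y.1 + t • u, y.2 + t) = cubeAlt φ n v ts y := by
  induction n generalizing y with
  | zero => exact hφ y t
  | succ n ih =>
    simp only [cubeAlt]
    rw [ih]
    rw [show y.1 + t • u + ts 0 • v 0 = y.1 + ts 0 • v 0 + t • u by abel,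
      show y.2 + t + ts 0 = y.2 + ts 0 + t by ring]
    rw [ih (Fin.tail v) (Fin.tail ts) (y.1 + ts 0 • v 0, y.2 + ts 0)]

lemma cubeAlt_eq_zero (φ : V × ℕ → ℝ) (n : ℕ) (v : Fin n → V) (j : Fin n)
    (hφ : ∀ y t, φ (y.1 + t • v j, y.2 + t) = φ y) (ts : Fin n → ℕ) (y : V × ℕ) :
    cubeAlt φ n v ts y = 0 := by
  induction n generalizing y with
  | zero => exact j.elim0
  | succ n ih =>
    simp only [cubeAlt]
    refine Fin.cases (motive := fun j => (∀ y t, φ (y.1 + t • v j, y.2 + t) = φ y) → _) ?_ ?_ j hφ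
    · intro hφ
      rw [cubeAlt_shift_invariant φ (v 0) hφ, sub_self]
    · intro j hφ
      rw [ih (Fin.tail v) j hφ, ih (Fin.tail v) j hφ, sub_zero]

end cubes

/-! ### Alternating sums of reciprocals -/

/-- The alternating sum of `1 / x` over the cube with base point `d` and edges `T`. -/
def altInv : (n : ℕ) → (Fin n → ℕ) → ℕ → ℝ
  | 0, _, d => 1 / d
  | n + 1, T, d => altInv n (Fin.tail T) d - altInv n (Fin.tail T) (d + T 0)

/-- The product of the vertices of the cube with base point `d` and edges `T`. -/
def cubeProd : (n : ℕ) → (Fin n → ℕ) → ℕ → ℕ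
  | 0, _, d => d
  | n + 1, T, d => cubeProd n (Fin.tail T) d * cubeProd n (Fin.tail T) (d + T 0)

lemma cubeProd_pos (n : ℕ) (T : Fin n → ℕ) (d : ℕ) (hd : 0 < d) : 0 < cubeProd n T d := by
  induction n generalizing d with
  | zero => exact hd
  | succ n ih => exact Nat.mul_pos (ih _ _ hd) (ih _ _ (by omega))

lemma exists_int_eq_cubeProd_mul_altInv (n : ℕ) (T : Fin n → ℕ) (d : ℕ) (hd : 0 < d) :
    ∃ m : ℤ, (m : ℝ) = cubeProd n T d * altInv n T d := by
  induction n generalizing d with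
  | zero => exact ⟨1, by have : (d : ℝ) ≠ 0 := by positivity
                         simp [cubeProd, altInv, this]⟩
  | succ n ih =>
    obtain ⟨m₁, h₁⟩ := ih (Fin.tail T) d hd
    obtain ⟨m₂, h₂⟩ := ih (Fin.tail T) (d + T 0) (by omega)
    refine ⟨m₁ * cubeProd n (Fin.tail T) (d + T 0) - m₂ * cubeProd n (Fin.tail T) d, ?_⟩
    push_cast [cubeProd, altInv, h₁, h₂]
    ring

lemma altInv_eq_integral (n : ℕ) (T : Fin n → ℕ) (d : ℕ) (hd : 0 < d) :
    altInv n T d = ∫ y in (0:ℝ)..1, y ^ (d - 1) * ∏ j, (1 - y ^ T j) := by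
  induction n generalizing d with
  | zero =>
    simp only [altInv, Finset.univ_eq_empty, prod_empty, mul_one, integral_pow]
    rw [show d - 1 + 1 = d by omega]
    have : ((d - 1 : ℕ) : ℝ) + 1 = d := by rw [Nat.cast_sub hd]; simp
    rw [this]; simp [show d ≠ 0 by omega]
  | succ n ih =>
    simp only [altInv]
    rw [ih _ d hd, ih _ (d + T 0) (by omega), ← intervalIntegral.integral_sub]
    · refine intervalIntegral.integral_congr fun y _ => ?_
      simp only [Fin.prod_univ_succ, Fin.tail]
      rw [show d + T 0 - 1 = (d - 1) + T 0 by omega, pow_add]; ring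
    · exact (by fun_prop : Continuous fun y : ℝ => y ^ (d - 1) * ∏ j, (1 - y ^ (Fin.tail T) j)).intervalIntegrable _ _
    · exact (by fun_prop : Continuous fun y : ℝ => y ^ (d + T 0 - 1) * ∏ j, (1 - y ^ (Fin.tail T) j)).intervalIntegrable _ _

lemma altInv_le_one (n : ℕ) (T : Fin n → ℕ) (d : ℕ) (hd : 0 < d) : altInv n T d ≤ 1 := by
  rw [altInv_eq_integral n T d hd]
  calc _ ≤ ∫ y in (0:ℝ)..1, (1:ℝ) := by
        refine intervalIntegral.integral_mono_on zero_le_one ?_ (by simp) ?_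
        · exact (by fun_prop : Continuous fun y : ℝ => y ^ (d - 1) * ∏ j, (1 - y ^ T j)).intervalIntegrable _ _
        · intro y hy
          refine mul_le_one₀ (pow_le_one₀ hy.1 hy.2) ?_ ?_
          · exact prod_nonneg fun j _ => sub_nonneg.mpr (pow_le_one₀ hy.1 hy.2)
          · refine prod_le_one (fun j _ => sub_nonneg.mpr (pow_le_one₀ hy.1 hy.2)) fun j _ => ?_
            have := pow_nonneg hy.1 (T j); linarith
    _ = 1 := by simp

lemma altInv_ge (n : ℕ) (T : Fin n → ℕ) (d D : ℕ) (hd : 0 < d) (hD : 2 ≤ D) (hdD : d ≤ 2 * D)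
    (ε : ℝ) (hε : 0 < ε) (hT : ∀ j, ε * D ≤ T j) (hT' : ∀ j, T j ≤ 2 * D) :
    Real.exp (-4) / (2 * D) * (ε / 4) ^ n ≤ altInv n T d := by
  rw [altInv_eq_integral n T d hd]
  have hDr : (2 : ℝ) ≤ D := by exact_mod_cast hD
  have hcont : Continuous fun y : ℝ => y ^ (d - 1) * ∏ j, (1 - y ^ T j) := by fun_prop
  have hD0 : (0 : ℝ) < D := by linarith
  have h1D : 1 / (D : ℝ) ≤ 1 / 2 := one_div_le_one_div_of_le (by norm_num) hDr
  have h2D : 1 / (2 * D : ℝ) = (1 / D) / 2 := by field_simp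
  have hDpos : 0 < 1 / (D : ℝ) := by positivity
  calc _ = ∫ y in (1 - 1 / D : ℝ)..(1 - 1 / (2 * D)), Real.exp (-4) * (ε / 4) ^ n := by
        rw [intervalIntegral.integral_const, smul_eq_mul]; field_simp; ring
    _ ≤ ∫ y in (1 - 1 / D : ℝ)..(1 - 1 / (2 * D)), y ^ (d - 1) * ∏ j, (1 - y ^ T j) := by
        refine intervalIntegral.integral_mono_on (by linarith) (by simp)
          (hcont.intervalIntegrable _ _) fun y hy => ?_
        have hy0 : 0 ≤ y := by linarith [hy.1]
        have hy1 : y ≤ 1 := by linarith [hy.2]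
        refine mul_le_mul ?_ ?_ (by positivity) (by positivity)
        · have e1 : Real.exp (-(2 / D)) ≤ 1 - 1 / D := by
            rw [Real.exp_neg, inv_le_comm₀ (Real.exp_pos _) (by linarith)]
            refine le_trans ?_ (Real.add_one_le_exp _)
            rw [inv_le_iff_one_le_mul₀ (by linarith)]
            have : (2 / D : ℝ) = 2 * (1 / D) := by ring
            rw [this]; nlinarith
          calc Real.exp (-4) = Real.exp (-(2 / D)) ^ (2 * D) := by
                rw [← Real.exp_nat_mul]; congr 1; push_cast; field_simp; norm_num
            _ ≤ y ^ (2 * D) := by gcongr; linarith [hy.1]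
            _ ≤ y ^ (d - 1) := pow_le_pow_of_le_one hy0 hy1 (by omega)
        · have : (ε / 4) ^ n = ∏ _j : Fin n, (ε / 4) := by
            rw [prod_const, card_univ, Fintype.card_fin]
          rw [this]
          refine prod_le_prod (fun _ _ => by positivity) fun j _ => ?_
          set x : ℝ := T j / (2 * D) with hx
          have hx0 : 0 ≤ x := by positivity
          have hTj : (T j : ℝ) ≤ 2 * D := by exact_mod_cast hT' j
          have hx1 : x ≤ 1 := by rw [hx, div_le_one (by positivity)]; exact hTj
          have hxε : ε / 4 ≤ x / 2 := by
            rw [hx, div_div, div_le_div_iff₀ (by norm_num) (by positivity)]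
            nlinarith [hT j]
          have e2 : y ^ T j ≤ Real.exp (-x) := by
            calc y ^ T j ≤ (Real.exp (-(1 / (2 * D)))) ^ T j := by
                  gcongr
                  have := Real.add_one_le_exp (-(1 / (2 * D : ℝ)))
                  linarith [hy.2]
              _ = Real.exp (-x) := by
                  rw [← Real.exp_nat_mul]; congr 1; rw [hx]; field_simp
          have e3 : Real.exp (-x) ≤ 1 - x / 2 := by
            rw [Real.exp_neg, inv_le_comm₀ (Real.exp_pos _) (by linarith)]
            refine le_trans ?_ (Real.add_one_le_exp _)
            rw [inv_le_iff_one_le_mul₀ (by linarith)]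
            nlinarith
          linarith
    _ ≤ _ := by
        refine intervalIntegral.integral_mono_interval (by linarith) (by linarith) (by linarith) ?_
          (hcont.intervalIntegrable _ _)
        refine (MeasureTheory.ae_restrict_mem measurableSet_Ioc).mono fun y hy => ?_
        refine mul_nonneg (pow_nonneg hy.1.le _) ?_
        exact prod_nonneg fun j _ => sub_nonneg.mpr (pow_le_one₀ hy.1.le hy.2)

section dioph
variable {V : Type*} [AddCommGroup V]

lemma cubeAlt_approx (B : Finset (V × ℕ)) (a M : ℕ) (D κ ξ : ℝ) (hD : 0 < D) (β : V × ℕ → ℝ)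
    (hBD : ∀ y ∈ B, D ≤ a + M * y.2)
    (hB : ∀ y ∈ B, ∃ n : ℤ, |(a + M * y.2) * β y - ξ - n| ≤ κ)
    (n : ℕ) (v : Fin n → V) (ts : Fin n → ℕ) (y : V × ℕ) (hy : InCube B n v ts y) :
    ∃ z : ℤ, |cubeAlt β n v ts y - ξ * altInv n (fun j => M * ts j) (a + M * y.2) -
      z / cubeProd n (fun j => M * ts j) (a + M * y.2)| ≤ 2 ^ n * κ / D := by
  induction n generalizing y with
  | zero =>
    obtain ⟨m, hm⟩ := hB y hy
    have hd := hBD y hy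
    refine ⟨m, ?_⟩
    simp only [cubeAlt, altInv, cubeProd, pow_zero, one_mul]
    push_cast
    have hpos : (0 : ℝ) < a + M * y.2 := by linarith
    have : β y - ξ * (1 / (a + M * y.2)) - m / (a + M * y.2) =
        ((a + M * y.2) * β y - ξ - m) / (a + M * y.2) := by field_simp
    rw [this, abs_div, abs_of_pos hpos]
    have hκ : 0 ≤ κ := (abs_nonneg _).trans hm
    exact div_le_div₀ hκ hm hD hd
  | succ n ih =>
    obtain ⟨z₁, h₁⟩ := ih (Fin.tail v) (Fin.tail ts) y hy.1
    obtain ⟨z₂, h₂⟩ := ih (Fin.tail v) (Fin.tail ts) _ hy.2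
    have e : a + M * (y.2 + ts 0) = a + M * y.2 + M * ts 0 := by ring
    simp only [e] at h₂
    have hpos : 0 < a + M * y.2 := by
      have := hBD y (hy.1.mem)
      have : (0 : ℝ) < ((a + M * y.2 : ℕ) : ℝ) := by push_cast; linarith
      exact_mod_cast this
    set q₁ := cubeProd n (fun j => M * Fin.tail ts j) (a + M * y.2) with hq₁
    set q₂ := cubeProd n (fun j => M * Fin.tail ts j) (a + M * y.2 + M * ts 0) with hq₂
    have hq₁p : (0 : ℝ) < q₁ := by exact_mod_cast cubeProd_pos _ _ _ hpos
    have hq₂p : (0 : ℝ) < q₂ := by exact_mod_cast cubeProd_pos _ _ _ (by omega)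
    refine ⟨z₁ * q₂ - z₂ * q₁, ?_⟩
    have e1 : cubeProd (n + 1) (fun j => M * ts j) (a + M * y.2) = q₁ * q₂ := rfl
    have e2 : altInv (n + 1) (fun j => M * ts j) (a + M * y.2) =
      altInv n (fun j => M * Fin.tail ts j) (a + M * y.2) -
      altInv n (fun j => M * Fin.tail ts j) (a + M * y.2 + M * ts 0) := rfl
    rw [e1, e2]
    simp only [cubeAlt]
    have e3 : (((z₁ * q₂ - z₂ * q₁ : ℤ) : ℝ)) / ((q₁ * q₂ : ℕ) : ℝ) = z₁ / q₁ - z₂ / q₂ := by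
      push_cast; field_simp
    rw [e3]
    have h3 := abs_sub _ _ |>.trans (add_le_add h₁ h₂)
    refine le_trans (le_of_eq ?_) (h3.trans (le_of_eq ?_))
    · congr 1; ring
    · ring

lemma cubeProd_le (B : Finset (V × ℕ)) (a M U : ℕ) (hB : ∀ y ∈ B, a + M * y.2 ≤ U)
    (n : ℕ) (v : Fin n → V) (ts : Fin n → ℕ) (y : V × ℕ) (hy : InCube B n v ts y) :
    cubeProd n (fun j => M * ts j) (a + M * y.2) ≤ U ^ 2 ^ n := by
  induction n generalizing y with
  | zero => simpa [cubeProd] using hB y hy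
  | succ n ih =>
    have h₁ := ih (Fin.tail v) (Fin.tail ts) y hy.1
    have h₂ := ih (Fin.tail v) (Fin.tail ts) _ hy.2
    have e : a + M * (y.2 + ts 0) = a + M * y.2 + M * ts 0 := by ring
    simp only [e] at h₂
    rw [pow_succ, mul_two, pow_add]
    exact Nat.mul_le_mul h₁ h₂

/-- If `d β(y) ≡ ξ` approximately at all vertices of a cube over which the alternating sum of `β`
vanishes, then `ξ` is close to a rational with a denominator that depends only on the cube. -/
theorem exists_rational_of_cube (B : Finset (V × ℕ)) (a M : ℕ) (D κ ξ s₀ : ℝ) (hD : 0 < D)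
    (hs₀ : 0 < s₀) (β : V × ℕ → ℝ)
    (hBD : ∀ y ∈ B, D ≤ a + M * y.2)
    (hB : ∀ y ∈ B, ∃ n : ℤ, |(a + M * y.2) * β y - ξ - n| ≤ κ)
    (n : ℕ) (v : Fin n → V) (ts : Fin n → ℕ) (y : V × ℕ) (hy : InCube B n v ts y)
    (h0 : cubeAlt β n v ts y = 0) (m : ℕ)
    (hm : (m : ℝ) = cubeProd n (fun j => M * ts j) (a + M * y.2) *
      altInv n (fun j => M * ts j) (a + M * y.2))
    (hs : s₀ ≤ altInv n (fun j => M * ts j) (a + M * y.2)) :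
    ∃ z : ℤ, |ξ - z / m| ≤ 2 ^ n * κ / (D * s₀) := by
  obtain ⟨z, hz⟩ := cubeAlt_approx B a M D κ ξ hD β hBD hB n v ts y hy
  rw [h0] at hz
  set s := altInv n (fun j => M * ts j) (a + M * y.2)
  set q := cubeProd n (fun j => M * ts j) (a + M * y.2)
  have hpos : 0 < a + M * y.2 := by
    have := hBD y (hy.mem)
    have : (0 : ℝ) < ((a + M * y.2 : ℕ) : ℝ) := by push_cast; linarith
    exact_mod_cast this
  have hq : (0 : ℝ) < q := by exact_mod_cast cubeProd_pos _ _ _ hpos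
  have hsp : 0 < s := by linarith
  refine ⟨-z, ?_⟩
  have e : ξ - ((-z : ℤ) : ℝ) / m = -((0 - ξ * s - z / q) / s) := by
    rw [hm]; push_cast; field_simp; ring
  rw [e, abs_neg, abs_div, abs_of_pos hsp, div_le_iff₀ hsp]
  refine hz.trans ?_
  have hκ : 0 ≤ 2 ^ n * κ / D := (abs_nonneg _).trans hz
  calc 2 ^ n * κ / D ≤ 2 ^ n * κ / D * (s / s₀) := by
        refine le_mul_of_one_le_right hκ ?_
        rwa [one_le_div hs₀]
    _ = _ := by field_simp

end dioph

/-! ### Corners of box differences -/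

lemma boxDiff_eq_sum {G : Type*} [AddCommGroup G] (γ : G) (r : ℕ) (k : Fin r → ℤ)
    (θ : (Fin r → G) → ℝ) (h : Fin r → G) :
    boxDiff γ r k θ h = ∑ ω : Fin r → Bool, (∏ i, (if ω i then (-1 : ℝ) else 1)) *
      θ (fun i => h i - if ω i then k i • γ else 0) := by
  induction r with
  | zero =>
    simp only [boxDiff, univ_eq_empty, prod_empty, one_mul]
    rw [Fintype.sum_unique]
    exact congrArg θ (Subsingleton.elim _ _)
  | succ r ih =>
    simp only [boxDiff]
    rw [ih, sum_fin_cons]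
    rw [Fintype.sum_bool, ← sum_add_distrib]
    refine sum_congr rfl fun ω _ => ?_
    simp only [Fin.prod_univ_succ, Fin.cons_zero, Fin.cons_succ, if_true, Bool.false_eq_true, if_false]
    have e2 : (fun i => h i - if (Fin.cons true ω : Fin (r+1) → Bool) i then k i • γ else 0) =
        (Fin.cons (h 0 - k 0 • γ) (fun i => Fin.tail h i - if ω i = true then Fin.tail k i • γ else 0) : Fin (r+1) → G) := by
      funext i; refine Fin.cases ?_ (fun j => ?_) i
      · simp
      · simp [Fin.tail]
    have e3 : (fun i => h i - if (Fin.cons false ω : Fin (r+1) → Bool) i then k i • γ else 0) =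
        (Fin.cons (h 0) (fun i => Fin.tail h i - if ω i = true then Fin.tail k i • γ else 0) : Fin (r+1) → G) := by
      funext i; refine Fin.cases ?_ (fun j => ?_) i
      · simp
      · simp [Fin.tail]
    rw [e2, e3]; ring

/-- Edge directions of the cubes over which box differences cancel. -/
def cornerDir {G : Type*} [AddCommGroup G] (γ : G) (r : ℕ) (k : Fin r → ℤ) :
    Fin (Fintype.card (Fin r → Bool)) → (Fin r → G) :=
  fun j i => if (Fintype.equivFin (Fin r → Bool)).symm j i then k i • γ else 0

lemma cubeAlt_boxDiff {G : Type*} [AddCommGroup G] (γ₀ γ₁ : G) (r : ℕ) (k : Fin r → ℤ)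
    (θ : (Fin r → G) → ℝ) (ts : Fin (Fintype.card (Fin r → Bool)) → ℕ) (y : (Fin r → G) × ℕ) :
    cubeAlt (fun y => boxDiff (γ₀ + y.2 • γ₁) r k θ y.1) _ (cornerDir γ₁ r k) ts y = 0 := by
  simp only [boxDiff_eq_sum]
  rw [cubeAlt_sum]
  refine sum_eq_zero fun ω _ => ?_
  refine cubeAlt_eq_zero _ _ _ (Fintype.equivFin (Fin r → Bool) ω) ?_ _ _
  intro y t
  dsimp only
  congr 2
  funext i
  simp only [cornerDir, Equiv.symm_apply_apply, Pi.add_apply, Pi.smul_apply]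
  split_ifs
  · rw [add_smul, ← add_assoc, smul_add, smul_comm t (k i)]; abel
  · simp

/-! ### Reciprocals of primes in `4`-adic ranges -/

lemma log_four_eq : Real.log 4 = 2 * Real.log 2 := by
  rw [show (4:ℝ) = 2 ^ 2 by norm_num, Real.log_pow]; norm_num

lemma theta_block_ge (j : ℕ) (hj : 10 ≤ j) :
    (4 : ℝ) ^ (j + 1) / 4 ≤ Chebyshev.theta (4 ^ (j + 1) : ℕ) - Chebyshev.theta (4 ^ j : ℕ) := by
  have h1 := Chebyshev.theta_ge (4 ^ (j + 1))
  have h2 := Chebyshev.theta_le_log4_mul_x (x := ((4 ^ j : ℕ) : ℝ)) (by positivity)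
  set w : ℝ := 2 ^ (j + 1) with hw
  have hsq : ((4 ^ (j + 1) : ℕ) : ℝ) = w ^ 2 := by
    rw [hw, ← pow_mul, mul_comm, pow_mul]; norm_num
  have hsq' : ((4 ^ j : ℕ) : ℝ) = w ^ 2 / 4 := by
    rw [← hsq]; push_cast; rw [pow_succ]; ring
  have hw0 : 0 < w := by positivity
  have hlin : 64 * ((j : ℝ) + 1) ≤ w := by
    have : ∀ j : ℕ, 10 ≤ j → 64 * (j + 1) ≤ 2 ^ (j + 1) := by
      intro j hj
      induction j, hj using Nat.le_induction with
      | base => norm_num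
      | succ j hj ih => rw [pow_succ]; omega
    have := this j hj
    rw [hw]; exact_mod_cast this
  rw [hsq] at h1; rw [hsq'] at h2
  rw [Real.sqrt_sq hw0.le, Real.log_pow, hw, Real.log_pow, ← hw] at h1
  rw [hsq, hsq']
  have e4 : (4 : ℝ) ^ (j + 1) = w ^ 2 := by rw [← hsq]; push_cast; rfl
  rw [e4]
  rw [log_four_eq] at h2
  have hl1 := Real.log_two_gt_d9
  have hl2 := Real.log_two_lt_d9
  have hlog : Real.log (w ^ 2 + 1) ≤ 2 * w := by
    have : Real.log (w ^ 2 + 1) ≤ Real.log ((w + 1) ^ 2) :=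
      Real.log_le_log (by positivity) (by nlinarith)
    rw [Real.log_pow] at this
    have h3 := Real.log_le_sub_one_of_pos (show 0 < w + 1 by linarith)
    push_cast at this; linarith
  push_cast at h1
  have h5 : 2 * w * (2 * ((j + 1) * Real.log 2)) ≤ w ^ 2 * (0.0625 * 0.6931471808) := by
    have : (2:ℝ) * ((j + 1) * Real.log 2) ≤ w / 32 * 0.6931471808 := by nlinarith
    nlinarith
  have hw64 : (704:ℝ) ≤ w := by
    have : (10:ℝ) ≤ j := by exact_mod_cast hj
    linarith
  nlinarith

lemma sum_inv_primes_block (j : ℕ) (hj : 10 ≤ j) :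
    1 / (6 * ((j : ℝ) + 1)) ≤ ∑ p ∈ (Ioc (4 ^ j) (4 ^ (j + 1))).filter Nat.Prime, (1 / (p : ℝ)) ∧
    ∑ p ∈ (Ioc (4 ^ j) (4 ^ (j + 1))).filter Nat.Prime, (1 / (p : ℝ)) ≤ 4 / j := by
  have hj0 : (0:ℝ) < j := by have : 0 < j := by omega
                             exact_mod_cast this
  set P := (Ioc (4 ^ j) (4 ^ (j + 1))).filter Nat.Prime with hP
  have hmono : (4:ℕ) ^ j ≤ 4 ^ (j + 1) := Nat.pow_le_pow_right (by norm_num) (by omega)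
  have htheta : Chebyshev.theta (4 ^ (j + 1) : ℕ) - Chebyshev.theta (4 ^ j : ℕ) =
      ∑ p ∈ P, Real.log p := by
    rw [Chebyshev.theta, Chebyshev.theta, Nat.floor_natCast, Nat.floor_natCast, hP,
      ← Ioc_union_Ioc_eq_Ioc (Nat.zero_le _) hmono, filter_union, sum_union, add_sub_cancel_left]
    refine disjoint_filter_filter ?_
    rw [Finset.disjoint_left]; intro x; simp; omega
  have hl4 : 0 < Real.log 4 := Real.log_pos (by norm_num)
  have hlow := theta_block_ge j hj
  have hup := Chebyshev.theta_le_log4_mul_x (x := ((4 ^ (j + 1) : ℕ) : ℝ)) (by positivity)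
  have hth0 := Chebyshev.theta_nonneg ((4 ^ j : ℕ) : ℝ)
  have hmem : ∀ p ∈ P, (4:ℝ) ^ j < p ∧ (p:ℝ) ≤ 4 ^ (j + 1) ∧ j * Real.log 4 ≤ Real.log p ∧
      Real.log p ≤ (j + 1) * Real.log 4 := by
    intro p hp
    simp only [hP, mem_filter, mem_Ioc] at hp
    have a1 : (4:ℝ) ^ j < p := by exact_mod_cast hp.1.1
    have a2 : (p:ℝ) ≤ 4 ^ (j + 1) := by exact_mod_cast hp.1.2
    have hp0 : (0:ℝ) < p := by have := hp.2.pos; exact_mod_cast this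
    refine ⟨a1, a2, ?_, ?_⟩
    · rw [← Real.log_pow]; exact Real.log_le_log (by positivity) a1.le
    · have := Real.log_le_log hp0 a2
      rw [Real.log_pow] at this; push_cast at this; exact this
  have hl2 := Real.log_two_lt_d9
  constructor
  · have : ∑ p ∈ P, Real.log p ≤ ∑ p ∈ P, (1 / (p:ℝ)) * (4 ^ (j + 1) * ((j + 1) * Real.log 4)) := by
      refine sum_le_sum fun p hp => ?_
      obtain ⟨a1, a2, a3, a4⟩ := hmem p hp
      have hp0 : (0:ℝ) < p := lt_of_le_of_lt (by positivity) a1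
      rw [one_div_mul_eq_div, le_div_iff₀ hp0, mul_comm]
      have : 0 ≤ Real.log p := le_trans (by positivity) a3
      gcongr
    rw [← sum_mul, ← htheta] at this
    have h3 := hlow.trans this
    rw [div_le_iff₀ (by positivity)]
    have h4 : (4:ℝ) ^ (j + 1) * 1 ≤ 4 ^ (j + 1) * ((∑ p ∈ P, (1 / (p:ℝ))) * (4 * (j + 1) * Real.log 4)) := by
      linarith
    have h5 := le_of_mul_le_mul_left h4 (by positivity)
    have hs : 0 ≤ ∑ p ∈ P, (1 / (p:ℝ)) := by positivity
    rw [log_four_eq] at h5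
    refine h5.trans ?_
    refine mul_le_mul_of_nonneg_left ?_ hs
    nlinarith
  · have : ∑ p ∈ P, (1 / (p:ℝ)) * (4 ^ j * (j * Real.log 4)) ≤ ∑ p ∈ P, Real.log p := by
      refine sum_le_sum fun p hp => ?_
      obtain ⟨a1, a2, a3, a4⟩ := hmem p hp
      have hp0 : (0:ℝ) < p := lt_of_le_of_lt (by positivity) a1
      rw [one_div_mul_eq_div, div_le_iff₀ hp0, mul_comm (Real.log _)]
      gcongr
    rw [← sum_mul, ← htheta] at this
    rw [le_div_iff₀ hj0]
    push_cast at hup this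
    have h4 : (4:ℝ) ^ j * Real.log 4 * ((∑ p ∈ P, (1 / (p:ℝ))) * j) ≤ 4 ^ j * Real.log 4 * 4 := by
      rw [pow_succ] at hup this
      push_cast at hth0
      linarith
    exact le_of_mul_le_mul_left h4 (by positivity)

lemma sum_inv_primes_Ioc_split {a b c : ℕ} (hab : a ≤ b) (hbc : b ≤ c) :
    ∑ p ∈ (Ioc a c).filter Nat.Prime, (1 / (p : ℝ)) =
      ∑ p ∈ (Ioc a b).filter Nat.Prime, (1 / (p : ℝ)) + ∑ p ∈ (Ioc b c).filter Nat.Prime, (1 / (p : ℝ)) := by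
  rw [← Ioc_union_Ioc_eq_Ioc hab hbc, filter_union, sum_union]
  refine disjoint_filter_filter ?_
  rw [Finset.disjoint_left]; intro x; simp; omega

lemma sum_inv_primes_four_pow (a b : ℕ) (ha : 10 ≤ a) (hab : a ≤ b) :
    ∑ j ∈ Ico a b, 1 / (6 * ((j : ℝ) + 1)) ≤ ∑ p ∈ (Ioc (4 ^ a) (4 ^ b)).filter Nat.Prime, (1 / (p : ℝ)) ∧
    ∑ p ∈ (Ioc (4 ^ a) (4 ^ b)).filter Nat.Prime, (1 / (p : ℝ)) ≤ ∑ j ∈ Ico a b, 4 / (j : ℝ) := by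
  induction b, hab using Nat.le_induction with
  | base => simp
  | succ b hb ih =>
    rw [sum_Ico_succ_top hb, sum_Ico_succ_top hb,
      sum_inv_primes_Ioc_split (Nat.pow_le_pow_right (by norm_num) hb)
        (Nat.pow_le_pow_right (by norm_num) (Nat.le_succ b))]
    have := sum_inv_primes_block b (by omega)
    exact ⟨add_le_add ih.1 this.1, add_le_add ih.2 this.2⟩

lemma sum_inv_primes_bounds (a I : ℕ) (ha : 10 ≤ a) :
    (I : ℝ) / 12 ≤ ∑ p ∈ (Ioc (4 ^ a) (4 ^ (a * 2 ^ I))).filter Nat.Prime, (1 / (p : ℝ)) ∧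
    ∑ p ∈ (Ioc (4 ^ a) (4 ^ (a * 2 ^ I))).filter Nat.Prime, (1 / (p : ℝ)) ≤ 4 * I := by
  induction I with
  | zero => simp
  | succ I ih =>
    set c := a * 2 ^ I with hc
    have hca : a ≤ c := Nat.le_mul_of_pos_right a (by positivity)
    have hc2 : a * 2 ^ (I + 1) = 2 * c := by rw [hc]; ring
    have hc0 : (0:ℝ) < c := by have : 0 < c := by omega
                               exact_mod_cast this
    rw [hc2, sum_inv_primes_Ioc_split (Nat.pow_le_pow_right (by norm_num) hca)
        (Nat.pow_le_pow_right (by norm_num) (show c ≤ 2 * c by omega))]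
    have h := sum_inv_primes_four_pow c (2 * c) (by omega) (by omega)
    have l1 : (1:ℝ) / 12 ≤ ∑ j ∈ Ico c (2 * c), 1 / (6 * ((j : ℝ) + 1)) := by
      calc (1:ℝ) / 12 = ∑ j ∈ Ico c (2 * c), 1 / (12 * (c:ℝ)) := by
            rw [sum_const, Nat.card_Ico, nsmul_eq_mul, show 2 * c - c = c by omega]; field_simp
        _ ≤ _ := by
            refine sum_le_sum fun j hj => ?_
            rw [mem_Ico] at hj
            have : (j:ℝ) + 1 ≤ 2 * c := by exact_mod_cast hj.2
            exact one_div_le_one_div_of_le (by positivity) (by linarith)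
    have l2 : ∑ j ∈ Ico c (2 * c), 4 / (j : ℝ) ≤ 4 := by
      calc _ ≤ ∑ j ∈ Ico c (2 * c), 4 / (c:ℝ) := by
            refine sum_le_sum fun j hj => ?_
            rw [mem_Ico] at hj
            have : (c:ℝ) ≤ j := by exact_mod_cast hj.1
            gcongr
        _ = 4 := by
            rw [sum_const, Nat.card_Ico, nsmul_eq_mul, show 2 * c - c = c by omega]; field_simp
    push_cast
    constructor
    · linarith [ih.1, h.1]
    · linarith [ih.2, h.2]

/-! ### A Bonferroni form of the Kátai–Daboussi criterion -/

lemma alternating_choose_approx (m J : ℕ) :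
    |1 - ∑ j ∈ Icc 1 J, (-1 : ℝ) ^ (j + 1) * (m.choose j : ℝ)| ≤
      (if m = 0 then 1 else 0) + (m.choose J : ℝ) := by
  have e : 1 - ∑ j ∈ Icc 1 J, (-1 : ℝ) ^ (j + 1) * (m.choose j : ℝ) =
      ∑ j ∈ range (J + 1), (-1 : ℝ) ^ j * (m.choose j : ℝ) := by
    rw [range_eq_Ico, sum_eq_sum_Ico_succ_bot (Nat.succ_pos J)]
    have : Icc 1 J = Ico (0 + 1) (J + 1) := by ext; simp
    rw [this, sub_eq_add_neg, ← sum_neg_distrib]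
    simp [pow_succ]
  rw [e]
  rcases m with _ | m
  · rw [sum_eq_single 0]
    · simp
    · intro j _ hj; simp [Nat.choose_eq_zero_of_lt (Nat.pos_of_ne_zero hj)]
    · simp
  · have h := Int.alternating_sum_range_choose_eq_choose (n := m) (m := J)
    have h' : ∑ j ∈ range (J + 1), (-1 : ℝ) ^ j * ((m + 1).choose j : ℝ) = (-1) ^ J * (m.choose J : ℝ) := by
      exact_mod_cast h
    rw [h', abs_mul, abs_pow, abs_neg, abs_one, one_pow, one_mul, Nat.abs_cast, if_neg (by omega), zero_add]
    exact_mod_cast Nat.choose_le_choose J (Nat.le_succ m)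

lemma prod_dvd_iff_subset (R : Finset ℕ) (hR : ∀ p ∈ R, p.Prime) (A : Finset ℕ) (hA : A ⊆ R) (n : ℕ) :
    (∏ p ∈ A, p) ∣ n ↔ A ⊆ R.filter (· ∣ n) := by
  constructor
  · intro h p hp
    exact mem_filter.2 ⟨hA hp, (dvd_prod_of_mem _ hp).trans h⟩
  · intro h
    exact prod_primes_dvd n (fun p hp => (hR p (hA hp)).prime) fun p hp => (mem_filter.1 (h hp)).2

lemma sum_powersetCard_dvd (R : Finset ℕ) (hR : ∀ p ∈ R, p.Prime) (j n : ℕ) :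
    ∑ A ∈ powersetCard j R, (if (∏ p ∈ A, p) ∣ n then (1:ℝ) else 0) =
      ((R.filter (· ∣ n)).card.choose j : ℝ) := by
  rw [← card_powersetCard, sum_boole]
  congr 2
  ext A
  simp only [mem_filter, mem_powersetCard]
  constructor
  · rintro ⟨⟨h1, h2⟩, h3⟩; exact ⟨(prod_dvd_iff_subset R hR A h1 n).1 h3, h2⟩
  · rintro ⟨h1, h2⟩
    have := h1.trans (filter_subset _ _)
    exact ⟨⟨this, h2⟩, (prod_dvd_iff_subset R hR A this n).2 h1⟩

lemma card_dvd_le (N d : ℕ) : (((Ioc 0 N).filter (d ∣ ·)).card : ℝ) ≤ N / d := by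
  rw [Nat.Ioc_filter_dvd_card_eq_div]; exact Nat.cast_div_le

lemma sum_choose_le (R : Finset ℕ) (hR : ∀ p ∈ R, p.Prime) (N J : ℕ) (S : ℝ) (hS : ∑ p ∈ R, 1 / (p : ℝ) ≤ S) :
    ∑ n ∈ Ioc 0 N, ((R.filter (· ∣ n)).card.choose J : ℝ) ≤ N * Real.exp (Real.exp 1 * S - J) := by
  have h1 : ∑ n ∈ Ioc 0 N, ((R.filter (· ∣ n)).card.choose J : ℝ) ≤
      ∑ A ∈ powersetCard J R, N * ∏ p ∈ A, 1 / (p : ℝ) := by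
    simp_rw [← sum_powersetCard_dvd R hR J]
    rw [sum_comm]
    refine sum_le_sum fun A _ => ?_
    rw [sum_boole]
    refine (card_dvd_le N _).trans (le_of_eq ?_)
    rw [prod_div_distrib, prod_const_one]; push_cast; ring
  have h2 : ∑ A ∈ powersetCard J R, N * ∏ p ∈ A, 1 / (p : ℝ) ≤
      ∑ A ∈ R.powerset, N * (Real.exp (-J) * ∏ p ∈ A, (Real.exp 1 * (1 / (p : ℝ)))) := by
    refine (sum_le_sum fun A hA => ?_).trans (sum_le_sum_of_subset_of_nonneg
      (fun A hA => mem_powerset.2 (mem_powersetCard.1 hA).1) fun A _ _ => by positivity)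
    rw [prod_mul_distrib, prod_const, (mem_powersetCard.1 hA).2, ← mul_assoc (Real.exp _), ← Real.exp_nat_mul,
      ← Real.exp_add]
    simp
  refine h1.trans (h2.trans ?_)
  rw [← mul_sum, ← mul_sum, ← prod_one_add]
  have h3 := Real.prod_one_add_le_exp_sum R (f := fun p : ℕ => Real.exp 1 * (1 / (p : ℝ)))
    (by intro p; positivity)
  rw [sub_eq_neg_add, Real.exp_add]
  gcongr
  refine h3.trans (Real.exp_le_exp.2 ?_)
  rw [← mul_sum]; gcongr

lemma card_sifted_le (R : Finset ℕ) (hR : ∀ p ∈ R, p.Prime) (N : ℕ) (S : ℝ) (hS : S ≤ ∑ p ∈ R, 1 / (p : ℝ)) :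
    (((Ioc 0 N).filter fun n => (R.filter (· ∣ n)).card = 0).card : ℝ) ≤
      N * Real.exp (-S) + 2 ^ R.card := by
  have hind : ∀ n : ℕ, (if (R.filter (· ∣ n)).card = 0 then (1:ℝ) else 0) =
      ∑ A ∈ R.powerset, (-1) ^ A.card * (if (∏ p ∈ A, p) ∣ n then (1:ℝ) else 0) := by
    intro n
    have : ∏ p ∈ R, (1 + (if p ∣ n then (-1:ℝ) else 0)) =
        (if (R.filter (· ∣ n)).card = 0 then (1:ℝ) else 0) := by
      split_ifs with h
      · refine prod_eq_one fun p hp => ?_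
        rw [card_eq_zero, filter_eq_empty_iff] at h
        simp [h hp]
      · obtain ⟨p, hp⟩ := card_pos.1 (Nat.pos_of_ne_zero h)
        rw [mem_filter] at hp
        exact prod_eq_zero hp.1 (by simp [hp.2])
    rw [← this, prod_one_add]
    refine sum_congr rfl fun A hA => ?_
    rw [mem_powerset] at hA
    rw [prod_ite_zero, prod_const]
    have : (∀ i ∈ A, i ∣ n) ↔ (∏ p ∈ A, p) ∣ n := by
      rw [prod_dvd_iff_subset R hR A hA n]
      exact ⟨fun h p hp => mem_filter.2 ⟨hA hp, h p hp⟩, fun h p hp => (mem_filter.1 (h hp)).2⟩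
    simp only [this]; split_ifs <;> simp
  have h1 : (((Ioc 0 N).filter fun n => (R.filter (· ∣ n)).card = 0).card : ℝ) =
      ∑ A ∈ R.powerset, (-1 : ℝ) ^ A.card * ((N / ∏ p ∈ A, p : ℕ) : ℝ) := by
    rw [← sum_boole]
    simp_rw [hind]
    rw [sum_comm]
    refine sum_congr rfl fun A _ => ?_
    rw [← mul_sum, sum_boole, Nat.Ioc_filter_dvd_card_eq_div]
  have h2 : ∑ A ∈ R.powerset, (-1 : ℝ) ^ A.card * ((N / ∏ p ∈ A, p : ℕ) : ℝ) ≤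
      ∑ A ∈ R.powerset, (N * ∏ p ∈ A, (-(1 / (p : ℝ))) + 1) := by
    refine sum_le_sum fun A hA => ?_
    have hpos : 0 < ∏ p ∈ A, p := prod_pos fun p hp => (hR p (mem_powerset.1 hA hp)).pos
    have e1 : ∏ p ∈ A, (-(1 / (p : ℝ))) = (-1) ^ A.card * (1 / ((∏ p ∈ A, p : ℕ) : ℝ)) := by
      rw [prod_neg, prod_div_distrib, prod_const_one]; push_cast; rfl
    rw [e1]
    have e2 : ((N / ∏ p ∈ A, p : ℕ) : ℝ) ≤ N / ((∏ p ∈ A, p : ℕ) : ℝ) := Nat.cast_div_le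
    have e3 : (N : ℝ) / ((∏ p ∈ A, p : ℕ) : ℝ) ≤ ((N / ∏ p ∈ A, p : ℕ) : ℝ) + 1 := by
      rw [div_le_iff₀ (by exact_mod_cast hpos)]
      have := Nat.lt_div_mul_add (a := N) hpos
      have h' : (N : ℝ) ≤ (((N / ∏ p ∈ A, p) * (∏ p ∈ A, p) + ∏ p ∈ A, p : ℕ) : ℝ) := by
        exact_mod_cast this.le
      push_cast at h' ⊢; linarith
    have e4 : (N : ℝ) * ((-1) ^ A.card * (1 / ((∏ p ∈ A, p : ℕ) : ℝ))) =
      (-1) ^ A.card * (N / ((∏ p ∈ A, p : ℕ) : ℝ)) := by ring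
    rw [e4]
    rcases neg_one_pow_eq_or ℝ A.card with h | h <;> rw [h] <;> linarith
  rw [h1]
  refine h2.trans ?_
  rw [sum_add_distrib, ← mul_sum, ← prod_one_add, sum_const, card_powerset, nsmul_eq_mul, mul_one]
  push_cast
  gcongr
  calc ∏ p ∈ R, (1 + -(1 / (p : ℝ))) ≤ ∏ p ∈ R, Real.exp (-(1 / (p : ℝ))) := by
        refine prod_le_prod (fun p hp => ?_) fun p _ => ?_
        · have : (1:ℝ) ≤ p := by exact_mod_cast (hR p hp).one_le
          have := (div_le_one (by linarith)).2 this
          linarith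
        · rw [add_comm]; exact Real.add_one_le_exp _
    _ ≤ _ := by
        rw [← Real.exp_sum, sum_neg_distrib]
        exact Real.exp_le_exp.2 (by linarith)

lemma sum_filter_dvd_eq (N d : ℕ) (hd : 0 < d) (w : ℕ → ℂ) :
    ∑ n ∈ (Ioc 0 N).filter (d ∣ ·), w n = ∑ u ∈ Ioc 0 (N / d), w (d * u) := by
  symm
  refine sum_bij (fun u _ => d * u) ?_ ?_ ?_ ?_
  · intro u hu
    simp only [mem_filter, mem_Ioc] at *
    exact ⟨⟨Nat.mul_pos hd hu.1, (Nat.mul_le_mul_left d hu.2).trans (Nat.mul_div_le N d)⟩, dvd_mul_right _ _⟩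
  · intro a _ b _ h; exact Nat.eq_of_mul_eq_mul_left hd h
  · intro n hn
    simp only [mem_filter, mem_Ioc] at hn
    obtain ⟨u, rfl⟩ := hn.2
    refine ⟨u, ?_, rfl⟩
    rw [mem_Ioc]
    exact ⟨Nat.pos_of_mul_pos_left hn.1.1, (Nat.le_div_iff_mul_le hd).2 (by rw [mul_comm]; exact hn.1.2)⟩
  · intro _ _; rfl

lemma norm_sum_moebius_dvd_le (R : Finset ℕ) (hR : ∀ p ∈ R, p.Prime) (z : ℕ) (hz : 0 < z) (hRz : ∀ p ∈ R, z ≤ p) (N J : ℕ) (F : ℕ → ℂ)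
    (hF : ∀ n, ‖F n‖ ≤ 1) (A : Finset ℕ) (hA : A ⊆ R) (hAJ : A.card ≤ J) :
    ‖∑ n ∈ (Ioc 0 N).filter ((∏ p ∈ A, p) ∣ ·), (ArithmeticFunction.moebius n : ℂ) * F n‖ ≤
      ‖∑ u ∈ Ioc 0 (N / ∏ p ∈ A, p), (ArithmeticFunction.moebius u : ℂ) * F ((∏ p ∈ A, p) * u)‖ +
        J * N / z * ∏ p ∈ A, 1 / (p : ℝ) := by
  set d := ∏ p ∈ A, p with hd
  have hpos : 0 < d := prod_pos fun p hp => (hR p (hA hp)).pos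
  have hz0 : (0:ℝ) < z := by exact_mod_cast hz
  have hmu : ∀ n : ℕ, ‖(ArithmeticFunction.moebius n : ℂ)‖ ≤ 1 := by
    intro n
    rw [← Int.cast_one, Complex.norm_intCast]
    exact_mod_cast ArithmeticFunction.abs_moebius_le_one
  rw [sum_filter_dvd_eq N d hpos]
  have key : ∀ u, ‖(ArithmeticFunction.moebius (d * u) : ℂ) * F (d * u) -
      (ArithmeticFunction.moebius d : ℂ) * ((ArithmeticFunction.moebius u : ℂ) * F (d * u))‖ ≤
      ∑ p ∈ A, if p ∣ u then (1:ℝ) else 0 := by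
    intro u
    by_cases hc : Nat.Coprime d u
    · rw [ArithmeticFunction.isMultiplicative_moebius.map_mul_of_coprime hc]
      push_cast
      rw [mul_assoc, sub_self, norm_zero]
      exact sum_nonneg fun p _ => by split_ifs <;> norm_num
    · have : ∃ p ∈ A, p ∣ u := by
        by_contra! h
        refine hc ?_
        rw [hd, Nat.coprime_prod_left_iff]
        intro p hp
        exact (Nat.Prime.coprime_iff_not_dvd (hR p (hA hp))).2 (h p hp)
      obtain ⟨p, hp, hpu⟩ := this
      have hnz : ArithmeticFunction.moebius (d * u) = 0 := by
        rw [ArithmeticFunction.moebius_eq_zero_of_not_squarefree]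
        intro hs
        exact hc (Nat.coprime_of_squarefree_mul hs)
      rw [hnz]
      simp only [Int.cast_zero, zero_mul, zero_sub, norm_neg, norm_mul]
      calc _ ≤ (1:ℝ) := by
            refine mul_le_one₀ (hmu _) (by positivity) (mul_le_one₀ (hmu _) (norm_nonneg _) (hF _))
        _ = if p ∣ u then (1:ℝ) else 0 := by rw [if_pos hpu]
        _ ≤ _ := single_le_sum (f := fun p => if p ∣ u then (1:ℝ) else 0)
            (fun p _ => by split_ifs <;> norm_num) hp
  have h1 : ‖∑ u ∈ Ioc 0 (N / d), (ArithmeticFunction.moebius (d * u) : ℂ) * F (d * u) -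
      (ArithmeticFunction.moebius d : ℂ) * ∑ u ∈ Ioc 0 (N / d), (ArithmeticFunction.moebius u : ℂ) * F (d * u)‖ ≤
      J * N / z * ∏ p ∈ A, 1 / (p : ℝ) := by
    rw [mul_sum, ← sum_sub_distrib]
    refine (norm_sum_le _ _).trans ((sum_le_sum fun u _ => key u).trans ?_)
    rw [sum_comm]
    have : ∀ p ∈ A, ∑ u ∈ Ioc 0 (N / d), (if p ∣ u then (1:ℝ) else 0) ≤ N / d / z := by
      intro p hp
      rw [sum_boole]
      refine (card_dvd_le _ _).trans ?_
      have : (z:ℝ) ≤ p := by exact_mod_cast hRz p (hA hp)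
      have h2 : ((N / d : ℕ) : ℝ) ≤ N / d := Nat.cast_div_le
      gcongr
    refine (sum_le_sum this).trans ?_
    rw [sum_const, nsmul_eq_mul, prod_div_distrib, prod_const_one, hd]
    push_cast
    calc (A.card : ℝ) * (N / (∏ p ∈ A, (p:ℝ)) / z) ≤ J * (N / (∏ p ∈ A, (p:ℝ)) / z) := by gcongr
      _ = _ := by ring
  have h2 : ‖(ArithmeticFunction.moebius d : ℂ) * ∑ u ∈ Ioc 0 (N / d), (ArithmeticFunction.moebius u : ℂ) * F (d * u)‖ ≤
      ‖∑ u ∈ Ioc 0 (N / d), (ArithmeticFunction.moebius u : ℂ) * F (d * u)‖ := by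
    rw [norm_mul]; exact mul_le_of_le_one_left (norm_nonneg _) (hmu d)
  have h3 := norm_sub_norm_le (∑ u ∈ Ioc 0 (N / d), (ArithmeticFunction.moebius (d * u) : ℂ) * F (d * u))
    ((ArithmeticFunction.moebius d : ℂ) * ∑ u ∈ Ioc 0 (N / d), (ArithmeticFunction.moebius u : ℂ) * F (d * u))
  linarith

/-- The finite inequality behind the criterion. -/
theorem norm_sum_moebius_le (R : Finset ℕ) (hR : ∀ p ∈ R, p.Prime) (z : ℕ) (hz : 0 < z) (hRz : ∀ p ∈ R, z ≤ p) (N J : ℕ) (F : ℕ → ℂ)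
    (hF : ∀ n, ‖F n‖ ≤ 1) (S₁ S₂ : ℝ) (hS₁ : S₁ ≤ ∑ p ∈ R, 1 / (p : ℝ)) (hS₂ : ∑ p ∈ R, 1 / (p : ℝ) ≤ S₂) :
    ‖∑ n ∈ Ioc 0 N, (ArithmeticFunction.moebius n : ℂ) * F n‖ ≤
      N * Real.exp (-S₁) + 2 ^ R.card + N * Real.exp (Real.exp 1 * S₂ - J) +
      J * N / z * Real.exp S₂ +
      ∑ A ∈ R.powerset.filter (fun A => 1 ≤ A.card ∧ A.card ≤ J),
        ‖∑ u ∈ Ioc 0 (N / ∏ p ∈ A, p), (ArithmeticFunction.moebius u : ℂ) * F ((∏ p ∈ A, p) * u)‖ := by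
  set w : ℕ → ℂ := fun n => (ArithmeticFunction.moebius n : ℂ) * F n with hw
  have hw1 : ∀ n, ‖w n‖ ≤ 1 := by
    intro n
    rw [hw]; simp only [norm_mul]
    refine mul_le_one₀ ?_ (norm_nonneg _) (hF n)
    rw [← Int.cast_one, Complex.norm_intCast]
    exact_mod_cast ArithmeticFunction.abs_moebius_le_one
  set m : ℕ → ℕ := fun n => (R.filter (· ∣ n)).card with hm
  have hdecomp : ∑ n ∈ Ioc 0 N, w n =
      ∑ n ∈ Ioc 0 N, ((1 - ∑ j ∈ Icc 1 J, (-1 : ℝ) ^ (j + 1) * ((m n).choose j : ℝ) : ℝ) : ℂ) * w n +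
      ∑ j ∈ Icc 1 J, (-1 : ℂ) ^ (j + 1) * ∑ A ∈ powersetCard j R, ∑ n ∈ (Ioc 0 N).filter ((∏ p ∈ A, p) ∣ ·), w n := by
    have : ∀ j, ∑ A ∈ powersetCard j R, ∑ n ∈ (Ioc 0 N).filter ((∏ p ∈ A, p) ∣ ·), w n =
        ∑ n ∈ Ioc 0 N, (((m n).choose j : ℝ) : ℂ) * w n := by
      intro j
      simp_rw [sum_filter]
      rw [sum_comm]
      refine sum_congr rfl fun n _ => ?_
      rw [← sum_powersetCard_dvd R hR j n]
      push_cast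
      rw [sum_mul]
      refine sum_congr rfl fun A _ => ?_
      split_ifs <;> simp
    simp_rw [this, mul_sum]
    rw [sum_comm, ← sum_add_distrib]
    refine sum_congr rfl fun n _ => ?_
    push_cast
    simp_rw [← mul_assoc]
    rw [← sum_mul]; ring
  have h1 : ‖∑ n ∈ Ioc 0 N, ((1 - ∑ j ∈ Icc 1 J, (-1 : ℝ) ^ (j + 1) * ((m n).choose j : ℝ) : ℝ) : ℂ) * w n‖ ≤
      N * Real.exp (-S₁) + 2 ^ R.card + N * Real.exp (Real.exp 1 * S₂ - J) := by
    have a1 := card_sifted_le R hR N S₁ hS₁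
    have a2 := sum_choose_le R hR N J S₂ hS₂
    rw [← sum_boole] at a1
    refine le_trans ?_ (add_le_add a1 a2)
    rw [← sum_add_distrib]
    refine (norm_sum_le _ _).trans (sum_le_sum fun n _ => ?_)
    rw [norm_mul, Complex.norm_real, Real.norm_eq_abs]
    exact (mul_le_of_le_one_right (abs_nonneg _) (hw1 n)).trans (alternating_choose_approx _ _)
  have h2 : ‖∑ j ∈ Icc 1 J, (-1 : ℂ) ^ (j + 1) * ∑ A ∈ powersetCard j R, ∑ n ∈ (Ioc 0 N).filter ((∏ p ∈ A, p) ∣ ·), w n‖ ≤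
      ∑ A ∈ R.powerset.filter (fun A => 1 ≤ A.card ∧ A.card ≤ J),
        ‖∑ n ∈ (Ioc 0 N).filter ((∏ p ∈ A, p) ∣ ·), w n‖ := by
    have e : ∑ A ∈ R.powerset.filter (fun A => 1 ≤ A.card ∧ A.card ≤ J),
        ‖∑ n ∈ (Ioc 0 N).filter ((∏ p ∈ A, p) ∣ ·), w n‖ =
        ∑ j ∈ Icc 1 J, ∑ A ∈ powersetCard j R, ‖∑ n ∈ (Ioc 0 N).filter ((∏ p ∈ A, p) ∣ ·), w n‖ := by
      rw [← sum_fiberwise_of_maps_to (g := fun A : Finset ℕ => A.card) (t := Icc 1 J)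
        (fun A hA => mem_Icc.2 (mem_filter.1 hA).2)]
      refine sum_congr rfl fun j hj => sum_congr ?_ fun _ _ => rfl
      ext A
      simp only [mem_filter, mem_powerset, mem_powersetCard]
      rw [mem_Icc] at hj
      constructor
      · rintro ⟨⟨h1, _⟩, h2⟩; exact ⟨h1, h2⟩
      · rintro ⟨h1, h2⟩; exact ⟨⟨h1, by omega⟩, h2⟩
    rw [e]
    refine (norm_sum_le _ _).trans (sum_le_sum fun j _ => ?_)
    rw [norm_mul, norm_pow, norm_neg, norm_one, one_pow, one_mul]
    exact norm_sum_le _ _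
  have h3 : ∑ A ∈ R.powerset.filter (fun A => 1 ≤ A.card ∧ A.card ≤ J),
      ‖∑ n ∈ (Ioc 0 N).filter ((∏ p ∈ A, p) ∣ ·), w n‖ ≤
      ∑ A ∈ R.powerset.filter (fun A => 1 ≤ A.card ∧ A.card ≤ J),
        ‖∑ u ∈ Ioc 0 (N / ∏ p ∈ A, p), (ArithmeticFunction.moebius u : ℂ) * F ((∏ p ∈ A, p) * u)‖ +
      J * N / z * Real.exp S₂ := by
    have hsum : ∑ A ∈ R.powerset.filter (fun A => 1 ≤ A.card ∧ A.card ≤ J), J * N / z * ∏ p ∈ A, 1 / (p : ℝ) ≤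
        J * N / z * Real.exp S₂ := by
      rw [← mul_sum]
      refine mul_le_mul_of_nonneg_left ?_ (by positivity)
      calc _ ≤ ∑ A ∈ R.powerset, ∏ p ∈ A, 1 / (p : ℝ) :=
            sum_le_sum_of_subset_of_nonneg (filter_subset _ _) fun A _ _ => by positivity
        _ = ∏ p ∈ R, (1 + 1 / (p : ℝ)) := (prod_one_add R).symm
        _ ≤ _ := (Real.prod_one_add_le_exp_sum R (f := fun p : ℕ => 1 / (p : ℝ)) (fun p => by positivity)).trans (Real.exp_le_exp.2 hS₂)
    refine le_trans ?_ (add_le_add le_rfl hsum)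
    rw [← sum_add_distrib]
    refine sum_le_sum fun A hA => ?_
    rw [mem_filter, mem_powerset] at hA
    exact norm_sum_moebius_dvd_le R hR z hz hRz N J F hF A hA.1 hA.2.2
  rw [hdecomp]
  have := norm_add_le (∑ n ∈ Ioc 0 N, ((1 - ∑ j ∈ Icc 1 J, (-1 : ℝ) ^ (j + 1) * ((m n).choose j : ℝ) : ℝ) : ℂ) * w n)
    (∑ j ∈ Icc 1 J, (-1 : ℂ) ^ (j + 1) * ∑ A ∈ powersetCard j R, ∑ n ∈ (Ioc 0 N).filter ((∏ p ∈ A, p) ∣ ·), w n)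
  linarith

lemma sum_Ioc_two_pow (g : ℕ → ℝ) (a L : ℕ) (h : a ≤ L) :
    ∑ d ∈ Ioc (2 ^ a) (2 ^ L), g d = ∑ i ∈ Ico a L, ∑ d ∈ Ioc (2 ^ i) (2 * 2 ^ i), g d := by
  induction L, h using Nat.le_induction with
  | base => simp
  | succ L hL ih =>
    rw [sum_Ico_succ_top hL, ← ih, ← pow_succ', sum_Ioc_consecutive]
    · exact Nat.pow_le_pow_right (by norm_num) hL
    · exact Nat.pow_le_pow_right (by norm_num) (Nat.le_succ L)

lemma sum_le_sum_image_prod (R : Finset ℕ) (hR : ∀ p ∈ R, p.Prime) (z y J : ℕ)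
    (hz : ∀ p ∈ R, z < p) (hy : ∀ p ∈ R, p ≤ y) (hy1 : 1 ≤ y) (g : ℕ → ℝ) (hg : ∀ d, 0 ≤ g d) :
    ∑ A ∈ R.powerset.filter (fun A => 1 ≤ A.card ∧ A.card ≤ J), g (∏ p ∈ A, p) ≤
      ∑ d ∈ Ioc z (y ^ J), g d := by
  rw [← sum_image (f := g) (g := fun A : Finset ℕ => ∏ p ∈ A, p)]
  · refine sum_le_sum_of_subset_of_nonneg ?_ fun _ _ _ => hg _
    intro d hd
    rw [mem_image] at hd
    obtain ⟨A, hA, rfl⟩ := hd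
    rw [mem_filter, mem_powerset] at hA
    obtain ⟨hAR, h1, hJ⟩ := hA
    obtain ⟨p, hp⟩ := card_pos.1 h1
    rw [mem_Ioc]
    constructor
    · refine (hz p (hAR hp)).trans_le (Nat.le_of_dvd (prod_pos fun q hq => (hR q (hAR hq)).pos) (dvd_prod_of_mem _ hp))
    · calc ∏ p ∈ A, p ≤ y ^ A.card := prod_le_pow_card A _ y fun p hp => hy p (hAR hp)
        _ ≤ y ^ J := Nat.pow_le_pow_right hy1 hJ
  · intro A hA A' hA' h
    simp only [coe_filter, mem_powerset, Set.mem_ofPred_eq] at hA hA'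
    have h1 := Nat.primeFactors_prod fun p hp => hR p (hA.1 hp)
    have h2 := Nat.primeFactors_prod fun p hp => hR p (hA'.1 hp)
    rw [← h1, ← h2]; exact congrArg _ h

set_option maxHeartbeats 1000000 in
/-- If `μ` correlates with a bounded function `F`, then on some dyadic range of dilations `d`
it correlates with the dilates `u ↦ F (d u)`. -/
theorem exists_dilation_correlation :
    ∃ B : ℕ, ∀ Λ : ℝ, (B : ℝ) ≤ Λ → ∀ N : ℕ, Real.exp (Real.exp (Λ ^ B)) ≤ N → ∀ F : ℕ → ℂ,
      (∀ n, ‖F n‖ ≤ 1) →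
      N / Λ ≤ ‖∑ n ∈ Ioc 0 N, (ArithmeticFunction.moebius n : ℂ) * F n‖ →
      ∃ D : ℕ, Real.exp Λ ≤ D ∧ (D : ℝ) ≤ Real.exp (Λ ^ B) ∧
        N / Λ ^ B ≤ ∑ d ∈ Ioc D (2 * D),
          ‖∑ u ∈ Ioc 0 (N / d), (ArithmeticFunction.moebius u : ℂ) * F (d * u)‖ := by
  set C₁ : ℝ := 6 * 16 ^ 13 * 169 * 16 with hC₁
  set C₂ : ℝ := 169 * 16 * 16 ^ 52 * 16 * (Nat.factorial 55) with hC₂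
  obtain ⟨B, hB⟩ := exists_nat_ge (max 19 (max C₁ C₂))
  refine ⟨B, fun Λ hΛ N hN F hF hcor => ?_⟩
  have hB19 : 19 ≤ B := by
    have : (19:ℝ) ≤ B := (le_max_left _ _).trans hB
    exact_mod_cast this
  have hΛC₁ : C₁ ≤ Λ := ((le_max_left _ _).trans (le_max_right _ _)).trans (hB.trans hΛ)
  have hΛC₂ : C₂ ≤ Λ := ((le_max_right _ _).trans (le_max_right _ _)).trans (hB.trans hΛ)
  have hΛ19 : 19 ≤ Λ := (le_max_left _ _).trans (hB.trans hΛ)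
  have hΛ0 : 0 < Λ := by linarith
  have hΛ1 : 1 ≤ Λ := by linarith
  set a := ⌈2 * Λ⌉₊ with ha
  set I := ⌈12 * Real.log (16 * Λ)⌉₊ with hI
  have ha1 : 2 * Λ ≤ a := Nat.le_ceil _
  have ha2 : (a:ℝ) ≤ 3 * Λ := by
    have := Nat.ceil_lt_add_one (show 0 ≤ 2 * Λ by linarith)
    linarith
  have ha10 : 10 ≤ a := by
    have : (10:ℝ) ≤ a := by linarith
    exact_mod_cast this
  have hlog1 : 1 ≤ Real.log (16 * Λ) := by
    rw [Real.le_log_iff_exp_le (by linarith)]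
    have := Real.exp_one_lt_d9
    linarith
  have hI1 : 12 * Real.log (16 * Λ) ≤ I := Nat.le_ceil _
  have hI2 : (I:ℝ) ≤ 13 * Real.log (16 * Λ) := by
    have := Nat.ceil_lt_add_one (show 0 ≤ 12 * Real.log (16 * Λ) by linarith)
    linarith
  have hlogle : Real.log (16 * Λ) ≤ 16 * Λ := (Real.log_le_sub_one_of_pos (by linarith)).trans (by linarith)
  have hIpos : 1 ≤ I := by
    have : (1:ℝ) ≤ I := by linarith
    exact_mod_cast this
  clear_value a I
  have hexpI : ∀ c : ℕ, Real.exp (c * I) ≤ (16 * Λ) ^ (13 * c) := by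
    intro c
    rw [← Real.exp_log (show 0 < (16 * Λ) ^ (13 * c) by positivity), Real.log_pow]
    refine Real.exp_le_exp.2 ?_
    push_cast
    have : (0:ℝ) ≤ c := by positivity
    nlinarith
  have h2I : (2:ℝ) ^ I ≤ (16 * Λ) ^ 13 := by
    have h1 := hexpI 1
    have : (2:ℝ) ^ I ≤ Real.exp 1 ^ I := by
      gcongr
      have := Real.exp_one_gt_d9; linarith
    rw [← Real.exp_nat_mul] at this
    refine this.trans ?_
    simpa using h1
  set J := 13 * I with hJ
  set L := 2 * (a * 2 ^ I) * J with hL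
  have hLle : (L:ℝ) ≤ Λ ^ 16 := by
    rw [hL, hJ]; push_cast
    calc 2 * ((a:ℝ) * 2 ^ I) * (13 * I) ≤ 2 * ((3 * Λ) * (16 * Λ) ^ 13) * (13 * (13 * (16 * Λ))) := by
          have : (I:ℝ) ≤ 13 * (16 * Λ) := by linarith
          gcongr
      _ = C₁ * Λ ^ 15 := by rw [hC₁]; ring
      _ ≤ Λ * Λ ^ 15 := by gcongr
      _ = Λ ^ 16 := by ring
  have haL : 2 * a ≤ L := by
    rw [hL]
    have h1 : 1 ≤ 2 ^ I := Nat.one_le_two_pow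
    have h2 : a * 1 ≤ a * 2 ^ I := Nat.mul_le_mul_left a h1
    have : 1 ≤ J := by omega
    nlinarith
  have hLpos : 0 < L := by omega
  set R := (Ioc (4 ^ a) (4 ^ (a * 2 ^ I))).filter Nat.Prime with hRdef
  have hR : ∀ p ∈ R, p.Prime := fun p hp => (mem_filter.1 hp).2
  have hRz : ∀ p ∈ R, 4 ^ a < p := fun p hp => (mem_Ioc.1 (mem_filter.1 hp).1).1
  have hRy : ∀ p ∈ R, p ≤ 4 ^ (a * 2 ^ I) := fun p hp => (mem_Ioc.1 (mem_filter.1 hp).1).2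
  obtain ⟨hS₁, hS₂⟩ := sum_inv_primes_bounds a I ha10
  have main := norm_sum_moebius_le R hR (4 ^ a) (by positivity) (fun p hp => (hRz p hp).le) N J F hF
    ((I:ℝ) / 12) (4 * I) hS₁ hS₂
  have hN0 : (0:ℝ) < N := lt_of_lt_of_le (Real.exp_pos _) hN
  have t1 : N * Real.exp (-((I:ℝ) / 12)) ≤ N / (16 * Λ) := by
    rw [div_eq_mul_inv (N:ℝ)]
    gcongr
    rw [Real.exp_neg]
    gcongr
    rw [← Real.log_le_iff_le_exp (by positivity)]
    linarith
  have t3 : N * Real.exp (Real.exp 1 * (4 * I) - J) ≤ N / (16 * Λ) := by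
    rw [div_eq_mul_inv (N:ℝ)]
    gcongr
    rw [← Real.exp_log (show 0 < 16 * Λ by positivity), ← Real.exp_neg]
    refine Real.exp_le_exp.2 ?_
    rw [hJ]; push_cast
    have := Real.exp_one_lt_d9
    nlinarith
  have hza : Real.exp (2 * Λ) ≤ ((4 ^ a : ℕ) : ℝ) := by
    calc Real.exp (2 * Λ) ≤ Real.exp (a * 1) := Real.exp_le_exp.2 (by linarith)
      _ = Real.exp 1 ^ a := Real.exp_nat_mul _ _
      _ ≤ 4 ^ a := by gcongr; have := Real.exp_one_lt_d9; linarith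
      _ = _ := by push_cast; rfl
  have t4 : J * N / ((4 ^ a : ℕ) : ℝ) * Real.exp (4 * I) ≤ N / (16 * Λ) := by
    have h55 : (J:ℝ) * Real.exp (4 * I) * (16 * Λ) ≤ Real.exp (2 * Λ) := by
      have e4 : Real.exp (4 * I) ≤ (16 * Λ) ^ 52 := by simpa using hexpI 4
      have hfac : (0:ℝ) < (Nat.factorial 55 : ℝ) := by positivity
      calc (J:ℝ) * Real.exp (4 * I) * (16 * Λ) ≤ (13 * (13 * (16 * Λ))) * (16 * Λ) ^ 52 * (16 * Λ) := by
            have : (I:ℝ) ≤ 13 * (16 * Λ) := by linarith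
            rw [hJ]; push_cast; gcongr
        _ = (C₂ * Λ ^ 54) / (Nat.factorial 55 : ℝ) := by
            rw [eq_div_iff hfac.ne', hC₂]; ring
        _ ≤ (Λ * Λ ^ 54) / (Nat.factorial 55 : ℝ) := by gcongr
        _ = Λ ^ 55 / (Nat.factorial 55 : ℝ) := by ring
        _ ≤ Real.exp Λ := Real.pow_div_factorial_le_exp Λ hΛ0.le 55
        _ ≤ _ := Real.exp_le_exp.2 (by linarith)
    rw [div_mul_eq_mul_div, div_le_div_iff₀ (lt_of_lt_of_le (Real.exp_pos _) hza) (by positivity)]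
    calc J * N * Real.exp (4 * I) * (16 * Λ) = N * (J * Real.exp (4 * I) * (16 * Λ)) := by ring
      _ ≤ _ := by gcongr; exact h55.trans hza
  have hΛB : ∀ n : ℕ, n ≤ B → Λ ^ n ≤ Λ ^ B := fun n hn => pow_le_pow_right₀ hΛ1 hn
  have hLB : (L:ℝ) + 1 ≤ Λ ^ B := by
    have h1 := hΛB 17 (by omega)
    have h2 : Λ ^ 17 = Λ * Λ ^ 16 := by ring
    have h3 : 1 ≤ Λ ^ 16 := one_le_pow₀ hΛ1
    nlinarith
  have t2 : (2:ℝ) ^ R.card ≤ N / (16 * Λ) := by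
    have hcard : (R.card : ℝ) ≤ Real.exp L := by
      have h1 : R.card ≤ 4 ^ (a * 2 ^ I) := by
        refine (card_filter_le _ _).trans ?_
        rw [Nat.card_Ioc]; exact Nat.sub_le _ _
      have h2 : (4:ℝ) ^ (a * 2 ^ I) ≤ Real.exp L := by
        have h3 : (4:ℝ) ≤ Real.exp 2 := by
          have : Real.exp 2 = Real.exp 1 ^ 2 := by rw [← Real.exp_nat_mul]; norm_num
          rw [this]
          have := Real.exp_one_gt_d9; nlinarith
        calc (4:ℝ) ^ (a * 2 ^ I) ≤ Real.exp 2 ^ (a * 2 ^ I) := by gcongr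
          _ = Real.exp ((a * 2 ^ I : ℕ) * 2) := (Real.exp_nat_mul _ _).symm
          _ ≤ Real.exp L := by
            refine Real.exp_le_exp.2 ?_
            rw [hL]
            have : (1:ℝ) ≤ J := by have : 1 ≤ J := by omega
                                   exact_mod_cast this
            push_cast
            have h4 : (0:ℝ) ≤ 2 * (a * 2 ^ I) := by positivity
            have h5 := mul_le_mul_of_nonneg_left this h4
            linarith
      exact le_trans (by exact_mod_cast h1) h2
    have hle : 16 * Λ ≤ Real.exp (Real.exp L) := by
      have h1 : 16 * Λ ≤ L := by
        have : (2:ℝ) * a * 13 ≤ L := by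
          have h1 : 1 ≤ 2 ^ I := Nat.one_le_two_pow
          have h2 : a * 1 ≤ a * 2 ^ I := Nat.mul_le_mul_left a h1
          have h3 : 13 ≤ J := by omega
          have : 2 * a * 13 ≤ L := by
            rw [hL]
            exact Nat.mul_le_mul (by omega) h3
          exact_mod_cast this
        linarith
      have h2 := Real.add_one_le_exp (L:ℝ)
      have h3 := Real.add_one_le_exp (Real.exp L)
      linarith
    rw [le_div_iff₀ (by positivity)]
    calc (2:ℝ) ^ R.card * (16 * Λ) ≤ Real.exp 1 ^ R.card * Real.exp (Real.exp L) := by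
          gcongr
          have := Real.exp_one_gt_d9; linarith
      _ = Real.exp (R.card + Real.exp L) := by
          rw [← Real.exp_nat_mul, ← Real.exp_add]; simp
      _ ≤ Real.exp (Real.exp (Λ ^ B)) := by
          refine Real.exp_le_exp.2 ?_
          calc (R.card:ℝ) + Real.exp L ≤ Real.exp L * 2 := by linarith
            _ ≤ Real.exp L * Real.exp 1 := by
                gcongr
                have := Real.exp_one_gt_d9; linarith
            _ = Real.exp (L + 1) := by rw [Real.exp_add]
            _ ≤ _ := Real.exp_le_exp.2 hLB
      _ ≤ N := hN
  set g : ℕ → ℝ := fun d => ‖∑ u ∈ Ioc 0 (N / d), (ArithmeticFunction.moebius u : ℂ) * F (d * u)‖ with hg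
  have hsum := sum_le_sum_image_prod R hR (4 ^ a) (4 ^ (a * 2 ^ I)) J hRz hRy (Nat.one_le_pow _ _ (by norm_num)) g
    (fun d => norm_nonneg _)
  have e1 : (4 ^ (a * 2 ^ I)) ^ J = 2 ^ L := by
    rw [show 4 = 2 ^ 2 by norm_num, ← pow_mul, ← pow_mul, hL, ← mul_assoc]
  have e2 : 4 ^ a = 2 ^ (2 * a) := by rw [pow_mul]; norm_num
  rw [e1, e2, sum_Ioc_two_pow g _ _ haL] at hsum
  have htot : N / (2 * Λ) ≤ ∑ i ∈ Ico (2 * a) L, ∑ d ∈ Ioc (2 ^ i) (2 * 2 ^ i), g d := by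
    have e3 : (N:ℝ) / Λ = 16 * (N / (16 * Λ)) := by field_simp
    have e4 : (N:ℝ) / (2 * Λ) = 8 * (N / (16 * Λ)) := by field_simp; norm_num
    have e5 : (0:ℝ) ≤ N / (16 * Λ) := by positivity
    rw [e3] at hcor
    rw [e4]
    linarith
  obtain ⟨i, hi, hi2⟩ : ∃ i ∈ Ico (2 * a) L, N / (2 * Λ) / L ≤ ∑ d ∈ Ioc (2 ^ i) (2 * 2 ^ i), g d := by
    by_contra! hcon
    have hL0 : (0:ℝ) < L := by exact_mod_cast hLpos
    have hne : (Ico (2 * a) L).Nonempty := by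
      by_contra h
      rw [not_nonempty_iff_eq_empty] at h
      rw [h, sum_empty] at htot
      have : 0 < (N:ℝ) / (2 * Λ) := by positivity
      linarith
    have := sum_lt_sum_of_nonempty hne hcon
    rw [sum_const, nsmul_eq_mul, Nat.card_Ico] at this
    have h2 : ((L - 2 * a : ℕ) : ℝ) * (N / (2 * Λ) / L) ≤ N / (2 * Λ) := by
      calc ((L - 2 * a : ℕ) : ℝ) * (N / (2 * Λ) / L) ≤ L * (N / (2 * Λ) / L) := by
            gcongr; exact Nat.sub_le _ _
        _ = _ := by field_simp
    linarith
  rw [mem_Ico] at hi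
  refine ⟨2 ^ i, ?_, ?_, le_trans ?_ hi2⟩
  · refine le_trans ?_ (hza.trans ?_)
    · exact Real.exp_le_exp.2 (by linarith)
    · rw [e2]; exact_mod_cast Nat.pow_le_pow_right (by norm_num) hi.1
  · push_cast
    calc (2:ℝ) ^ i ≤ Real.exp 1 ^ i := by
          gcongr; have := Real.exp_one_gt_d9; linarith
      _ = Real.exp i := by rw [← Real.exp_nat_mul]; simp
      _ ≤ _ := by
          refine Real.exp_le_exp.2 ?_
          have : (i:ℝ) ≤ L := by exact_mod_cast hi.2.le
          linarith
  · rw [div_div]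
    gcongr
    have h1 := hΛB 18 (by omega)
    calc 2 * Λ * L ≤ Λ * Λ * Λ ^ 16 := by gcongr; linarith
      _ = Λ ^ 18 := by ring
      _ ≤ _ := h1

/-! ### From many large Fourier coefficients to one major arc -/

lemma sum_residue_split {β : Type*} [AddCommMonoid β] (m : ℕ) (hm : 0 < m) (s t : Finset ℤ) (H : ℤ → β)
    (hs : ∀ w, H w ≠ 0 → w ∈ s) (ht : ∀ i ∈ range m, ∀ w : ℤ, H (i + m * w) ≠ 0 → w ∈ t) :
    ∑ w ∈ s, H w = ∑ i ∈ range m, ∑ w ∈ t, H (i + m * w) := by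
  rw [← sum_product']
  symm
  have hm' : (0:ℤ) < m := by exact_mod_cast hm
  refine sum_bij_ne_zero (fun x _ _ => (x.1 : ℤ) + m * x.2) ?_ ?_ ?_ ?_
  · intro x _ hx; exact hs _ hx
  · intro x hx _ y hy _ h
    simp only [mem_product, mem_range] at hx hy
    have h1 := congrArg (· % (m:ℤ)) h
    have h2 := congrArg (· / (m:ℤ)) h
    simp only [Int.add_mul_emod_self_left] at h1
    rw [Int.emod_eq_of_lt (by omega) (by exact_mod_cast hx.1),
      Int.emod_eq_of_lt (by omega) (by exact_mod_cast hy.1)] at h1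
    simp only [Int.add_mul_ediv_left _ _ hm'.ne'] at h2
    rw [Int.ediv_eq_zero_of_lt (by omega) (by exact_mod_cast hx.1),
      Int.ediv_eq_zero_of_lt (by omega) (by exact_mod_cast hy.1)] at h2
    ext
    · exact_mod_cast h1
    · simpa using h2
  · intro w _ hw
    have e : (((w % m).toNat : ℕ) : ℤ) + m * (w / m) = w := by
      rw [Int.toNat_of_nonneg (Int.emod_nonneg _ hm'.ne')]; exact Int.emod_add_mul_ediv w m
    have hi : (w % m).toNat ∈ range m := by
      rw [mem_range]; have := Int.emod_lt_of_pos w hm'; omega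
    exact ⟨((w % m).toNat, w / m), mem_product.2 ⟨hi, ht _ hi _ (by rwa [e])⟩, by simpa only [e] using hw, e⟩
  · intro _ _ _; rfl

lemma ee_sub_le (s t : ℝ) : ‖ee s - ee t‖ ≤ 2 * Real.pi * |s - t| := by
  have : ee s - ee t = ee t * (ee (s - t) - 1) := by
    rw [mul_sub, mul_one, ← ee_add]; congr 2; ring
  rw [this, norm_mul, norm_ee, one_mul]
  exact norm_ee_sub_one_le _

/-- Splitting into residues modulo `m` absorbs a rational phase with denominator `m`. -/
lemma norm_sum_rational_phase_le (Y m : ℕ) (hm : 0 < m) (G : ℤ → ℂ) (hG : ∀ w, w ∉ Ico (0 : ℤ) Y → G w = 0)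
    (z : ℤ) (η : ℝ) :
    ‖∑ w ∈ Ico (0 : ℤ) Y, G w * ee ((z / m + η) * w)‖ ≤
      ∑ i ∈ range m, ‖∑ w ∈ Ico (0 : ℤ) Y, G (i + m * w) * ee (η * m * w)‖ := by
  have hm0 : (m:ℝ) ≠ 0 := by exact_mod_cast hm.ne'
  rw [sum_residue_split m hm (Ico (0:ℤ) Y) (Ico (0:ℤ) Y)]
  · refine (norm_sum_le _ _).trans (sum_le_sum fun i _ => le_of_eq ?_)
    have : ∀ w : ℤ, G (i + m * w) * ee ((z / m + η) * ((i + m * w : ℤ) : ℝ)) =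
        ee ((z / m + η) * i) * (G (i + m * w) * ee (η * m * w)) := by
      intro w
      have : (z / m + η) * ((i + m * w : ℤ) : ℝ) = (z / m + η) * i + η * m * w + (z * w : ℤ) := by
        push_cast; field_simp; ring
      rw [this, ee_add_int, ee_add]; ring
    simp_rw [this]
    rw [← mul_sum, norm_mul, norm_ee, one_mul]
  · intro w hw; by_contra h; exact hw (by simp [hG w h])
  · intro i hi w hw
    by_contra h
    refine hw ?_
    rw [hG, zero_mul]
    intro h'
    refine h ?_
    rw [mem_range] at hi
    rw [mem_Ico] at h' ⊢
    constructor
    · by_contra hneg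
      have : (m:ℤ) * w ≤ m * (-1) := mul_le_mul_of_nonneg_left (by omega) (by positivity)
      omega
    · rcases le_or_gt w 0 with h0 | h0
      · have : 0 < Y := by
          by_contra hY
          have : Y = 0 := by omega
          simp [this] at h'; omega
        omega
      · have : w * 1 ≤ w * m := mul_le_mul_of_nonneg_left (by exact_mod_cast hm) h0.le
        have e : w * (m:ℤ) = m * w := mul_comm _ _
        omega

theorem exists_common_phase {ι : Type*} (P : Finset ι) (Y m : ℕ) (hY : 0 < Y) (hm : 0 < m) (G : ι → ℤ → ℂ)
    (hG1 : ∀ p w, ‖G p w‖ ≤ 1)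
    (hG : ∀ p w, w ∉ Ico (0 : ℤ) Y → G p w = 0) (α : ι → ℝ) (σ R : ℝ) (hσ : 0 < σ) (hσ1 : σ ≤ 1) (hR : 1 ≤ R)
    (hα : ∀ p ∈ P, ∃ z : ℤ, |α p - z / m| ≤ R / Y)
    (h : ∀ p ∈ P, σ * Y ≤ ‖∑ w ∈ Ico (0 : ℤ) Y, G p w * ee (α p * w)‖) :
    ∃ η : ℝ, |η| ≤ 2 * R / Y ∧ σ ^ 2 / (64 * R) * P.card * Y ≤
      ∑ p ∈ P, ∑ i ∈ range m, ‖∑ w ∈ Ico (0 : ℤ) Y, G p (i + m * w) * ee (η * m * w)‖ := by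
  have hY0 : (0:ℝ) < Y := by exact_mod_cast hY
  rcases P.eq_empty_or_nonempty with rfl | hne
  · exact ⟨0, by simp; positivity, by simp⟩
  choose! z hz using hα
  set ν : ℝ := σ / (8 * Y) with hν
  have hν0 : 0 < ν := by positivity
  set β : ι → ℝ := fun p => α p - z p / m with hβ
  set j : ι → ℤ := fun p => round (β p / ν) with hj
  have hjβ : ∀ p, |β p - j p * ν| ≤ ν / 2 := by
    intro p
    have h1 := abs_sub_round (β p / ν)
    have : β p - j p * ν = (β p / ν - round (β p / ν)) * ν := by
      rw [hj]; field_simp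
    rw [this, abs_mul, abs_of_pos hν0]
    nlinarith
  set J : ℕ := ⌈8 * R / σ⌉₊ + 1 with hJ
  have hRσ : 1 ≤ R / σ := by rw [le_div_iff₀ hσ]; linarith
  have hJle : (2 * J + 1 : ℝ) ≤ 32 * R / σ := by
    have := Nat.ceil_lt_add_one (show 0 ≤ 8 * R / σ by positivity)
    rw [hJ]; push_cast
    have e : 8 * R / σ = 8 * (R / σ) := by ring
    have e' : 32 * R / σ = 32 * (R / σ) := by ring
    linarith
  have hjmem : ∀ p ∈ P, j p ∈ Icc (-J : ℤ) J := by
    intro p hp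
    have h1 : |(j p : ℝ)| * ν ≤ R / Y + ν / 2 := by
      have h2 := hjβ p
      have h3 : |(j p : ℝ) * ν| ≤ |β p| + |β p - j p * ν| := by
        calc |(j p : ℝ) * ν| = |β p - (β p - j p * ν)| := by congr 1; ring
          _ ≤ _ := abs_sub _ _
      rw [abs_mul, abs_of_pos hν0] at h3
      have := hz p hp
      linarith
    have h4 : |(j p : ℝ)| ≤ J := by
      have : R / Y = (8 * R / σ) * ν := by rw [hν]; field_simp
      rw [this] at h1
      have h5 : |(j p : ℝ)| ≤ 8 * R / σ + 1 := by
        by_contra hc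
        push Not at hc
        have := mul_lt_mul_of_pos_right hc hν0
        nlinarith
      have := Nat.le_ceil (8 * R / σ)
      rw [hJ]; push_cast; linarith
    rw [mem_Icc, ← abs_le]; exact_mod_cast h4
  set E : ι → ℝ → ℝ := fun p η => ∑ i ∈ range m, ‖∑ w ∈ Ico (0 : ℤ) Y, G p (i + m * w) * ee (η * m * w)‖ with hE
  have hE0 : ∀ p η, 0 ≤ E p η := fun p η => sum_nonneg fun _ _ => norm_nonneg _
  have hbig : ∀ p ∈ P, σ / 2 * Y ≤ E p (j p * ν) := by
    intro p hp
    refine le_trans ?_ (norm_sum_rational_phase_le Y m hm (G p) (hG p) (z p) (j p * ν))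
    have h1 : ‖∑ w ∈ Ico (0 : ℤ) Y, G p w * ee (α p * w) -
        ∑ w ∈ Ico (0 : ℤ) Y, G p w * ee ((z p / m + j p * ν) * w)‖ ≤ σ / 2 * Y := by
      rw [← sum_sub_distrib]
      refine (norm_sum_le _ _).trans ?_
      have : ∀ w ∈ Ico (0 : ℤ) Y, ‖G p w * ee (α p * w) - G p w * ee ((z p / m + j p * ν) * w)‖ ≤ σ / 2 := by
        intro w hw
        rw [mem_Ico] at hw
        rw [← mul_sub, norm_mul]
        refine (mul_le_of_le_one_left (norm_nonneg _) (hG1 p w)).trans ((ee_sub_le _ _).trans ?_)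
        have e : α p * w - (z p / m + j p * ν) * w = (β p - j p * ν) * w := by rw [hβ]; ring
        rw [e, abs_mul]
        have hw0 : (0:ℝ) ≤ w := by exact_mod_cast hw.1
        have hwY : (w:ℝ) ≤ Y := by exact_mod_cast hw.2.le
        rw [abs_of_nonneg hw0]
        calc 2 * Real.pi * (|β p - j p * ν| * w) ≤ 2 * 4 * (ν / 2 * Y) := by
              gcongr
              · exact Real.pi_le_four
              · exact hjβ p
          _ = σ / 2 := by rw [hν]; field_simp; norm_num
      refine (sum_le_sum this).trans (le_of_eq ?_)
      rw [sum_const, Int.card_Ico, nsmul_eq_mul]; simp; ring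
    have h2 := norm_sub_norm_le (∑ w ∈ Ico (0 : ℤ) Y, G p w * ee (α p * w))
      (∑ w ∈ Ico (0 : ℤ) Y, G p w * ee ((z p / m + j p * ν) * w))
    have := h p hp
    linarith
  have htot : σ / 2 * Y * P.card ≤ ∑ t ∈ Icc (-J : ℤ) J, ∑ p ∈ P.filter (fun p => j p = t), E p (t * ν) := by
    calc σ / 2 * Y * P.card = ∑ p ∈ P, σ / 2 * Y := by rw [sum_const, nsmul_eq_mul]; ring
      _ ≤ ∑ p ∈ P, E p (j p * ν) := sum_le_sum hbig
      _ = _ := by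
        rw [← sum_fiberwise_of_maps_to hjmem]
        refine sum_congr rfl fun t _ => sum_congr rfl fun p hp => ?_
        rw [(mem_filter.1 hp).2]
  obtain ⟨t, ht, ht2⟩ : ∃ t ∈ (Icc (-J : ℤ) J).filter (fun t => ∃ p ∈ P, j p = t), σ / 2 * Y * P.card / (2 * J + 1) ≤
      ∑ p ∈ P.filter (fun p => j p = t), E p (t * ν) := by
    by_contra! hc
    have hle : ∀ t ∈ Icc (-J : ℤ) J, ∑ p ∈ P.filter (fun p => j p = t), E p (t * ν) ≤
        if (∃ p ∈ P, j p = t) then σ / 2 * Y * P.card / (2 * J + 1) else 0 := by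
      intro t ht
      split_ifs with hx
      · exact (hc t (mem_filter.2 ⟨ht, hx⟩)).le
      · rw [filter_eq_empty_iff.2, sum_empty]
        intro p hp hpt; exact hx ⟨p, hp, hpt⟩
    obtain ⟨p₀, hp₀⟩ := hne
    have hlt : ∑ t ∈ Icc (-J : ℤ) J, ∑ p ∈ P.filter (fun p => j p = t), E p (t * ν) <
        ∑ t ∈ Icc (-J : ℤ) J, σ / 2 * Y * P.card / (2 * J + 1) := by
      refine sum_lt_sum (fun t ht => (hle t ht).trans ?_) ⟨j p₀, hjmem p₀ hp₀, ?_⟩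
      · split_ifs
        · exact le_rfl
        · positivity
      · exact hc _ (mem_filter.2 ⟨hjmem p₀ hp₀, p₀, hp₀, rfl⟩)
    rw [sum_const, Int.card_Icc, nsmul_eq_mul] at hlt
    have e : (((J : ℤ) + 1 - -J).toNat : ℝ) = 2 * J + 1 := by
      have : ((J : ℤ) + 1 - -J).toNat = 2 * J + 1 := by omega
      rw [this]; push_cast; ring
    rw [e, mul_div_cancel₀ _ (by positivity)] at hlt
    linarith
  rw [mem_filter] at ht
  obtain ⟨_, p₁, hp₁, hp₁t⟩ := ht
  refine ⟨t * ν, ?_, ?_⟩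
  · have h1 := hjβ p₁
    rw [hp₁t] at h1
    have h2 := hz p₁ hp₁
    have h3 : |(t:ℝ) * ν| ≤ |β p₁| + |β p₁ - t * ν| := by
      calc |(t : ℝ) * ν| = |β p₁ - (β p₁ - t * ν)| := by congr 1; ring
        _ ≤ _ := abs_sub _ _
    have h4 : ν / 2 ≤ R / Y := by
      rw [hν, div_div, div_le_div_iff₀ (by positivity) (by positivity)]
      nlinarith
    have e : 2 * R / Y = R / Y + R / Y := by ring
    rw [e]
    exact h3.trans (add_le_add h2 (h1.trans h4))
  · refine le_trans ?_ (ht2.trans (sum_le_sum_of_subset_of_nonneg (filter_subset _ _) fun p _ _ => hE0 _ _))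
    rw [le_div_iff₀ (by positivity)]
    calc σ ^ 2 / (64 * R) * P.card * Y * (2 * J + 1) ≤ σ ^ 2 / (64 * R) * P.card * Y * (32 * R / σ) := by gcongr
      _ = _ := by field_simp; norm_num

lemma sum_le_card_large (ι : Type*) (I : Finset ι) (f : ι → ℝ) (σ Y : ℝ) (hσY : 0 ≤ σ * Y) (hf : ∀ i ∈ I, f i ≤ Y) :
    ∑ i ∈ I, f i ≤ Y * (I.filter fun i => σ * Y ≤ f i).card + σ * Y * I.card := by
  rw [← sum_filter_add_sum_filter_not I (fun i => σ * Y ≤ f i)]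
  refine add_le_add ?_ ?_
  · calc _ ≤ ∑ i ∈ I.filter (fun i => σ * Y ≤ f i), Y := sum_le_sum fun i hi => hf i (mem_filter.1 hi).1
      _ = _ := by rw [sum_const, nsmul_eq_mul]; ring
  · calc _ ≤ ∑ i ∈ I.filter (fun i => ¬ σ * Y ≤ f i), σ * Y :=
          sum_le_sum fun i hi => (not_le.1 (mem_filter.1 hi).2).le
      _ = ((I.filter fun i => ¬ σ * Y ≤ f i).card : ℝ) * (σ * Y) := by rw [sum_const, nsmul_eq_mul]
      _ ≤ I.card * (σ * Y) := by gcongr; exact filter_subset _ _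
      _ = _ := by ring

lemma card_small_coordinate_le (n τ : ℕ) (x : ℝ) (hx : 1 ≤ x) :
    (((Fintype.piFinset fun _ : Fin n => range τ).filter fun ts => ∃ j, (ts j : ℝ) < x).card : ℝ) * τ ≤
      n * (2 * x) * τ ^ n := by
  have h1 : ((Fintype.piFinset fun _ : Fin n => range τ).filter fun ts => ∃ j, (ts j : ℝ) < x) ⊆
      univ.biUnion fun j : Fin n => Fintype.piFinset
        (Function.update (fun _ : Fin n => range τ) j ((range τ).filter fun t : ℕ => (t : ℝ) < x)) := by
    intro ts hts
    simp only [mem_filter, Fintype.mem_piFinset] at hts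
    obtain ⟨hts, j, hj⟩ := hts
    rw [mem_biUnion]
    refine ⟨j, mem_univ _, ?_⟩
    rw [Fintype.mem_piFinset]
    intro i
    by_cases h : i = j
    · subst h; simp only [Function.update_self, mem_filter]; exact ⟨hts i, hj⟩
    · rw [Function.update_of_ne h]; exact hts i
  have hsmall : (((range τ).filter fun t : ℕ => (t : ℝ) < x).card : ℝ) ≤ 2 * x := by
    have : (range τ).filter (fun t : ℕ => (t : ℝ) < x) ⊆ range ⌈x⌉₊ := by
      intro t ht
      rw [mem_filter] at ht
      rw [mem_range]; exact Nat.lt_ceil.2 ht.2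
    have h2 := card_le_card this
    rw [card_range] at h2
    have h3 := Nat.ceil_lt_add_one (show 0 ≤ x by linarith)
    have h4 : (((range τ).filter fun t : ℕ => (t : ℝ) < x).card : ℝ) ≤ ⌈x⌉₊ := by exact_mod_cast h2
    linarith
  have h2 : ∀ j : Fin n, ((Fintype.piFinset
        (Function.update (fun _ : Fin n => range τ) j ((range τ).filter fun t : ℕ => (t : ℝ) < x))).card : ℝ) * τ ≤
      2 * x * τ ^ n := by
    intro j
    rw [Fintype.card_piFinset]
    have e : (fun i => (Function.update (fun _ : Fin n => range τ) j ((range τ).filter fun t : ℕ => (t : ℝ) < x) i).card) =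
        Function.update (fun _ : Fin n => τ) j ((range τ).filter fun t : ℕ => (t : ℝ) < x).card := by
      funext i
      by_cases h : i = j
      · subst h; simp
      · simp [Function.update_of_ne h]
    rw [e, prod_update_of_mem (mem_univ j)]
    push_cast
    rw [prod_const, card_sdiff_of_subset (subset_univ _), card_univ, Fintype.card_fin, card_singleton, mul_assoc,
      ← pow_succ, Nat.sub_add_cancel (Fin.pos j)]
    gcongr
  calc _ ≤ ((∑ j : Fin n, (Fintype.piFinset
        (Function.update (fun _ : Fin n => range τ) j ((range τ).filter fun t : ℕ => (t : ℝ) < x))).card : ℕ) : ℝ) * τ := by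
        gcongr
        exact (card_le_card h1).trans card_biUnion_le
    _ ≤ ∑ j : Fin n, 2 * x * τ ^ n := by
        push_cast
        rw [sum_mul]
        exact sum_le_sum fun j _ => h2 j
    _ = _ := by rw [sum_const, card_univ, Fintype.card_fin, nsmul_eq_mul]; ring

/-- Many cubes share the same base height and the same long edges. -/
theorem exists_popular_cube {V ι : Type*} [AddCommGroup V] [Fintype V] (P : Finset ι) (hP : P.Nonempty)
    (τ n : ℕ) (hτ : 0 < τ) (B : ι → Finset (V × ℕ)) (hB : ∀ p, ∀ y ∈ B p, y.2 < τ) (v : ι → Fin n → V)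
    (δ δ₂ ε : ℝ) (hδ : 0 < δ) (hδ₂ : δ₂ = (δ / 2) ^ 2 ^ n) (hε : ε = δ₂ / (2 * (n + 1))) (hετ : 1 ≤ ε * τ)
    (h : δ * P.card * Fintype.card V * τ ≤ ∑ p ∈ P, ((B p).card : ℝ)) :
    ∃ (ts : Fin n → ℕ) (d : ℕ), (∀ j, ε * τ ≤ ts j ∧ ts j < τ) ∧
      δ₂ * P.card ≤ (P.filter fun p => ∃ x, InCube (B p) n (v p) ts (x, d)).card := by
  have hV : (0:ℝ) < Fintype.card V := by
    have : 0 < Fintype.card V := Fintype.card_pos_iff.2 ⟨0⟩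
    exact_mod_cast this
  have hτ0 : (0:ℝ) < τ := by exact_mod_cast hτ
  have hP0 : (0:ℝ) < P.card := by exact_mod_cast card_pos.2 hP
  have hδ₂0 : 0 < δ₂ := by rw [hδ₂]; positivity
  set W : ℝ := (Fintype.card V : ℝ) with hW
  set S : ℝ := ∑ ts ∈ Fintype.piFinset (fun _ : Fin n => range τ), ∑ p ∈ P,
    (((B p).filter (InCube (B p) n (v p) ts)).card : ℝ) with hS
  have s3 : 2 * τ ^ (n + 1) * W * P.card * δ₂ ≤ S := by
    have h1 : ∑ p ∈ P, 2 * (τ : ℝ) ^ (n + 1) * W * ((B p).card / (2 * W * τ)) ^ 2 ^ n ≤ S := by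
      rw [hS, sum_comm]
      exact sum_le_sum fun p _ => sum_card_inCube_ge τ hτ n (v p) (B p) (hB p)
    refine le_trans ?_ h1
    rw [← mul_sum, mul_assoc (2 * (τ:ℝ) ^ (n + 1) * W)]
    refine mul_le_mul_of_nonneg_left ?_ (by positivity)
    obtain ⟨q, hq⟩ : ∃ q, 2 ^ n = q + 1 := ⟨2 ^ n - 1, by have := Nat.one_le_two_pow (n := n); omega⟩
    have hpm := sum_pow_le_card_pow_mul P (fun p => ((B p).card : ℝ) / (2 * W * τ)) (fun p _ => by positivity) q
    have hx : P.card * (δ / 2) ≤ ∑ p ∈ P, ((B p).card : ℝ) / (2 * W * τ) := by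
      rw [← sum_div, le_div_iff₀ (by positivity)]
      linarith
    have h4 : (P.card * (δ / 2)) ^ (q + 1) ≤ (P.card : ℝ) ^ q * ∑ p ∈ P, (((B p).card : ℝ) / (2 * W * τ)) ^ (q + 1) :=
      le_trans (by gcongr) hpm
    rw [hδ₂, hq]
    have h5 : (P.card : ℝ) ^ q * (P.card * (δ / 2) ^ (q + 1)) ≤
        (P.card : ℝ) ^ q * ∑ p ∈ P, (((B p).card : ℝ) / (2 * W * τ)) ^ (q + 1) := by
      refine le_trans (le_of_eq ?_) h4
      rw [mul_pow, pow_succ]; ring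
    exact le_of_mul_le_mul_left h5 (by positivity)
  have hBcard : ∀ p, ((B p).card : ℝ) ≤ W * τ := by
    intro p
    have : B p ⊆ univ ×ˢ range τ := by
      intro y hy; rw [mem_product]; exact ⟨mem_univ _, mem_range.2 (hB p y hy)⟩
    have h2 := card_le_card this
    rw [card_product, card_univ, card_range] at h2
    rw [hW]; exact_mod_cast h2
  set bad := (Fintype.piFinset fun _ : Fin n => range τ).filter fun ts => ∃ j, (ts j : ℝ) < ε * τ with hbad
  set good := (Fintype.piFinset fun _ : Fin n => range τ).filter fun ts => ¬ ∃ j, (ts j : ℝ) < ε * τ with hgood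
  have s4 : ∑ ts ∈ bad, ∑ p ∈ P, (((B p).filter (InCube (B p) n (v p) ts)).card : ℝ) ≤
      τ ^ (n + 1) * W * P.card * δ₂ := by
    have h1 := card_small_coordinate_le n τ (ε * τ) hετ
    calc _ ≤ ∑ ts ∈ bad, ∑ p ∈ P, W * τ := by
          refine sum_le_sum fun ts _ => sum_le_sum fun p _ => le_trans ?_ (hBcard p)
          exact_mod_cast card_filter_le _ _
      _ = (bad.card * τ) * (P.card * W) := by rw [sum_const, sum_const, nsmul_eq_mul, nsmul_eq_mul]; ring
      _ ≤ (n * (2 * (ε * τ)) * τ ^ n) * (P.card * W) := by gcongr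
      _ = (n * (2 * ε)) * (τ ^ (n + 1) * W * P.card) := by ring
      _ ≤ δ₂ * (τ ^ (n + 1) * W * P.card) := by
          gcongr
          rw [hε]
          have hn : (0:ℝ) < n + 1 := by positivity
          have : n * (2 * (δ₂ / (2 * (n + 1)))) = δ₂ * (n / (n + 1)) := by field_simp
          rw [this]
          refine mul_le_of_le_one_right hδ₂0.le ?_
          rw [div_le_one hn]; linarith
      _ = _ := by ring
  have s5 : τ ^ (n + 1) * W * P.card * δ₂ ≤
      ∑ ts ∈ good, ∑ p ∈ P, (((B p).filter (InCube (B p) n (v p) ts)).card : ℝ) := by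
    have := sum_filter_add_sum_filter_not (Fintype.piFinset fun _ : Fin n => range τ)
      (fun ts => ∃ j, (ts j : ℝ) < ε * τ) (fun ts => ∑ p ∈ P, (((B p).filter (InCube (B p) n (v p) ts)).card : ℝ))
    rw [← hS, ← hbad, ← hgood] at this
    linarith
  have s6 : ∀ ts p, (((B p).filter (InCube (B p) n (v p) ts)).card : ℝ) ≤
      ∑ d ∈ range τ, W * if (∃ x, InCube (B p) n (v p) ts (x, d)) then (1:ℝ) else 0 := by
    intro ts p
    have hsub : (B p).filter (InCube (B p) n (v p) ts) ⊆
        (univ : Finset V) ×ˢ ((range τ).filter fun d => ∃ x, InCube (B p) n (v p) ts (x, d)) := by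
      intro y hy
      rw [mem_filter] at hy
      rw [mem_product, mem_filter, mem_range]
      exact ⟨mem_univ _, hB p y hy.1, y.1, hy.2⟩
    have := card_le_card hsub
    rw [card_product, card_univ] at this
    rw [← mul_sum, sum_boole, hW]; exact_mod_cast this
  have s7 : τ ^ (n + 1) * W * P.card * δ₂ ≤ ∑ ts ∈ good, ∑ d ∈ range τ,
      W * ((P.filter fun p => ∃ x, InCube (B p) n (v p) ts (x, d)).card : ℝ) := by
    refine s5.trans (sum_le_sum fun ts _ => ?_)
    refine (sum_le_sum fun p _ => s6 ts p).trans (le_of_eq ?_)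
    rw [sum_comm]
    refine sum_congr rfl fun d _ => ?_
    rw [← mul_sum, sum_boole]
  by_contra! hc
  have hgc : (good.card : ℝ) ≤ τ ^ n := by
    have h1 := card_filter_le (Fintype.piFinset fun _ : Fin n => range τ) fun ts => ¬ ∃ j, (ts j : ℝ) < ε * τ
    rw [Fintype.card_piFinset] at h1
    simp only [card_range, prod_const, card_univ, Fintype.card_fin] at h1
    exact_mod_cast h1
  have hgne : good.Nonempty := by
    by_contra hne
    rw [not_nonempty_iff_eq_empty] at hne
    rw [hne, sum_empty] at s7
    have : 0 < τ ^ (n + 1) * W * P.card * δ₂ := by positivity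
    linarith
  have hlt : ∑ ts ∈ good, ∑ d ∈ range τ,
      W * ((P.filter fun p => ∃ x, InCube (B p) n (v p) ts (x, d)).card : ℝ) <
      ∑ ts ∈ good, ∑ d ∈ range τ, W * (δ₂ * P.card) := by
    refine sum_lt_sum_of_nonempty hgne fun ts hts => sum_lt_sum_of_nonempty ⟨0, mem_range.2 hτ⟩ fun d _ => ?_
    refine mul_lt_mul_of_pos_left (hc ts d fun j => ?_) hV
    rw [hgood, mem_filter, Fintype.mem_piFinset] at hts
    push Not at hts
    exact ⟨hts.2 j, mem_range.1 (hts.1 j)⟩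
  rw [sum_const, sum_const, card_range, nsmul_eq_mul, nsmul_eq_mul] at hlt
  have : (good.card : ℝ) * (τ * (W * (δ₂ * P.card))) ≤ τ ^ n * (τ * (W * (δ₂ * P.card))) := by gcongr
  have e : (τ:ℝ) ^ (n + 1) * W * P.card * δ₂ = τ ^ n * (τ * (W * (δ₂ * P.card))) := by ring
  linarith

theorem exists_major_arc {V ι : Type*} [AddCommGroup V] [Fintype V] (P : Finset ι) (hP : P.Nonempty)
    (n Y D a M τ : ℕ) (hY : 0 < Y) (hD : 2 ≤ D) (hDa : D < a) (hτ : 0 < τ) (hτ1 : D ≤ M * τ)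
    (hτ2 : ∀ t < τ, M * t ≤ 2 * D) (g : ι → ℤ → ℂ) (hg1 : ∀ p w, ‖g p w‖ ≤ 1)
    (hg : ∀ p w, w ∉ Ico (0 : ℤ) Y → g p w = 0) (y : ι → ℕ → ℤ) (β : ι → V × ℕ → ℝ) (v : ι → Fin n → V)
    (hβ : ∀ p ts x, cubeAlt (β p) n (v p) ts x = 0)
    (δ δ₂ ε R : ℝ) (hδ : 0 < δ) (hδ1 : δ ≤ 1) (hδ₂ : δ₂ = (δ ^ 3 / 32) ^ 2 ^ n) (hε : ε = δ₂ / (2 * (n + 1)))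
    (hετ : 1 ≤ ε * τ) (hR : R = 4 / δ ^ 2 * (1 + 2 ^ (n + 1) * Real.exp 4 * (4 / ε) ^ n))
    (h : δ * P.card * Fintype.card V * τ * Y ≤ ∑ p ∈ P,
      ∑ x ∈ (univ : Finset V) ×ˢ ((range τ).filter fun d => a + M * d ≤ 2 * D),
        ‖∑ w ∈ Ico (0 : ℤ) Y, if w ≤ y p x.2 then g p w * ee ((a + M * x.2) * β p x * w) else 0‖) :
    ∃ d m : ℕ, a + M * d ≤ 2 * D ∧ 0 < m ∧ m ≤ (2 * D) ^ 2 ^ n ∧ ∃ η : ℝ, |η| ≤ 2 * R / Y ∧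
      δ ^ 2 / (256 * R) * (δ₂ * P.card) * Y ≤ ∑ p ∈ P, ∑ i ∈ range m,
        ‖∑ w ∈ Ico (0 : ℤ) Y, (if i + m * w ≤ y p d then g p (i + m * w) else 0) * ee (η * m * w)‖ := by
  have hV : (0:ℝ) < Fintype.card V := by
    have : 0 < Fintype.card V := Fintype.card_pos_iff.2 ⟨0⟩
    exact_mod_cast this
  have hτ0 : (0:ℝ) < τ := by exact_mod_cast hτ
  have hY0 : (0:ℝ) < Y := by exact_mod_cast hY
  have hD0 : (0:ℝ) < D := by have : 0 < D := by omega
                             exact_mod_cast this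
  have hP0 : (0:ℝ) < P.card := by exact_mod_cast card_pos.2 hP
  have hδ₂0 : 0 < δ₂ := by rw [hδ₂]; positivity
  have hε0 : 0 < ε := by rw [hε]; positivity
  set W : ℝ := (Fintype.card V : ℝ) with hW
  set T := (univ : Finset V) ×ˢ ((range τ).filter fun d => a + M * d ≤ 2 * D) with hT
  set f : ι → V × ℕ → ℝ := fun p x =>
    ‖∑ w ∈ Ico (0 : ℤ) Y, if w ≤ y p x.2 then g p w * ee ((a + M * x.2) * β p x * w) else 0‖ with hf
  have hTcard : (T.card : ℝ) ≤ W * τ := by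
    rw [hT, card_product, card_univ]
    have := card_filter_le (range τ) fun d => a + M * d ≤ 2 * D
    rw [card_range] at this
    push_cast; gcongr
  have hfY : ∀ p x, f p x ≤ Y := by
    intro p x
    refine (norm_sum_le _ _).trans ?_
    calc _ ≤ ∑ w ∈ Ico (0 : ℤ) Y, (1:ℝ) := by
          refine sum_le_sum fun w _ => ?_
          split_ifs
          · rw [norm_mul, norm_ee, mul_one]; exact hg1 p w
          · simp
      _ = Y := by simp
  set I : ι → Finset (V × ℕ) := fun p => T.filter fun x => δ / 2 * Y ≤ f p x with hI
  have hIsum : δ / 2 * P.card * W * τ ≤ ∑ p ∈ P, ((I p).card : ℝ) := by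
    have h1 : ∑ p ∈ P, ∑ x ∈ T, f p x ≤ ∑ p ∈ P, (Y * ((I p).card : ℝ) + δ / 2 * Y * (W * τ)) := by
      refine sum_le_sum fun p _ => (sum_le_card_large _ T (f p) (δ / 2) Y (by positivity) fun x _ => hfY p x).trans ?_
      gcongr
    rw [sum_add_distrib, ← mul_sum, sum_const, nsmul_eq_mul] at h1
    have h2 := h.trans h1
    have h3 : Y * (δ / 2 * P.card * W * τ) ≤ Y * ∑ p ∈ P, ((I p).card : ℝ) := by linarith
    exact le_of_mul_le_mul_left h3 hY0
  have hpop : ∀ p, ∃ ξ : ℝ, ∃ I' ⊆ I p, (δ / 2) ^ 2 / 2 * (I p).card ≤ I'.card ∧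
      ∀ x ∈ I', ∃ k : ℤ, |(a + M * x.2) * β p x - ξ - k| ≤ 1 / ((δ / 2) ^ 2 * Y) := by
    intro p
    exact exists_popular_frequency (I p) (g p) (hg1 p) Y hY (fun x => (a + M * x.2) * β p x) (fun x => y p x.2)
      (δ / 2) (by positivity) fun x hx => (mem_filter.1 hx).2
  choose ξ B hBI hBcard hBξ using hpop
  have hBmem : ∀ p, ∀ x ∈ B p, x.2 < τ ∧ a + M * x.2 ≤ 2 * D ∧ δ / 2 * Y ≤ f p x := by
    intro p x hx
    have := hBI p hx
    rw [hI, mem_filter, hT, mem_product, mem_filter, mem_range] at this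
    exact ⟨this.1.2.1, this.1.2.2, this.2⟩
  have hBsum : δ ^ 3 / 16 * P.card * W * τ ≤ ∑ p ∈ P, ((B p).card : ℝ) := by
    calc δ ^ 3 / 16 * P.card * W * τ = (δ / 2) ^ 2 / 2 * (δ / 2 * P.card * W * τ) := by ring
      _ ≤ (δ / 2) ^ 2 / 2 * ∑ p ∈ P, ((I p).card : ℝ) := by gcongr
      _ = ∑ p ∈ P, (δ / 2) ^ 2 / 2 * ((I p).card : ℝ) := mul_sum _ _ _
      _ ≤ _ := sum_le_sum fun p _ => hBcard p
  obtain ⟨ts, d, hts, hcard⟩ := exists_popular_cube P hP τ n hτ B (fun p x hx => (hBmem p x hx).1) v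
    (δ ^ 3 / 16) δ₂ ε (by positivity) (by rw [hδ₂]; congr 1; ring) hε hετ hBsum
  set 𝒢 := P.filter fun p => ∃ x, InCube (B p) n (v p) ts (x, d) with h𝒢
  have hne : 𝒢.Nonempty := by
    rw [← card_pos]
    have : (0:ℝ) < 𝒢.card := lt_of_lt_of_le (by positivity) hcard
    exact_mod_cast this
  have hcube : ∀ p ∈ 𝒢, ∃ x, InCube (B p) n (v p) ts (x, d) := fun p hp => (mem_filter.1 hp).2
  choose! x hx using hcube
  obtain ⟨p₀, hp₀⟩ := hne
  have hmem₀ := hBmem p₀ _ (InCube.mem _ _ _ _ _ (hx p₀ hp₀))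
  have had : 0 < a + M * d := by omega
  obtain ⟨m', hm'⟩ := exists_int_eq_cubeProd_mul_altInv n (fun j => M * ts j) (a + M * d) had
  have hs : Real.exp (-4) / (2 * D) * (ε / 4) ^ n ≤ altInv n (fun j => M * ts j) (a + M * d) := by
    refine altInv_ge n _ _ D had hD hmem₀.2.1 ε hε0 (fun j => ?_) (fun j => hτ2 _ (hts j).2)
    have h1 : (D:ℝ) ≤ M * τ := by exact_mod_cast hτ1
    push_cast
    calc ε * D ≤ ε * (M * τ) := by gcongr
      _ = M * (ε * τ) := by ring
      _ ≤ _ := by gcongr; exact (hts j).1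
  have hs0 : 0 < Real.exp (-4) / (2 * D) * (ε / 4) ^ n := by positivity
  have hprod0 : 0 < cubeProd n (fun j => M * ts j) (a + M * d) := cubeProd_pos _ _ _ had
  have hm'0 : (0:ℝ) < m' := by
    rw [hm']
    have : (0:ℝ) < cubeProd n (fun j => M * ts j) (a + M * d) := by exact_mod_cast hprod0
    exact mul_pos this (hs0.trans_le hs)
  obtain ⟨m, rfl⟩ : ∃ m : ℕ, m' = m := ⟨m'.toNat, by
    have : 0 < m' := by exact_mod_cast hm'0
    omega⟩
  have hm0 : 0 < m := by exact_mod_cast hm'0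
  have hmle : m ≤ (2 * D) ^ 2 ^ n := by
    have h1 := cubeProd_le (B p₀) a M (2 * D) (fun y hy => (hBmem p₀ y hy).2.1) n (v p₀) ts _ (hx p₀ hp₀)
    have h2 := altInv_le_one n (fun j => M * ts j) (a + M * d) had
    have h3 : (m:ℝ) ≤ cubeProd n (fun j => M * ts j) (a + M * d) := by
      have := hm'
      push_cast at this
      rw [this]; exact mul_le_of_le_one_right (by positivity) h2
    have h4 : m ≤ cubeProd n (fun j => M * ts j) (a + M * d) := by exact_mod_cast h3
    exact h4.trans h1
  set κ : ℝ := 1 / ((δ / 2) ^ 2 * Y) with hκ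
  set G : ι → ℤ → ℂ := fun p w => if w ≤ y p d then g p w else 0 with hG
  have hR1 : 1 ≤ R := by
    rw [hR]
    have h1 : (1:ℝ) ≤ 4 / δ ^ 2 := by
      rw [le_div_iff₀ (by positivity)]
      have : δ ^ 2 ≤ 1 := pow_le_one₀ hδ.le hδ1
      linarith
    have h2 : (1:ℝ) ≤ 1 + 2 ^ (n + 1) * Real.exp 4 * (4 / ε) ^ n := by
      have : (0:ℝ) ≤ 2 ^ (n + 1) * Real.exp 4 * (4 / ε) ^ n := by positivity
      linarith
    exact one_le_mul_of_one_le_of_one_le h1 h2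
  have hαz : ∀ p ∈ 𝒢, ∃ z : ℤ, |(a + M * d) * β p (x p, d) - z / m| ≤ R / Y := by
    intro p hp
    obtain ⟨z, hz⟩ := exists_rational_of_cube (B p) a M D κ (ξ p) _ hD0 hs0 (β p)
      (fun y hy => by
        have : (D:ℝ) ≤ a := by exact_mod_cast hDa.le
        have h2 : (0:ℝ) ≤ M * y.2 := by positivity
        linarith) (hBξ p) n (v p) ts (x p, d) (hx p hp) (hβ _ _ _) m (by exact_mod_cast hm') hs
    obtain ⟨k, hk⟩ := hBξ p _ (InCube.mem _ _ _ _ _ (hx p hp))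
    refine ⟨z + k * m, ?_⟩
    have hm1 : (m:ℝ) ≠ 0 := by exact_mod_cast hm0.ne'
    have e : (a + M * d) * β p (x p, d) - ((z + k * m : ℤ) : ℝ) / m =
        ((a + M * d) * β p (x p, d) - ξ p - k) + (ξ p - z / m) := by
      push_cast; field_simp; ring
    rw [e]
    refine (abs_add_le _ _).trans ((add_le_add hk hz).trans (le_of_eq ?_))
    rw [hκ, hR]
    have e4 : Real.exp 4 = 1 / Real.exp (-4) := by rw [Real.exp_neg]; simp
    rw [e4, pow_succ]
    simp only [div_pow]
    have := Real.exp_pos (-4)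
    field_simp
    ring
  have hlarge : ∀ p ∈ 𝒢, δ / 2 * Y ≤ ‖∑ w ∈ Ico (0 : ℤ) Y, G p w * ee ((a + M * d) * β p (x p, d) * w)‖ := by
    intro p hp
    have h1 := (hBmem p _ (InCube.mem _ _ _ _ _ (hx p hp))).2.2
    refine h1.trans (le_of_eq ?_)
    simp only [hf, hG]
    congr 1
    refine sum_congr rfl fun w _ => ?_
    split_ifs <;> simp
  obtain ⟨η, hη, hsum⟩ := exists_common_phase 𝒢 Y m hY hm0 G
    (fun p w => by simp only [hG]; split_ifs; exacts [hg1 p w, by simp])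
    (fun p w hw => by simp only [hG, hg p w hw, ite_self])
    (fun p => (a + M * d) * β p (x p, d)) (δ / 2) R (by positivity) (by linarith) hR1 hαz hlarge
  refine ⟨d, m, hmem₀.2.1, hm0, hmle, η, hη, ?_⟩
  calc δ ^ 2 / (256 * R) * (δ₂ * P.card) * Y ≤ δ ^ 2 / (256 * R) * 𝒢.card * Y := by gcongr
    _ = (δ / 2) ^ 2 / (64 * R) * 𝒢.card * Y := by ring
    _ ≤ _ := hsum
    _ ≤ _ := sum_le_sum_of_subset_of_nonneg (filter_subset _ _) fun p _ _ => sum_nonneg fun _ _ => norm_nonneg _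

/-! ### The Möbius function on residue classes -/

/-- The Möbius function restricted to `[1, N]`, as a function on the integers. -/
def muN (N : ℕ) (x : ℤ) : ℂ := if 0 < x ∧ x ≤ N then (ArithmeticFunction.moebius x.toNat : ℂ) else 0

/-- The restriction of `muN N` to the progression `b + M ℤ`. -/
def classFn (N M b : ℕ) (n : ℤ) : ℂ := muN N (b + M * n)

/-- The function on `ZMod Q` induced by the values of `f` on `[0, Q)`. -/
def liftZ (Q : ℕ) (f : ℤ → ℂ) (y : ZMod Q) : ℂ := f (y.val : ℤ)

/-- The sum over residue classes modulo `M` of the `U^{r+1}` energies of the Möbius function. -/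
def classEnergy (r N M : ℕ) : ℝ :=
  ∑ b ∈ range M, ∑ h : Fin r → ZMod (4 * (N / M + 1) + 1),
    ‖∑ y, cubeDeriv r h (liftZ _ (classFn N M b)) y‖ ^ 2

lemma norm_moebius_le (n : ℕ) : ‖(ArithmeticFunction.moebius n : ℂ)‖ ≤ 1 := by
  rw [← Int.cast_one, Complex.norm_intCast]
  exact_mod_cast ArithmeticFunction.abs_moebius_le_one

lemma norm_muN_le (N : ℕ) (x : ℤ) : ‖muN N x‖ ≤ 1 := by
  rw [muN]; split_ifs
  · exact norm_moebius_le _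
  · simp

lemma norm_classFn_le (N M b : ℕ) (n : ℤ) : ‖classFn N M b n‖ ≤ 1 := norm_muN_le _ _

lemma norm_liftZ_le (Q : ℕ) (f : ℤ → ℂ) (hf : ∀ n, ‖f n‖ ≤ 1) (y : ZMod Q) : ‖liftZ Q f y‖ ≤ 1 := hf _

lemma classFn_support (N M b : ℕ) (hb : b < M) (n : ℤ) (h : n ∉ Ico (0 : ℤ) ((N / M + 1 : ℕ) : ℤ)) :
    classFn N M b n = 0 := by
  rw [classFn, muN, if_neg]
  rintro ⟨h1, h2⟩
  refine h ?_
  have hM : (0:ℤ) < M := by omega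
  rw [mem_Ico]
  constructor
  · by_contra hc
    have : (M:ℤ) * n ≤ M * (-1) := mul_le_mul_of_nonneg_left (by omega) hM.le
    omega
  · have h3 : n * M ≤ N := by rw [mul_comm]; omega
    have := (Int.le_ediv_iff_mul_le hM).2 h3
    push_cast; omega

/-- The product of all the factors of `cubeDeriv` except the base one. -/
def cubeTail {G : Type*} [AddCommGroup G] : (r : ℕ) → (Fin r → G) → (G → ℂ) → G → ℂ
  | 0, _, _, _ => 1
  | r + 1, h, f, y => cubeTail r (Fin.tail h) f y * conj (cubeDeriv r (Fin.tail h) f (y + h 0))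

lemma cubeDeriv_eq_mul_cubeTail {G : Type*} [AddCommGroup G] (r : ℕ) (h : Fin r → G) (f : G → ℂ) (y : G) :
    cubeDeriv r h f y = f y * cubeTail r h f y := by
  induction r with
  | zero => simp [cubeDeriv, cubeTail]
  | succ r ih => simp only [cubeDeriv, cubeTail, ih, mul_assoc]

lemma norm_cubeTail_le {G : Type*} [AddCommGroup G] (r : ℕ) (h : Fin r → G) (f : G → ℂ) (hf : ∀ y, ‖f y‖ ≤ 1)
    (y : G) : ‖cubeTail r h f y‖ ≤ 1 := by
  induction r with
  | zero => simp [cubeTail]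
  | succ r ih =>
    simp only [cubeTail, norm_mul, RCLike.norm_conj]
    exact mul_le_one₀ (ih _) (norm_nonneg _) (norm_cubeDeriv_le _ _ _ hf _)

lemma removable_cubeTail {G : Type*} [AddCommGroup G] (γ : G) (r : ℕ) (g : G → ℂ) (hg : ∀ y, ‖g y‖ ≤ 1)
    (y₀ : G) : Removable γ r (fun w h => cubeTail r h g (y₀ + w • γ)) := by
  induction r with
  | zero => intro w h; rfl
  | succ r ih =>
    refine ⟨_, fun y h => conj (cubeDeriv r h g (y₀ + y)), ih, ?_, ?_⟩
    · intro y h; rw [RCLike.norm_conj]; exact norm_cubeDeriv_le _ _ _ hg _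
    · intro w h₁ h
      simp only [cubeTail, Fin.tail_cons, Fin.cons_zero]
      rw [show y₀ + w • γ + h₁ = y₀ + (h₁ + w • γ) by abel]

lemma sum_zmod_lift (Q X : ℕ) [NeZero Q] (hX : X ≤ Q) (f : ℤ → ℂ) (hf : ∀ n, n ∉ Ico (0 : ℤ) X → f n = 0)
    (H : ZMod Q → ℂ) :
    ∑ y, liftZ Q f y * H y = ∑ n ∈ Ico (0 : ℤ) X, f n * H (n : ZMod Q) := by
  refine sum_bij_ne_zero (fun y _ _ => (y.val : ℤ)) ?_ ?_ ?_ ?_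
  · intro y _ hy
    by_contra h
    exact hy (by rw [liftZ, hf _ h, zero_mul])
  · intro a _ _ b _ _ h
    exact ZMod.val_injective Q (by exact_mod_cast h)
  · intro n hn hne
    rw [mem_Ico] at hn
    have e : ((n : ZMod Q).val : ℤ) = n := by
      rw [ZMod.val_intCast]; exact Int.emod_eq_of_lt hn.1 (by omega)
    exact ⟨(n : ZMod Q), mem_univ _, by rw [liftZ, e]; exact hne, e⟩
  · intro y _ _
    rw [liftZ]; simp

lemma card_liftZ_support (Q X : ℕ) [NeZero Q] (f : ℤ → ℂ) (hf : ∀ n, n ∉ Ico (0 : ℤ) X → f n = 0)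
    (G : ZMod Q → ℂ) (hG : ∀ y, liftZ Q f y = 0 → G y = 0) :
    (univ.filter fun y => G y ≠ 0).card ≤ X := by
  calc (univ.filter fun y => G y ≠ 0).card ≤ (range X).card := by
        refine card_le_card_of_injOn (fun y => y.val) ?_ (fun a _ b _ h => ZMod.val_injective Q h)
        intro y hy
        simp only [coe_filter, mem_univ, true_and, Set.mem_ofPred_eq] at hy
        rw [coe_range, Set.mem_Iio]
        by_contra hc
        refine hy (hG y (hf _ ?_))
        rw [mem_Ico]; beta_reduce at hc; omega
    _ = X := card_range X

/-- Large `U^{r+2}` energy gives a correlation with linear phases. -/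
theorem exists_phase_correlation (r N M : ℕ) (δ : ℝ)
    (h : δ * M * (N / M + 1 : ℕ) ^ (r + 3) ≤ classEnergy (r + 1) N M) :
    ∃ (θ : ℕ → (Fin r → ZMod (4 * (N / M + 1) + 1)) → ℝ) (c : ℕ → (Fin r → ZMod (4 * (N / M + 1) + 1)) → ℂ),
      (∀ b h, ‖c b h‖ = 1) ∧
      δ * M * (N / M + 1 : ℕ) ^ (r + 1) ≤ ‖∑ b ∈ range M, ∑ h, ∑ n ∈ Ico (0 : ℤ) ((N / M + 1 : ℕ) : ℤ),
        classFn N M b n * (c b h * ee (n * θ b h) * cubeTail r h (liftZ _ (classFn N M b)) n)‖ := by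
  set X := N / M + 1 with hX
  have hX0 : (0:ℝ) < X := by positivity
  let G : ℕ → (Fin r → ZMod (4 * X + 1)) → ZMod (4 * X + 1) → ℂ := fun b h y =>
    cubeDeriv r h (liftZ _ (classFn N M b)) y
  have hex : ∀ b h, ∃ j : ZMod (4 * X + 1), b < M → ∑ h₀, ‖∑ y, G b h y * conj (G b h (y + h₀))‖ ^ 2 ≤
      X ^ 2 * ‖∑ y, G b h y * ZMod.stdAddChar (j * y)‖ := by
    intro b h
    by_cases hb : b < M
    · obtain ⟨j, hj⟩ := exists_large_fourier X (G b h)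
        (norm_cubeDeriv_le r h _ (norm_liftZ_le _ _ (norm_classFn_le N M b)))
        (card_liftZ_support _ X _ (classFn_support N M b hb) _ fun y hy => cubeDeriv_eq_zero r h _ y hy)
      exact ⟨j, fun _ => hj⟩
    · exact ⟨0, fun h => absurd h hb⟩
  choose j hj using hex
  set θ : ℕ → (Fin r → ZMod (4 * X + 1)) → ℝ := fun b h => ((j b h).val / (4 * X + 1 : ℕ) : ℝ) with hθ
  have hsum : ∀ b < M, ∀ h, ∑ y, G b h y * ZMod.stdAddChar (j b h * y) =
      ∑ n ∈ Ico (0 : ℤ) (X : ℤ), classFn N M b n * (ee (n * θ b h) * cubeTail r h (liftZ _ (classFn N M b)) n) := by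
    intro b hb h
    have := sum_zmod_lift (4 * X + 1) X (by omega) (classFn N M b) (classFn_support N M b hb)
      (fun y => ZMod.stdAddChar (j b h * y) * cubeTail r h (liftZ _ (classFn N M b)) y)
    simp only [stdAddChar_mul_intCast] at this
    rw [← this]
    refine sum_congr rfl fun y _ => ?_
    simp only [G, cubeDeriv_eq_mul_cubeTail]; ring
  choose c hc1 hc using fun b h => exists_unimodular (∑ y, G b h y * ZMod.stdAddChar (j b h * y))
  refine ⟨θ, c, hc1, ?_⟩
  have e1 : ∑ b ∈ range M, ∑ h, ∑ n ∈ Ico (0 : ℤ) (X : ℤ),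
        classFn N M b n * (c b h * ee (n * θ b h) * cubeTail r h (liftZ _ (classFn N M b)) n) =
      ((∑ b ∈ range M, ∑ h, ‖∑ y, G b h y * ZMod.stdAddChar (j b h * y)‖ : ℝ) : ℂ) := by
    push_cast
    refine sum_congr rfl fun b hb => sum_congr rfl fun h _ => ?_
    rw [← hc, hsum b (mem_range.1 hb), mul_sum]
    refine sum_congr rfl fun n _ => by ring
  rw [e1, Complex.norm_real, Real.norm_of_nonneg (by positivity)]
  have e2 : classEnergy (r + 1) N M ≤ X ^ 2 * ∑ b ∈ range M, ∑ h, ‖∑ y, G b h y * ZMod.stdAddChar (j b h * y)‖ := by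
    rw [classEnergy, mul_sum]
    refine sum_le_sum fun b hb => ?_
    rw [sum_fin_cons, sum_comm, mul_sum]
    refine sum_le_sum fun h _ => ?_
    refine le_trans (le_of_eq ?_) (hj b h (mem_range.1 hb))
    simp only [cubeDeriv_cons, G]
    rfl
  have e3 : (X:ℝ) ^ 2 * (δ * M * X ^ (r + 1)) ≤
      X ^ 2 * ∑ b ∈ range M, ∑ h, ‖∑ y, G b h y * ZMod.stdAddChar (j b h * y)‖ := by
    refine le_trans (le_of_eq ?_) (h.trans e2)
    ring
  exact le_of_mul_le_mul_left e3 (by positivity)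

lemma sum_Ioc_nat_eq_int {β : Type*} [AddCommMonoid β] (L : ℕ) (f : ℕ → β) :
    ∑ u ∈ Ioc 0 L, f u = ∑ x ∈ Ioc (0 : ℤ) L, f x.toNat := by
  refine sum_bij (fun u _ => (u : ℤ)) ?_ ?_ ?_ ?_
  · intro u hu; simp only [mem_Ioc] at *; omega
  · intro a _ b _ h; exact_mod_cast h
  · intro x hx; simp only [mem_Ioc] at *; exact ⟨x.toNat, by omega, by omega⟩
  · intro u _; simp

/-- Splitting a Möbius sum into residue classes modulo `M`. -/
lemma sum_moebius_eq_sum_classFn (L M Y : ℕ) (hM : 0 < M) (hY : L / M < Y) (Ψ : ℕ → ℂ) :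
    ∑ u ∈ Ioc 0 L, (ArithmeticFunction.moebius u : ℂ) * Ψ u =
      ∑ v ∈ range M, ∑ w ∈ Ico (0 : ℤ) Y, classFn L M v w * Ψ (v + M * w.toNat) := by
  rw [sum_Ioc_nat_eq_int]
  have e : ∀ x ∈ Ioc (0:ℤ) L, (ArithmeticFunction.moebius x.toNat : ℂ) * Ψ x.toNat = muN L x * Ψ x.toNat := by
    intro x hx
    rw [mem_Ioc] at hx
    rw [muN, if_pos hx]
  rw [sum_congr rfl e, sum_residue_split M hM (Ioc (0:ℤ) L) (Ico (0:ℤ) Y)]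
  · refine sum_congr rfl fun v _ => sum_congr rfl fun w hw => ?_
    rw [mem_Ico] at hw
    obtain ⟨k, rfl⟩ := Int.eq_ofNat_of_zero_le hw.1
    rw [classFn]
    congr 2
  · intro x hx
    rw [mem_Ioc]
    by_contra h
    exact hx (by rw [muN, if_neg h, zero_mul])
  · intro v hv w hw
    by_contra h
    refine hw ?_
    have h0 := classFn_support L M v (mem_range.1 hv) w (fun h' => h ?_)
    · rw [← classFn, h0, zero_mul]
    · rw [mem_Ico] at h' ⊢; push_cast at h'; omega

/-- The function whose correlation with `μ` encodes the linear phases of all the derivatives. -/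
def phaseFn (r M Q : ℕ) [NeZero Q] (g : ℕ → ZMod Q → ℂ) (θ : ℕ → (Fin r → ZMod Q) → ℝ)
    (c : ℕ → (Fin r → ZMod Q) → ℂ) (x : ℕ) : ℂ :=
  ∑ h, c (x % M) h * ee ((x / M : ℕ) * θ (x % M) h) * cubeTail r h (g (x % M)) ((x / M : ℕ) : ZMod Q)

lemma norm_phaseFn_le (r M Q : ℕ) [NeZero Q] (g : ℕ → ZMod Q → ℂ) (hg : ∀ b y, ‖g b y‖ ≤ 1)
    (θ : ℕ → (Fin r → ZMod Q) → ℝ) (c : ℕ → (Fin r → ZMod Q) → ℂ) (hc : ∀ b h, ‖c b h‖ = 1) (x : ℕ) :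
    ‖phaseFn r M Q g θ c x‖ ≤ Q ^ r := by
  refine (norm_sum_le _ _).trans ?_
  calc _ ≤ ∑ h : Fin r → ZMod Q, (1:ℝ) := by
        refine sum_le_sum fun h _ => ?_
        rw [norm_mul, norm_mul, hc, norm_ee, one_mul, one_mul]
        exact norm_cubeTail_le _ _ _ (hg _) _
    _ = Q ^ r := by simp

/-- Large `U^{r+2}` energy gives a correlation of `μ` with many dilates of a phase function. -/
theorem exists_dilated_phase_correlation (r : ℕ) : ∃ B : ℕ, ∀ Λ : ℝ, (B : ℝ) ≤ Λ → ∀ N M : ℕ, 0 < M →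
    Real.exp (Real.exp (Λ ^ B)) ≤ N →
    1 / Λ * M * (N / M + 1 : ℕ) ^ (r + 3) ≤ classEnergy (r + 1) N M →
    ∃ (θ : ℕ → (Fin r → ZMod (4 * (N / M + 1) + 1)) → ℝ) (c : ℕ → (Fin r → ZMod (4 * (N / M + 1) + 1)) → ℂ)
      (D : ℕ), (∀ b h, ‖c b h‖ = 1) ∧ Real.exp Λ ≤ D ∧ (D : ℝ) ≤ Real.exp (Λ ^ B) ∧
      1 / Λ ^ B * N * (4 * (N / M + 1) + 1 : ℕ) ^ r ≤ ∑ d ∈ Ioc D (2 * D), ‖∑ u ∈ Ioc 0 (N / d),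
        (ArithmeticFunction.moebius u : ℂ) *
          phaseFn r M _ (fun b => liftZ _ (classFn N M b)) θ c (d * u)‖ := by
  obtain ⟨B, hB⟩ := exists_dilation_correlation
  refine ⟨max (2 * B) (5 ^ r + 1), fun Λ hΛ N M hM hN h => ?_⟩
  set C := max (2 * B) (5 ^ r + 1) with hC
  have hC1 : ((2 * B : ℕ) : ℝ) ≤ Λ := le_trans (by exact_mod_cast le_max_left _ _) hΛ
  have hC2 : ((5 ^ r + 1 : ℕ) : ℝ) ≤ Λ := le_trans (by exact_mod_cast le_max_right _ _) hΛ
  push_cast at hC1 hC2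
  have h5 : (1:ℝ) ≤ 5 ^ r := one_le_pow₀ (by norm_num)
  have hΛ1 : 1 ≤ Λ := by linarith
  have hΛ0 : 0 < Λ := by linarith
  have hpow : ∀ n ≤ C, Λ ^ n ≤ Λ ^ C := fun n hn => pow_le_pow_right₀ hΛ1 hn
  have h2B : (Λ ^ 2) ^ B ≤ Λ ^ C := by rw [← pow_mul]; exact hpow _ (le_max_left _ _)
  have hphase := exists_phase_correlation r N M (1 / Λ) h
  obtain ⟨X, hX⟩ : ∃ X, X = N / M + 1 := ⟨_, rfl⟩
  rw [← hX] at hphase ⊢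
  obtain ⟨θ, c, hc, hcor⟩ := hphase
  set Ψ := phaseFn r M (4 * X + 1) (fun b => liftZ _ (classFn N M b)) θ c with hΨ
  have hΨ1 := norm_phaseFn_le r M (4 * X + 1) (fun b => liftZ _ (classFn N M b))
    (fun b => norm_liftZ_le _ _ (norm_classFn_le N M b)) θ c hc
  set q : ℝ := ((4 * X + 1 : ℕ) : ℝ) ^ r with hq
  have hq0 : 0 < q := by positivity
  have hsum : ∑ u ∈ Ioc 0 N, (ArithmeticFunction.moebius u : ℂ) * Ψ u =
      ∑ b ∈ range M, ∑ h, ∑ n ∈ Ico (0 : ℤ) (X : ℤ),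
        classFn N M b n * (c b h * ee (n * θ b h) * cubeTail r h (liftZ _ (classFn N M b)) n) := by
    rw [sum_moebius_eq_sum_classFn N M X hM (by omega)]
    refine sum_congr rfl fun b hb => ?_
    rw [sum_comm]
    refine sum_congr rfl fun n hn => ?_
    rw [mem_Ico] at hn
    rw [mem_range] at hb
    obtain ⟨k, rfl⟩ := Int.eq_ofNat_of_zero_le hn.1
    have e1 : (b + M * k) % M = b := by rw [Nat.add_mul_mod_self_left, Nat.mod_eq_of_lt hb]
    have e2 : (b + M * k) / M = k := by rw [Nat.add_mul_div_left _ _ hM, Nat.div_eq_of_lt hb, zero_add]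
    rw [Int.toNat_natCast, hΨ, phaseFn, e1, e2, mul_sum]
    simp
  have hXN : (N:ℝ) ≤ M * X := by
    have := Nat.lt_mul_div_succ N hM
    rw [hX]; exact_mod_cast this.le
  have hqX : q ≤ 5 ^ r * X ^ r := by
    rw [hq, ← mul_pow]; gcongr
    have : 1 ≤ X := by rw [hX]; exact Nat.le_add_left _ _
    have : 4 * X + 1 ≤ 5 * X := by omega
    exact_mod_cast this
  obtain ⟨D, hD1, hD2, hD3⟩ := hB (Λ ^ 2) (by nlinarith) N
    ((Real.exp_le_exp.2 (Real.exp_le_exp.2 h2B)).trans hN) (fun x => (q : ℂ)⁻¹ * Ψ x) (fun x => by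
      rw [norm_mul, norm_inv, Complex.norm_real, Real.norm_of_nonneg hq0.le, inv_mul_le_iff₀ hq0, mul_one]
      exact hΨ1 x) (by
      have e : ∑ n ∈ Ioc 0 N, (ArithmeticFunction.moebius n : ℂ) * ((q : ℂ)⁻¹ * Ψ n) =
          (q:ℂ)⁻¹ * ∑ n ∈ Ioc 0 N, (ArithmeticFunction.moebius n : ℂ) * Ψ n := by
        rw [mul_sum]; exact sum_congr rfl fun n _ => by ring
      rw [e, norm_mul, norm_inv, Complex.norm_real, Real.norm_of_nonneg hq0.le, hsum]
      refine le_trans ?_ (mul_le_mul_of_nonneg_left hcor (by positivity))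
      rw [le_inv_mul_iff₀ hq0, mul_div_assoc', div_le_iff₀ (by positivity)]
      calc q * N ≤ (5 ^ r * X ^ r) * (M * X) := by gcongr
        _ ≤ (Λ * X ^ r) * (M * X) := by gcongr; linarith
        _ = _ := by rw [pow_succ (X:ℝ)]; field_simp)
  refine ⟨θ, c, D, hc, (Real.exp_le_exp.2 (by nlinarith)).trans hD1, hD2.trans (Real.exp_le_exp.2 h2B), ?_⟩
  have e : ∀ d, ∑ u ∈ Ioc 0 (N / d), (ArithmeticFunction.moebius u : ℂ) * ((q : ℂ)⁻¹ * Ψ (d * u)) =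
          (q:ℂ)⁻¹ * ∑ u ∈ Ioc 0 (N / d), (ArithmeticFunction.moebius u : ℂ) * Ψ (d * u) := by
    intro d; rw [mul_sum]; exact sum_congr rfl fun n _ => by ring
  simp only [e, norm_mul, norm_inv, Complex.norm_real, Real.norm_of_nonneg hq0.le] at hD3
  rw [← mul_sum, le_inv_mul_iff₀ hq0] at hD3
  refine le_trans ?_ hD3
  calc 1 / Λ ^ C * N * q ≤ 1 / (Λ ^ 2) ^ B * N * q := by gcongr
    _ = _ := by ring

/-- Cauchy–Schwarz elimination applied to the dilated correlations. -/
theorem sum_box_ge_of_dilated_correlation (r N M D Q Y : ℕ) [NeZero Q] (hM : 0 < M) (hD : 0 < D)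
    (hDM : D * M ≤ N) (hY : Y = N / (D * M) + 1) (g : ℕ → ZMod Q → ℂ) (hg : ∀ b y, ‖g b y‖ ≤ 1)
    (θ : ℕ → (Fin r → ZMod Q) → ℝ) (c : ℕ → (Fin r → ZMod Q) → ℂ) (hc : ∀ b h, ‖c b h‖ = 1) (δ : ℝ) (hδ : 0 ≤ δ)
    (h : δ * N * Q ^ r ≤ ∑ d ∈ Ioc D (2 * D), ‖∑ u ∈ Ioc 0 (N / d),
        (ArithmeticFunction.moebius u : ℂ) * phaseFn r M Q g θ c (d * u)‖) :
    (δ / 4) ^ 2 ^ r * D * M * Q ^ r * Y ^ (r + 1) ≤ ∑ d ∈ Ioc D (2 * D), ∑ v ∈ range M,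
      ∑ k ∈ Fintype.piFinset (fun _ : Fin r => Ioo (-Y : ℤ) Y), ∑ h : Fin r → ZMod Q,
        ‖∑ w ∈ Ico (0 : ℤ) Y, cubeDeriv r k (classFn (N / d) M v) w *
          ee (d * w * boxDiff (d : ZMod Q) r k (θ (d * v % M)) h)‖ := by
  have hQ0 : (0:ℝ) < Q := by exact_mod_cast Nat.pos_of_ne_zero (NeZero.ne Q)
  have hY0 : (0:ℝ) < Y := by rw [hY]; positivity
  have hD0 : (0:ℝ) < D := by exact_mod_cast hD
  have hM0 : (0:ℝ) < M := by exact_mod_cast hM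
  have hYN : (D * M * Y : ℝ) ≤ 2 * N := by
    have h1 : D * M * (N / (D * M)) ≤ N := Nat.mul_div_le _ _
    have : D * M * Y ≤ 2 * N := by rw [hY, mul_add]; omega
    exact_mod_cast this
  set E : ℕ → ℕ → ℝ := fun d v => ‖∑ w ∈ Ico (0 : ℤ) Y, ∑ h : Fin r → ZMod Q, classFn (N / d) M v w *
      (c (d * v % M) h * ee ((d * v / M : ℕ) * θ (d * v % M) h)) * ee ((d : ℤ) * w * θ (d * v % M) h) *
      cubeTail r h (g (d * v % M)) (((d * v / M : ℕ) : ZMod Q) + w • (d : ZMod Q))‖ with hE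
  have hsplit : ∀ d ∈ Ioc D (2 * D), ‖∑ u ∈ Ioc 0 (N / d),
        (ArithmeticFunction.moebius u : ℂ) * phaseFn r M Q g θ c (d * u)‖ ≤ ∑ v ∈ range M, E d v := by
    intro d hd
    rw [mem_Ioc] at hd
    have hYd : N / d / M < Y := by
      rw [Nat.div_div_eq_div_mul, hY]
      have : N / (d * M) ≤ N / (D * M) := Nat.div_le_div_left (Nat.mul_le_mul_right M hd.1.le) (by positivity)
      omega
    rw [sum_moebius_eq_sum_classFn (N / d) M Y hM hYd (fun u => phaseFn r M Q g θ c (d * u))]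
    refine (norm_sum_le _ _).trans (sum_le_sum fun v _ => le_of_eq ?_)
    rw [hE]
    congr 1
    refine sum_congr rfl fun w hw => ?_
    rw [mem_Ico] at hw
    obtain ⟨k, rfl⟩ := Int.eq_ofNat_of_zero_le hw.1
    have e0 : d * (v + M * k) = d * v + M * (d * k) := by ring
    have e1 : (d * (v + M * k)) % M = d * v % M := by rw [e0, Nat.add_mul_mod_self_left]
    have e2 : (d * (v + M * k)) / M = d * v / M + d * k := by rw [e0, Nat.add_mul_div_left _ _ hM]
    rw [Int.toNat_natCast, phaseFn, e1, e2, mul_sum]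
    refine sum_congr rfl fun h _ => ?_
    have e3 : ee ((d * v / M + d * k : ℕ) * θ (d * v % M) h) = ee ((d * v / M : ℕ) * θ (d * v % M) h) *
        ee ((d : ℤ) * (k : ℤ) * θ (d * v % M) h) := by
      rw [← ee_add]; congr 1; push_cast; ring
    have e4 : ((d * v / M + d * k : ℕ) : ZMod Q) = ((d * v / M : ℕ) : ZMod Q) + (k : ℤ) • (d : ZMod Q) := by
      push_cast; simp [mul_comm]
    rw [e3, e4]; ring
  have hE0 : ∀ d v, 0 ≤ E d v := fun d v => norm_nonneg _
  set S : ℕ → ℕ → ℝ := fun d v => ∑ k ∈ Fintype.piFinset (fun _ : Fin r => Ioo (-Y : ℤ) Y), ∑ h : Fin r → ZMod Q,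
        ‖∑ w ∈ Ico (0 : ℤ) Y, cubeDeriv r k (classFn (N / d) M v) w *
          ee (d * w * boxDiff (d : ZMod Q) r k (θ (d * v % M)) h)‖ with hS
  have helim : ∀ d ∈ Ioc D (2 * D), ∀ v ∈ range M, E d v ^ 2 ^ r * ((Q * Y) ^ r * Y) ≤
      2 ^ 2 ^ r * (Y * Q ^ r) ^ 2 ^ r * S d v := by
    intro d hd v hv
    rw [mem_Ioc] at hd
    have hYd : N / d / M < Y := by
      rw [Nat.div_div_eq_div_mul, hY]
      have : N / (d * M) ≤ N / (D * M) := Nat.div_le_div_left (Nat.mul_le_mul_right M hd.1.le) (by positivity)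
      omega
    have := removable_elimination (d : ZMod Q) (d : ℤ) Y r (classFn (N / d) M v)
      (fun w hw => classFn_support _ _ _ (mem_range.1 hv) w (fun h' => hw (by
        rw [mem_Ico] at h' ⊢
        exact ⟨h'.1, h'.2.trans_le (by exact_mod_cast hYd)⟩)))
      (fun h => c (d * v % M) h * ee ((d * v / M : ℕ) * θ (d * v % M) h))
      (fun h => by rw [norm_mul, hc, norm_ee, one_mul]) (θ (d * v % M))
      (fun w h => cubeTail r h (g (d * v % M)) (((d * v / M : ℕ) : ZMod Q) + w • (d : ZMod Q)))
      (removable_cubeTail _ r _ (hg _) _)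
    rw [ZMod.card] at this
    simpa only [hE, hS, Int.cast_natCast] using this
  have htot : δ * N * Q ^ r ≤ ∑ x ∈ Ioc D (2 * D) ×ˢ range M, E x.1 x.2 := by
    rw [sum_product]; exact h.trans (sum_le_sum hsplit)
  obtain ⟨q, hq⟩ : ∃ q, 2 ^ r = q + 1 := ⟨2 ^ r - 1, by have := Nat.one_le_two_pow (n := r); omega⟩
  have hpm := sum_pow_le_card_pow_mul (Ioc D (2 * D) ×ˢ range M) (fun x => E x.1 x.2) (fun x _ => hE0 _ _) q
  have hcard : ((Ioc D (2 * D) ×ˢ range M).card : ℝ) = D * M := by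
    rw [card_product, Nat.card_Ioc, card_range, show 2 * D - D = D by omega]; push_cast; ring
  rw [hcard, ← hq] at hpm
  have h1 : (δ * N * Q ^ r) ^ 2 ^ r * ((Q * Y) ^ r * Y) ≤
      (D * M : ℝ) ^ q * (2 ^ 2 ^ r * (Y * Q ^ r) ^ 2 ^ r * ∑ d ∈ Ioc D (2 * D), ∑ v ∈ range M, S d v) := by
    calc (δ * N * Q ^ r) ^ 2 ^ r * ((Q * Y) ^ r * Y) ≤
        ((D * M : ℝ) ^ q * ∑ x ∈ Ioc D (2 * D) ×ˢ range M, E x.1 x.2 ^ 2 ^ r) * ((Q * Y) ^ r * Y) := by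
          refine mul_le_mul_of_nonneg_right ?_ (by positivity)
          exact le_trans (by gcongr) hpm
      _ = (D * M : ℝ) ^ q * ∑ x ∈ Ioc D (2 * D) ×ˢ range M, E x.1 x.2 ^ 2 ^ r * ((Q * Y) ^ r * Y) := by
          rw [mul_assoc, sum_mul]
      _ ≤ (D * M : ℝ) ^ q * ∑ x ∈ Ioc D (2 * D) ×ˢ range M, 2 ^ 2 ^ r * (Y * Q ^ r) ^ 2 ^ r * S x.1 x.2 := by
          refine mul_le_mul_of_nonneg_left (sum_le_sum fun x hx => ?_) (by positivity)
          rw [mem_product] at hx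
          exact helim _ hx.1 _ hx.2
      _ = _ := by rw [← mul_sum, sum_product]
  set T := ∑ d ∈ Ioc D (2 * D), ∑ v ∈ range M, S d v with hT
  have h2 : (δ * (D * M * Y / 2) * Q ^ r) ^ 2 ^ r * ((Q * Y) ^ r * Y) ≤
      (D * M : ℝ) ^ q * (2 ^ 2 ^ r * (Y * Q ^ r) ^ 2 ^ r * T) := by
    refine le_trans ?_ h1
    gcongr
    linarith
  have hpos : (0:ℝ) < (D * M : ℝ) ^ q * (2 ^ 2 ^ r * (Y * Q ^ r) ^ 2 ^ r) := by positivity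
  refine le_of_mul_le_mul_left (le_trans (le_of_eq ?_) (h2.trans (le_of_eq (by ring)))) hpos
  have e1 : (δ * (D * M * Y / 2) * Q ^ r : ℝ) = (δ / 4) * (D * M) * 2 * (Y * Q ^ r) := by ring
  rw [e1, mul_pow _ (Y * (Q:ℝ) ^ r), mul_pow _ (2:ℝ), mul_pow _ ((D:ℝ) * M), hq, pow_succ ((D:ℝ) * M), mul_pow (Q:ℝ)]
  ring

/-! ### Reduction to a single dilate and a single modulus -/

lemma exists_cutoff_cubeDeriv (r : ℕ) (k : Fin r → ℤ) (f : ℤ → ℂ) (y : ℤ) :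
    ∃ y' : ℤ, ∀ w, cubeDeriv r k (fun w => if w ≤ y then f w else 0) w =
      if w ≤ y' then cubeDeriv r k f w else 0 := by
  induction r with
  | zero => exact ⟨y, fun w => rfl⟩
  | succ r ih =>
    obtain ⟨y', hy'⟩ := ih (Fin.tail k)
    refine ⟨min y' (y' - k 0), fun w => ?_⟩
    simp only [cubeDeriv, hy']
    by_cases h1 : w ≤ y' <;> by_cases h2 : w + k 0 ≤ y'
    · rw [if_pos h1, if_pos h2, if_pos (by omega)]
    · rw [if_neg h2, if_neg (c := w ≤ min y' (y' - k 0)) (by omega)]; simp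
    · rw [if_neg h1, if_neg (c := w ≤ min y' (y' - k 0)) (by omega)]; simp
    · rw [if_neg h1, if_neg (c := w ≤ min y' (y' - k 0)) (by omega)]; simp

lemma classFn_eq_cutoff (L L' M v : ℕ) (hM : 0 < M) (h : L ≤ L') :
    classFn L M v = fun w => if w ≤ ((L : ℤ) - v) / M then classFn L' M v w else 0 := by
  funext w
  have hM' : (0:ℤ) < M := by exact_mod_cast hM
  have e : w ≤ ((L : ℤ) - v) / M ↔ (v + M * w : ℤ) ≤ L := by
    rw [Int.le_ediv_iff_mul_le hM', mul_comm]; omega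
  simp only [e, classFn, muN]
  have : (L:ℤ) ≤ L' := by exact_mod_cast h
  by_cases h1 : (v + M * w : ℤ) ≤ L
  · simp [h1, h1.trans this]
  · simp [h1]

lemma sum_Ioc_le_sum_progressions (D M : ℕ) (hM : 0 < M) (f : ℕ → ℝ) (hf : ∀ d, 0 ≤ f d) :
    ∑ d ∈ Ioc D (2 * D), f d ≤ ∑ a ∈ Ioc D (D + M),
      ∑ d ∈ (range (D / M + 1)).filter (fun d => a + M * d ≤ 2 * D), f (a + M * d) := by
  have hmaps : ∀ d ∈ Ioc D (2 * D), D + 1 + (d - D - 1) % M ∈ Ioc D (D + M) := by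
    intro d hd
    have := Nat.mod_lt (d - D - 1) hM
    rw [mem_Ioc]; omega
  rw [← sum_fiberwise_of_maps_to hmaps]
  refine sum_le_sum fun a ha => ?_
  rw [← sum_image (f := f) (g := fun d => a + M * d) (fun x _ y _ h => by
    have : M * x = M * y := by simpa using h
    exact Nat.eq_of_mul_eq_mul_left hM this)]
  refine sum_le_sum_of_subset_of_nonneg ?_ fun _ _ _ => hf _
  intro d hd
  simp only [mem_filter, mem_Ioc, mem_image, mem_range] at hd ⊢
  have e := Nat.mod_add_div (d - D - 1) M
  refine ⟨(d - D - 1) / M, ⟨?_, ?_⟩, ?_⟩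
  · have : (d - D - 1) / M ≤ D / M := Nat.div_le_div_right (by omega)
    omega
  · omega
  · omega

lemma polynomial_bounds (r n : ℕ) : ∃ c : ℝ, 0 < c ∧ c ≤ 1 ∧ ∃ K : ℕ, ∀ δ δ₁ δ₂ ε R : ℝ, 0 < δ → δ ≤ 1 →
    δ₁ = δ / 2 ^ (r + 1) → δ₂ = (δ₁ ^ 3 / 32) ^ 2 ^ n → ε = δ₂ / (2 * (n + 1)) →
    R = 4 / δ₁ ^ 2 * (1 + 2 ^ (n + 1) * Real.exp 4 * (4 / ε) ^ n) →
    c * δ ^ K ≤ ε ∧ 2 * R ≤ 1 / (c * δ ^ K) ∧ c * δ ^ K ≤ δ₁ ^ 2 / (256 * R) * δ₂ := by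
  set c₁ : ℝ := (1 / (32 * (2 ^ (r + 1)) ^ 3)) ^ 2 ^ n with hc₁
  set c₂ : ℝ := c₁ / (2 * (n + 1)) with hc₂
  set A : ℝ := 2 ^ (n + 1) * Real.exp 4 with hA
  set c₃ : ℝ := c₂ ^ n / ((2 ^ (r + 1)) ^ 2 * (4 * (1 + A) * 4 ^ n)) with hc₃
  have hc₁0 : 0 < c₁ := by positivity
  have hc₂0 : 0 < c₂ := by positivity
  have hA0 : 0 < A := by positivity
  have hc₃0 : 0 < c₃ := by positivity
  set K₀ := 3 * 2 ^ n with hK₀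
  set c₄ : ℝ := c₃ * c₁ / (256 * (2 ^ (r + 1)) ^ 2) with hc₄
  have hc₄0 : 0 < c₄ := by positivity
  refine ⟨min 1 (min c₂ (min (c₃ / 2) c₄)), by positivity, min_le_left _ _, 4 + n * K₀ + K₀, ?_⟩
  intro δ δ₁ δ₂ ε R hδ hδ1 h1 h2 hε hR
  set c := min 1 (min c₂ (min (c₃ / 2) c₄)) with hc
  have hc0 : 0 < c := by positivity
  have hcc₂ : c ≤ c₂ := (min_le_right _ _).trans (min_le_left _ _)
  have hcc₃ : c ≤ c₃ / 2 := (min_le_right _ _).trans ((min_le_right _ _).trans (min_le_left _ _))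
  have hcc₄ : c ≤ c₄ := (min_le_right _ _).trans ((min_le_right _ _).trans (min_le_right _ _))
  have hδ₂ : δ₂ = c₁ * δ ^ K₀ := by
    rw [h2, h1, hc₁, hK₀, pow_mul, ← mul_pow]; congr 1; rw [div_pow]; field_simp
  have hεe : ε = c₂ * δ ^ K₀ := by rw [hε, hδ₂, hc₂]; ring
  have hε0 : 0 < ε := by rw [hεe]; positivity
  have hc₁1 : c₁ ≤ 1 := by
    rw [hc₁]
    refine pow_le_one₀ (by positivity) ?_
    rw [div_le_one (by positivity)]
    have : (1:ℝ) ≤ (2 ^ (r + 1)) ^ 3 := one_le_pow₀ (one_le_pow₀ (by norm_num))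
    linarith
  have hε4 : ε ≤ 4 := by
    rw [hεe]
    have h3 : c₂ ≤ 1 := by
      rw [hc₂, div_le_one (by positivity)]
      have : (0:ℝ) ≤ n := by positivity
      linarith
    have h4 : δ ^ K₀ ≤ 1 := pow_le_one₀ hδ.le hδ1
    have : c₂ * δ ^ K₀ ≤ 1 := mul_le_one₀ h3 (by positivity) h4
    linarith
  have hRpos : 0 < R := by
    rw [hR, h1]; positivity
  have hRle : R * (c₃ * δ ^ (2 + n * K₀)) ≤ 1 := by
    have h5 : (1:ℝ) ≤ (4 / ε) ^ n := one_le_pow₀ (by rw [le_div_iff₀ hε0]; linarith)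
    have h6 : R ≤ 4 / δ₁ ^ 2 * ((1 + A) * (4 / ε) ^ n) := by
      rw [hR]; gcongr; linarith
    calc R * (c₃ * δ ^ (2 + n * K₀)) ≤ 4 / δ₁ ^ 2 * ((1 + A) * (4 / ε) ^ n) * (c₃ * δ ^ (2 + n * K₀)) := by gcongr
      _ = 1 := by
        rw [h1, hεe, hc₃, div_pow 4, mul_pow, ← pow_mul, mul_comm K₀ n, pow_add δ]
        have : (0:ℝ) < 1 + A := by positivity
        field_simp
  have hdec : ∀ a b : ℕ, a ≤ b → δ ^ b ≤ δ ^ a := fun a b hab => pow_le_pow_of_le_one hδ.le hδ1 hab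
  refine ⟨?_, ?_, ?_⟩
  · rw [hεe]
    exact mul_le_mul hcc₂ (hdec _ _ (by omega)) (by positivity) (by positivity)
  · rw [le_div_iff₀ (by positivity)]
    calc 2 * R * (c * δ ^ (4 + n * K₀ + K₀)) ≤ 2 * R * (c₃ / 2 * δ ^ (2 + n * K₀)) := by
          gcongr 2 * R * ?_
          exact mul_le_mul hcc₃ (hdec _ _ (by omega)) (by positivity) (by positivity)
      _ = R * (c₃ * δ ^ (2 + n * K₀)) := by ring
      _ ≤ 1 := hRle
  · have h7 : c₃ * δ ^ (2 + n * K₀) ≤ 1 / R := by rw [le_div_iff₀ hRpos]; linarith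
    calc c * δ ^ (4 + n * K₀ + K₀) ≤ c₄ * δ ^ (4 + n * K₀ + K₀) := by gcongr
      _ = δ₁ ^ 2 / 256 * (c₃ * δ ^ (2 + n * K₀)) * δ₂ := by
          rw [h1, hδ₂, hc₄]
          have : δ ^ (4 + n * K₀ + K₀) = δ ^ 2 * δ ^ (2 + n * K₀) * δ ^ K₀ := by rw [← pow_add, ← pow_add]; congr 1; ring
          rw [this]; field_simp
      _ ≤ δ₁ ^ 2 / 256 * (1 / R) * δ₂ := by
          have : 0 ≤ δ₂ := by rw [hδ₂]; positivity
          gcongr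
      _ = _ := by field_simp

theorem exists_major_arc_dilate (r : ℕ) : ∃ c : ℝ, 0 < c ∧ c ≤ 1 ∧ ∃ K : ℕ,
    ∀ (N M D Q Y : ℕ) [NeZero Q] (θ : ℕ → (Fin r → ZMod Q) → ℝ) (δ : ℝ), 0 < M → M ≤ D → 2 ≤ D →
      Y = N / (D * M) + 1 → 0 < δ → δ ≤ 1 → (M : ℝ) ≤ c * δ ^ K * D →
      δ * D * M * Q ^ r * Y ^ (r + 1) ≤ ∑ d ∈ Ioc D (2 * D), ∑ v ∈ range M,
        ∑ k ∈ Fintype.piFinset (fun _ : Fin r => Ioo (-Y : ℤ) Y), ∑ h : Fin r → ZMod Q,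
          ‖∑ w ∈ Ico (0 : ℤ) Y, cubeDeriv r k (classFn (N / d) M v) w *
            ee (d * w * boxDiff (d : ZMod Q) r k (θ (d * v % M)) h)‖ →
      ∃ (d m : ℕ) (η : ℝ), D < d ∧ d ≤ 2 * D ∧ 0 < m ∧ m ≤ (2 * D) ^ 2 ^ 2 ^ r ∧
        |η| ≤ 1 / (c * δ ^ K) / Y ∧
        c * δ ^ K * M * Y ^ (r + 1) ≤ ∑ v ∈ range M,
          ∑ k ∈ Fintype.piFinset (fun _ : Fin r => Ioo (-Y : ℤ) Y), ∑ i ∈ range m,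
            ‖∑ w ∈ Ico (0 : ℤ) Y, cubeDeriv r k (classFn (N / d) M v) (i + m * w) * ee (η * m * w)‖ := by
  obtain ⟨c, hc0, hc1, K, hcK⟩ := polynomial_bounds r (Fintype.card (Fin r → Bool))
  refine ⟨c, hc0, hc1, K, ?_⟩
  intro N M D Q Y _ θ δ hM hMD hD hY hδ hδ1 hτD hin
  set n := Fintype.card (Fin r → Bool) with hn
  have hn2 : n = 2 ^ r := by rw [hn]; simp
  obtain ⟨hb1, hb2, hb3⟩ := hcK δ _ _ _ _ hδ hδ1 rfl rfl rfl rfl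
  set δ₁ := δ / 2 ^ (r + 1) with hδ₁
  set δ₂ := (δ₁ ^ 3 / 32) ^ 2 ^ n with hδ₂
  set ε := δ₂ / (2 * (n + 1)) with hε
  set R := 4 / δ₁ ^ 2 * (1 + 2 ^ (n + 1) * Real.exp 4 * (4 / ε) ^ n) with hR
  have hY1 : 1 ≤ Y := by rw [hY]; exact Nat.le_add_left _ _
  have hY0 : (0:ℝ) < Y := by exact_mod_cast hY1
  have hM0 : (0:ℝ) < M := by exact_mod_cast hM
  have hD0 : (0:ℝ) < D := by have : 0 < D := by omega
                             exact_mod_cast this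
  have hQ0 : (0:ℝ) < Q := by exact_mod_cast Nat.pos_of_ne_zero (NeZero.ne Q)
  set box := Fintype.piFinset (fun _ : Fin r => Ioo (-Y : ℤ) Y) with hbox
  set τ := D / M + 1 with hτ
  have hτ1 : D ≤ M * τ := (Nat.lt_mul_div_succ D hM).le
  have hMdiv : M * (D / M) ≤ D := Nat.mul_div_le D M
  have hτle : M * τ ≤ 2 * D := by rw [hτ, mul_add]; omega
  set f : ℕ → ℝ := fun d => ∑ v ∈ range M, ∑ k ∈ box, ∑ h : Fin r → ZMod Q,
          ‖∑ w ∈ Ico (0 : ℤ) Y, cubeDeriv r k (classFn (N / d) M v) w *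
            ee (d * w * boxDiff (d : ZMod Q) r k (θ (d * v % M)) h)‖ with hf
  have hf0 : ∀ d, 0 ≤ f d := fun d => sum_nonneg fun _ _ => sum_nonneg fun _ _ => sum_nonneg fun _ _ => norm_nonneg _
  have hprog := hin.trans (sum_Ioc_le_sum_progressions D M hM f hf0)
  obtain ⟨a, ha, ha2⟩ : ∃ a ∈ Ioc D (D + M), δ * D * Q ^ r * Y ^ (r + 1) ≤
      ∑ d ∈ (range τ).filter (fun d => a + M * d ≤ 2 * D), f (a + M * d) := by
    by_contra! hcon
    have hne : (Ioc D (D + M)).Nonempty := ⟨D + 1, by rw [mem_Ioc]; omega⟩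
    have := sum_lt_sum_of_nonempty hne hcon
    rw [sum_const, nsmul_eq_mul, Nat.card_Ioc, Nat.add_sub_cancel_left] at this
    linarith
  rw [mem_Ioc] at ha
  set P := range M ×ˢ box with hP
  have hboxcard : (box.card : ℝ) = ((2 * Y - 1 : ℕ) : ℝ) ^ r := by
    rw [hbox, Fintype.card_piFinset, prod_const, card_univ, Fintype.card_fin, Int.card_Ioo]
    push_cast; congr 2; omega
  have hPcard : (P.card : ℝ) = M * ((2 * Y - 1 : ℕ) : ℝ) ^ r := by
    rw [hP, card_product, card_range]; push_cast; rw [hboxcard]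
  have hY2 : ((2 * Y - 1 : ℕ) : ℝ) ≤ 2 * Y := by
    have : 2 * Y - 1 ≤ 2 * Y := by omega
    exact_mod_cast this
  have hY3 : (Y : ℝ) ≤ ((2 * Y - 1 : ℕ) : ℝ) := by
    have : Y ≤ 2 * Y - 1 := by omega
    exact_mod_cast this
  have hPne : P.Nonempty := by
    rw [← card_pos]
    have : (0:ℝ) < P.card := by
      rw [hPcard]
      have : (0:ℝ) < ((2 * Y - 1 : ℕ) : ℝ) := lt_of_lt_of_le hY0 hY3
      positivity
    exact_mod_cast this
  set g : ℕ × (Fin r → ℤ) → ℤ → ℂ := fun p => if p.1 < M then cubeDeriv r p.2 (classFn (N / D) M p.1) else 0 with hg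
  have hcut : ∀ (p : ℕ × (Fin r → ℤ)) (d : ℕ), ∃ y : ℤ, p.1 < M → ∀ w,
      cubeDeriv r p.2 (classFn (N / (a + M * d)) M p.1) w = if w ≤ y then g p w else 0 := by
    intro p d
    have hle : N / (a + M * d) ≤ N / D := Nat.div_le_div_left (by omega) (by omega)
    obtain ⟨y, hy⟩ := exists_cutoff_cubeDeriv r p.2 (classFn (N / D) M p.1) ((((N / (a + M * d) : ℕ) : ℤ) - p.1) / M)
    refine ⟨y, fun hp w => ?_⟩
    rw [classFn_eq_cutoff _ _ M p.1 hM hle, hy]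
    simp only [hg, if_pos hp]
  choose y hy using hcut
  set β : ℕ × (Fin r → ℤ) → (Fin r → ZMod Q) × ℕ → ℝ := fun p x =>
    boxDiff ((a : ZMod Q) + x.2 • (M : ZMod Q)) r p.2 (θ (a * p.1 % M)) x.1 with hβ
  have hετ : 1 ≤ ε * τ := by
    have h1 : (D:ℝ) ≤ M * τ := by exact_mod_cast hτ1
    have h2 : (M:ℝ) ≤ ε * D := hτD.trans (by gcongr)
    have hε0 : 0 ≤ ε := le_trans (by positivity) hb1
    have h3 : (M:ℝ) * 1 ≤ M * (ε * τ) := by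
      calc (M:ℝ) * 1 ≤ ε * D := by linarith
        _ ≤ ε * (M * τ) := by gcongr
        _ = _ := by ring
    exact le_of_mul_le_mul_left h3 hM0
  have hsum : δ₁ * P.card * Fintype.card (Fin r → ZMod Q) * τ * Y ≤ ∑ p ∈ P,
      ∑ x ∈ (univ : Finset (Fin r → ZMod Q)) ×ˢ ((range τ).filter fun d => a + M * d ≤ 2 * D),
        ‖∑ w ∈ Ico (0 : ℤ) Y, if w ≤ y p x.2 then g p w * ee ((a + M * x.2) * β p x * w) else 0‖ := by
    have e1 : ∑ p ∈ P, ∑ x ∈ (univ : Finset (Fin r → ZMod Q)) ×ˢ ((range τ).filter fun d => a + M * d ≤ 2 * D),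
        ‖∑ w ∈ Ico (0 : ℤ) Y, if w ≤ y p x.2 then g p w * ee ((a + M * x.2) * β p x * w) else 0‖ =
        ∑ d ∈ (range τ).filter (fun d => a + M * d ≤ 2 * D), f (a + M * d) := by
      simp_rw [sum_product_right]
      rw [sum_comm]
      refine sum_congr rfl fun d _ => ?_
      rw [hP, sum_product, hf]
      refine sum_congr rfl fun v hv => sum_congr rfl fun k _ => sum_congr rfl fun h _ => ?_
      congr 1
      refine sum_congr rfl fun w _ => ?_
      rw [hy (v, k) d (mem_range.1 hv)]
      have e2 : (a + M * d) * v % M = a * v % M := by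
        rw [add_mul, mul_assoc, Nat.add_mul_mod_self_left]
      have e3 : ((a + M * d : ℕ) : ZMod Q) = (a : ZMod Q) + d • (M : ZMod Q) := by
        push_cast; simp [mul_comm]
      rw [e2, e3]
      simp only [hβ]
      split_ifs
      · congr 2; push_cast; ring
      · simp
    rw [e1]
    refine le_trans ?_ ha2
    rw [hPcard, Fintype.card_fun, ZMod.card, Fintype.card_fin]
    push_cast
    have h4 : (M:ℝ) * τ ≤ 2 * D := by exact_mod_cast hτle
    calc δ₁ * (M * ((2 * Y - 1 : ℕ) : ℝ) ^ r) * Q ^ r * τ * Y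
        = δ₁ * Q ^ r * Y * ((2 * Y - 1 : ℕ) : ℝ) ^ r * (M * τ) := by ring
      _ ≤ δ₁ * Q ^ r * Y * (2 * Y) ^ r * (2 * D) := by gcongr
      _ = _ := by rw [hδ₁, mul_pow, pow_succ (2:ℝ), pow_succ (Y:ℝ)]; field_simp
  obtain ⟨d, m, hd, hm, hmle, η, hη, hout⟩ := exists_major_arc P hPne n Y D a M τ hY1 hD ha.1 (Nat.succ_pos _) hτ1
    (fun t ht => (Nat.mul_le_mul_left M ht.le).trans hτle) g
    (fun p w => by
      simp only [hg]; split_ifs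
      · exact norm_cubeDeriv_le _ _ _ (norm_classFn_le _ _ _) _
      · simp)
    (fun p w hw => by
      simp only [hg]; split_ifs with hp
      · refine cubeDeriv_eq_zero _ _ _ _ (classFn_support _ _ _ hp w ?_)
        rwa [Nat.div_div_eq_div_mul, ← hY]
      · rfl) y β (fun p => cornerDir (M : ZMod Q) r p.2)
    (fun p ts x => cubeAlt_boxDiff _ _ r p.2 _ ts x) δ₁ δ₂ ε R (by positivity)
    (by rw [hδ₁, div_le_one (by positivity)]; exact hδ1.trans (one_le_pow₀ (by norm_num))) hδ₂ hε hετ hR hsum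
  refine ⟨a + M * d, m, η, by omega, hd, hm, by rwa [← hn2], ?_, ?_⟩
  · refine hη.trans ?_
    gcongr
  · have e1 : ∑ p ∈ P, ∑ i ∈ range m,
        ‖∑ w ∈ Ico (0 : ℤ) Y, (if i + m * w ≤ y p d then g p (i + m * w) else 0) * ee (η * m * w)‖ =
        ∑ v ∈ range M, ∑ k ∈ box, ∑ i ∈ range m,
            ‖∑ w ∈ Ico (0 : ℤ) Y, cubeDeriv r k (classFn (N / (a + M * d)) M v) (i + m * w) * ee (η * m * w)‖ := by
      rw [hP, sum_product]
      refine sum_congr rfl fun v hv => sum_congr rfl fun k _ => sum_congr rfl fun i _ => ?_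
      congr 1
      refine sum_congr rfl fun w _ => ?_
      rw [hy (v, k) d (mem_range.1 hv)]
    rw [← e1]
    refine le_trans ?_ hout
    calc c * δ ^ K * M * Y ^ (r + 1) = c * δ ^ K * (M * Y ^ r) * Y := by ring
      _ ≤ δ₁ ^ 2 / (256 * R) * δ₂ * P.card * Y := by
          gcongr
          rw [hPcard]; gcongr
      _ = _ := by ring

set_option maxHeartbeats 1000000 in
/-- Large `U^{r+2}` energy of `μ` on progressions forces large `r`-fold correlations on a
short dilate, along progressions of larger modulus. -/
theorem exists_major_arc_of_energy (r : ℕ) : ∃ B : ℕ, ∀ Λ : ℝ, (B : ℝ) ≤ Λ → ∀ N M : ℕ, 0 < M →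
    (M : ℝ) ≤ Real.exp Λ → Real.exp (Real.exp (Λ ^ B)) ≤ N →
    1 / Λ * M * (N / M + 1 : ℕ) ^ (r + 3) ≤ classEnergy (r + 1) N M →
    ∃ (d m Y : ℕ) (η : ℝ), 0 < d ∧ (d : ℝ) ≤ Real.exp (Λ ^ B) ∧ 0 < m ∧ (m : ℝ) ≤ Real.exp (Λ ^ B) ∧
      N / d / M < Y ∧ |η| ≤ Λ ^ B / Y ∧
      1 / Λ ^ B * M * Y ^ (r + 1) ≤ ∑ v ∈ range M,
        ∑ k ∈ Fintype.piFinset (fun _ : Fin r => Ioo (-Y : ℤ) Y), ∑ i ∈ range m,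
          ‖∑ w ∈ Ico (0 : ℤ) Y, cubeDeriv r k (classFn (N / d) M v) (i + m * w) * ee (η * m * w)‖ := by
  obtain ⟨B₁, hB₁⟩ := exists_dilated_phase_correlation r
  obtain ⟨c, hc0, hc1, K, hcK⟩ := exists_major_arc_dilate r
  set E := 2 * B₁ * (2 ^ r * K) + 1 with hE
  set L : ℝ := 4 ^ (2 ^ r * K) / c with hL
  obtain ⟨B, hB⟩ := exists_nat_ge (max L (2 * B₁ + E + 3 * 2 ^ 2 ^ r + 10 + (E + 1).factorial * 4 ^ 2))
  have hBL : L ≤ B := (le_max_left _ _).trans hB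
  have hB2 : 2 * B₁ + E + 3 * 2 ^ 2 ^ r + 10 + (E + 1).factorial * 4 ^ 2 ≤ B := by
    have := (le_max_right _ _).trans hB
    exact_mod_cast this
  refine ⟨B, fun Λ hΛ N M hM hMΛ hN hen => ?_⟩
  have hfac : 1 ≤ (E + 1).factorial := Nat.factorial_pos _
  have hpow2 : 1 ≤ 2 ^ 2 ^ r := Nat.one_le_two_pow
  have hΛB : ((2 * B₁ + E + 3 * 2 ^ 2 ^ r + 10 + (E + 1).factorial * 4 ^ 2 : ℕ) : ℝ) ≤ Λ :=
    le_trans (by exact_mod_cast hB2) hΛ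
  push_cast at hΛB
  have hfac' : (1:ℝ) ≤ ((E + 1).factorial : ℝ) := by exact_mod_cast hfac
  have hp' : (1:ℝ) ≤ 2 ^ 2 ^ r := by exact_mod_cast hpow2
  have hB₁0 : (0:ℝ) ≤ B₁ := by positivity
  have hE0 : (0:ℝ) ≤ E := by positivity
  have hΛ10 : 10 ≤ Λ := by linarith
  have hΛ0 : 0 < Λ := by linarith
  have hΛ1 : 1 ≤ Λ := by linarith
  have hmono : ∀ n ≤ B, Λ ^ n ≤ Λ ^ B := fun n hn => pow_le_pow_right₀ hΛ1 hn
  have h2B₁ : (Λ ^ 2) ^ B₁ ≤ Λ ^ B := by rw [← pow_mul]; exact hmono _ (by omega)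
  obtain ⟨θ, co, D, hco, hD1, hD2, hcor⟩ := hB₁ (Λ ^ 2) (by nlinarith) N M hM
    ((Real.exp_le_exp.2 (Real.exp_le_exp.2 h2B₁)).trans hN) (by
      refine le_trans ?_ hen
      gcongr
      nlinarith)
  have hD0 : (0:ℝ) < D := lt_of_lt_of_le (Real.exp_pos _) hD1
  have hΛ2 : Λ + 2 ≤ Λ ^ 2 := by nlinarith
  have hD2' : 2 ≤ D := by
    have h1 := Real.add_one_le_exp (Λ ^ 2)
    have : (2:ℝ) ≤ D := by nlinarith
    exact_mod_cast this
  have hMD' : (M:ℝ) ≤ D := hMΛ.trans ((Real.exp_le_exp.2 (by linarith)).trans hD1)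
  have hMD : M ≤ D := by exact_mod_cast hMD'
  have hDM : D * M ≤ N := by
    have : (D * M : ℝ) ≤ N := by
      calc (D * M : ℝ) ≤ Real.exp ((Λ ^ 2) ^ B₁) * Real.exp Λ := by gcongr
        _ = Real.exp ((Λ ^ 2) ^ B₁ + Λ) := by rw [Real.exp_add]
        _ ≤ Real.exp (Real.exp (Λ ^ B)) := by
            refine Real.exp_le_exp.2 ?_
            have h1 := Real.add_one_le_exp (Λ ^ B / 2)
            have h2 : Real.exp (Λ ^ B) = Real.exp (Λ ^ B / 2) * Real.exp (Λ ^ B / 2) := by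
              rw [← Real.exp_add]; congr 1; ring
            have h3 : Λ ≤ Λ ^ B := by
              have := hmono 1 (by omega)
              simpa using this
            rw [h2]
            nlinarith
        _ ≤ N := hN
    exact_mod_cast this
  obtain ⟨Y, hY⟩ : ∃ Y, Y = N / (D * M) + 1 := ⟨_, rfl⟩
  have hcon := sum_box_ge_of_dilated_correlation r N M D (4 * (N / M + 1) + 1) Y hM (by omega) hDM hY _
    (fun b => norm_liftZ_le _ _ (norm_classFn_le N M b)) θ co hco (1 / (Λ ^ 2) ^ B₁) (by positivity) hcor
  set δ : ℝ := (1 / (Λ ^ 2) ^ B₁ / 4) ^ 2 ^ r with hδ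
  have hδ0 : 0 < δ := by positivity
  have hδ1 : δ ≤ 1 := by
    refine pow_le_one₀ (by positivity) ?_
    rw [div_div, div_le_one (by positivity)]
    have : 1 ≤ (Λ ^ 2) ^ B₁ := one_le_pow₀ (one_le_pow₀ hΛ1)
    linarith
  have hΛE : 1 / Λ ^ E ≤ c * δ ^ K := by
    have e1 : δ ^ K = 1 / (Λ ^ (2 * B₁ * (2 ^ r * K)) * 4 ^ (2 ^ r * K)) := by
      rw [hδ, ← pow_mul, div_div, div_pow, one_pow, mul_pow, ← pow_mul, ← pow_mul,
        mul_assoc 2 B₁]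
    rw [e1, hE, pow_succ, mul_one_div, div_le_div_iff₀ (by positivity) (by positivity), one_mul]
    have h4 : (4:ℝ) ^ (2 ^ r * K) ≤ c * Λ := by
      have := hBL.trans hΛ
      rw [hL, div_le_iff₀ hc0] at this
      linarith
    calc Λ ^ (2 * B₁ * (2 ^ r * K)) * 4 ^ (2 ^ r * K) ≤ Λ ^ (2 * B₁ * (2 ^ r * K)) * (c * Λ) := by gcongr
      _ = _ := by ring
  have hcδ0 : 0 < c * δ ^ K := by positivity
  have hexpΛ : Λ ^ E ≤ Real.exp Λ := by
    have h1 := Real.pow_div_factorial_le_exp Λ hΛ0.le (E + 1)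
    rw [div_le_iff₀ (by positivity)] at h1
    have h2 : ((E + 1).factorial : ℝ) ≤ Λ := by linarith
    have h3 : Λ ^ (E + 1) ≤ Real.exp Λ * Λ := h1.trans (by gcongr)
    rw [pow_succ] at h3
    exact le_of_mul_le_mul_right h3 hΛ0
  have hMτ : (M : ℝ) ≤ c * δ ^ K * D := by
    refine le_trans ?_ (mul_le_mul_of_nonneg_right hΛE hD0.le)
    rw [one_div, ← div_eq_inv_mul, le_div_iff₀ (by positivity)]
    calc M * Λ ^ E ≤ Real.exp Λ * Real.exp Λ := by gcongr
      _ = Real.exp (Λ + Λ) := (Real.exp_add _ _).symm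
      _ ≤ Real.exp (Λ ^ 2) := Real.exp_le_exp.2 (by nlinarith)
      _ ≤ D := hD1
  obtain ⟨d, m, η, hd1, hd2, hm0, hm, hη, hout⟩ := hcK N M D (4 * (N / M + 1) + 1) Y θ δ hM hMD hD2' hY hδ0 hδ1
    hMτ hcon
  have h2D : (2 * D : ℝ) ≤ Real.exp (Λ ^ (2 * B₁) + 1) := by
    rw [Real.exp_add, pow_mul]
    have := Real.exp_one_gt_d9
    calc (2 * D : ℝ) ≤ Real.exp 1 * Real.exp ((Λ ^ 2) ^ B₁) := by gcongr; linarith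
      _ = _ := by ring
  have hEB : Λ ^ E ≤ Λ ^ B := hmono _ (by omega)
  have hbig : 2 ^ 2 ^ r * (Λ ^ (2 * B₁) + 1) ≤ Λ ^ B := by
    have h1 : 1 ≤ Λ ^ (2 * B₁) := one_le_pow₀ hΛ1
    calc (2:ℝ) ^ 2 ^ r * (Λ ^ (2 * B₁) + 1) ≤ (2:ℝ) ^ 2 ^ r * (2 * Λ ^ (2 * B₁)) := by gcongr; linarith
      _ = (2 * 2 ^ 2 ^ r) * Λ ^ (2 * B₁) := by ring
      _ ≤ Λ * Λ ^ (2 * B₁) := by gcongr; linarith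
      _ = Λ ^ (2 * B₁ + 1) := by ring
      _ ≤ _ := hmono _ (by omega)
  refine ⟨d, m, Y, η, by omega, ?_, hm0, ?_, ?_, ?_, ?_⟩
  · have : (d:ℝ) ≤ 2 * D := by exact_mod_cast hd2
    refine this.trans (h2D.trans (Real.exp_le_exp.2 (le_trans ?_ hbig)))
    have h1 : 1 ≤ Λ ^ (2 * B₁) := one_le_pow₀ hΛ1
    nlinarith
  · calc (m:ℝ) ≤ (2 * D : ℝ) ^ 2 ^ 2 ^ r := by exact_mod_cast hm
      _ ≤ Real.exp (Λ ^ (2 * B₁) + 1) ^ 2 ^ 2 ^ r := by gcongr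
      _ = Real.exp ((2 ^ 2 ^ r : ℕ) * (Λ ^ (2 * B₁) + 1)) := (Real.exp_nat_mul _ _).symm
      _ ≤ _ := by push_cast; exact Real.exp_le_exp.2 hbig
  · rw [Nat.div_div_eq_div_mul, hY]
    have : N / (d * M) ≤ N / (D * M) := Nat.div_le_div_left (Nat.mul_le_mul_right M hd1.le) (by positivity)
    omega
  · refine hη.trans ?_
    gcongr
    rw [div_le_iff₀ hcδ0]
    have h1 : 1 ≤ Λ ^ E * (c * δ ^ K) := by
      have := mul_le_mul_of_nonneg_left hΛE (show 0 ≤ Λ ^ E by positivity)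
      rwa [mul_one_div, div_self (by positivity)] at this
    exact h1.trans (by gcongr)
  · refine le_trans ?_ hout
    gcongr
    refine le_trans ?_ hΛE
    gcongr

/-! ### From correlations along progressions back to Gowers energies -/

lemma sum_range_mul_eq {β : Type*} [AddCommMonoid β] (M m : ℕ) (hM : 0 < M) (f : ℕ → β) :
    ∑ b ∈ range (M * m), f b = ∑ v ∈ range M, ∑ i ∈ range m, f (v + M * i) := by
  rw [← sum_product']
  refine (sum_bij' (fun x _ => x.1 + M * x.2) (fun b _ => (b % M, b / M)) ?_ ?_ ?_ ?_ ?_).symm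
  · intro x hx
    simp only [mem_product, mem_range] at *
    calc x.1 + M * x.2 < M + M * x.2 := by omega
      _ = M * (x.2 + 1) := by ring
      _ ≤ M * m := Nat.mul_le_mul_left M hx.2
  · intro b hb
    simp only [mem_product, mem_range] at *
    exact ⟨Nat.mod_lt _ hM, Nat.div_lt_of_lt_mul hb⟩
  · intro x hx
    simp only [mem_product, mem_range] at hx
    ext
    · simp [Nat.mod_eq_of_lt hx.1]
    · simp [Nat.add_mul_div_left _ _ hM, Nat.div_eq_of_lt hx.1]
  · intro b _; exact Nat.mod_add_div b M
  · intro x _; rfl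

lemma classFn_mul (L M m v i : ℕ) (w : ℤ) : classFn L (M * m) (v + M * i) w = classFn L M v (i + m * w) := by
  simp only [classFn]; congr 1; push_cast; ring

lemma cubeDeriv_eq_zero_of_large_step (Y : ℕ) (f : ℤ → ℂ) (hf : ∀ w, w ∉ Ico (0 : ℤ) Y → f w = 0) (r : ℕ)
    (k : Fin r → ℤ) (j : Fin r) (hj : k j ∉ Ioo (-Y : ℤ) Y) (w : ℤ) : cubeDeriv r k f w = 0 := by
  induction r generalizing w with
  | zero => exact j.elim0
  | succ r ih =>
    simp only [cubeDeriv]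
    refine Fin.cases (fun hj => ?_) (fun j' hj => ?_) j hj
    · by_cases hw : w ∈ Ico (0 : ℤ) Y
      · rw [cubeDeriv_eq_zero r _ f (w + k 0) (hf _ ?_), map_zero, mul_zero]
        intro h
        refine hj ?_
        simp only [mem_Ico, mem_Ioo] at *
        omega
      · rw [cubeDeriv_eq_zero r _ f w (hf _ hw), zero_mul]
    · rw [ih (Fin.tail k) j' hj, zero_mul]

lemma cubeDeriv_mul_ee (η : ℝ) (f : ℤ → ℂ) (r : ℕ) (k : Fin (r + 1) → ℤ) :
    ∃ u : ℂ, ‖u‖ = 1 ∧ ∀ w, cubeDeriv (r + 1) k (fun w => f w * ee (η * w)) w = u * cubeDeriv (r + 1) k f w := by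
  induction r with
  | zero =>
    refine ⟨ee (-(η * k 0)), norm_ee _, fun w => ?_⟩
    simp only [cubeDeriv, map_mul, ← ee_neg]
    have : ee (-(η * k 0)) = ee (η * w) * ee (-(η * (w + k 0 : ℤ))) := by
      rw [← ee_add]; congr 1; push_cast; ring
    rw [this]; ring
  | succ r ih =>
    obtain ⟨u, hu, h⟩ := ih (Fin.tail k)
    refine ⟨u * conj u, by rw [norm_mul, RCLike.norm_conj, hu, one_mul], fun w => ?_⟩
    have e : ∀ g : ℤ → ℂ, cubeDeriv (r + 1 + 1) k g w = cubeDeriv (r + 1) (Fin.tail k) g w *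
        conj (cubeDeriv (r + 1) (Fin.tail k) g (w + k 0)) := fun _ => rfl
    rw [e, e, h, h, map_mul]; ring

lemma liftZ_intCast (X : ℕ) (f : ℤ → ℂ) (hf : ∀ w, w ∉ Ico (0 : ℤ) X → f w = 0) (w : ℤ)
    (hw : w ∈ Ico (-X : ℤ) (2 * X)) : liftZ (4 * X + 1) f (w : ZMod (4 * X + 1)) = f w := by
  rw [mem_Ico] at hw
  rw [liftZ, ZMod.val_intCast]
  rcases le_or_gt 0 w with h | h
  · rw [Int.emod_eq_of_lt h (by push_cast; omega)]
  · have : w % ((4 * X + 1 : ℕ) : ℤ) = w + (4 * X + 1 : ℕ) := by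
      rw [← Int.add_emod_right, Int.emod_eq_of_lt] <;> push_cast <;> omega
    rw [this, hf, hf]
    · rw [mem_Ico]; omega
    · rw [mem_Ico]; push_cast; omega

lemma cubeDeriv_liftZ (X : ℕ) (f : ℤ → ℂ) (hf : ∀ w, w ∉ Ico (0 : ℤ) X → f w = 0) (r : ℕ) (k : Fin r → ℤ)
    (hk : ∀ j, k j ∈ Ioo (-X : ℤ) X) (w : ℤ) (hw : w ∈ Ico (-X : ℤ) (2 * X)) :
    cubeDeriv r (fun j => (k j : ZMod (4 * X + 1))) (liftZ (4 * X + 1) f) (w : ZMod (4 * X + 1)) =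
      cubeDeriv r k f w := by
  induction r generalizing w with
  | zero => exact liftZ_intCast X f hf w hw
  | succ r ih =>
    have ih' := ih (Fin.tail k) (fun j => hk _)
    simp only [cubeDeriv]
    rw [show Fin.tail (fun j => (k j : ZMod (4 * X + 1))) = fun j => (Fin.tail k j : ZMod (4 * X + 1)) from rfl,
      ih' w hw]
    by_cases h : w ∈ Ico (0 : ℤ) X
    · have := ih' (w + k 0) (by
        have := hk 0
        simp only [mem_Ico, mem_Ioo] at *; omega)
      push_cast at this
      rw [this]
    · rw [cubeDeriv_eq_zero r _ f w (hf w h), zero_mul, zero_mul]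

lemma sum_box_le_sum_zmod (X : ℕ) (f : ℤ → ℂ) (hf : ∀ w, w ∉ Ico (0 : ℤ) X → f w = 0) (r : ℕ) :
    ∑ k ∈ Fintype.piFinset (fun _ : Fin r => Ioo (-X : ℤ) X), ‖∑ w ∈ Ico (0 : ℤ) X, cubeDeriv r k f w‖ ≤
      ∑ h : Fin r → ZMod (4 * X + 1), ‖∑ y, cubeDeriv r h (liftZ (4 * X + 1) f) y‖ := by
  have e : ∀ k ∈ Fintype.piFinset (fun _ : Fin r => Ioo (-X : ℤ) X),
      ‖∑ w ∈ Ico (0 : ℤ) X, cubeDeriv r k f w‖ =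
      ‖∑ y, cubeDeriv r (fun j => (k j : ZMod (4 * X + 1))) (liftZ (4 * X + 1) f) y‖ := by
    intro k hk
    rw [Fintype.mem_piFinset] at hk
    congr 1
    simp_rw [cubeDeriv_eq_mul_cubeTail r _ (liftZ (4 * X + 1) f)]
    rw [sum_zmod_lift (4 * X + 1) X (by omega) f hf]
    refine sum_congr rfl fun w hw => ?_
    rw [mem_Ico] at hw
    have hw' : w ∈ Ico (-X : ℤ) (2 * X) := by rw [mem_Ico]; omega
    rw [← liftZ_intCast X f hf w hw', ← cubeDeriv_eq_mul_cubeTail, cubeDeriv_liftZ X f hf r k hk w hw']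
  rw [sum_congr rfl e, ← sum_image (f := fun h => ‖∑ y, cubeDeriv r h (liftZ (4 * X + 1) f) y‖)
    (g := fun (k : Fin r → ℤ) j => (k j : ZMod (4 * X + 1)))]
  · exact sum_le_sum_of_subset_of_nonneg (subset_univ _) fun _ _ _ => norm_nonneg _
  · intro k hk k' hk' h
    simp only [Fintype.coe_piFinset, Set.mem_pi, Set.mem_univ, true_imp_iff, coe_Ioo, Set.mem_Ioo] at hk hk'
    funext j
    have h1 := congrFun h j
    simp only [ZMod.intCast_eq_intCast_iff] at h1
    have h2 := h1.dvd
    have := Int.eq_zero_of_abs_lt_dvd h2 (by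
      have a := hk j
      have b := hk' j
      rw [abs_lt]; push_cast; omega)
    omega

/-- The part of `cubeDeriv r (k₀ + m k') f (i + m w)` that is removable in `(w, k')`. -/
def stepTail (m Q : ℕ) (f : ℤ → ℂ) (i : ℤ) : (r : ℕ) → (Fin r → ℕ) → ℤ → (Fin r → ZMod Q) → ℂ
  | 0, _, _, _ => 1
  | r + 1, k₀, w, h => stepTail m Q f i r (Fin.tail k₀) w (Fin.tail h) *
      conj (cubeDeriv r (fun j => (Fin.tail k₀ j : ℤ) + m * (Fin.tail h j).valMinAbs) f
        (i + k₀ 0 + m * (h 0 + (w : ZMod Q)).valMinAbs))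

lemma removable_stepTail (m Q : ℕ) (f : ℤ → ℂ) (hf : ∀ w, ‖f w‖ ≤ 1) (i : ℤ) (r : ℕ) (k₀ : Fin r → ℕ) :
    Removable (1 : ZMod Q) r (stepTail m Q f i r k₀) := by
  induction r with
  | zero => intro w h; rfl
  | succ r ih =>
    refine ⟨_, fun y h => conj (cubeDeriv r (fun j => (Fin.tail k₀ j : ℤ) + m * (h j).valMinAbs) f
        (i + k₀ 0 + m * y.valMinAbs)), ih (Fin.tail k₀), ?_, ?_⟩
    · intro y h; rw [RCLike.norm_conj]; exact norm_cubeDeriv_le _ _ _ hf _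
    · intro w h₁ h
      simp [stepTail]

lemma cubeDeriv_eq_mul_stepTail (X m : ℕ) (f : ℤ → ℂ) (i : ℤ) (r : ℕ) (k₀ : Fin r → ℕ) (k : Fin r → ℤ)
    (hk : ∀ j, k j ∈ Ico (-X : ℤ) X) (w : ℤ) (hw : w ∈ Ico (0 : ℤ) X) :
    cubeDeriv r (fun j => (k₀ j : ℤ) + m * k j) f (i + m * w) =
      f (i + m * w) * stepTail m (4 * X + 1) f i r k₀ w (fun j => (k j : ZMod (4 * X + 1))) := by
  have hval : ∀ x : ℤ, x ∈ Ico (-X : ℤ) (2 * X) → ((x : ZMod (4 * X + 1))).valMinAbs = x := by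
    intro x hx
    rw [mem_Ico] at hx
    rw [ZMod.valMinAbs_spec]
    refine ⟨rfl, ?_⟩
    rw [Set.mem_Ioc]; push_cast; omega
  induction r with
  | zero => simp [cubeDeriv, stepTail]
  | succ r ih =>
    have ih' := ih (Fin.tail k₀) (Fin.tail k) (fun j => hk _)
    simp only [cubeDeriv, stepTail]
    have e1 : Fin.tail (fun j => (k₀ j : ℤ) + m * k j) = fun j => (Fin.tail k₀ j : ℤ) + m * Fin.tail k j := rfl
    have e2 : Fin.tail (fun j => (k j : ZMod (4 * X + 1))) = fun j => (Fin.tail k j : ZMod (4 * X + 1)) := rfl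
    rw [e1, e2, ih', mul_assoc]
    congr 3
    have e3 : ((k 0 : ZMod (4 * X + 1)) + (w : ZMod (4 * X + 1))) = ((k 0 + w : ℤ) : ZMod (4 * X + 1)) := by push_cast; rfl
    rw [e3, hval _ (by
      have := hk 0
      simp only [mem_Ico] at *; omega)]
    congr 1
    · funext j
      have := hk j.succ
      rw [hval _ (by simp only [mem_Ico, Fin.tail] at *; omega)]
    · ring

/-- Elimination of the steps `k'` for a fixed residue `k₀` of the steps. -/
lemma stepTail_elimination (X m : ℕ) (f : ℤ → ℂ) (hf : ∀ w, ‖f w‖ ≤ 1) (i : ℕ)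
    (hfi : ∀ w : ℤ, w ∉ Ico (0 : ℤ) X → f (i + m * w) = 0) (s : ℕ) (hs : 0 < s) (k₀ : Fin s → ℕ) (η : ℝ) :
    (∑ k ∈ Fintype.piFinset (fun _ : Fin s => Ico (-X : ℤ) X),
      ‖∑ w ∈ Ico (0 : ℤ) X, cubeDeriv s (fun j => (k₀ j : ℤ) + m * k j) f (i + m * w) * ee (η * w)‖) ^ 2 ^ s *
        X ^ (s + 1) ≤
      2 ^ 2 ^ s * (X * (4 * X + 1) ^ s) ^ 2 ^ s *
        ∑ h : Fin s → ZMod (4 * X + 1), ‖∑ y, cubeDeriv s h (liftZ (4 * X + 1) (fun w => f (i + m * w))) y‖ := by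
  set Q := 4 * X + 1 with hQ
  set B := stepTail m Q f i s k₀ with hB
  set F : ℤ → ℂ := fun w => f (i + m * w) * ee (η * w) with hF
  set K := Fintype.piFinset (fun _ : Fin s => Ico (-X : ℤ) X) with hK
  set A : (Fin s → ℤ) → ℂ := fun k => ∑ w ∈ Ico (0 : ℤ) X, F w * B w (fun j => (k j : ZMod Q)) with hA
  have hAeq : ∀ k ∈ K, ∑ w ∈ Ico (0 : ℤ) X, cubeDeriv s (fun j => (k₀ j : ℤ) + m * k j) f (i + m * w) * ee (η * w) =
      A k := by
    intro k hk
    rw [hK, Fintype.mem_piFinset] at hk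
    refine sum_congr rfl fun w hw => ?_
    rw [cubeDeriv_eq_mul_stepTail X m f i s k₀ k hk w hw]
    simp only [hF, hB]; ring
  choose u hu1 hu using fun k => exists_unimodular (A k)
  have hinj : Set.InjOn (fun (k : Fin s → ℤ) j => (k j : ZMod Q)) K := by
    intro k hk k' hk' h
    simp only [hK, Fintype.coe_piFinset, Set.mem_pi, Set.mem_univ, true_imp_iff, coe_Ico, Set.mem_Ico] at hk hk'
    funext j
    have h1 := congrFun h j
    simp only [ZMod.intCast_eq_intCast_iff] at h1
    have := Int.eq_zero_of_abs_lt_dvd h1.dvd (by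
      have a := hk j
      have b := hk' j
      rw [abs_lt, hQ]; push_cast; omega)
    omega
  let Φ : (Fin s → ZMod Q) → ℂ := fun h => if h ∈ K.image (fun (k : Fin s → ℤ) j => (k j : ZMod Q)) then
    u (fun j => (h j).valMinAbs) else 0
  have hΦ : ∀ h, ‖Φ h‖ ≤ 1 := by
    intro h; simp only [Φ]; split_ifs
    · rw [hu1]
    · simp
  have hΦk : ∀ k ∈ K, Φ (fun j => (k j : ZMod Q)) = u k := by
    intro k hk
    simp only [Φ]
    rw [if_pos (mem_image_of_mem _ hk)]
    congr 1
    funext j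
    rw [hK, Fintype.mem_piFinset] at hk
    have := hk j
    rw [mem_Ico] at this
    rw [ZMod.valMinAbs_spec]
    refine ⟨rfl, ?_⟩
    rw [Set.mem_Ioc, hQ]; push_cast; omega
  have hsum : ∑ w ∈ Ico (0 : ℤ) X, ∑ h, F w * Φ h * ee ((0:ℤ) * w * (0:ℝ)) * B w h =
      ((∑ k ∈ K, ‖A k‖ : ℝ) : ℂ) := by
    rw [sum_comm]
    rw [Complex.ofReal_sum]
    have : ∀ h, h ∉ K.image (fun (k : Fin s → ℤ) j => (k j : ZMod Q)) →
        ∑ w ∈ Ico (0 : ℤ) X, F w * Φ h * ee ((0:ℤ) * w * (0:ℝ)) * B w h = 0 := by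
      intro h hh
      refine sum_eq_zero fun w _ => ?_
      simp only [Φ, if_neg hh]; ring
    rw [← sum_subset (subset_univ _) (fun h _ hh => this h hh), sum_image hinj]
    refine sum_congr rfl fun k hk => ?_
    rw [hΦk k hk, ← hu k, hA, mul_sum]
    refine sum_congr rfl fun w _ => ?_
    simp only [mul_zero, ee_zero]; ring
  have helim := removable_elimination (1 : ZMod Q) 0 X s F (fun w hw => by simp only [hF, hfi w hw, zero_mul]) Φ hΦ
    (fun _ => 0) B (removable_stepTail m Q f hf i s k₀)
  rw [hsum, Complex.norm_real, Real.norm_of_nonneg (sum_nonneg fun _ _ => norm_nonneg _), ZMod.card] at helim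
  simp only [Int.cast_zero, zero_mul, ee_zero, mul_one, sum_const, card_univ, nsmul_eq_mul] at helim
  rw [Fintype.card_fun, ZMod.card, Fintype.card_fin] at helim
  have hbox : ∑ k ∈ Fintype.piFinset (fun _ : Fin s => Ioo (-X : ℤ) X), ((Q ^ s : ℕ) : ℝ) *
      ‖∑ w ∈ Ico (0 : ℤ) X, cubeDeriv s k F w‖ ≤ (Q : ℝ) ^ s *
        ∑ h : Fin s → ZMod Q, ‖∑ y, cubeDeriv s h (liftZ Q (fun w => f (i + m * w))) y‖ := by
    rw [← mul_sum]
    push_cast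
    gcongr
    refine le_trans (le_of_eq (sum_congr rfl fun k _ => ?_)) (sum_box_le_sum_zmod X _ hfi s)
    obtain ⟨r, rfl⟩ : ∃ r, s = r + 1 := ⟨s - 1, by omega⟩
    obtain ⟨v, hv1, hv⟩ := cubeDeriv_mul_ee η (fun w => f (i + m * w)) r k
    rw [hF, sum_congr rfl fun w _ => hv w, ← mul_sum, norm_mul, hv1, one_mul]
  have hQ0 : (0:ℝ) < Q := by rw [hQ]; positivity
  rw [sum_congr rfl fun k hk => by rw [hAeq k hk]]
  have h3 := helim.trans (mul_le_mul_of_nonneg_left hbox (by positivity))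
  have h4 : (Q:ℝ) ^ s * ((∑ k ∈ K, ‖A k‖) ^ 2 ^ s * X ^ (s + 1)) ≤ (Q:ℝ) ^ s * (2 ^ 2 ^ s * (X * (4 * X + 1) ^ s) ^ 2 ^ s *
        ∑ h : Fin s → ZMod Q, ‖∑ y, cubeDeriv s h (liftZ Q (fun w => f (i + m * w))) y‖) := by
    have e : (4 * X + 1 : ℝ) = Q := by rw [hQ]; push_cast; ring
    rw [e]
    refine le_trans (le_of_eq ?_) (h3.trans (le_of_eq (by ring)))
    rw [mul_pow (Q:ℝ)]; ring
  exact le_of_mul_le_mul_left h4 (by positivity)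

lemma sum_box_le_sum_residues (r m X Y : ℕ) (hm : 0 < m) (hYX : Y ≤ m * X) (φ : (Fin r → ℤ) → ℝ)
    (hφ : ∀ k, 0 ≤ φ k) :
    ∑ k ∈ Fintype.piFinset (fun _ : Fin r => Ioo (-Y : ℤ) Y), φ k ≤
      ∑ k₀ ∈ Fintype.piFinset (fun _ : Fin r => range m), ∑ k ∈ Fintype.piFinset (fun _ : Fin r => Ico (-X : ℤ) X),
        φ (fun j => (k₀ j : ℤ) + m * k j) := by
  have hm' : (0:ℤ) < m := by exact_mod_cast hm
  have hYX' : (Y:ℤ) ≤ m * X := by exact_mod_cast hYX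
  rw [← sum_product']
  have e : ∀ x : ℤ, (((x % m).toNat : ℕ) : ℤ) + m * (x / m) = x := by
    intro x
    rw [Int.toNat_of_nonneg (Int.emod_nonneg _ hm'.ne')]; exact Int.emod_add_mul_ediv x m
  have e1 : ∀ k ∈ Fintype.piFinset (fun _ : Fin r => Ioo (-Y : ℤ) Y), φ k =
      (fun x : (Fin r → ℕ) × (Fin r → ℤ) => φ fun j => (x.1 j : ℤ) + m * x.2 j)
        ((fun j => (k j % m).toNat, fun j => k j / m)) := by
    intro k _
    simp only [e]
  rw [sum_congr rfl e1, ← sum_image (f := fun x : (Fin r → ℕ) × (Fin r → ℤ) => φ fun j => (x.1 j : ℤ) + m * x.2 j)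
    (g := fun k : Fin r → ℤ => ((fun j => (k j % m).toNat, fun j => k j / m) : (Fin r → ℕ) × (Fin r → ℤ)))]
  · refine sum_le_sum_of_subset_of_nonneg ?_ fun _ _ _ => hφ _
    intro x hx
    rw [mem_image] at hx
    obtain ⟨k, hk, rfl⟩ := hx
    rw [Fintype.mem_piFinset] at hk
    rw [mem_product, Fintype.mem_piFinset, Fintype.mem_piFinset]
    constructor
    · intro j
      rw [mem_range]
      have := Int.emod_lt_of_pos (k j) hm'
      have := Int.emod_nonneg (k j) hm'.ne'
      simp only; omega
    · intro j
      have h1 := hk j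
      rw [mem_Ioo] at h1
      rw [mem_Ico]
      constructor
      · rw [Int.le_ediv_iff_mul_le hm', neg_mul, mul_comm]; omega
      · rw [Int.ediv_lt_iff_lt_mul hm', mul_comm]; omega
  · intro k _ k' _ h
    funext j
    rw [← e (k j), ← e (k' j)]
    have h1 := congrFun (congrArg Prod.fst h) j
    have h2 := congrFun (congrArg Prod.snd h) j
    simp only at h1 h2
    rw [h1, h2]

/-- Correlations along progressions of modulus `m` inside the classes modulo `M` force a large
energy on the classes modulo `M m`. -/
theorem classEnergy_ge_of_progressions (r L M m Y : ℕ) (hr : 0 < r) (hM : 0 < M) (hm : 0 < m) (hMm : M * m ≤ L)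
    (hY : L / M < Y) (η δ : ℝ) (hδ : 0 ≤ δ)
    (h : δ * M * Y ^ (r + 1) ≤ ∑ v ∈ range M,
        ∑ k ∈ Fintype.piFinset (fun _ : Fin r => Ioo (-Y : ℤ) Y), ∑ i ∈ range m,
          ‖∑ w ∈ Ico (0 : ℤ) Y, cubeDeriv r k (classFn L M v) (i + m * w) * ee (η * m * w)‖) :
    (δ / (2 ^ (r + 2) * 5 ^ r)) ^ (2 * 2 ^ r) / 5 ^ r * (M * m) * (L / (M * m) + 1 : ℕ) ^ (r + 2) ≤
      classEnergy r L (M * m) := by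
  obtain ⟨X, hX⟩ : ∃ X, X = L / (M * m) + 1 := ⟨_, rfl⟩
  have hMm0 : 0 < M * m := Nat.mul_pos hM hm
  have hM0 : (0:ℝ) < M := by exact_mod_cast hM
  have hm0 : (0:ℝ) < m := by exact_mod_cast hm
  have hX1 : 1 ≤ X := by rw [hX]; exact Nat.le_add_left _ _
  have hX0 : (0:ℝ) < X := by exact_mod_cast hX1
  have hdiv : L / (M * m) = L / M / m := (Nat.div_div_eq_div_mul _ _ _).symm
  have hmL : m ≤ L / M := (Nat.le_div_iff_mul_le hM).2 (by rwa [mul_comm])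
  have hmX : m * X ≤ 2 * Y := by
    rw [hX, hdiv, mul_add]
    have := Nat.mul_div_le (L / M) m
    omega
  have hY₀X : L / M + 1 ≤ m * X := by
    rw [hX, hdiv]
    exact Nat.lt_mul_div_succ (L / M) hm
  have hXY : X ≤ Y := by
    rw [hX, hdiv]
    have := Nat.div_le_self (L / M) m
    omega
  have hsupp : ∀ v < M, ∀ i < m, ∀ w : ℤ, w ∉ Ico (0 : ℤ) X → classFn L M v (i + m * w) = 0 := by
    intro v hv i hi w hw
    rw [← classFn_mul]
    refine classFn_support L (M * m) (v + M * i) ?_ w (by rwa [← hX])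
    calc v + M * i < M + M * i := by omega
      _ = M * (i + 1) := by ring
      _ ≤ M * m := Nat.mul_le_mul_left M hi
  set W : ℕ → ℕ → ℝ := fun v i => ∑ h : Fin r → ZMod (4 * X + 1),
    ‖∑ y, cubeDeriv r h (liftZ (4 * X + 1) (fun w => classFn L M v (i + m * w))) y‖ with hW
  set E : ℕ → ℕ → (Fin r → ℕ) → ℝ := fun v i k₀ => ∑ k ∈ Fintype.piFinset (fun _ : Fin r => Ico (-X : ℤ) X),
      ‖∑ w ∈ Ico (0 : ℤ) X, cubeDeriv r (fun j => (k₀ j : ℤ) + m * k j) (classFn L M v) (i + m * w) * ee (η * m * w)‖ with hE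
  have hE0 : ∀ v i k₀, 0 ≤ E v i k₀ := fun _ _ _ => sum_nonneg fun _ _ => norm_nonneg _
  set Z := range M ×ˢ range m ×ˢ Fintype.piFinset (fun _ : Fin r => range m) with hZ
  have hZcard : (Z.card : ℝ) = M * m ^ (r + 1) := by
    rw [hZ, card_product, card_product, Fintype.card_piFinset]
    simp only [card_range, prod_const, card_univ, Fintype.card_fin]
    push_cast; ring
  have hS : δ * M * Y ^ (r + 1) ≤ ∑ x ∈ Z, E x.1 x.2.1 x.2.2 := by
    refine h.trans ?_
    rw [hZ, sum_product]
    refine sum_le_sum fun v hv => ?_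
    rw [sum_comm, sum_product]
    refine sum_le_sum fun i hi => ?_
    rw [mem_range] at hv hi
    have e1 : ∑ k ∈ Fintype.piFinset (fun _ : Fin r => Ioo (-Y : ℤ) Y),
        ‖∑ w ∈ Ico (0 : ℤ) Y, cubeDeriv r k (classFn L M v) (i + m * w) * ee (η * m * w)‖ =
        ∑ k ∈ Fintype.piFinset (fun _ : Fin r => Ioo (-(L / M + 1 : ℕ) : ℤ) (L / M + 1 : ℕ)),
        ‖∑ w ∈ Ico (0 : ℤ) X, cubeDeriv r k (classFn L M v) (i + m * w) * ee (η * m * w)‖ := by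
      have e2 : ∀ k, ∑ w ∈ Ico (0 : ℤ) Y, cubeDeriv r k (classFn L M v) (i + m * w) * ee (η * m * w) =
          ∑ w ∈ Ico (0 : ℤ) X, cubeDeriv r k (classFn L M v) (i + m * w) * ee (η * m * w) := by
        intro k
        symm
        refine sum_subset (Ico_subset_Ico_right (by exact_mod_cast hXY)) fun w _ hw => ?_
        rw [cubeDeriv_eq_zero _ _ _ _ (hsupp v hv i hi w hw), zero_mul]
      simp only [e2]
      symm
      refine sum_subset ?_ ?_
      · intro k hk
        rw [Fintype.mem_piFinset] at hk ⊢
        intro j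
        have := hk j
        rw [mem_Ioo] at this ⊢
        have hc : ((L / M + 1 : ℕ) : ℤ) ≤ Y := by exact_mod_cast hY
        omega
      · intro k _ hk
        rw [Fintype.mem_piFinset] at hk
        push Not at hk
        obtain ⟨j, hj⟩ := hk
        rw [norm_eq_zero]
        refine sum_eq_zero fun w _ => ?_
        rw [cubeDeriv_eq_zero_of_large_step _ _ (fun w hw => classFn_support L M v hv w hw) r k j hj, zero_mul]
    rw [e1]
    exact sum_box_le_sum_residues r m X (L / M + 1) hm hY₀X
      (fun k => ‖∑ w ∈ Ico (0 : ℤ) X, cubeDeriv r k (classFn L M v) (i + m * w) * ee (η * m * w)‖)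
      fun _ => norm_nonneg _
  have helim : ∀ x ∈ Z, E x.1 x.2.1 x.2.2 ^ 2 ^ r * X ^ (r + 1) ≤
      2 ^ 2 ^ r * (X * (4 * X + 1) ^ r) ^ 2 ^ r * W x.1 x.2.1 := by
    intro x hx
    rw [hZ, mem_product, mem_product, mem_range, mem_range] at hx
    exact stepTail_elimination X m (classFn L M x.1) (norm_classFn_le _ _ _) x.2.1
      (hsupp x.1 hx.1 x.2.1 hx.2.1) r hr x.2.2 (η * m)
  set V := ∑ v ∈ range M, ∑ i ∈ range m, W v i with hV
  have hV0 : 0 ≤ V := sum_nonneg fun _ _ => sum_nonneg fun _ _ => sum_nonneg fun _ _ => norm_nonneg _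
  have hsumW : ∑ x ∈ Z, W x.1 x.2.1 = m ^ r * V := by
    rw [hZ, sum_product, hV, mul_sum]
    refine sum_congr rfl fun v _ => ?_
    rw [sum_product, mul_sum]
    refine sum_congr rfl fun i _ => ?_
    simp only [sum_const, Fintype.card_piFinset, nsmul_eq_mul]
    simp
  obtain ⟨q, hq⟩ : ∃ q, 2 ^ r = q + 1 := ⟨2 ^ r - 1, by have := Nat.one_le_two_pow (n := r); omega⟩
  have hpm := sum_pow_le_card_pow_mul Z (fun x => E x.1 x.2.1 x.2.2) (fun x _ => hE0 _ _ _) q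
  rw [hZcard, ← hq] at hpm
  set G : ℝ := X * (4 * X + 1) ^ r with hG
  have hG0 : 0 < G := by positivity
  have h1 : (δ * M * Y ^ (r + 1)) ^ 2 ^ r * X ^ (r + 1) ≤
      (M * m ^ (r + 1) : ℝ) ^ q * (2 ^ 2 ^ r * G ^ 2 ^ r * (m ^ r * V)) := by
    calc (δ * M * Y ^ (r + 1)) ^ 2 ^ r * X ^ (r + 1) ≤
        ((M * m ^ (r + 1) : ℝ) ^ q * ∑ x ∈ Z, E x.1 x.2.1 x.2.2 ^ 2 ^ r) * X ^ (r + 1) := by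
          refine mul_le_mul_of_nonneg_right (le_trans ?_ hpm) (by positivity)
          gcongr
      _ = (M * m ^ (r + 1) : ℝ) ^ q * ∑ x ∈ Z, E x.1 x.2.1 x.2.2 ^ 2 ^ r * X ^ (r + 1) := by
          rw [mul_assoc, sum_mul]
      _ ≤ (M * m ^ (r + 1) : ℝ) ^ q * ∑ x ∈ Z, 2 ^ 2 ^ r * G ^ 2 ^ r * W x.1 x.2.1 := by
          exact mul_le_mul_of_nonneg_left (sum_le_sum fun x hx => helim x hx) (by positivity)
      _ = _ := by rw [← mul_sum, hsumW]
  set δ' : ℝ := δ / (2 ^ (r + 2) * 5 ^ r) with hδ'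
  have hδ'0 : 0 ≤ δ' := by positivity
  have hGle : G ≤ 5 ^ r * X ^ (r + 1) := by
    have : (4 * X + 1 : ℝ) ≤ 5 * X := by
      have : (1:ℝ) ≤ X := by exact_mod_cast hX1
      linarith
    calc G ≤ X * (5 * X) ^ r := by rw [hG]; gcongr
      _ = _ := by rw [mul_pow]; ring
  have hlow : δ' * (M * m ^ (r + 1)) * (2 * G) ≤ δ * M * Y ^ (r + 1) := by
    have hmXY : (m * X : ℝ) / 2 ≤ Y := by
      have : (m * X : ℝ) ≤ 2 * Y := by exact_mod_cast hmX
      linarith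
    calc δ' * (M * m ^ (r + 1)) * (2 * G) ≤ δ' * (M * m ^ (r + 1)) * (2 * (5 ^ r * X ^ (r + 1))) := by gcongr
      _ = δ * M * ((m * X : ℝ) / 2) ^ (r + 1) := by
          rw [hδ', div_pow, mul_pow, pow_succ (2:ℝ) (r + 1)]; field_simp
      _ ≤ _ := by gcongr
  have h2 : δ' ^ 2 ^ r * (M * m) * X ^ (r + 1) ≤ V := by
    have h3 : (δ' * (M * m ^ (r + 1)) * (2 * G)) ^ 2 ^ r * X ^ (r + 1) ≤
        (M * m ^ (r + 1) : ℝ) ^ q * (2 ^ 2 ^ r * G ^ 2 ^ r * (m ^ r * V)) := by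
      refine le_trans ?_ h1
      gcongr
    have hpos : (0:ℝ) < (M * m ^ (r + 1) : ℝ) ^ q * (2 ^ 2 ^ r * G ^ 2 ^ r * m ^ r) := by positivity
    refine le_of_mul_le_mul_left (le_trans (le_of_eq ?_) (h3.trans (le_of_eq (by ring)))) hpos
    rw [mul_pow _ (2 * G), mul_pow 2 G, mul_pow δ', hq, pow_succ ((M:ℝ) * m ^ (r + 1)) q, pow_succ (m:ℝ) r]
    ring
  have hVen : V ^ 2 ≤ (M * m) * (4 * X + 1) ^ r * classEnergy r L (M * m) := by
    have e1 : V = ∑ b ∈ range (M * m), ∑ h : Fin r → ZMod (4 * (L / (M * m) + 1) + 1),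
        ‖∑ y, cubeDeriv r h (liftZ _ (classFn L (M * m) b)) y‖ := by
      subst hX
      rw [sum_range_mul_eq M m hM, hV]
      refine sum_congr rfl fun v _ => sum_congr rfl fun i _ => ?_
      have : classFn L (M * m) (v + M * i) = fun w => classFn L M v (i + m * w) := by
        funext w; exact classFn_mul _ _ _ _ _ _
      rw [this]
    rw [e1, classEnergy, ← sum_product', ← sum_product']
    refine sq_sum_le_card_mul_sum_sq.trans (le_of_eq ?_)
    rw [card_product, card_range, card_univ, Fintype.card_fun, ZMod.card, Fintype.card_fin, hX]
    push_cast; ring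
  rw [← hX]
  have h5 : (4 * X + 1 : ℝ) ^ r ≤ 5 ^ r * X ^ r := by
    rw [← mul_pow]; gcongr
    have : (1:ℝ) ≤ X := by exact_mod_cast hX1
    linarith
  have hen0 : 0 ≤ classEnergy r L (M * m) := sum_nonneg fun _ _ => sum_nonneg fun _ _ => by positivity
  have h6 : (δ' ^ 2 ^ r * (M * m) * X ^ (r + 1)) ^ 2 ≤ (M * m) * (5 ^ r * X ^ r) * classEnergy r L (M * m) :=
    calc _ ≤ V ^ 2 := by gcongr
      _ ≤ _ := hVen
      _ ≤ _ := by gcongr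
  have hpos : (0:ℝ) < (M * m) * (5 ^ r * X ^ r) := by positivity
  refine le_of_mul_le_mul_left (le_trans (le_of_eq ?_) h6) hpos
  rw [mul_pow, mul_pow, ← pow_mul δ', mul_comm (2 ^ r) 2]
  have : (X:ℝ) ^ (r + 2) * X ^ r = (X ^ (r + 1)) ^ 2 := by rw [← pow_add, ← pow_mul]; congr 1; ring
  rw [← this]
  field_simp

/-! ### Upper bounds for Dirichlet `L`-series near the line `re s = 1` -/

/-- The mean value of a Dirichlet character, i.e. the residue of its `L`-series at `1`. -/
def charMean {q : ℕ} [NeZero q] (χ : DirichletCharacter ℂ q) : ℂ := (∑ a : ZMod q, χ a) / q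

lemma sum_range_zmod_eq {q : ℕ} [NeZero q] (f : ZMod q → ℂ) : ∑ k ∈ range q, f k = ∑ a, f a := by
  obtain ⟨n, rfl⟩ : ∃ n, q = n + 1 := ⟨q - 1, by have := NeZero.pos q; omega⟩
  rw [← Fin.sum_univ_eq_sum_range (fun k : ℕ => f (k : ZMod (n + 1)))]
  refine Fintype.sum_congr _ _ fun a => ?_
  congr 1
  exact ZMod.natCast_zmod_val (n := n + 1) a

lemma norm_charMean_le {q : ℕ} [NeZero q] (χ : DirichletCharacter ℂ q) : ‖charMean χ‖ ≤ 1 := by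
  rw [charMean, norm_div, Complex.norm_natCast]
  have hq : (0:ℝ) < q := by exact_mod_cast NeZero.pos q
  rw [div_le_one hq]
  refine (norm_sum_le _ _).trans ((sum_le_sum fun a _ => χ.norm_le_one a).trans ?_)
  simp [ZMod.card]

/-- The partial sums of a Dirichlet character, compensated by their main term. -/
def charRem {q : ℕ} [NeZero q] (χ : DirichletCharacter ℂ q) (t : ℝ) : ℂ :=
  ∑ k ∈ Icc 1 ⌊t⌋₊, χ k - charMean χ * t

lemma norm_charRem_le {q : ℕ} [NeZero q] (χ : DirichletCharacter ℂ q) {t : ℝ} (ht : 0 ≤ t) :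
    ‖charRem χ t‖ ≤ 3 * q := by
  have hq : 1 ≤ q := NeZero.pos q
  have hq' : (1:ℝ) ≤ q := by exact_mod_cast hq
  have hper : ∑ k ∈ range q, χ ((k + 1 : ℕ) : ZMod q) = charMean χ * q := by
    have : (q : ℂ) ≠ 0 := by exact_mod_cast NeZero.ne q
    rw [charMean, div_mul_cancel₀ _ this]
    simp only [Nat.cast_add, Nat.cast_one]
    rw [sum_range_zmod_eq (fun a => χ (a + 1))]
    exact Equiv.sum_comp (Equiv.addRight (1 : ZMod q)) χ
  have key : ∀ n : ℕ, ‖∑ k ∈ range n, χ ((k + 1 : ℕ) : ZMod q) - charMean χ * n‖ ≤ 2 * q := by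
    intro n
    induction n using Nat.strong_induction_on with
    | _ n ih =>
      rcases lt_or_ge n q with h | h
      · have h1 : ‖∑ k ∈ range n, χ ((k + 1 : ℕ) : ZMod q)‖ ≤ n :=
          (norm_sum_le _ _).trans ((sum_le_sum fun a _ => χ.norm_le_one _).trans (by simp))
        have h2 : ‖charMean χ * n‖ ≤ n := by
          rw [norm_mul, Complex.norm_natCast]
          exact mul_le_of_le_one_left (by positivity) (norm_charMean_le χ)
        have h3 : (n:ℝ) ≤ q := by exact_mod_cast h.le
        exact (norm_sub_le _ _).trans (by linarith)
      · obtain ⟨m, rfl⟩ := Nat.exists_eq_add_of_le h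
        rw [sum_range_add, hper]
        have e : ∀ k ∈ range m, χ ((q + k + 1 : ℕ) : ZMod q) = χ ((k + 1 : ℕ) : ZMod q) := by
          intro k _
          congr 1
          push_cast
          simp
        rw [sum_congr rfl e]
        refine le_trans (le_of_eq ?_) (ih m (by omega))
        congr 1
        push_cast
        ring
  have h1 := key ⌊t⌋₊
  rw [charRem, range_eq_Ico, sum_Ico_add' (fun k : ℕ => χ (k : ZMod q)) 0 ⌊t⌋₊ 1] at *
  have e : Ico (0 + 1) (⌊t⌋₊ + 1) = Icc 1 ⌊t⌋₊ := by ext x; simp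
  rw [e] at h1
  have h2 : ‖charMean χ * (⌊t⌋₊ : ℂ) - charMean χ * t‖ ≤ 1 := by
    rw [← mul_sub, norm_mul]
    refine mul_le_one₀ (norm_charMean_le χ) (norm_nonneg _) ?_
    have : ((⌊t⌋₊ : ℂ) - t) = ((⌊t⌋₊ - t : ℝ) : ℂ) := by push_cast; ring
    rw [this, Complex.norm_real, Real.norm_eq_abs, abs_le]
    have := Nat.floor_le ht
    have := Nat.lt_floor_add_one t
    constructor <;> linarith
  calc _ = ‖(∑ k ∈ Icc 1 ⌊t⌋₊, χ (k : ZMod q) - charMean χ * (⌊t⌋₊ : ℂ)) + (charMean χ * (⌊t⌋₊ : ℂ) - charMean χ * t)‖ := by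
        congr 1; ring
    _ ≤ 2 * q + 1 := (norm_add_le _ _).trans (add_le_add h1 h2)
    _ ≤ _ := by linarith

/-- The regular part of the `L`-series of a Dirichlet character at `1`. -/
def charReg {q : ℕ} [NeZero q] (χ : DirichletCharacter ℂ q) (s : ℂ) : ℂ :=
  charMean χ + s * ∫ t in Set.Ioi (1 : ℝ), charRem χ t * (t : ℂ) ^ (-(s + 1))

lemma measurable_charRem {q : ℕ} [NeZero q] (χ : DirichletCharacter ℂ q) : Measurable (charRem χ) := by
  refine Measurable.sub ?_ (by fun_prop)
  exact (measurable_from_nat (f := fun n : ℕ => ∑ k ∈ Icc 1 n, χ (k : ZMod q))).comp Nat.measurable_floor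

lemma integrableOn_charRem {q : ℕ} [NeZero q] (χ : DirichletCharacter ℂ q) {s : ℂ} (hs : 0 < s.re) :
    MeasureTheory.IntegrableOn (fun t : ℝ => charRem χ t * (t : ℂ) ^ (-(s + 1))) (Set.Ioi 1) := by
  have h1 : MeasureTheory.IntegrableOn (fun t : ℝ => (t : ℂ) ^ (-(s + 1))) (Set.Ioi 1) :=
    integrableOn_Ioi_cpow_of_lt (by simp; linarith) zero_lt_one
  refine MeasureTheory.Integrable.bdd_mul (c := 3 * q) h1 (measurable_charRem χ).aestronglyMeasurable ?_
  filter_upwards [MeasureTheory.ae_restrict_mem measurableSet_Ioi] with t ht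
  exact norm_charRem_le χ (zero_le_one.trans (le_of_lt ht))

lemma LSeries_eq_charReg {q : ℕ} [NeZero q] (χ : DirichletCharacter ℂ q) {s : ℂ} (hs : 1 < s.re) :
    LSeries (fun n => χ n) s = charMean χ / (s - 1) + charReg χ s := by
  have hs1 : s - 1 ≠ 0 := by
    intro h
    have := congrArg Complex.re h
    simp at this; linarith
  have hO : (fun n : ℕ => ∑ k ∈ Icc 1 n, ‖χ (k : ZMod q)‖) =O[Filter.atTop] fun n => (n : ℝ) ^ (1 : ℝ) := by
    refine Asymptotics.IsBigO.of_bound 1 (Filter.Eventually.of_forall fun n => ?_)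
    rw [one_mul, Real.rpow_one, Real.norm_of_nonneg (by positivity), Real.norm_of_nonneg (by positivity)]
    exact (sum_le_sum fun a _ => χ.norm_le_one _).trans (by simp)
  rw [LSeries_eq_mul_integral' (fun n => χ n) zero_le_one hs hO, charReg]
  have h1 : ∫ t in Set.Ioi (1 : ℝ), (∑ k ∈ Icc 1 ⌊t⌋₊, χ (k : ZMod q)) * (t : ℂ) ^ (-(s + 1)) =
      (∫ t in Set.Ioi (1 : ℝ), charRem χ t * (t : ℂ) ^ (-(s + 1))) +
        ∫ t in Set.Ioi (1 : ℝ), charMean χ * (t : ℂ) ^ (-s) := by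
    rw [← MeasureTheory.integral_add (integrableOn_charRem χ (by linarith))
      ((integrableOn_Ioi_cpow_of_lt (by simpa using hs) zero_lt_one).const_mul _)]
    refine MeasureTheory.setIntegral_congr_fun measurableSet_Ioi fun t ht => ?_
    have ht0 : (t : ℂ) ≠ 0 := by
      rw [Complex.ofReal_ne_zero]; exact (zero_lt_one.trans ht).ne'
    have e : (t : ℂ) ^ (-s) = t * (t : ℂ) ^ (-(s + 1)) := by
      rw [show -s = 1 + -(s + 1) by ring, Complex.cpow_add _ _ ht0, Complex.cpow_one]
    simp only [charRem]
    rw [e]; ring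
  rw [h1, MeasureTheory.integral_const_mul, integral_Ioi_cpow_of_lt (by simpa using hs) zero_lt_one,
    Complex.ofReal_one, Complex.one_cpow]
  have hs2 : -s + 1 ≠ 0 := by
    intro h; apply hs1; linear_combination -h
  field_simp
  ring

lemma norm_charReg_le {q : ℕ} [NeZero q] (χ : DirichletCharacter ℂ q) {s : ℂ} (hs : 1 / 2 ≤ s.re) :
    ‖charReg χ s‖ ≤ 8 * q * ‖s‖ := by
  have hq : (1:ℝ) ≤ q := by exact_mod_cast NeZero.pos q
  have hn : 1 / 2 ≤ ‖s‖ := hs.trans ((le_abs_self _).trans (Complex.abs_re_le_norm s))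
  have h1 : ‖∫ t in Set.Ioi (1 : ℝ), charRem χ t * (t : ℂ) ^ (-(s + 1))‖ ≤ 6 * q := by
    calc _ ≤ ∫ t in Set.Ioi (1 : ℝ), 3 * q * t ^ (-(3 / 2) : ℝ) := by
          refine MeasureTheory.norm_integral_le_of_norm_le
            ((integrableOn_Ioi_rpow_of_lt (by norm_num) zero_lt_one).const_mul _) ?_
          filter_upwards [MeasureTheory.ae_restrict_mem measurableSet_Ioi] with t ht
          have ht' : (1:ℝ) < t := ht
          rw [norm_mul, Complex.norm_cpow_eq_rpow_re_of_pos (by linarith)]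
          refine mul_le_mul (norm_charRem_le χ (by linarith)) ?_ (by positivity) (by positivity)
          refine Real.rpow_le_rpow_of_exponent_le ht'.le ?_
          simp; linarith
      _ = _ := by
          rw [MeasureTheory.integral_const_mul, integral_Ioi_rpow_of_lt (by norm_num) zero_lt_one]
          norm_num; ring
  calc ‖charReg χ s‖ ≤ ‖charMean χ‖ + ‖s‖ * ‖∫ t in Set.Ioi (1 : ℝ), charRem χ t * (t : ℂ) ^ (-(s + 1))‖ := by
        rw [charReg, ← norm_mul]; exact norm_add_le _ _
    _ ≤ 1 + ‖s‖ * (6 * q) := add_le_add (norm_charMean_le χ) (by gcongr)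
    _ ≤ _ := by nlinarith

lemma differentiableAt_charReg {q : ℕ} [NeZero q] (χ : DirichletCharacter ℂ q) {s : ℂ} (hs : 0 < s.re) :
    DifferentiableAt ℂ (charReg χ) s := by
  have e : charReg χ = fun s => charMean χ + s * mellin (Set.indicator (Set.Ioi 1) (charRem χ)) (-s) := by
    funext s
    rw [charReg, mellin]
    congr 2
    have : ∀ t : ℝ, (t : ℂ) ^ (-s - 1) • Set.indicator (Set.Ioi 1) (charRem χ) t =
        Set.indicator (Set.Ioi 1) (fun t : ℝ => charRem χ t * (t : ℂ) ^ (-(s + 1))) t := by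
      intro t
      by_cases h : t ∈ Set.Ioi (1 : ℝ)
      · rw [Set.indicator_of_mem h, Set.indicator_of_mem h, smul_eq_mul, mul_comm]
        congr 2; ring
      · rw [Set.indicator_of_notMem h, Set.indicator_of_notMem h, smul_zero]
    simp_rw [this]
    rw [MeasureTheory.setIntegral_indicator measurableSet_Ioi]
    congr 2
    ext t
    simp only [Set.mem_Ioi, Set.mem_inter_iff]
    constructor
    · intro h; exact ⟨by linarith, h⟩
    · exact fun h => h.2
  rw [e]
  have hb : ∀ t, ‖Set.indicator (Set.Ioi 1) (charRem χ) t‖ ≤ 3 * q := by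
    intro t
    by_cases h : t ∈ Set.Ioi (1 : ℝ)
    · rw [Set.indicator_of_mem h]
      exact norm_charRem_le χ (zero_le_one.trans (le_of_lt h))
    · rw [Set.indicator_of_notMem h, norm_zero]; positivity
  have hmeas : Measurable (Set.indicator (Set.Ioi 1) (charRem χ)) :=
    (measurable_charRem χ).indicator measurableSet_Ioi
  have hd : DifferentiableAt ℂ (mellin (Set.indicator (Set.Ioi 1) (charRem χ))) (-s) := by
    refine mellin_differentiableAt_of_isBigO_rpow (a := 0) (b := (-s).re - 1) ?_ ?_ (by simpa using hs) ?_ (by linarith)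
    · intro x _
      refine MeasureTheory.IntegrableAtFilter.filter_mono nhdsWithin_le_nhds ?_
      refine ⟨Metric.ball x 1, Metric.ball_mem_nhds x one_pos, ?_⟩
      refine MeasureTheory.Measure.integrableOn_of_bounded (M := 3 * q) MeasureTheory.measure_ball_lt_top.ne
        hmeas.aestronglyMeasurable (Filter.Eventually.of_forall hb)
    · refine Asymptotics.IsBigO.of_bound (3 * q) (Filter.Eventually.of_forall fun t => ?_)
      simpa using hb t
    · refine Asymptotics.IsBigO.of_bound 1 ?_
      have : Set.Ioo (0:ℝ) 1 ∈ nhdsWithin (0:ℝ) (Set.Ioi 0) := Ioo_mem_nhdsGT zero_lt_one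
      filter_upwards [this] with t ht
      rw [Set.indicator_of_notMem (by simp; exact ht.2.le), norm_zero]
      positivity
  exact (differentiableAt_const _).add (differentiableAt_id.mul (hd.comp s differentiableAt_id.neg))

lemma norm_deriv_charReg_le {q : ℕ} [NeZero q] (χ : DirichletCharacter ℂ q) {s : ℂ} (hs : 1 ≤ s.re) :
    ‖deriv (charReg χ) s‖ ≤ 24 * q * ‖s‖ := by
  have hq : (1:ℝ) ≤ q := by exact_mod_cast NeZero.pos q
  have hn : 1 ≤ ‖s‖ := hs.trans ((le_abs_self _).trans (Complex.abs_re_le_norm s))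
  have hre : ∀ z ∈ Metric.closedBall s (1 / 2), 1 / 2 ≤ z.re := by
    intro z hz
    rw [Metric.mem_closedBall, dist_eq_norm] at hz
    have h1 := (Complex.abs_re_le_norm (z - s)).trans hz
    rw [Complex.sub_re, abs_le] at h1
    linarith [h1.1]
  have := Complex.norm_deriv_le_of_forall_mem_sphere_norm_le (f := charReg χ) (c := s) (R := 1 / 2)
    (C := 12 * q * ‖s‖) (by norm_num) ?_ ?_
  · refine this.trans (le_of_eq ?_); ring
  · refine DifferentiableOn.diffContOnCl_ball (U := {z | 0 < z.re}) ?_ ?_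
    · exact fun z hz => (differentiableAt_charReg χ hz).differentiableWithinAt
    · intro z hz
      have := hre z hz
      simp only [Set.mem_ofPred_eq]; linarith
  · intro z hz
    have hz' := Metric.sphere_subset_closedBall hz
    refine (norm_charReg_le χ (hre z hz')).trans ?_
    rw [Metric.mem_closedBall, dist_eq_norm] at hz'
    have : ‖z‖ ≤ ‖s‖ + 1 / 2 := by
      calc ‖z‖ = ‖s + (z - s)‖ := by congr 1; ring
        _ ≤ _ := (norm_add_le _ _).trans (by linarith)
    nlinarith

/-! ### A lower bound for `L(1, χ)` with `χ` quadratic -/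

lemma zetaMul_apply {q : ℕ} (χ : DirichletCharacter ℂ q) (n : ℕ) :
    χ.zetaMul n = ∑ d ∈ n.divisors, χ (d : ZMod q) := by
  rw [DirichletCharacter.zetaMul, ArithmeticFunction.coe_zeta_mul_apply]
  refine sum_congr rfl fun d hd => ?_
  change (if d = 0 then 0 else χ (d : ZMod q)) = _
  rw [if_neg (Nat.pos_of_mem_divisors hd).ne']

lemma zetaMul_sq_ge_one {q : ℕ} [NeZero q] {χ : DirichletCharacter ℂ q} (hχ : χ ^ 2 = 1) {n : ℕ} (hn : n ≠ 0) :
    ∃ r : ℝ, 1 ≤ r ∧ χ.zetaMul (n ^ 2) = r := by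
  rw [χ.isMultiplicative_zetaMul.multiplicative_factorization _ (pow_ne_zero 2 hn)]
  refine Finset.prod_induction _ (fun z : ℂ => ∃ r : ℝ, 1 ≤ r ∧ z = r) ?_ ⟨1, le_rfl, by simp⟩ ?_
  · rintro a b ⟨r, hr, rfl⟩ ⟨s, hs, rfl⟩
    exact ⟨r * s, one_le_mul_of_one_le_of_one_le hr hs, by push_cast; ring⟩
  · intro p hp
    have hp' : p.Prime := Nat.prime_of_mem_primeFactors hp
    rw [Nat.factorization_pow]
    simp only [Finsupp.smul_apply, smul_eq_mul]
    obtain ⟨k, hk⟩ : ∃ k, k = n.factorization p := ⟨_, rfl⟩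
    rw [← hk]
    rw [zetaMul_apply, Nat.sum_divisors_prime_pow hp']
    simp only [Nat.cast_pow, map_pow]
    rcases MulChar.isQuadratic_iff_sq_eq_one.mpr hχ p with h | h | h
    · refine ⟨1, le_rfl, ?_⟩
      rw [h, sum_range_succ']
      simp
    · refine ⟨2 * k + 1, by linarith [(Nat.cast_nonneg k : (0:ℝ) ≤ k)], ?_⟩
      rw [h]
      simp
    · refine ⟨1, le_rfl, ?_⟩
      rw [h, sum_range_succ]
      have := neg_one_geom_sum (R := ℂ) (n := 2 * k)
      rw [this]
      simp

lemma sum_mul_antitone_le (a : ℕ → ℂ) (c : ℕ → ℝ) (B : ℝ) (ha : ∀ n, ‖∑ k ∈ range n, a k‖ ≤ B)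
    (hc : Antitone c) (hc0 : ∀ n, 0 ≤ c n) (n : ℕ) : ‖∑ k ∈ range n, a k * c k‖ ≤ B * c 0 := by
  have hB : 0 ≤ B := by simpa using ha 0
  have key : ∀ n, ∑ k ∈ range n, a k * (c k : ℂ) =
      c n * ∑ k ∈ range n, a k + ∑ k ∈ range n, ((c k - c (k + 1) : ℝ) : ℂ) * ∑ i ∈ range (k + 1), a i := by
    intro n
    induction n with
    | zero => simp
    | succ n ih =>
      rw [sum_range_succ, ih, sum_range_succ _ n, sum_range_succ _ n, sum_range_succ a n]
      push_cast
      ring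
  rw [key]
  calc _ ≤ c n * B + ∑ k ∈ range n, (c k - c (k + 1)) * B := by
        refine (norm_add_le _ _).trans (add_le_add ?_ ((norm_sum_le _ _).trans (sum_le_sum fun k _ => ?_)))
        · rw [norm_mul, Complex.norm_real, Real.norm_of_nonneg (hc0 n)]
          exact mul_le_mul_of_nonneg_left (ha n) (hc0 n)
        · have : 0 ≤ c k - c (k + 1) := sub_nonneg.2 (hc (Nat.le_succ k))
          rw [norm_mul, Complex.norm_real, Real.norm_of_nonneg this]
          exact mul_le_mul_of_nonneg_left (ha _) this
    _ = B * c 0 := by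
        rw [← sum_mul, Finset.sum_range_sub']
        ring

/-- The weights `1 / (n (1 - x)) - x ^ n / (1 - x ^ n)`, `n ≥ 1`. -/
def lambertWeight (x : ℝ) (n : ℕ) : ℝ := 1 / ((n + 1 : ℕ) * (1 - x)) - x ^ (n + 1) / (1 - x ^ (n + 1))

lemma sq_mul_pow_le_geom_sum_sq {x : ℝ} (hx : 0 ≤ x) (n : ℕ) :
    ((n : ℝ) + 1) ^ 2 * x ^ n ≤ (∑ i ∈ range (n + 1), x ^ i) ^ 2 := by
  have h := Finset.sum_sq_le_sum_mul_sum_of_sq_le_mul (range (n + 1)) (r := fun _ => √(x ^ n))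
    (f := fun i => x ^ i) (g := fun i => x ^ (n - i)) (fun i _ => by positivity) (fun i _ => by positivity)
    (fun i hi => le_of_eq <| by
      rw [Real.sq_sqrt (by positivity), ← pow_add]
      congr 1
      rw [mem_range] at hi; omega)
  have e : ∑ i ∈ range (n + 1), x ^ (n - i) = ∑ i ∈ range (n + 1), x ^ i := by
    rw [← sum_range_reflect]
    refine sum_congr rfl fun i hi => ?_
    rw [mem_range] at hi
    congr 1; omega
  rw [e, sum_const, card_range, nsmul_eq_mul, mul_pow, Real.sq_sqrt (by positivity), ← sq] at h
  exact_mod_cast h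

lemma lambertWeight_antitone {x : ℝ} (hx0 : 0 < x) (hx1 : x < 1) : Antitone (lambertWeight x) := by
  refine antitone_nat_of_succ_le fun n => ?_
  have hd : 0 < 1 - x := by linarith
  have h1 : 0 < 1 - x ^ (n + 1) := sub_pos.2 (pow_lt_one₀ hx0.le hx1 (Nat.succ_ne_zero n))
  have h2 : 0 < 1 - x ^ (n + 2) := sub_pos.2 (pow_lt_one₀ hx0.le hx1 (Nat.succ_ne_zero (n + 1)))
  set G := ∑ i ∈ range (n + 1), x ^ i with hG
  set H := ∑ i ∈ range (n + 2), x ^ i with hH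
  have hG0 : 0 ≤ G := sum_nonneg fun _ _ => by positivity
  have hH0 : 0 ≤ H := sum_nonneg fun _ _ => by positivity
  have eG : 1 - x ^ (n + 1) = (1 - x) * G := (mul_neg_geom_sum x (n + 1)).symm
  have eH : 1 - x ^ (n + 2) = (1 - x) * H := (mul_neg_geom_sum x (n + 2)).symm
  have hGH : ((n:ℝ) + 1) * (n + 2) * x ^ (n + 1) ≤ G * H := by
    have a := sq_mul_pow_le_geom_sum_sq hx0.le n
    have b := sq_mul_pow_le_geom_sum_sq hx0.le (n + 1)
    refine le_of_sq_le_sq ?_ (by positivity)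
    calc (((n:ℝ) + 1) * (n + 2) * x ^ (n + 1)) ^ 2
        = (((n : ℝ) + 1) ^ 2 * x ^ n) * ((((n + 1 : ℕ) : ℝ) + 1) ^ 2 * x ^ (n + 1)) * x := by push_cast; ring
      _ ≤ G ^ 2 * H ^ 2 * 1 := by
          refine mul_le_mul (mul_le_mul a b (by positivity) (by positivity)) hx1.le hx0.le (by positivity)
      _ = _ := by ring
  have e1 : lambertWeight x n - lambertWeight x (n + 1) =
      (G * H - (n + 1) * (n + 2) * x ^ (n + 1)) / ((n + 1) * (n + 2) * (1 - x) * (G * H)) := by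
    have hG1 : G ≠ 0 := fun h => by rw [h, mul_zero] at eG; exact h1.ne' eG
    have hH1 : H ≠ 0 := fun h => by rw [h, mul_zero] at eH; exact h2.ne' eH
    simp only [lambertWeight]
    rw [show n + 1 + 1 = n + 2 from rfl, eG, eH]
    have e2 : x ^ (n + 1) = 1 - (1 - x) * G := by rw [← eG]; ring
    have e3 : x ^ (n + 2) = 1 - (1 - x) * H := by rw [← eH]; ring
    have e4 : H = 1 + x * G := by
      rw [hH, hG, sum_range_succ', mul_sum, pow_zero, add_comm]
      congr 1
      exact sum_congr rfl fun i _ => by ring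
    rw [e3, e2]
    push_cast
    field_simp
    rw [e4]
    ring
  have : 0 ≤ lambertWeight x n - lambertWeight x (n + 1) := by
    rw [e1]
    refine div_nonneg (by linarith) (by positivity)
  linarith

lemma lambertWeight_nonneg {x : ℝ} (hx0 : 0 < x) (hx1 : x < 1) (n : ℕ) : 0 ≤ lambertWeight x n := by
  have hd : 0 < 1 - x := by linarith
  have h1 : 0 < 1 - x ^ (n + 1) := sub_pos.2 (pow_lt_one₀ hx0.le hx1 (Nat.succ_ne_zero n))
  rw [lambertWeight, sub_nonneg, div_le_div_iff₀ h1 (by positivity), one_mul]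
  rw [← mul_neg_geom_sum x (n + 1)]
  have : x ^ (n + 1) * (n + 1 : ℕ) ≤ ∑ i ∈ range (n + 1), x ^ i := by
    rw [mul_comm, ← nsmul_eq_mul, ← card_range (n + 1), ← sum_const, card_range]
    refine sum_le_sum fun i hi => pow_le_pow_of_le_one hx0.le hx1.le ?_
    rw [mem_range] at hi; omega
  nlinarith

lemma charMean_eq_zero {q : ℕ} [NeZero q] {χ : DirichletCharacter ℂ q} (hχ : χ ≠ 1) : charMean χ = 0 := by
  rw [charMean, MulChar.sum_eq_zero_of_ne_one hχ, zero_div]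

lemma tendsto_sum_char_div {q : ℕ} [NeZero q] {χ : DirichletCharacter ℂ q} (hχ : χ ≠ 1) :
    Filter.Tendsto (fun n : ℕ => ∑ k ∈ range n, χ ((k + 1 : ℕ) : ZMod q) / (k + 1 : ℕ)) Filter.atTop
      (nhds (charReg χ 1)) := by
  have hS : ∀ t : ℝ, 0 ≤ t → ‖∑ k ∈ Icc 1 ⌊t⌋₊, χ (k : ZMod q)‖ ≤ 3 * q := by
    intro t ht
    have := norm_charRem_le χ ht
    rwa [charRem, charMean_eq_zero hχ, zero_mul, sub_zero] at this
  set c : ℕ → ℂ := fun n => if n = 0 then 0 else χ n with hc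
  have hc1 : ∀ n, ∑ k ∈ Icc 0 n, c k = ∑ k ∈ Icc 1 n, χ (k : ZMod q) := by
    intro n
    rw [← insert_Icc_add_one_left_eq_Icc n.zero_le, sum_insert (by simp), zero_add]
    simp only [hc, if_true, zero_add]
    refine sum_congr rfl fun k hk => ?_
    rw [mem_Icc] at hk
    rw [if_neg (by omega)]
  have hder : ∀ t : ℝ, 0 < t → deriv (fun x : ℝ => (x : ℂ) ^ (-1 : ℂ)) t = -(t : ℂ) ^ (-2 : ℂ) := by
    intro t ht
    rw [Complex.deriv_ofReal_cpow_const ht.ne' (by norm_num)]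
    norm_num
  have h := tendsto_sum_mul_atTop_nhds_one_sub_integral₀ (c := c) (f := fun x : ℝ => (x : ℂ) ^ (-1 : ℂ)) (l := 0)
    (g := fun t => t ^ (-2 : ℝ)) (if_pos rfl) ?_ ?_ ?_ ?_ ?_
  · have e : (0 : ℂ) - ∫ t in Set.Ioi (1:ℝ), deriv (fun x : ℝ => (x : ℂ) ^ (-1 : ℂ)) t * ∑ k ∈ Icc 0 ⌊t⌋₊, c k =
        charReg χ 1 := by
      rw [charReg, charMean_eq_zero hχ, zero_add, one_mul, zero_sub, ← MeasureTheory.integral_neg]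
      refine MeasureTheory.setIntegral_congr_fun measurableSet_Ioi fun t ht => ?_
      change -(deriv (fun x : ℝ => (x : ℂ) ^ (-1 : ℂ)) t * ∑ k ∈ Icc 0 ⌊t⌋₊, c k) = charRem χ t * (t : ℂ) ^ (-(1 + 1) : ℂ)
      rw [hder t (zero_lt_one.trans ht), hc1, charRem, charMean_eq_zero hχ]
      norm_num
      ring
    rw [e] at h
    rw [← Filter.tendsto_add_atTop_iff_nat 1]
    refine ((Filter.tendsto_add_atTop_iff_nat 1).2 h).congr fun n => ?_
    rw [← insert_Icc_add_one_left_eq_Icc (n + 1).zero_le, sum_insert (by simp), zero_add]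
    have : Icc 1 (n + 1) = Ico (0 + 1) (n + 1 + 1) := by ext; simp
    rw [this, ← sum_Ico_add' _ 0 (n + 1) 1, ← range_eq_Ico]
    simp only [hc, if_true, mul_zero, zero_add]
    refine sum_congr rfl fun k _ => ?_
    rw [if_neg (by omega), Complex.ofReal_natCast, Complex.cpow_neg_one]
    field_simp
  · intro t ht
    exact differentiableAt_id.ofReal_cpow_const (zero_lt_one.trans_le ht).ne' (by norm_num)
  · refine (Iff.mpr integrableOn_Ici_iff_integrableOn_Ioi
      (integrableOn_Ioi_deriv_ofReal_cpow zero_lt_one (by simp))).locallyIntegrableOn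
  · have h0 : Filter.Tendsto (fun n : ℕ => 3 * q / (n : ℝ)) Filter.atTop (nhds 0) :=
      tendsto_const_div_atTop_nhds_zero_nat _
    refine squeeze_zero_norm (fun n => ?_) h0
    rw [hc1, norm_mul, Complex.ofReal_natCast, Complex.cpow_neg_one, norm_inv, Complex.norm_natCast, div_eq_inv_mul]
    refine mul_le_mul_of_nonneg_left ?_ (by positivity)
    simpa using hS n (by positivity)
  · refine Asymptotics.IsBigO.of_bound (3 * q) ?_
    filter_upwards [Filter.eventually_gt_atTop 0] with t ht
    rw [hder t ht, hc1, norm_mul, norm_neg, Complex.norm_cpow_eq_rpow_re_of_pos ht, mul_comm]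
    simp only [Complex.neg_re, Complex.re_ofNat]
    rw [Real.norm_of_nonneg (by positivity)]
    exact mul_le_mul_of_nonneg_right (hS t ht.le) (by positivity)
  · exact integrableAtFilter_rpow_atTop_iff.mpr (by norm_num)

lemma tendsto_sum_lambert {q : ℕ} [NeZero q] (χ : DirichletCharacter ℂ q) {x : ℝ} (hx0 : 0 < x) (hx1 : x < 1) :
    Summable (fun n : ℕ => χ.zetaMul n * (x : ℂ) ^ n) ∧
    Filter.Tendsto (fun n : ℕ => ∑ k ∈ range n, χ ((k + 1 : ℕ) : ZMod q) * (x ^ (k + 1) / (1 - x ^ (k + 1)) : ℝ))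
      Filter.atTop (nhds (∑' n : ℕ, χ.zetaMul n * (x : ℂ) ^ n)) := by
  have hxn : ‖(x : ℂ)‖ < 1 := by rw [Complex.norm_real, Real.norm_of_nonneg hx0.le]; exact hx1
  have hs : Summable fun p : ℕ+ × ℕ+ => χ (p.1 : ℕ) * (x : ℂ) ^ (p.1 * p.2 : ℕ) := by
    have h0 := (summable_prod_mul_pow 0 hxn).norm
    refine Summable.of_norm_bounded h0 fun p => ?_
    rw [pow_zero, one_mul, norm_mul]
    exact mul_le_of_le_one_left (norm_nonneg _) (χ.norm_le_one _)
  have hs' := (sigmaAntidiagonalEquivProd.summable_iff).2 hs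
  have hfib : ∀ e : ℕ+, ∑' y : (Nat.divisorsAntidiagonal e),
      ((fun p : ℕ+ × ℕ+ => χ (p.1 : ℕ) * (x : ℂ) ^ (p.1 * p.2 : ℕ)) ∘ sigmaAntidiagonalEquivProd) ⟨e, y⟩ =
      χ.zetaMul e * (x : ℂ) ^ (e : ℕ) := by
    intro e
    rw [tsum_fintype]
    simp only [Function.comp, sigmaAntidiagonalEquivProd, divisorsAntidiagonalFactors, Equiv.coe_fn_mk, PNat.mk_coe]
    rw [Finset.univ_eq_attach, (e : ℕ).divisorsAntidiagonal.sum_attach (fun y => χ (y.1 : ℕ) * (x : ℂ) ^ (y.1 * y.2)),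
      zetaMul_apply, sum_mul, Nat.sum_divisorsAntidiagonal (fun a b => χ (a : ℕ) * (x : ℂ) ^ (a * b))]
    refine sum_congr rfl fun d hd => ?_
    rw [Nat.mul_div_cancel' (Nat.dvd_of_mem_divisors hd)]
  have hZ : Summable (fun n : ℕ+ => χ.zetaMul n * (x : ℂ) ^ (n : ℕ)) := by
    refine (hs'.sigma).congr fun e => ?_
    exact hfib e
  have hgeo : ∀ a : ℕ+, ∑' b : ℕ+, χ (a : ℕ) * (x : ℂ) ^ (a * b : ℕ) =
      χ (a : ℕ) * (x ^ (a : ℕ) / (1 - x ^ (a : ℕ)) : ℝ) := by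
    intro a
    have ha : ‖(x : ℂ) ^ (a : ℕ)‖ < 1 := by
      rw [norm_pow]; exact pow_lt_one₀ (norm_nonneg _) hxn a.ne_zero
    rw [tsum_mul_left]
    congr 1
    have h1 := tsum_pnat_eq_tsum_succ (f := fun n : ℕ => ((x : ℂ) ^ (a : ℕ)) ^ n)
    simp only [pow_mul]
    rw [h1]
    simp only [pow_succ]
    rw [tsum_mul_right, tsum_geometric_of_norm_lt_one ha]
    push_cast
    rw [div_eq_inv_mul]
  have htot : ∑' n : ℕ+, χ (n : ℕ) * ((x ^ (n : ℕ) / (1 - x ^ (n : ℕ)) : ℝ) : ℂ) =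
      ∑' n : ℕ+, χ.zetaMul n * (x : ℂ) ^ (n : ℕ) := by
    rw [← tsum_congr hgeo, ← hs.tsum_prod, ← sigmaAntidiagonalEquivProd.tsum_eq, ← tsum_congr hfib]
    exact hs'.tsum_sigma
  have hsum1 : Summable (fun n : ℕ+ => χ (n : ℕ) * ((x ^ (n : ℕ) / (1 - x ^ (n : ℕ)) : ℝ) : ℂ)) :=
    hs.prod.congr fun a => hgeo a
  have hZ' : Summable (fun n : ℕ => χ.zetaMul n * (x : ℂ) ^ n) := by
    rw [← summable_nat_add_iff 1]
    exact (Equiv.pnatEquivNat.symm.summable_iff (f := fun n : ℕ+ => χ.zetaMul n * (x : ℂ) ^ (n : ℕ))).2 hZ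
  refine ⟨hZ', ?_⟩
  have e2 : ∑' n : ℕ, χ.zetaMul n * (x : ℂ) ^ n = ∑' n : ℕ+, χ.zetaMul n * (x : ℂ) ^ (n : ℕ) := by
    rw [← tsum_zero_pnat_eq_tsum_nat hZ']
    simp
  rw [e2, ← htot, tsum_pnat_eq_tsum_succ (f := fun n : ℕ => χ (n : ℕ) * ((x ^ n / (1 - x ^ n) : ℝ) : ℂ))]
  refine Summable.tendsto_sum_tsum_nat ?_
  exact (Equiv.pnatEquivNat.symm.summable_iff
    (f := fun n : ℕ+ => χ (n : ℕ) * ((x ^ (n : ℕ) / (1 - x ^ (n : ℕ)) : ℝ) : ℂ))).2 hsum1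

/-- An effective lower bound for `L(1, χ)`, `χ` a nontrivial quadratic character. -/
theorem norm_charReg_one_ge {q : ℕ} [NeZero q] {χ : DirichletCharacter ℂ q} (hχ : χ ≠ 1) (hχ2 : χ ^ 2 = 1) :
    1 / (128 * q) ≤ ‖charReg χ 1‖ := by
  have hq : (1:ℝ) ≤ q := by exact_mod_cast NeZero.pos q
  set x : ℝ := 1 - 1 / (1024 * q ^ 2) with hx
  have hd0 : (0:ℝ) < 1 / (1024 * q ^ 2) := by positivity
  have hd1 : (1:ℝ) / (1024 * q ^ 2) < 1 := by
    rw [div_lt_one (by positivity)]; nlinarith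
  have hx0 : 0 < x := by rw [hx]; linarith
  have hx1 : x < 1 := by rw [hx]; linarith
  obtain ⟨hZ, hlam⟩ := tendsto_sum_lambert χ hx0 hx1
  set f := ∑' n : ℕ, χ.zetaMul n * (x : ℂ) ^ n with hf
  have hS : ∀ n, ‖∑ k ∈ range n, χ ((k + 1 : ℕ) : ZMod q)‖ ≤ 3 * q := by
    intro n
    have := norm_charRem_le χ (t := n) (by positivity)
    rw [charRem, charMean_eq_zero hχ, zero_mul, sub_zero, Nat.floor_natCast] at this
    rw [range_eq_Ico, sum_Ico_add' (fun k : ℕ => χ (k : ZMod q)) 0 n 1]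
    have e : Ico (0 + 1) (n + 1) = Icc 1 n := by ext; simp
    rwa [e]
  have hw0 : lambertWeight x 0 = 1 := by
    have : 1 - x ≠ 0 := by linarith
    simp only [lambertWeight, zero_add, Nat.cast_one, one_mul, pow_one]
    field_simp
  have hbd : ‖charReg χ 1 * ((1 / (1 - x) : ℝ) : ℂ) - f‖ ≤ 3 * q := by
    have ht := (((tendsto_sum_char_div hχ).mul_const ((1 / (1 - x) : ℝ) : ℂ)).sub hlam).norm
    refine le_of_tendsto' ht fun n => ?_
    have := sum_mul_antitone_le (fun k => χ ((k + 1 : ℕ) : ZMod q)) (lambertWeight x) (3 * q) hS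
      (lambertWeight_antitone hx0 hx1) (lambertWeight_nonneg hx0 hx1) n
    rw [hw0, mul_one] at this
    refine le_trans (le_of_eq ?_) this
    congr 1
    rw [sum_mul, ← sum_sub_distrib]
    refine sum_congr rfl fun k _ => ?_
    rw [lambertWeight, Complex.ofReal_sub, mul_sub]
    congr 1
    have : (1 - x : ℂ) ≠ 0 := by
      rw [← Complex.ofReal_one, ← Complex.ofReal_sub, Complex.ofReal_ne_zero]; linarith
    push_cast
    field_simp
  have hfge : 12 * (q : ℝ) ≤ ‖f‖ := by
    refine le_trans ?_ (Complex.re_le_norm f)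
    rw [hf, Complex.re_tsum hZ]
    have hnn : ∀ n : ℕ, 0 ≤ (χ.zetaMul n * (x : ℂ) ^ n).re := by
      intro n
      have h0 := DirichletCharacter.zetaMul_nonneg hχ2 n
      rw [Complex.nonneg_iff] at h0
      rw [← Complex.ofReal_pow, Complex.re_mul_ofReal]
      exact mul_nonneg h0.1 (by positivity)
    have hsr : Summable fun n : ℕ => (χ.zetaMul n * (x : ℂ) ^ n).re := (Complex.hasSum_re hZ.hasSum).summable
    have h1 := hsr.sum_le_tsum ((Icc 1 (16 * q)).image fun k => k ^ 2) (fun n _ => hnn n)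
    refine le_trans ?_ h1
    rw [sum_image (fun a _ b _ h => (Nat.pow_left_injective (n := 2) (by norm_num)) h)]
    calc 12 * (q : ℝ) = ∑ k ∈ Icc 1 (16 * q), (3 / 4 : ℝ) := by
          rw [sum_const, Nat.card_Icc, nsmul_eq_mul]; push_cast; ring_nf
      _ ≤ _ := by
          refine sum_le_sum fun k hk => ?_
          rw [mem_Icc] at hk
          obtain ⟨r, hr, hre⟩ := zetaMul_sq_ge_one hχ2 (n := k) (by omega)
          rw [hre, ← Complex.ofReal_pow, ← Complex.ofReal_mul, Complex.ofReal_re]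
          have hk' : (k:ℝ) ≤ 16 * q := by exact_mod_cast hk.2
          have h2 : 3 / 4 ≤ x ^ (k ^ 2) := by
            have hb := one_add_mul_le_pow (a := -(1 / (1024 * (q:ℝ) ^ 2))) (by linarith) (k ^ 2)
            rw [← sub_eq_add_neg 1, ← hx] at hb
            refine le_trans ?_ hb
            have : (k:ℝ) ^ 2 * (1 / (1024 * (q:ℝ) ^ 2)) ≤ 1 / 4 := by
              rw [mul_one_div, div_le_div_iff₀ (by positivity) (by norm_num)]
              nlinarith [(Nat.cast_nonneg k : (0:ℝ) ≤ k)]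
            push_cast
            linarith
          nlinarith
  have h3 : 9 * (q:ℝ) ≤ ‖charReg χ 1 * ((1 / (1 - x) : ℝ) : ℂ)‖ := by
    have h4 := norm_sub_norm_le f (charReg χ 1 * ((1 / (1 - x) : ℝ) : ℂ))
    rw [norm_sub_rev] at h4
    linarith
  have e1 : 1 - x = 1 / (1024 * q ^ 2) := by rw [hx]; ring
  rw [norm_mul, Complex.norm_real, e1, one_div_one_div, Real.norm_of_nonneg (by positivity)] at h3
  rw [div_le_iff₀ (by positivity)]
  have h5 : 9 * (q:ℝ) * 1 ≤ (‖charReg χ 1‖ * (1024 * q)) * q := by nlinarith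
  have h6 : (9:ℝ) ≤ ‖charReg χ 1‖ * (1024 * q) := by
    by_contra hcon
    push Not at hcon
    nlinarith
  linarith

/-! ### Lower bounds for Dirichlet `L`-series near the line `re s = 1` -/

lemma norm_LSeries_le_of_bounded {f : ℕ → ℂ} (hf : ∀ n, ‖f n‖ ≤ 1) {s : ℂ} (hs : 1 < s.re) :
    ‖LSeries f s‖ ≤ s.re / (s.re - 1) := by
  have hO : (fun n : ℕ => ∑ k ∈ Icc 1 n, ‖(1 : ℂ)‖) =O[Filter.atTop] fun n => (n : ℝ) ^ (1 : ℝ) := by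
    refine Asymptotics.IsBigO.of_bound 1 (Filter.Eventually.of_forall fun n => ?_)
    simp
  have hsr : 1 < ((s.re : ℝ) : ℂ).re := by simpa using hs
  have hsum1 : LSeriesSummable (fun _ => (1 : ℂ)) s.re := LSeriesSummable_of_sum_norm_bigO hO zero_le_one (by simpa using hs)
  have hterm : ∀ n, ‖LSeries.term f s n‖ ≤ ‖LSeries.term (fun _ => (1 : ℂ)) s.re n‖ := by
    intro n
    rw [LSeries.norm_term_eq, LSeries.norm_term_eq]
    split_ifs
    · rfl
    · rw [Complex.ofReal_re, norm_one]
      gcongr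
      exact hf n
  have hS := hsum1.norm
  have h1 : ‖LSeries f s‖ ≤ ∑' n, ‖LSeries.term (fun _ => (1 : ℂ)) s.re n‖ :=
    (norm_tsum_le_tsum_norm (hS.of_nonneg_of_le (fun _ => norm_nonneg _) hterm)).trans
      ((hS.of_nonneg_of_le (fun _ => norm_nonneg _) hterm).tsum_le_tsum hterm hS)
  have h2 : ((∑' n, ‖LSeries.term (fun _ => (1 : ℂ)) s.re n‖ : ℝ) : ℂ) = LSeries (fun _ => (1 : ℂ)) s.re := by
    rw [LSeries, Complex.ofReal_tsum]
    refine tsum_congr fun n => ?_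
    rw [LSeries.norm_term_eq, LSeries.term]
    split_ifs
    · simp
    · rw [norm_one, Complex.ofReal_re, Complex.ofReal_div, Complex.ofReal_cpow (by positivity)]
      simp
  have h3 : ‖LSeries (fun _ => (1 : ℂ)) s.re‖ ≤ s.re / (s.re - 1) := by
    rw [LSeries_eq_mul_integral' _ zero_le_one hsr hO, norm_mul, Complex.norm_real, Real.norm_of_nonneg (by linarith),
      div_eq_mul_inv]
    refine mul_le_mul_of_nonneg_left ?_ (by linarith)
    calc _ ≤ ∫ t in Set.Ioi (1 : ℝ), t ^ (-s.re) := by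
          refine MeasureTheory.norm_integral_le_of_norm_le (integrableOn_Ioi_rpow_of_lt (by linarith) zero_lt_one) ?_
          filter_upwards [MeasureTheory.ae_restrict_mem measurableSet_Ioi] with t ht
          have ht' : (0:ℝ) < t := zero_lt_one.trans ht
          rw [norm_mul, Complex.norm_cpow_eq_rpow_re_of_pos ht']
          have e : t ^ (-s.re) = t * t ^ (-((s.re : ℂ) + 1)).re := by
            rw [show -s.re = 1 + (-((s.re : ℂ) + 1)).re by simp, Real.rpow_add ht', Real.rpow_one]
          rw [e]
          refine mul_le_mul_of_nonneg_right ?_ (by positivity)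
          rw [sum_const, Nat.card_Icc, nsmul_eq_mul, mul_one, Complex.norm_natCast, Nat.add_sub_cancel]
          exact Nat.floor_le ht'.le
      _ = _ := by
          rw [integral_Ioi_rpow_of_lt (by linarith) zero_lt_one, Real.one_rpow, neg_div, ← one_div, ← div_neg]
          congr 1; ring
  refine h1.trans (le_trans ?_ h3)
  rw [← h2, Complex.norm_real]
  exact le_abs_self _

/-- The `L`-series of a Dirichlet character. -/
def charL {q : ℕ} (χ : DirichletCharacter ℂ q) (s : ℂ) : ℂ := LSeries (fun n => χ n) s

/-- The `L`-series of the twist of the Möbius function by a Dirichlet character. -/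
def charM {q : ℕ} (χ : DirichletCharacter ℂ q) (s : ℂ) : ℂ :=
  LSeries ((fun n : ℕ => χ n) * fun n => (ArithmeticFunction.moebius n : ℂ)) s

lemma charL_mul_charM {q : ℕ} (χ : DirichletCharacter ℂ q) {s : ℂ} (hs : 1 < s.re) : charL χ s * charM χ s = 1 :=
  DirichletCharacter.LSeries.mul_mu_eq_one χ hs

lemma norm_moebius_char_le {q : ℕ} (χ : DirichletCharacter ℂ q) (n : ℕ) :
    ‖((fun n : ℕ => χ n) * fun n => (ArithmeticFunction.moebius n : ℂ)) n‖ ≤ 1 := by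
  rw [Pi.mul_apply, norm_mul]
  exact mul_le_one₀ (χ.norm_le_one _) (norm_nonneg _) (norm_moebius_le n)

lemma norm_charL_ge_of_one_lt {q : ℕ} (χ : DirichletCharacter ℂ q) {s : ℂ} (hs : 1 < s.re) :
    (s.re - 1) / s.re ≤ ‖charL χ s‖ := by
  have h1 := norm_LSeries_le_of_bounded (norm_moebius_char_le χ) hs
  have h2 : ‖charL χ s‖ * ‖charM χ s‖ = 1 := by rw [← norm_mul, charL_mul_charM χ hs, norm_one]
  have h0 : 0 < s.re / (s.re - 1) := div_pos (by linarith) (by linarith)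
  have h3 : 1 ≤ ‖charL χ s‖ * (s.re / (s.re - 1)) :=
    h2.symm.le.trans (mul_le_mul_of_nonneg_left h1 (norm_nonneg _))
  rw [← one_div_div, div_le_iff₀ h0]
  exact h3

lemma charL_eq {q : ℕ} [NeZero q] (χ : DirichletCharacter ℂ q) {s : ℂ} (hs : 1 < s.re) :
    charL χ s = charMean χ / (s - 1) + charReg χ s := LSeries_eq_charReg χ hs

lemma sub_one_ne_zero_of_re {s : ℂ} (hs : 1 < s.re) : s - 1 ≠ 0 := by
  intro h
  have := congrArg Complex.re h
  simp at this; linarith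

lemma hasDerivAt_charL {q : ℕ} [NeZero q] (χ : DirichletCharacter ℂ q) {s : ℂ} (hs : 1 < s.re) :
    HasDerivAt (charL χ) (-charMean χ / (s - 1) ^ 2 + deriv (charReg χ) s) s := by
  have h0 := sub_one_ne_zero_of_re hs
  have h1 : HasDerivAt (fun z => charMean χ / (z - 1) + charReg χ z)
      (-charMean χ / (s - 1) ^ 2 + deriv (charReg χ) s) s := by
    refine HasDerivAt.add ?_ (differentiableAt_charReg χ (by linarith)).hasDerivAt
    have h2 := (hasDerivAt_const s (charMean χ)).div ((hasDerivAt_id s).sub_const 1) h0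
    convert! h2 using 1
    simp
  refine h1.congr_of_eventuallyEq ?_
  filter_upwards [(isOpen_lt continuous_const Complex.continuous_re).mem_nhds hs] with z hz
  exact charL_eq χ hz

lemma norm_deriv_charL_le {q : ℕ} [NeZero q] (χ : DirichletCharacter ℂ q) {s : ℂ} (hs : 1 < s.re) :
    ‖deriv (charL χ) s‖ ≤ ‖charMean χ‖ / ‖s - 1‖ ^ 2 + 24 * q * ‖s‖ := by
  rw [(hasDerivAt_charL χ hs).deriv]
  refine (norm_add_le _ _).trans (add_le_add (le_of_eq ?_) (norm_deriv_charReg_le χ hs.le))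
  rw [norm_div, norm_neg, norm_pow]

lemma norm_charL_le {q : ℕ} [NeZero q] (χ : DirichletCharacter ℂ q) {s : ℂ} (hs : 1 < s.re) :
    ‖charL χ s‖ ≤ ‖charMean χ‖ / ‖s - 1‖ + 8 * q * ‖s‖ := by
  rw [charL_eq χ hs]
  refine (norm_add_le _ _).trans (add_le_add (le_of_eq ?_) (norm_charReg_le χ (by linarith)))
  rw [norm_div]

lemma norm_charL_ge_of_bounds {q : ℕ} [NeZero q] (χ : DirichletCharacter ℂ q) (t D : ℝ) (hD : 1 ≤ D)
    (h1 : ∀ s : ℂ, 1 < s.re → s.re ≤ 2 → s.im = t → ‖deriv (charL χ) s‖ ≤ D)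
    (h2 : ∀ s : ℂ, 1 < s.re → s.re ≤ 2 → s.im = 2 * t → ‖charL (χ ^ 2) s‖ ≤ D)
    {s : ℂ} (hs : 1 < s.re) (hs2 : s.re ≤ 2) (ht : s.im = t) : 1 / (256 * D ^ 4) ≤ ‖charL χ s‖ := by
  have hfar : ∀ s : ℂ, 1 + 1 / (256 * D ^ 5) ≤ s.re → s.re ≤ 2 → s.im = t → 1 / (128 * D ^ 4) ≤ ‖charL χ s‖ := by
    intro s hs hs2 ht
    set x := s.re - 1 with hx
    have hx0 : 1 / (256 * D ^ 5) ≤ x := by rw [hx]; linarith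
    have hxpos : 0 < x := lt_of_lt_of_le (by positivity) hx0
    have hs' : s = 1 + x + Complex.I * t := by
      rw [hx, ← ht]; apply Complex.ext <;> simp
    have key := χ.norm_LSeries_product_ge_one hxpos t
    have e1 : ‖LSeries (fun n => (1 : DirichletCharacter ℂ q) n) (1 + x)‖ ≤ 2 / x := by
      have hre : 1 < ((1 : ℂ) + x).re := by simp [hxpos]
      have hre' : ((1 : ℂ) + x).re = 1 + x := by simp
      refine (norm_LSeries_le_of_bounded (fun n => DirichletCharacter.norm_le_one _ _) hre).trans ?_
      rw [hre', add_sub_cancel_left]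
      gcongr
      linarith
    have e2 : ‖LSeries (fun n => (χ ^ 2) n) (1 + x + 2 * Complex.I * t)‖ ≤ D := by
      refine h2 _ (by simp [hxpos]) (by simp; linarith) (by simp)
    rw [norm_mul, norm_mul, norm_pow, norm_pow, ← hs'] at key
    have h3 : 1 ≤ (2 / x) ^ 3 * ‖charL χ s‖ ^ 4 * D := by
      refine le_trans key ?_
      exact mul_le_mul (mul_le_mul (pow_le_pow_left₀ (norm_nonneg _) e1 3) le_rfl (by positivity) (by positivity))
        e2 (norm_nonneg _) (by positivity)
    have h4 : x ^ 3 / (8 * D) ≤ ‖charL χ s‖ ^ 4 := by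
      rw [div_le_iff₀ (by positivity)]
      have : (2 / x) ^ 3 * ‖charL χ s‖ ^ 4 * D = (‖charL χ s‖ ^ 4 * (8 * D)) / x ^ 3 := by
        rw [div_pow]; ring
      rw [this, le_div_iff₀ (by positivity)] at h3
      linarith
    refine le_of_pow_le_pow_left₀ (n := 4) (by norm_num) (norm_nonneg _) (le_trans ?_ h4)
    calc (1 / (128 * D ^ 4)) ^ 4 ≤ (1 / (256 * D ^ 5)) ^ 3 / (8 * D) := by
          rw [div_pow, div_pow, div_div, one_pow, one_pow]
          refine one_div_le_one_div_of_le (by positivity) ?_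
          have : (0:ℝ) < D ^ 16 := by positivity
          nlinarith
      _ ≤ _ := by gcongr
  rcases le_or_gt (1 + 1 / (256 * D ^ 5)) s.re with h | h
  · refine le_trans ?_ (hfar s h hs2 ht)
    refine one_div_le_one_div_of_le (by positivity) ?_
    have : (0:ℝ) < D ^ 4 := by positivity
    linarith
  · set z : ℂ := ⟨1 + 1 / (256 * D ^ 5), t⟩ with hz
    have hD5 : 1 / (256 * D ^ 5) ≤ 1 := by
      rw [div_le_one (by positivity)]
      have : 1 ≤ D ^ 5 := one_le_pow₀ hD
      linarith
    have hz1 := hfar z (by rw [hz]) (by rw [hz]; linarith) (by rw [hz])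
    have hconv : Convex ℝ {w : ℂ | (1 < w.re ∧ w.re ≤ 2) ∧ (w.im ≤ t ∧ t ≤ w.im)} :=
      ((convex_halfSpace_re_gt 1).inter (convex_halfSpace_re_le 2)).inter
        ((convex_halfSpace_im_le t).inter (convex_halfSpace_im_ge t))
    have hmv := hconv.norm_image_sub_le_of_norm_deriv_le (f := charL χ) (C := D) (x := s) (y := z)
      (fun w hw => (hasDerivAt_charL χ hw.1.1).differentiableAt)
      (fun w hw => h1 w hw.1.1 hw.1.2 (le_antisymm hw.2.1 hw.2.2)) ⟨⟨hs, hs2⟩, ht.le, ht.ge⟩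
      ⟨⟨by rw [hz]; simp; positivity, by rw [hz]; linarith⟩, by rw [hz], by rw [hz]⟩
    have hzs : ‖z - s‖ ≤ 1 / (256 * D ^ 5) := by
      have : z - s = ((1 + 1 / (256 * D ^ 5) - s.re : ℝ) : ℂ) := by
        apply Complex.ext
        · rw [Complex.sub_re, Complex.ofReal_re]
        · rw [Complex.sub_im, Complex.ofReal_im, ht, hz, sub_self]
      rw [this, Complex.norm_real, Real.norm_of_nonneg (by linarith)]
      linarith
    have h5 : ‖charL χ z - charL χ s‖ ≤ 1 / (256 * D ^ 4) := by
      refine hmv.trans ((mul_le_mul_of_nonneg_left hzs (by linarith)).trans (le_of_eq ?_))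
      field_simp
    have h6 := norm_sub_norm_le (charL χ z) (charL χ s)
    have h7 : 1 / (128 * D ^ 4) = 1 / (256 * D ^ 4) + 1 / (256 * D ^ 4) := by field_simp; norm_num
    linarith

lemma charMean_one_ge {q : ℕ} [NeZero q] : 1 / (q:ℝ) ≤ ‖charMean (1 : DirichletCharacter ℂ q)‖ := by
  have hq : (0:ℝ) < q := by exact_mod_cast NeZero.pos q
  rw [charMean, norm_div, Complex.norm_natCast]
  gcongr
  have : ∑ a : ZMod q, (1 : DirichletCharacter ℂ q) a = ((Nat.card (ZMod q)ˣ : ℕ) : ℂ) := by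
    rw [MulChar.sum_one_eq_card_units, Nat.card_eq_fintype_card]
  rw [this, Complex.norm_natCast]
  exact_mod_cast Nat.card_pos

set_option maxHeartbeats 400000 in
/-- The derivative of `1 / L(s, χ)` grows at most polynomially in the modulus and in `s`. -/
theorem norm_deriv_charL_le_sq {q : ℕ} [NeZero q] (χ : DirichletCharacter ℂ q) {s : ℂ} (hs : 1 < s.re) (hs2 : s.re ≤ 2) :
    ‖deriv (charL χ) s‖ ≤ 10 ^ 120 * q ^ 36 * ‖s‖ ^ 9 * ‖charL χ s‖ ^ 2 := by
  have hq : (1:ℝ) ≤ q := by exact_mod_cast NeZero.pos q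
  have hn : 1 ≤ ‖s‖ := hs.le.trans ((le_abs_self _).trans (Complex.abs_re_le_norm s))
  set τ : ℝ := 1 / (10 ^ 5 * q ^ 2) with hτ
  have hτ0 : 0 < τ := by positivity
  have hτ1 : τ ≤ 1 := by
    rw [hτ, div_le_one (by positivity)]; nlinarith
  have hnorm : ∀ w : ℂ, 1 < w.re → w.re ≤ 2 → ‖w‖ ≤ 2 + |w.im| := by
    intro w h1 h2
    refine (Complex.norm_le_abs_re_add_abs_im w).trans ?_
    rw [abs_of_pos (by linarith)]; linarith
  have ht_le : |s.im| ≤ ‖s‖ := Complex.abs_im_le_norm s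
  set D : ℝ := 10 ^ 11 * q ^ 4 * (1 + |s.im|) with hD
  have hq4 : (q:ℝ) ≤ q ^ 4 := le_self_pow₀ hq (by norm_num)
  have hq41 : (1:ℝ) ≤ q ^ 4 := one_le_pow₀ hq
  have hD1 : 1 ≤ D := by
    rw [hD]
    have := abs_nonneg s.im
    nlinarith
  have hDs : D ≤ 2 * 10 ^ 11 * q ^ 4 * ‖s‖ := by
    have : 1 + |s.im| ≤ 2 * ‖s‖ := by linarith
    calc D ≤ 10 ^ 11 * q ^ 4 * (2 * ‖s‖) := by rw [hD]; gcongr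
      _ = _ := by ring
  have hτinv : 1 / τ ^ 2 = 10 ^ 10 * q ^ 4 := by rw [hτ, div_pow, one_pow, one_div_one_div]; ring
  have hτinv1 : 1 / τ ≤ 10 ^ 10 * q ^ 4 := by
    rw [hτ, one_div_one_div]
    have : (q:ℝ) ^ 2 ≤ q ^ 4 := pow_le_pow_right₀ hq (by norm_num)
    linarith
  have hDlow : ∀ c : ℝ, c ≤ 10 ^ 10 * q ^ 4 → c + 24 * q * (2 + 2 * |s.im|) ≤ D := by
    intro c hc
    rw [hD]
    have := abs_nonneg s.im
    nlinarith [mul_nonneg (sub_nonneg.2 hq4) this]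
  by_cases hgood : τ ≤ |s.im| ∨ (χ ≠ 1 ∧ χ ^ 2 ≠ 1)
  · have hd : ∀ w : ℂ, 1 < w.re → w.re ≤ 2 → w.im = s.im → ‖deriv (charL χ) w‖ ≤ D := by
      intro w hw hw2 hwt
      have hw0 : ‖charMean χ‖ / ‖w - 1‖ ^ 2 ≤ 10 ^ 10 * q ^ 4 := by
        rcases hgood with h | h
        · rw [← hτinv]
          have : τ ≤ ‖w - 1‖ := by
            refine h.trans (le_trans (le_of_eq ?_) (Complex.abs_im_le_norm _))
            simp [hwt]
          gcongr
          exact norm_charMean_le χ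
        · rw [charMean_eq_zero h.1, norm_zero, zero_div]; positivity
      refine (norm_deriv_charL_le χ hw).trans (le_trans ?_ (hDlow _ hw0))
      have := hnorm w hw hw2
      rw [hwt] at this
      have := abs_nonneg s.im
      gcongr
      linarith
    have h2 : ∀ w : ℂ, 1 < w.re → w.re ≤ 2 → w.im = 2 * s.im → ‖charL (χ ^ 2) w‖ ≤ D := by
      intro w hw hw2 hwt
      have hw0 : ‖charMean (χ ^ 2)‖ / ‖w - 1‖ ≤ 10 ^ 10 * q ^ 4 := by
        rcases hgood with h | h
        · refine le_trans ?_ hτinv1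
          have : τ ≤ ‖w - 1‖ := by
            refine h.trans (le_trans ?_ (Complex.abs_im_le_norm _))
            simp only [Complex.sub_im, Complex.one_im, sub_zero, hwt, abs_mul, abs_two]
            linarith [abs_nonneg s.im]
          gcongr
          exact norm_charMean_le _
        · rw [charMean_eq_zero h.2, norm_zero, zero_div]; positivity
      refine (norm_charL_le (χ ^ 2) hw).trans (le_trans ?_ (hDlow _ hw0))
      have := hnorm w hw hw2
      rw [hwt, abs_mul, abs_two] at this
      gcongr
      norm_num
    have hlow := norm_charL_ge_of_bounds χ s.im D hD1 hd h2 hs hs2 rfl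
    calc ‖deriv (charL χ) s‖ ≤ D := hd s hs hs2 rfl
      _ = 2 ^ 16 * D ^ 9 * (1 / (256 * D ^ 4)) ^ 2 := by field_simp; norm_num
      _ ≤ 2 ^ 16 * (2 * 10 ^ 11 * q ^ 4 * ‖s‖) ^ 9 * ‖charL χ s‖ ^ 2 := by gcongr
      _ = 2 ^ 16 * (2 * 10 ^ 11) ^ 9 * q ^ 36 * ‖s‖ ^ 9 * ‖charL χ s‖ ^ 2 := by ring
      _ ≤ _ := by gcongr; norm_num
  · push Not at hgood
    obtain ⟨htτ, hχ⟩ := hgood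
    have hfin : ∀ c : ℝ, 0 ≤ c → c ≤ 10 ^ 120 * q ^ 36 → ‖deriv (charL χ) s‖ ≤ c * ‖charL χ s‖ ^ 2 →
        ‖deriv (charL χ) s‖ ≤ 10 ^ 120 * q ^ 36 * ‖s‖ ^ 9 * ‖charL χ s‖ ^ 2 := by
      intro c hc hc' h
      refine h.trans ?_
      have : 1 ≤ ‖s‖ ^ 9 := one_le_pow₀ hn
      refine mul_le_mul_of_nonneg_right (hc'.trans (le_mul_of_one_le_right (by positivity) this)) (by positivity)
    have hs3 : ‖s‖ ≤ 3 := (hnorm s hs hs2).trans (by linarith)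
    have hq36 : ∀ k ≤ 36, (q:ℝ) ^ k ≤ q ^ 36 := fun k hk => pow_le_pow_right₀ hq hk
    rcases le_or_gt τ (s.re - 1) with hfar | hnear
    · have h1 := norm_charL_ge_of_one_lt χ hs
      have h2 : τ / 2 ≤ ‖charL χ s‖ := by
        refine le_trans ?_ h1
        gcongr
      have h3 : τ ≤ ‖s - 1‖ := by
        refine hfar.trans (le_trans (le_abs_self _) (le_trans (le_of_eq ?_) (Complex.abs_re_le_norm _)))
        simp
      have h4 : ‖deriv (charL χ) s‖ ≤ 10 ^ 11 * q ^ 4 := by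
        refine (norm_deriv_charL_le χ hs).trans ?_
        have : ‖charMean χ‖ / ‖s - 1‖ ^ 2 ≤ 10 ^ 10 * q ^ 4 := by
          rw [← hτinv]; gcongr; exact norm_charMean_le χ
        nlinarith
      refine hfin (4 * 10 ^ 21 * q ^ 8) (by positivity) ?_ ?_
      · exact mul_le_mul (by norm_num) (hq36 8 (by norm_num)) (by positivity) (by positivity)
      · calc _ ≤ 10 ^ 11 * (q:ℝ) ^ 4 := h4
          _ = 4 * 10 ^ 11 * q ^ 4 * (1 / τ ^ 2) * (τ / 2) ^ 2 := by field_simp; norm_num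
          _ = 4 * 10 ^ 21 * q ^ 8 * (τ / 2) ^ 2 := by rw [hτinv]; ring
          _ ≤ _ := by gcongr
    · have hs1 : ‖s - 1‖ ≤ 2 * τ := by
        refine (Complex.norm_le_abs_re_add_abs_im _).trans ?_
        rw [Complex.sub_re, Complex.sub_im, Complex.one_re, Complex.one_im, sub_zero, abs_of_pos (by linarith)]
        linarith
      have hs0 : 0 < ‖s - 1‖ := norm_pos_iff.2 (sub_one_ne_zero_of_re hs)
      by_cases hχ1 : χ = 1
      · subst hχ1
        set κ := ‖charMean (1 : DirichletCharacter ℂ q)‖ with hκ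
        have hκq : 1 / (q:ℝ) ≤ κ := charMean_one_ge
        have hκ0 : 0 < κ := lt_of_lt_of_le (by positivity) hκq
        have hk1 : 48 * q ≤ κ / ‖s - 1‖ := by
          rw [le_div_iff₀ hs0]
          calc 48 * q * ‖s - 1‖ ≤ 48 * q * (2 * τ) := by gcongr
            _ = (96 / 10 ^ 5) * (1 / q) := by rw [hτ]; field_simp; norm_num
            _ ≤ 1 * (1 / q) := by gcongr; norm_num
            _ ≤ κ := by rw [one_mul]; exact hκq
        have h1 : κ / ‖s - 1‖ / 2 ≤ ‖charL (1 : DirichletCharacter ℂ q) s‖ := by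
          rw [charL_eq (1 : DirichletCharacter ℂ q) hs]
          have a := norm_sub_norm_le (charMean (1 : DirichletCharacter ℂ q) / (s - 1)) (-charReg (1 : DirichletCharacter ℂ q) s)
          rw [sub_neg_eq_add, norm_neg, norm_div, ← hκ] at a
          have b := norm_charReg_le (1 : DirichletCharacter ℂ q) (s := s) (by linarith)
          nlinarith
        have h2 : ‖deriv (charL (1 : DirichletCharacter ℂ q)) s‖ ≤ 3 * κ / ‖s - 1‖ ^ 2 := by
          refine (norm_deriv_charL_le (1 : DirichletCharacter ℂ q) hs).trans ?_
          have c : κ / ‖s - 1‖ ≤ κ / ‖s - 1‖ ^ 2 := by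
            refine div_le_div_of_nonneg_left hκ0.le (by positivity) ?_
            refine pow_le_of_le_one hs0.le ?_ (by norm_num)
            refine hs1.trans ?_
            rw [hτ, mul_one_div, div_le_one (by positivity)]; nlinarith
          have : 24 * q * ‖s‖ ≤ 2 * (κ / ‖s - 1‖) := by nlinarith
          have e : 3 * κ / ‖s - 1‖ ^ 2 = κ / ‖s - 1‖ ^ 2 + 2 * (κ / ‖s - 1‖ ^ 2) := by ring
          rw [e]
          linarith
        refine hfin (12 * q) (by positivity) ?_ ?_
        · refine mul_le_mul (by norm_num) ?_ (by positivity) (by positivity)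
          simpa using hq36 1 (by norm_num)
        · calc _ ≤ 3 * κ / ‖s - 1‖ ^ 2 := h2
            _ = 12 * (1 / κ) * (κ / ‖s - 1‖ / 2) ^ 2 := by field_simp; norm_num
            _ ≤ 12 * q * (κ / ‖s - 1‖ / 2) ^ 2 := by
                gcongr
                rw [div_le_iff₀ hκ0]
                rw [div_le_iff₀ (by positivity)] at hκq
                linarith
            _ ≤ _ := by gcongr
      · have hreg := norm_charReg_one_ge hχ1 (hχ hχ1)
        have hL : charL χ s = charReg χ s := by rw [charL_eq χ hs, charMean_eq_zero hχ1, zero_div, zero_add]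
        have hconv : Convex ℝ ({w : ℂ | 1 ≤ w.re} ∩ Metric.closedBall 0 3) :=
          (convex_halfSpace_re_ge 1).inter (convex_closedBall (0:ℂ) 3)
        have hmv := hconv.norm_image_sub_le_of_norm_deriv_le (f := charReg χ) (C := 72 * q) (x := s) (y := 1)
          (fun w hw => differentiableAt_charReg χ (by have h0 : (1:ℝ) ≤ w.re := hw.1; linarith))
          (fun w hw => (norm_deriv_charReg_le χ hw.1).trans (by
            have := hw.2
            rw [mem_closedBall_zero_iff] at this
            nlinarith)) ⟨hs.le, by simpa using hs3⟩ ⟨by simp, by simp⟩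
        have h1 : 1 / (200 * q) ≤ ‖charL χ s‖ := by
          rw [hL]
          have a := norm_sub_norm_le (charReg χ 1) (charReg χ s)
          have b : 72 * q * ‖1 - s‖ ≤ (144 / 10 ^ 5) * (1 / q) := by
            rw [norm_sub_rev]
            calc 72 * q * ‖s - 1‖ ≤ 72 * q * (2 * τ) := by gcongr
              _ = _ := by rw [hτ]; field_simp; norm_num
          have e1 : 1 / (128 * (q:ℝ)) = (1 / 128) * (1 / q) := by field_simp
          have e2 : 1 / (200 * (q:ℝ)) = (1 / 200) * (1 / q) := by field_simp
          rw [e1] at hreg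
          rw [e2]
          have : 0 < 1 / (q:ℝ) := by positivity
          linarith
        have h2 : ‖deriv (charL χ) s‖ ≤ 72 * q := by
          refine (norm_deriv_charL_le χ hs).trans ?_
          rw [charMean_eq_zero hχ1, norm_zero, zero_div, zero_add]
          nlinarith
        refine hfin (72 * 200 ^ 2 * q ^ 3) (by positivity) ?_ ?_
        · exact mul_le_mul (by norm_num) (hq36 3 (by norm_num)) (by positivity) (by positivity)
        · calc _ ≤ 72 * (q:ℝ) := h2
            _ = 72 * 200 ^ 2 * q ^ 3 * (1 / (200 * q)) ^ 2 := by field_simp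
            _ ≤ _ := by gcongr

/-! ### Mellin inversion and sums of the Möbius function twisted by characters -/

/-- The smooth cutoff `(1 - y)₊ ^ 10`. -/
def smoothCut (y : ℝ) : ℂ := ((max (1 - y) 0 ^ 10 : ℝ) : ℂ)

/-- The Mellin transform of `smoothCut`. -/
def cutTransform (s : ℂ) : ℂ := (Nat.factorial 10 : ℂ) / ∏ j ∈ range 11, (s + j)

lemma continuous_smoothCut : Continuous smoothCut := by
  unfold smoothCut; fun_prop

lemma smoothCut_cpow_eq (s : ℂ) (t : ℝ) :
    (t : ℂ) ^ (s - 1) • smoothCut t =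
      Set.indicator (Set.Iic 1) (fun t : ℝ => (t : ℂ) ^ (s - 1) * (1 - (t : ℂ)) ^ ((10 + 1 : ℂ) - 1)) t := by
  by_cases h : t ∈ Set.Iic (1 : ℝ)
  · rw [Set.indicator_of_mem h, smul_eq_mul, smoothCut, max_eq_left (by simpa using h)]
    congr 1
    rw [add_sub_cancel_right]
    push_cast
    exact (Complex.cpow_natCast _ 10).symm
  · rw [Set.indicator_of_notMem h, smoothCut, max_eq_right (by simp at h; linarith)]
    simp

lemma hasMellin_smoothCut {s : ℂ} (hs : 0 < s.re) : HasMellin smoothCut s (cutTransform s) := by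
  have hset : Set.Ioi (0:ℝ) ∩ Set.Iic 1 = Set.Ioc 0 1 := Set.Ioi_inter_Iic
  constructor
  · rw [MellinConvergent]
    simp_rw [smoothCut_cpow_eq]
    rw [MeasureTheory.IntegrableOn, MeasureTheory.integrable_indicator_iff measurableSet_Iic, MeasureTheory.IntegrableOn,
      MeasureTheory.Measure.restrict_restrict measurableSet_Iic, Set.inter_comm, hset]
    have := Complex.betaIntegral_convergent hs (v := 10 + 1) (by norm_num)
    rwa [intervalIntegrable_iff_integrableOn_Ioc_of_le zero_le_one] at this
  · rw [mellin]
    simp_rw [smoothCut_cpow_eq]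
    rw [MeasureTheory.setIntegral_indicator measurableSet_Iic, hset, ← intervalIntegral.integral_of_le zero_le_one]
    have := Complex.betaIntegral_eval_nat_add_one_right hs 10
    rw [Complex.betaIntegral] at this
    rw [cutTransform]
    exact_mod_cast this

lemma norm_cutTransform_le {s : ℂ} (hs : 0 < s.re) : ‖cutTransform s‖ ≤ Nat.factorial 10 / ‖s‖ ^ 11 := by
  have hs0 : 0 < ‖s‖ := norm_pos_iff.2 fun h => by simp [h] at hs
  rw [cutTransform, norm_div, Complex.norm_natCast]
  gcongr
  rw [norm_prod]
  calc ‖s‖ ^ 11 = ∏ j ∈ range 11, ‖s‖ := by rw [prod_const, card_range]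
    _ ≤ _ := by
        refine prod_le_prod (fun _ _ => norm_nonneg _) fun j _ => ?_
        refine (sq_le_sq₀ (norm_nonneg _) (norm_nonneg _)).1 ?_
        rw [← Complex.normSq_eq_norm_sq, ← Complex.normSq_eq_norm_sq, Complex.normSq_apply, Complex.normSq_apply]
        simp only [Complex.add_re, Complex.natCast_re, Complex.add_im, Complex.natCast_im, add_zero]
        have : (0:ℝ) ≤ j := by positivity
        nlinarith

lemma continuous_cutTransform_line {σ : ℝ} (hσ : 0 < σ) :
    Continuous fun t : ℝ => cutTransform (σ + t * Complex.I) := by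
  unfold cutTransform
  refine Continuous.div continuous_const (by fun_prop) fun t => ?_
  rw [prod_ne_zero_iff]
  intro j _ h
  have := congrArg Complex.re h
  simp at this
  have : (0:ℝ) ≤ j := by positivity
  linarith

lemma norm_line_sq {σ : ℝ} (hσ : 1 ≤ σ) (t : ℝ) : 1 + t ^ 2 ≤ ‖(σ + t * Complex.I : ℂ)‖ ^ 2 := by
  rw [← Complex.normSq_eq_norm_sq, Complex.normSq_apply]
  simp
  nlinarith

lemma norm_cutTransform_line_le {σ : ℝ} (hσ : 1 ≤ σ) (t : ℝ) :
    ‖(σ + t * Complex.I : ℂ)‖ ^ 9 * ‖cutTransform (σ + t * Complex.I)‖ ≤ Nat.factorial 10 * (1 + t ^ 2)⁻¹ := by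
  have h := norm_cutTransform_le (s := σ + t * Complex.I) (by simp; linarith)
  have h2 := norm_line_sq hσ t
  have hpos : 0 < ‖(σ + t * Complex.I : ℂ)‖ := norm_pos_iff.2 fun h => by
    have := congrArg Complex.re h
    simp at this; linarith
  calc _ ≤ ‖(σ + t * Complex.I : ℂ)‖ ^ 9 * (Nat.factorial 10 / ‖(σ + t * Complex.I : ℂ)‖ ^ 11) := by gcongr
    _ = Nat.factorial 10 * (‖(σ + t * Complex.I : ℂ)‖ ^ 2)⁻¹ := by field_simp
    _ ≤ _ := by gcongr

lemma norm_cutTransform_line_le' {σ : ℝ} (hσ : 1 ≤ σ) (t : ℝ) :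
    ‖cutTransform (σ + t * Complex.I)‖ ≤ Nat.factorial 10 * (1 + t ^ 2)⁻¹ := by
  refine le_trans (le_mul_of_one_le_left (norm_nonneg _) (one_le_pow₀ ?_)) (norm_cutTransform_line_le hσ t)
  have h2 := norm_line_sq hσ t
  nlinarith [sq_nonneg t, norm_nonneg (σ + t * Complex.I : ℂ)]

lemma integrable_cutTransform {σ : ℝ} (hσ : 1 ≤ σ) :
    MeasureTheory.Integrable fun t : ℝ => cutTransform (σ + t * Complex.I) := by
  refine MeasureTheory.Integrable.mono' (integrable_inv_one_add_sq.const_mul (Nat.factorial 10 : ℝ))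
    (continuous_cutTransform_line (by linarith)).aestronglyMeasurable (Filter.Eventually.of_forall fun t => ?_)
  exact norm_cutTransform_line_le' hσ t

lemma smoothCut_eq_integral {σ : ℝ} (hσ : 1 ≤ σ) {u : ℝ} (hu : 0 < u) :
    smoothCut u = (1 / (2 * Real.pi)) • ∫ t : ℝ, (u : ℂ) ^ (-(σ + t * Complex.I)) • cutTransform (σ + t * Complex.I) := by
  have hre : ∀ t : ℝ, 0 < (σ + t * Complex.I : ℂ).re := fun t => by simp; linarith
  have hm : ∀ t : ℝ, mellin smoothCut (σ + t * Complex.I) = cutTransform (σ + t * Complex.I) :=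
    fun t => (hasMellin_smoothCut (hre t)).2
  have h := mellinInv_mellin_eq σ smoothCut hu (hasMellin_smoothCut (by simp; linarith)).1 ?_ continuous_smoothCut.continuousAt
  · rw [← h, mellinInv]
    simp_rw [hm]
  · rw [Complex.VerticalIntegrable]
    simp_rw [hm]
    exact integrable_cutTransform hσ

/-- The coefficients `log n · χ(n) μ(n)`. -/
def logMuChar {q : ℕ} (χ : DirichletCharacter ℂ q) : ℕ → ℂ :=
  LSeries.logMul ((fun n : ℕ => χ n) * fun n => (ArithmeticFunction.moebius n : ℂ))

lemma abscissa_moebius_char_le {q : ℕ} (χ : DirichletCharacter ℂ q) {s : ℂ} (hs : 1 < s.re) :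
    LSeries.abscissaOfAbsConv ((fun n : ℕ => χ n) * fun n => (ArithmeticFunction.moebius n : ℂ)) < s.re := by
  refine lt_of_le_of_lt (LSeries.abscissaOfAbsConv_le_of_forall_lt_LSeriesSummable (x := 1) fun y hy => ?_)
    (by exact_mod_cast hs)
  exact LSeriesSummable_of_bounded_of_one_lt_re (m := 1) (fun n _ => norm_moebius_char_le χ n) (by simpa using hy)

lemma norm_LSeries_logMuChar_le {q : ℕ} [NeZero q] (χ : DirichletCharacter ℂ q) {s : ℂ} (hs : 1 < s.re) (hs2 : s.re ≤ 2) :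
    ‖LSeries (logMuChar χ) s‖ ≤ 10 ^ 120 * q ^ 36 * ‖s‖ ^ 9 := by
  have h1 := LSeries_hasDerivAt (abscissa_moebius_char_le χ hs)
  have hL0 : charL χ s ≠ 0 := fun h => by simpa [h] using charL_mul_charM χ hs
  have h2 : HasDerivAt (charM χ) (-deriv (charL χ) s / charL χ s ^ 2) s := by
    refine ((hasDerivAt_charL χ hs).differentiableAt.hasDerivAt.inv hL0).congr_of_eventuallyEq ?_
    filter_upwards [(isOpen_lt continuous_const Complex.continuous_re).mem_nhds hs] with z hz
    exact (eq_inv_of_mul_eq_one_right (charL_mul_charM χ hz))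
  have h3 : -LSeries (logMuChar χ) s = -deriv (charL χ) s / charL χ s ^ 2 := h1.unique h2
  rw [← norm_neg, h3, norm_div, norm_neg, norm_pow, div_le_iff₀ (by positivity)]
  exact norm_deriv_charL_le_sq χ hs hs2

/-- The smoothed sum of `log n · χ(n) μ(n)`. -/
theorem norm_smooth_sum_le {q : ℕ} [NeZero q] (χ : DirichletCharacter ℂ q) {x : ℝ} (hx : Real.exp 1 ≤ x) :
    ‖∑' n : ℕ, logMuChar χ n * smoothCut (n / x)‖ ≤ 10 ^ 128 * q ^ 36 * x := by
  have hx0 : 0 < x := (Real.exp_pos 1).trans_le hx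
  have hlog : 1 ≤ Real.log x := by rwa [Real.le_log_iff_exp_le hx0]
  set σ : ℝ := 1 + 1 / Real.log x with hσ
  have hσ1 : 1 < σ := by rw [hσ]; have : 0 < 1 / Real.log x := by positivity
                         linarith
  have hσ2 : σ ≤ 2 := by
    rw [hσ]
    have : 1 / Real.log x ≤ 1 := by rw [div_le_one (by linarith)]; exact hlog
    linarith
  have hxσ : x ^ σ = Real.exp 1 * x := by
    rw [hσ, Real.rpow_add hx0, Real.rpow_one, Real.rpow_def_of_pos hx0, mul_one_div_cancel (by linarith), mul_comm]
  set b := logMuChar χ with hb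
  set F : ℕ → ℝ → ℂ := fun n t => LSeries.term b (σ + t * Complex.I) n * ((x : ℂ) ^ (σ + t * Complex.I : ℂ) *
    cutTransform (σ + t * Complex.I)) with hF
  have hb0 : b 0 = 0 := by simp [hb, logMuChar, LSeries.logMul]
  have hsumσ : LSeriesSummable b σ := LSeriesSummable_logMul_of_lt_re (abscissa_moebius_char_le χ (by simpa using hσ1))
  have hterm : ∀ n (t : ℝ), ‖LSeries.term b (σ + t * Complex.I) n‖ = ‖LSeries.term b σ n‖ := by
    intro n t
    rw [LSeries.norm_term_eq, LSeries.norm_term_eq]; simp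
  have hxn : ∀ t : ℝ, ‖(x : ℂ) ^ (σ + t * Complex.I : ℂ)‖ = x ^ σ := by
    intro t
    rw [Complex.norm_cpow_eq_rpow_re_of_pos hx0]; simp
  have hFn : ∀ n t, ‖F n t‖ = ‖LSeries.term b σ n‖ * x ^ σ * ‖cutTransform (σ + t * Complex.I)‖ := by
    intro n t
    rw [hF]; simp only
    rw [norm_mul, norm_mul, hterm, hxn, mul_assoc]
  have hFint : ∀ n, MeasureTheory.Integrable (F n) := by
    intro n
    refine MeasureTheory.Integrable.mono' (((integrable_cutTransform hσ1.le).norm).const_mul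
      (‖LSeries.term b σ n‖ * x ^ σ)) ?_ (Filter.Eventually.of_forall fun t => (hFn n t).le)
    refine Continuous.aestronglyMeasurable ?_
    refine Continuous.mul ?_ (Continuous.mul ?_ (continuous_cutTransform_line (by linarith)))
    · rcases eq_or_ne n 0 with h | h
      · simp only [h, LSeries.term_zero]; fun_prop
      · simp only [LSeries.term_of_ne_zero h]
        have hn : (n : ℂ) ≠ 0 := by exact_mod_cast h
        refine Continuous.div continuous_const ?_ fun t => ?_
        · exact Continuous.const_cpow (by fun_prop) (Or.inl hn)
        · simp [Complex.cpow_eq_zero_iff, hn]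
    · exact Continuous.const_cpow (by fun_prop) (Or.inl (by exact_mod_cast hx0.ne'))
  have hFsum : Summable fun n => ∫ t, ‖F n t‖ := by
    simp_rw [hFn, MeasureTheory.integral_const_mul]
    exact ((hsumσ.norm.mul_right _)).mul_right _
  have hswap := MeasureTheory.integral_tsum_of_summable_integral_norm hFint hFsum
  have hval : ∀ n, (1 / (2 * Real.pi)) • ∫ t, F n t = b n * smoothCut (n / x) := by
    intro n
    rcases eq_or_ne n 0 with h | h
    · simp [h, hF, hb0]
    · have hn : (0:ℝ) < n := by exact_mod_cast Nat.pos_of_ne_zero h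
      have hn' : (n : ℂ) ≠ 0 := by exact_mod_cast h
      rw [smoothCut_eq_integral hσ1.le (div_pos hn hx0), mul_smul_comm, ← MeasureTheory.integral_const_mul]
      congr 2
      funext t
      rw [hF]
      simp only [LSeries.term_of_ne_zero h, smul_eq_mul]
      rw [Complex.ofReal_div, Complex.div_cpow_ofReal_nonneg hn.le hx0.le, Complex.cpow_neg, Complex.cpow_neg,
        Complex.ofReal_natCast]
      have h1 : (n : ℂ) ^ (σ + t * Complex.I : ℂ) ≠ 0 := by simp [Complex.cpow_eq_zero_iff, hn']
      have h2 : (x : ℂ) ^ (σ + t * Complex.I : ℂ) ≠ 0 := by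
        simp [Complex.cpow_eq_zero_iff, hx0.ne']
      field_simp
  have htot : ∑' n : ℕ, b n * smoothCut (n / x) = (1 / (2 * Real.pi)) • ∫ t, ∑' n, F n t := by
    rw [← hswap, ← tsum_const_smul'']
    exact tsum_congr fun n => (hval n).symm
  rw [htot, norm_smul, Real.norm_of_nonneg (by positivity)]
  have hb1 : ‖∫ t, ∑' n, F n t‖ ≤ ∫ t : ℝ, (10 ^ 120 * q ^ 36 * x ^ σ * Nat.factorial 10) * (1 + t ^ 2)⁻¹ := by
    refine MeasureTheory.norm_integral_le_of_norm_le (integrable_inv_one_add_sq.const_mul _)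
      (Filter.Eventually.of_forall fun t => ?_)
    rw [hF]
    simp only
    rw [tsum_mul_right, norm_mul, norm_mul, hxn]
    have h1 := norm_LSeries_logMuChar_le χ (s := σ + t * Complex.I) (by simpa using hσ1) (by simpa using hσ2)
    rw [LSeries] at h1
    calc _ ≤ (10 ^ 120 * q ^ 36 * ‖(σ + t * Complex.I : ℂ)‖ ^ 9) * (x ^ σ * ‖cutTransform (σ + t * Complex.I)‖) :=
          mul_le_mul_of_nonneg_right h1 (by positivity)
      _ = 10 ^ 120 * q ^ 36 * x ^ σ * (‖(σ + t * Complex.I : ℂ)‖ ^ 9 * ‖cutTransform (σ + t * Complex.I)‖) := by ring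
      _ ≤ 10 ^ 120 * q ^ 36 * x ^ σ * (Nat.factorial 10 * (1 + t ^ 2)⁻¹) := by
          exact mul_le_mul_of_nonneg_left (norm_cutTransform_line_le hσ1.le t)
            (mul_nonneg (mul_nonneg (pow_nonneg (by norm_num) _) (pow_nonneg (Nat.cast_nonneg q) _)) (Real.rpow_nonneg hx0.le _))
      _ = _ := by ring
  rw [MeasureTheory.integral_const_mul, integral_univ_inv_one_add_sq] at hb1
  calc _ ≤ 1 / (2 * Real.pi) * (10 ^ 120 * q ^ 36 * x ^ σ * Nat.factorial 10 * Real.pi) := by gcongr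
    _ = (10 ^ 120 * Nat.factorial 10 * Real.exp 1 / 2) * q ^ 36 * x := by
        rw [hxσ]; field_simp
    _ ≤ _ := by
        gcongr
        have : Real.exp 1 ≤ 3 := Real.exp_one_lt_d9.le.trans (by norm_num)
        have e : (Nat.factorial 10 : ℝ) = 3628800 := by norm_num [Nat.factorial]
        rw [e]
        nlinarith

/-- A weight equal to `1` on `y ≥ 0` and to `0` on `y ≤ -10 h`. -/
def cutWeight (h y : ℝ) : ℝ :=
  (∑ i ∈ range 11, (-1) ^ i * (Nat.choose 10 i : ℝ) * max (y + i * h) 0 ^ 10) / (Nat.factorial 10 * h ^ 10)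

lemma cutWeight_of_nonneg {h y : ℝ} (hh : 0 < h) (hy : 0 ≤ y) : cutWeight h y = 1 := by
  have e : ∀ i ∈ range 11, (-1) ^ i * (Nat.choose 10 i : ℝ) * max (y + i * h) 0 ^ 10 =
      (-1) ^ i * (Nat.choose 10 i : ℝ) * (y + i * h) ^ 10 := by
    intro i _
    rw [max_eq_left (by positivity)]
  rw [cutWeight, sum_congr rfl e, div_eq_one_iff_eq (by positivity)]
  simp only [sum_range_succ, range_zero, sum_empty, Nat.choose, Nat.factorial]
  push_cast
  ring

lemma cutWeight_of_le {h y : ℝ} (hh : 0 < h) (hy : y ≤ -(10 * h)) : cutWeight h y = 0 := by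
  have e : ∀ i ∈ range 11, (-1) ^ i * (Nat.choose 10 i : ℝ) * max (y + i * h) 0 ^ 10 = 0 := by
    intro i hi
    have hi' : (i : ℝ) ≤ 10 := by
      rw [mem_range] at hi
      exact_mod_cast Nat.lt_succ_iff.1 hi
    rw [max_eq_right (by nlinarith)]
    simp
  rw [cutWeight, sum_eq_zero e, zero_div]

lemma abs_cutWeight_le {h y : ℝ} (hh : 0 < h) (hy : y ≤ 0) : |cutWeight h y| ≤ 10 ^ 14 := by
  rw [cutWeight, abs_div, abs_of_pos (by positivity : (0:ℝ) < Nat.factorial 10 * h ^ 10), div_le_iff₀ (by positivity)]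
  have hterm : ∀ i ∈ range 11, |(-1) ^ i * (Nat.choose 10 i : ℝ) * max (y + i * h) 0 ^ 10| ≤
      (Nat.choose 10 i : ℝ) * (10 * h) ^ 10 := by
    intro i hi
    have hi' : (i : ℝ) ≤ 10 := by
      rw [mem_range] at hi
      exact_mod_cast Nat.lt_succ_iff.1 hi
    rw [abs_mul, abs_mul, abs_pow, abs_neg, abs_one, one_pow, one_mul, Nat.abs_cast, abs_of_nonneg (by positivity)]
    gcongr
    exact max_le (by nlinarith) (by positivity)
  refine (abs_sum_le_sum_abs _ _).trans ((sum_le_sum hterm).trans ?_)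
  have hc : ∑ i ∈ range 11, (Nat.choose 10 i : ℝ) = 1024 := by
    have := Nat.sum_range_choose 10
    exact_mod_cast this
  rw [← sum_mul, hc, mul_pow]
  have h10 : 0 < h ^ 10 := by positivity
  have e : (1:ℝ) ≤ Nat.factorial 10 := by exact_mod_cast Nat.one_le_iff_ne_zero.2 (Nat.factorial_ne_zero 10)
  nlinarith [mul_le_mul_of_nonneg_right e h10.le]

lemma norm_logMuChar_le {q : ℕ} (χ : DirichletCharacter ℂ q) (n : ℕ) :
    ‖logMuChar χ n‖ ≤ Real.log n := by
  have hlog : 0 ≤ Real.log n := Real.log_natCast_nonneg n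
  rw [logMuChar, LSeries.logMul, norm_mul, ← Complex.natCast_log, Complex.norm_real, Real.norm_of_nonneg hlog]
  exact mul_le_of_le_one_right hlog (norm_moebius_char_le χ n)

lemma norm_sum_cutWeight_le {q : ℕ} [NeZero q] (χ : DirichletCharacter ℂ q) {X : ℕ} (hX : 3 ≤ X) {h : ℝ} (hh : 0 < h)
    (hhX : h ≤ X) :
    ‖∑ n ∈ range (11 * X + 1), logMuChar χ n * (cutWeight h (X - n) : ℂ)‖ ≤ 10 ^ 145 * q ^ 36 * X * (X / h) ^ 10 := by
  have hX0 : (0:ℝ) < X := by exact_mod_cast (by omega : 0 < X)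
  have hy : ∀ i ∈ range 11, Real.exp 1 ≤ X + i * h ∧ X + i * h ≤ 11 * X := by
    intro i hi
    have hi' : (i : ℝ) ≤ 10 := by
      rw [mem_range] at hi
      exact_mod_cast Nat.lt_succ_iff.1 hi
    have h1 : Real.exp 1 ≤ 3 := Real.exp_one_lt_d9.le.trans (by norm_num)
    have h2 : (3:ℝ) ≤ X := by exact_mod_cast hX
    have h3 : (0:ℝ) ≤ i * h := by positivity
    exact ⟨by linarith, by nlinarith⟩
  have hfin : ∀ i ∈ range 11, ∑' n : ℕ, logMuChar χ n * smoothCut (n / (X + i * h)) =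
      ∑ n ∈ range (11 * X + 1), logMuChar χ n * smoothCut (n / (X + i * h)) := by
    intro i hi
    refine tsum_eq_sum fun n hn => ?_
    rw [mem_range, not_lt] at hn
    have h1 : (11 * X + 1 : ℝ) ≤ n := by exact_mod_cast hn
    have h2 : 1 ≤ (n:ℝ) / (X + i * h) := by
      rw [one_le_div (by positivity)]
      linarith [(hy i hi).2]
    rw [smoothCut, max_eq_right (by linarith)]
    simp
  have hsplit : ∑ n ∈ range (11 * X + 1), logMuChar χ n * (cutWeight h (X - n) : ℂ) =
      ∑ i ∈ range 11, (((-1) ^ i * (Nat.choose 10 i : ℝ) * (X + i * h) ^ 10 / (Nat.factorial 10 * h ^ 10) : ℝ) : ℂ) *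
        ∑' n : ℕ, logMuChar χ n * smoothCut (n / (X + i * h)) := by
    symm
    rw [sum_congr rfl fun i hi => by rw [hfin i hi, mul_sum], sum_comm]
    refine sum_congr rfl fun n _ => ?_
    rw [cutWeight, sum_div, Complex.ofReal_sum, mul_sum]
    refine sum_congr rfl fun i _ => ?_
    symm
    have e : max ((X - n : ℝ) + i * h) 0 ^ 10 = (X + i * h) ^ 10 * max (1 - n / (X + i * h)) 0 ^ 10 := by
      rw [← mul_pow, mul_max_of_nonneg _ _ (by positivity), mul_zero]
      congr 2
      field_simp
      ring
    rw [e, smoothCut]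
    push_cast
    ring
  rw [hsplit]
  calc _ ≤ ∑ i ∈ range 11, (Nat.choose 10 i : ℝ) * ((11 * X) ^ 10 / h ^ 10 * (10 ^ 128 * q ^ 36 * (11 * X))) := by
        refine (norm_sum_le _ _).trans (sum_le_sum fun i hi => ?_)
        rw [norm_mul, Complex.norm_real, Real.norm_eq_abs, abs_div, abs_mul, abs_mul, abs_pow, abs_neg, abs_one, one_pow,
          one_mul, Nat.abs_cast, abs_of_nonneg (by positivity : (0:ℝ) ≤ (X + i * h) ^ 10),
          abs_of_nonneg (by positivity : (0:ℝ) ≤ Nat.factorial 10 * h ^ 10), mul_div_assoc, mul_assoc]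
        have hsm := norm_smooth_sum_le χ (hy i hi).1
        have e : (1:ℝ) ≤ Nat.factorial 10 := by exact_mod_cast Nat.one_le_iff_ne_zero.2 (Nat.factorial_ne_zero 10)
        refine mul_le_mul_of_nonneg_left (mul_le_mul ?_ (hsm.trans ?_) (norm_nonneg _) (by positivity)) (by positivity)
        · refine div_le_div₀ (by positivity) (pow_le_pow_left₀ (by positivity) (hy i hi).2 10) (by positivity) ?_
          exact le_mul_of_one_le_left (by positivity) e
        · exact mul_le_mul_of_nonneg_left (hy i hi).2
            (mul_nonneg (pow_nonneg (by norm_num) _) (pow_nonneg (Nat.cast_nonneg q) _))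
    _ = 1024 * (11 ^ 11 * 10 ^ 128) * q ^ 36 * X * (X / h) ^ 10 := by
        have hc : ∑ i ∈ range 11, (Nat.choose 10 i : ℝ) = 1024 := by
          have := Nat.sum_range_choose 10
          exact_mod_cast this
        rw [← sum_mul, hc, div_pow, mul_pow]
        ring
    _ ≤ _ := by
        have : (1024 * (11 ^ 11 * 10 ^ 128) : ℝ) ≤ 10 ^ 145 := by norm_num
        have h0 : (0:ℝ) ≤ q ^ 36 * X * (X / h) ^ 10 := by positivity
        calc _ = 1024 * (11 ^ 11 * 10 ^ 128) * (q ^ 36 * X * (X / h) ^ 10) := by ring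
          _ ≤ 10 ^ 145 * (q ^ 36 * X * (X / h) ^ 10) := mul_le_mul_of_nonneg_right this h0
          _ = _ := by ring

lemma prod_Icc_eq_factorial (n : ℕ) : ∏ k ∈ Icc 1 n, k = Nat.factorial n := by
  induction n with
  | zero => simp
  | succ n ih => rw [prod_Icc_succ_top (by omega), ih, Nat.factorial_succ, mul_comm]

/-- The prime number theorem for the Möbius function twisted by a Dirichlet character, with a
polynomial dependence on the modulus. -/
theorem norm_sum_moebius_char_le : ∃ C : ℝ, 0 < C ∧ ∀ (q : ℕ) [NeZero q] (χ : DirichletCharacter ℂ q) (X : ℕ) (δ : ℝ),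
    3 ≤ X → 0 < δ → δ ≤ 1 → ‖∑ n ∈ Icc 1 X, χ n * (ArithmeticFunction.moebius n : ℂ)‖ * Real.log X ≤
      C * X * (q ^ 36 / δ ^ 10 + δ * Real.log X) := by
  refine ⟨10 ^ 150, by positivity, fun q _ χ X δ hX hδ hδ1 => ?_⟩
  have hq : (1:ℝ) ≤ q := by exact_mod_cast NeZero.pos q
  have hX3 : (3:ℝ) ≤ X := by exact_mod_cast hX
  have hX0 : (0:ℝ) < X := by linarith
  have hlog1 : 1 ≤ Real.log X := by
    rw [Real.le_log_iff_exp_le hX0]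
    exact Real.exp_one_lt_d9.le.trans (by linarith)
  set h := δ * X with hh
  have hh0 : 0 < h := by positivity
  have hhX : h ≤ X := by rw [hh]; nlinarith
  set b := logMuChar χ with hb
  have hS := norm_sum_cutWeight_le χ hX hh0 hhX
  rw [← hb] at hS
  have hb0 : b 0 = 0 := by simp [hb, logMuChar, LSeries.logMul]
  have hsplit : ∑ n ∈ range (11 * X + 1), b n * (cutWeight h (X - n) : ℂ) =
      ∑ n ∈ Icc 1 X, b n + ∑ n ∈ Ioc X (11 * X), b n * (cutWeight h (X - n) : ℂ) := by
    have e : range (11 * X + 1) = insert 0 (Icc 1 X ∪ Ioc X (11 * X)) := by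
      ext n; simp only [mem_range, mem_insert, mem_union, mem_Icc, mem_Ioc]; omega
    rw [e, sum_insert (by simp), hb0, zero_mul, zero_add, sum_union]
    · congr 1
      refine sum_congr rfl fun n hn => ?_
      rw [mem_Icc] at hn
      have : (n:ℝ) ≤ X := by exact_mod_cast hn.2
      rw [cutWeight_of_nonneg hh0 (by linarith), Complex.ofReal_one, mul_one]
    · rw [disjoint_left]
      intro n h1 h2
      rw [mem_Icc] at h1; rw [mem_Ioc] at h2
      omega
  have hlog11 : Real.log (11 * X) ≤ 4 * Real.log X := by
    rw [Real.log_mul (by norm_num) hX0.ne']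
    have : Real.log 11 ≤ 3 := by
      rw [Real.log_le_iff_le_exp (by norm_num)]
      have : (2.7:ℝ) ≤ Real.exp 1 := (by norm_num : (2.7:ℝ) ≤ 2.7182818283).trans Real.exp_one_gt_d9.le
      calc (11:ℝ) ≤ 2.7 ^ 3 := by norm_num
        _ ≤ Real.exp 1 ^ 3 := by gcongr
        _ = Real.exp 3 := by rw [← Real.exp_nat_mul]; norm_num
    linarith
  have htail : ‖∑ n ∈ Ioc X (11 * X), b n * (cutWeight h (X - n) : ℂ)‖ ≤ (10 * h + 1) * (4 * Real.log X * 10 ^ 14) := by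
    set U := Ioc X (X + ⌊10 * h⌋₊) with hU
    have hsub : ∑ n ∈ Ioc X (11 * X), b n * (cutWeight h (X - n) : ℂ) =
        ∑ n ∈ Ioc X (11 * X) ∩ U, b n * (cutWeight h (X - n) : ℂ) := by
      symm
      refine sum_subset inter_subset_left fun n hn hnU => ?_
      rw [mem_inter, not_and] at hnU
      have h1 := hnU hn
      rw [hU, mem_Ioc, not_and, not_le] at h1
      rw [mem_Ioc] at hn
      have h2 := h1 hn.1
      obtain ⟨k, rfl⟩ := Nat.exists_eq_add_of_lt hn.1
      have h3 : ⌊10 * h⌋₊ < k + 1 := by omega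
      have h4 := (Nat.floor_lt (by positivity)).1 h3
      rw [cutWeight_of_le hh0 (by push_cast at h4 ⊢; linarith), Complex.ofReal_zero, mul_zero]
    rw [hsub]
    calc _ ≤ ∑ n ∈ Ioc X (11 * X) ∩ U, 4 * Real.log X * 10 ^ 14 := by
          refine (norm_sum_le _ _).trans (sum_le_sum fun n hn => ?_)
          rw [mem_inter, mem_Ioc] at hn
          have hn1 : (X:ℝ) < n := by exact_mod_cast hn.1.1
          have hn2 : (n:ℝ) ≤ 11 * X := by exact_mod_cast hn.1.2
          rw [norm_mul, Complex.norm_real, Real.norm_eq_abs]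
          refine mul_le_mul ((norm_logMuChar_le χ n).trans ((Real.log_le_log (by linarith) hn2).trans hlog11))
            (abs_cutWeight_le hh0 (by linarith)) (abs_nonneg _) (by linarith)
      _ ≤ (10 * h) * (4 * Real.log X * 10 ^ 14) := by
          rw [sum_const, nsmul_eq_mul]
          refine mul_le_mul_of_nonneg_right ?_ (by positivity)
          have h1 : (Ioc X (11 * X) ∩ U).card ≤ ⌊10 * h⌋₊ := by
            refine (card_le_card inter_subset_right).trans (le_of_eq ?_)
            rw [hU, Nat.card_Ioc]; omega
          exact (Nat.cast_le.2 h1).trans (Nat.floor_le (by positivity))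
      _ ≤ _ := by gcongr; linarith
  have hg : ‖∑ n ∈ Icc 1 X, b n‖ ≤ 10 ^ 145 * q ^ 36 * X * (1 / δ ^ 10) + (10 * h + 1) * (4 * Real.log X * 10 ^ 14) := by
    have e : (X / h : ℝ) ^ 10 = 1 / δ ^ 10 := by
      rw [hh, ← one_div_pow]
      congr 1
      field_simp
    rw [e] at hS
    have : ∑ n ∈ Icc 1 X, b n = ∑ n ∈ range (11 * X + 1), b n * (cutWeight h (X - n) : ℂ) -
        ∑ n ∈ Ioc X (11 * X), b n * (cutWeight h (X - n) : ℂ) := by rw [hsplit]; ring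
    rw [this]
    exact (norm_sub_le _ _).trans (add_le_add hS htail)
  have hrem : ‖∑ n ∈ Icc 1 X, (χ n * (ArithmeticFunction.moebius n : ℂ)) * ((Real.log X - Real.log n : ℝ) : ℂ)‖ ≤ X := by
    have h1 : ∀ n ∈ Icc 1 X, 0 ≤ Real.log X - Real.log n := by
      intro n hn
      rw [mem_Icc] at hn
      have : (0:ℝ) < n := by exact_mod_cast hn.1
      exact sub_nonneg.2 (Real.log_le_log this (by exact_mod_cast hn.2))
    have hfac : ∑ n ∈ Icc 1 X, Real.log n = Real.log (Nat.factorial X) := by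
      rw [← Real.log_prod (fun n hn => by
        rw [mem_Icc] at hn
        exact_mod_cast (by omega : n ≠ 0)), ← Nat.cast_prod, prod_Icc_eq_factorial]
    calc _ ≤ ∑ n ∈ Icc 1 X, (Real.log X - Real.log n) := by
          refine (norm_sum_le _ _).trans (sum_le_sum fun n hn => ?_)
          rw [norm_mul, Complex.norm_real, Real.norm_of_nonneg (h1 n hn)]
          exact mul_le_of_le_one_left (h1 n hn) (norm_moebius_char_le χ n)
      _ = Real.log (X ^ X / Nat.factorial X) := by
          rw [sum_sub_distrib, hfac, sum_const, Nat.card_Icc, nsmul_eq_mul, Nat.add_sub_cancel,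
            Real.log_div (by positivity) (by positivity), Real.log_pow]
      _ ≤ Real.log (Real.exp X) := Real.log_le_log (by positivity) (Real.pow_div_factorial_le_exp X (by positivity) X)
      _ = X := Real.log_exp _
  have hmain : (∑ n ∈ Icc 1 X, χ n * (ArithmeticFunction.moebius n : ℂ)) * ((Real.log X : ℝ) : ℂ) =
      ∑ n ∈ Icc 1 X, b n +
        ∑ n ∈ Icc 1 X, (χ n * (ArithmeticFunction.moebius n : ℂ)) * ((Real.log X - Real.log n : ℝ) : ℂ) := by
    rw [sum_mul, ← sum_add_distrib]
    refine sum_congr rfl fun n _ => ?_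
    rw [hb, logMuChar, LSeries.logMul, ← Complex.natCast_log, Pi.mul_apply]
    push_cast
    ring
  have hL : ‖∑ n ∈ Icc 1 X, χ n * (ArithmeticFunction.moebius n : ℂ)‖ * Real.log X =
      ‖(∑ n ∈ Icc 1 X, χ n * (ArithmeticFunction.moebius n : ℂ)) * ((Real.log X : ℝ) : ℂ)‖ := by
    rw [norm_mul, Complex.norm_real, Real.norm_of_nonneg (by linarith)]
  rw [hL, hmain]
  refine (norm_add_le _ _).trans ((add_le_add hg hrem).trans ?_)
  have hδ10 : 1 ≤ 1 / δ ^ 10 := by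
    rw [one_le_div (by positivity)]; exact pow_le_one₀ hδ.le hδ1
  have hq36 : (1:ℝ) ≤ q ^ 36 := one_le_pow₀ hq
  set P : ℝ := q ^ 36 * (1 / δ ^ 10) with hP
  have hP1 : 1 ≤ P := by rw [hP]; nlinarith
  have hlogX : Real.log X ≤ X := (Real.log_le_sub_one_of_pos hX0).trans (by linarith)
  have hXP : (X:ℝ) ≤ X * P := by nlinarith
  have e2 : (q:ℝ) ^ 36 / δ ^ 10 = P := by rw [hP]; ring
  rw [e2]
  calc _ = 10 ^ 145 * (X * P) + (40 * 10 ^ 14) * (X * (δ * Real.log X)) + 4 * 10 ^ 14 * Real.log X + X := by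
        rw [hP, hh]; ring
    _ ≤ 10 ^ 145 * (X * P) + (40 * 10 ^ 14) * (X * (δ * Real.log X)) + 4 * 10 ^ 14 * (X * P) + X * P := by
        gcongr
        exact hlogX.trans hXP
    _ = (10 ^ 145 + 4 * 10 ^ 14 + 1) * (X * P) + (40 * 10 ^ 14) * (X * (δ * Real.log X)) := by ring
    _ ≤ 10 ^ 150 * (X * P) + 10 ^ 150 * (X * (δ * Real.log X)) := by gcongr <;> norm_num
    _ = _ := by ring

/-! ### The Möbius function in residue classes -/

lemma norm_sum_moebius_char_le_of_le : ∃ C : ℝ, 0 < C ∧ ∀ (q : ℕ) [NeZero q] (χ : DirichletCharacter ℂ q) (L X : ℕ) (δ : ℝ),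
    X ≤ L → 1 ≤ L → 0 < δ → δ ≤ 1 → ‖∑ n ∈ Icc 1 X, χ n * (ArithmeticFunction.moebius n : ℂ)‖ * Real.log L ≤
      C * L * (q ^ 36 / δ ^ 10 + δ * Real.log L) := by
  obtain ⟨C, hC, h⟩ := norm_sum_moebius_char_le
  refine ⟨2 * C + 2, by positivity, fun q _ χ L X δ hXL hL hδ hδ1 => ?_⟩
  have hq : (1:ℝ) ≤ q := by exact_mod_cast NeZero.pos q
  have hL1 : (1:ℝ) ≤ L := by exact_mod_cast hL
  have hlog0 : 0 ≤ Real.log L := Real.log_natCast_nonneg L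
  have htriv : ‖∑ n ∈ Icc 1 X, χ n * (ArithmeticFunction.moebius n : ℂ)‖ ≤ X := by
    refine (norm_sum_le _ _).trans ((sum_le_sum fun n _ => norm_moebius_char_le χ n).trans ?_)
    simp
  have hP : 1 ≤ (q:ℝ) ^ 36 / δ ^ 10 := by
    rw [one_le_div (by positivity)]
    exact (pow_le_one₀ hδ.le hδ1).trans (one_le_pow₀ hq)
  have hPd : 1 ≤ (q:ℝ) ^ 36 / δ ^ 10 + δ * Real.log L := by
    have : 0 ≤ δ * Real.log L := by positivity
    linarith
  have hXL' : (X:ℝ) ≤ L := by exact_mod_cast hXL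
  have hsmall : (X:ℝ) * Real.log L ≤ 2 * L → ‖∑ n ∈ Icc 1 X, χ n * (ArithmeticFunction.moebius n : ℂ)‖ * Real.log L ≤
      (2 * C + 2) * L * (q ^ 36 / δ ^ 10 + δ * Real.log L) := by
    intro h1
    calc _ ≤ (X:ℝ) * Real.log L := by gcongr
      _ ≤ 2 * L * 1 := by linarith
      _ ≤ (2 * C + 2) * L * (q ^ 36 / δ ^ 10 + δ * Real.log L) := by gcongr; linarith
  rcases lt_or_ge X 3 with h3 | h3
  · apply hsmall
    have : (X:ℝ) ≤ 2 := by exact_mod_cast Nat.lt_succ_iff.1 h3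
    have h2 : Real.log L ≤ L := (Real.log_le_sub_one_of_pos (by linarith)).trans (by linarith)
    nlinarith
  have hX3 : (3:ℝ) ≤ X := by exact_mod_cast h3
  rcases le_or_gt (X ^ 2) L with hX2 | hX2
  · apply hsmall
    have h1 : (X:ℝ) ^ 2 ≤ L := by exact_mod_cast hX2
    have h2 : (X:ℝ) ≤ √L := Real.le_sqrt_of_sq_le h1
    have h4 : Real.log L ≤ 2 * √L := by
      have h5 : Real.log √L ≤ √L := (Real.log_le_sub_one_of_pos (by positivity)).trans (by linarith)
      rw [Real.log_sqrt (by linarith)] at h5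
      linarith
    calc (X:ℝ) * Real.log L ≤ √L * (2 * √L) := by gcongr
      _ = 2 * L := by rw [mul_left_comm, Real.mul_self_sqrt (by linarith)]
  · have h1 : (L:ℝ) ≤ (X:ℝ) ^ 2 := by exact_mod_cast hX2.le
    have h2 : Real.log L ≤ 2 * Real.log X := by
      have := Real.log_le_log (by linarith) h1
      rw [Real.log_pow] at this
      exact_mod_cast this
    have h4 : Real.log X ≤ Real.log L := Real.log_le_log (by linarith) hXL'
    calc _ ≤ ‖∑ n ∈ Icc 1 X, χ n * (ArithmeticFunction.moebius n : ℂ)‖ * (2 * Real.log X) := by gcongr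
      _ = 2 * (‖∑ n ∈ Icc 1 X, χ n * (ArithmeticFunction.moebius n : ℂ)‖ * Real.log X) := by ring
      _ ≤ 2 * (C * X * (q ^ 36 / δ ^ 10 + δ * Real.log X)) :=
          mul_le_mul_of_nonneg_left (h q χ X δ h3 hδ hδ1) (by norm_num)
      _ ≤ 2 * (C * L * (q ^ 36 / δ ^ 10 + δ * Real.log L)) := by gcongr
      _ ≤ _ := by
          have : 0 ≤ 2 * (L * ((q:ℝ) ^ 36 / δ ^ 10 + δ * Real.log L)) := by positivity
          linarith

lemma norm_sum_unit_class_le {q : ℕ} [NeZero q] {a : ZMod q} (ha : IsUnit a) (X : ℕ) (B : ℝ)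
    (hB : ∀ χ : DirichletCharacter ℂ q, ‖∑ n ∈ Icc 1 X, χ n * (ArithmeticFunction.moebius n : ℂ)‖ ≤ B) :
    ‖∑ n ∈ (Icc 1 X).filter (fun n : ℕ => (n : ZMod q) = a), (ArithmeticFunction.moebius n : ℂ)‖ ≤ B := by
  have hφ : 0 < q.totient := Nat.totient_pos.2 (NeZero.pos q)
  have hφ' : (0:ℝ) < q.totient := by exact_mod_cast hφ
  have e : (q.totient : ℂ) * ∑ n ∈ (Icc 1 X).filter (fun n : ℕ => (n : ZMod q) = a), (ArithmeticFunction.moebius n : ℂ) =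
      ∑ χ : DirichletCharacter ℂ q, χ a⁻¹ * ∑ n ∈ Icc 1 X, χ n * (ArithmeticFunction.moebius n : ℂ) := by
    simp_rw [mul_sum]
    rw [sum_comm, sum_filter]
    refine sum_congr rfl fun n _ => ?_
    have h := DirichletCharacter.sum_char_inv_mul_char_eq ℂ ha (n : ZMod q)
    simp_rw [← mul_assoc]
    rw [← sum_mul, h]
    by_cases hn : (n : ZMod q) = a
    · rw [if_pos hn, if_pos hn.symm]
    · rw [if_neg hn, if_neg (fun h => hn h.symm), zero_mul]
  have h1 : q.totient * ‖∑ n ∈ (Icc 1 X).filter (fun n : ℕ => (n : ZMod q) = a), (ArithmeticFunction.moebius n : ℂ)‖ ≤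
      q.totient * B := by
    rw [← Complex.norm_natCast q.totient, ← norm_mul, e]
    refine (norm_sum_le _ _).trans ?_
    calc _ ≤ ∑ χ : DirichletCharacter ℂ q, B := by
          refine sum_le_sum fun χ _ => ?_
          rw [norm_mul]
          refine (mul_le_mul (χ.norm_le_one _) (hB χ) (norm_nonneg _) zero_le_one).trans ?_
          rw [one_mul]
      _ = _ := by
          rw [sum_const, nsmul_eq_mul, card_univ, ← Nat.card_eq_fintype_card,
            DirichletCharacter.card_eq_totient_of_hasEnoughRootsOfUnity, Complex.norm_natCast]
  exact le_of_mul_le_mul_left h1 hφ'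

lemma norm_sum_class_le {q : ℕ} [NeZero q] (b X : ℕ) (B : ℝ)
    (hB : ∀ (Y : ℕ) (χ : DirichletCharacter ℂ q), Y ≤ X → ‖∑ n ∈ Icc 1 Y, χ n * (ArithmeticFunction.moebius n : ℂ)‖ ≤ B) :
    ‖∑ n ∈ (Icc 1 X).filter (fun n : ℕ => n ≡ b [MOD q]), (ArithmeticFunction.moebius n : ℂ)‖ ≤ q * B := by
  have hq : 0 < q := NeZero.pos q
  have hB0 : 0 ≤ B := (norm_nonneg _).trans (hB X 1 le_rfl)
  set g := Nat.gcd b q with hg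
  have hg0 : 0 < g := Nat.gcd_pos_of_pos_right b hq
  have hgq : g ∣ q := Nat.gcd_dvd_right b q
  have hcop : ∀ y, (Nat.Coprime g y ∧ g * y ≡ b [MOD q]) ↔ (IsUnit (y : ZMod q) ∧ ((g * y : ℕ) : ZMod q) = b) := by
    intro y
    rw [ZMod.isUnit_iff_coprime, ZMod.natCast_eq_natCast_iff]
    refine and_congr_left fun h => ⟨fun h1 => ?_, fun h1 => (Nat.Coprime.coprime_dvd_right hgq h1).symm⟩
    obtain ⟨q', hq'⟩ := hgq
    obtain ⟨b', hb'⟩ := Nat.gcd_dvd_left b q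
    rw [← hg] at hb'
    have hq0 : q' ≠ 0 := by rintro rfl; rw [mul_zero] at hq'; omega
    have hcop' : Nat.Coprime b' q' := by
      have h2 : Nat.gcd (g * b') (g * q') = g := by rw [← hb', ← hq']
      rw [Nat.gcd_mul_left] at h2
      exact Nat.eq_of_mul_eq_mul_left hg0 (by rw [h2, mul_one])
    have hmod : y ≡ b' [MOD q'] := by
      have h2 : g * y ≡ g * b' [MOD g * q'] := by rw [← hb', ← hq']; exact h
      exact Nat.ModEq.mul_left_cancel' hg0.ne' h2
    have h3 : Nat.Coprime y q' := by
      have := hmod.gcd_eq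
      rw [Nat.Coprime, this]
      exact hcop'
    rw [hq']
    exact Nat.Coprime.mul_right h1.symm h3
  have e1 : ∑ n ∈ (Icc 1 X).filter (fun n : ℕ => n ≡ b [MOD q]), (ArithmeticFunction.moebius n : ℂ) =
      ∑ y ∈ (Icc 1 (X / g)).filter (fun y : ℕ => g * y ≡ b [MOD q]), (ArithmeticFunction.moebius (g * y) : ℂ) := by
    symm
    refine sum_bij' (fun y _ => g * y) (fun n _ => n / g) ?_ ?_ ?_ ?_ ?_
    · intro y hy
      rw [mem_filter, mem_Icc] at hy ⊢
      refine ⟨⟨Nat.mul_pos hg0 hy.1.1, ?_⟩, hy.2⟩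
      rw [mul_comm]
      exact (Nat.le_div_iff_mul_le hg0).1 hy.1.2
    · intro n hn
      rw [mem_filter, mem_Icc] at hn ⊢
      have hdvd : g ∣ n := (hn.2.dvd_iff hgq).2 (Nat.gcd_dvd_left b q)
      refine ⟨⟨(Nat.le_div_iff_mul_le hg0).2 (by rw [one_mul]; exact Nat.le_of_dvd hn.1.1 hdvd), Nat.div_le_div_right hn.1.2⟩, ?_⟩
      rw [Nat.mul_div_cancel' hdvd]; exact hn.2
    · intro y _
      exact Nat.mul_div_cancel_left y hg0
    · intro n hn
      rw [mem_filter, mem_Icc] at hn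
      exact Nat.mul_div_cancel' ((hn.2.dvd_iff hgq).2 (Nat.gcd_dvd_left b q))
    · intro y _; rfl
  have e2 : ∑ y ∈ (Icc 1 (X / g)).filter (fun y : ℕ => g * y ≡ b [MOD q]), (ArithmeticFunction.moebius (g * y) : ℂ) =
      (ArithmeticFunction.moebius g : ℂ) * ∑ a ∈ univ.filter (fun a : ZMod q => IsUnit a ∧ (g : ZMod q) * a = b),
        ∑ n ∈ (Icc 1 (X / g)).filter (fun n : ℕ => (n : ZMod q) = a), (ArithmeticFunction.moebius n : ℂ) := by
    have h1 : ∀ y : ℕ, ¬ Nat.Coprime g y → (ArithmeticFunction.moebius (g * y) : ℂ) = 0 := by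
      intro y hy
      have : ¬ Squarefree (g * y) := fun h => hy (Nat.coprime_of_squarefree_mul h)
      rw [ArithmeticFunction.moebius_eq_zero_of_not_squarefree this, Int.cast_zero]
    have h2 : ∑ y ∈ (Icc 1 (X / g)).filter (fun y : ℕ => g * y ≡ b [MOD q]), (ArithmeticFunction.moebius (g * y) : ℂ) =
        ∑ y ∈ (Icc 1 (X / g)).filter (fun y : ℕ => IsUnit (y : ZMod q) ∧ (g : ZMod q) * y = b),
          (ArithmeticFunction.moebius g : ℂ) * (ArithmeticFunction.moebius y : ℂ) := by
      rw [sum_filter, sum_filter]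
      refine sum_congr rfl fun y _ => ?_
      have h3 := hcop y
      rw [Nat.cast_mul] at h3
      by_cases hc : Nat.Coprime g y
      · by_cases hm : g * y ≡ b [MOD q]
        · rw [if_pos hm, if_pos (h3.1 ⟨hc, hm⟩), ArithmeticFunction.isMultiplicative_moebius.map_mul_of_coprime hc]
          push_cast; rfl
        · rw [if_neg hm, if_neg (fun h => hm (h3.2 h).2)]
      · rw [h1 y hc, if_neg (fun h => hc (h3.2 h).1), ite_self]
    rw [h2, ← mul_sum]
    congr 1
    rw [← sum_biUnion]
    · refine sum_congr ?_ fun _ _ => rfl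
      ext y
      simp only [mem_filter, mem_biUnion, mem_univ, true_and]
      constructor
      · intro h; exact ⟨_, h.2, h.1, rfl⟩
      · rintro ⟨a, ha, hy, rfl⟩; exact ⟨hy, ha⟩
    · intro a _ a' _ haa
      rw [Function.onFun, disjoint_left]
      intro y h3 h4
      rw [mem_filter] at h3 h4
      exact haa (h3.2.symm.trans h4.2)
  rw [e1, e2, norm_mul]
  calc _ ≤ 1 * ∑ a ∈ univ.filter (fun a : ZMod q => IsUnit a ∧ (g : ZMod q) * a = b), B := by
        refine mul_le_mul (norm_moebius_le g) ((norm_sum_le _ _).trans (sum_le_sum fun a ha => ?_)) (norm_nonneg _) zero_le_one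
        rw [mem_filter] at ha
        exact norm_sum_unit_class_le ha.2.1 _ B fun χ => hB _ χ (Nat.div_le_self X g)
    _ ≤ q * B := by
        rw [one_mul, sum_const, nsmul_eq_mul]
        refine mul_le_mul_of_nonneg_right ?_ hB0
        have := card_filter_le (univ : Finset (ZMod q)) (fun a : ZMod q => IsUnit a ∧ (g : ZMod q) * a = b)
        rw [card_univ, ZMod.card] at this
        exact_mod_cast this

/-- Sums of the Möbius function over residue classes. -/
theorem norm_sum_moebius_class_le : ∃ C : ℝ, 0 < C ∧ ∀ (q b L X : ℕ) (δ : ℝ),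
    0 < q → X ≤ L → 2 ≤ L → 0 < δ → δ ≤ 1 →
      ‖∑ n ∈ (Icc 1 X).filter (fun n : ℕ => n ≡ b [MOD q]), (ArithmeticFunction.moebius n : ℂ)‖ ≤
        C * L * (q ^ 37 / (δ ^ 10 * Real.log L) + q * δ) := by
  obtain ⟨C, hC, h⟩ := norm_sum_moebius_char_le_of_le
  refine ⟨C, hC, fun q b L X δ hq hXL hL hδ hδ1 => ?_⟩
  have : NeZero q := ⟨hq.ne'⟩
  have hlog : 0 < Real.log L := Real.log_pos (by exact_mod_cast hL)
  refine (norm_sum_class_le b X (C * L * (q ^ 36 / (δ ^ 10 * Real.log L) + δ)) fun Y χ hY => ?_).trans (le_of_eq ?_)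
  · have h1 := h q χ L Y δ (hY.trans hXL) (by omega) hδ hδ1
    rw [← le_div_iff₀ hlog] at h1
    refine h1.trans (le_of_eq ?_)
    field_simp
  · ring

/-! ### Linear phases along progressions -/

lemma norm_sum_mul_slow_phase_le (f u : ℕ → ℂ) (E ε : ℝ) (hf : ∀ n, ‖∑ k ∈ range n, f k‖ ≤ E) (hu : ∀ n, ‖u n‖ ≤ 1)
    (hε : ∀ n, ‖u n - u (n + 1)‖ ≤ ε) (X : ℕ) : ‖∑ k ∈ range X, f k * u k‖ ≤ E * (1 + X * ε) := by
  have hE : 0 ≤ E := by simpa using hf 0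
  have key : ∀ n, ∑ k ∈ range n, f k * u k =
      u n * ∑ k ∈ range n, f k + ∑ k ∈ range n, (u k - u (k + 1)) * ∑ i ∈ range (k + 1), f i := by
    intro n
    induction n with
    | zero => simp
    | succ n ih =>
      rw [sum_range_succ, ih, sum_range_succ _ n, sum_range_succ _ n, sum_range_succ f n]
      ring
  rw [key]
  calc _ ≤ 1 * E + ∑ k ∈ range X, ε * E := by
        refine (norm_add_le _ _).trans (add_le_add ?_ ((norm_sum_le _ _).trans (sum_le_sum fun k _ => ?_)))
        · rw [norm_mul]; exact mul_le_mul (hu X) (hf X) (norm_nonneg _) zero_le_one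
        · rw [norm_mul]; exact mul_le_mul (hε k) (hf _) (norm_nonneg _) ((norm_nonneg _).trans (hε k))
    _ = _ := by rw [sum_const, card_range, nsmul_eq_mul]; ring

lemma sum_range_classFn (L q a T : ℕ) (ha : a < q) :
    ∑ w ∈ range T, classFn L q a w =
      ∑ n ∈ (Icc 1 (min L (a + q * T - 1))).filter (fun n : ℕ => n ≡ a [MOD q]), (ArithmeticFunction.moebius n : ℂ) := by
  have e1 : ∀ w ∈ range T, classFn L q a (w : ℤ) =
      if 0 < a + q * w ∧ a + q * w ≤ L then (ArithmeticFunction.moebius (a + q * w) : ℂ) else 0 := by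
    intro w _
    have h : ((a : ℤ) + q * w) = ((a + q * w : ℕ) : ℤ) := by push_cast; ring
    rw [classFn, h, muN, Int.toNat_natCast]
    have h2 : (0 < ((a + q * w : ℕ) : ℤ) ∧ ((a + q * w : ℕ) : ℤ) ≤ L) ↔ (0 < a + q * w ∧ a + q * w ≤ L) := by
      rw [Int.natCast_pos, Nat.cast_le]
    simp only [h2]
  rw [sum_congr rfl e1, ← sum_filter]
  refine sum_bij' (fun w _ => a + q * w) (fun n _ => n / q) ?_ ?_ ?_ ?_ ?_
  · intro w hw
    rw [mem_filter, mem_range] at hw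
    rw [mem_filter, mem_Icc]
    refine ⟨⟨hw.2.1, le_min hw.2.2 ?_⟩, ?_⟩
    · have : q * (w + 1) ≤ q * T := Nat.mul_le_mul_left q hw.1
      rw [mul_add, mul_one] at this
      omega
    · simp [Nat.ModEq]
  · intro n hn
    rw [mem_filter, mem_Icc, le_min_iff] at hn
    have h1 : n % q = a := by
      have := hn.2
      rwa [Nat.ModEq, Nat.mod_eq_of_lt ha] at this
    have h2 : a + q * (n / q) = n := by rw [← h1]; exact Nat.mod_add_div n q
    rw [mem_filter, mem_range, h2]
    refine ⟨?_, by omega, hn.1.2.1⟩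
    by_contra hc
    push Not at hc
    have : q * T ≤ q * (n / q) := Nat.mul_le_mul_left q hc
    omega
  · intro w _
    rw [Nat.add_mul_div_left _ _ (by omega), Nat.div_eq_of_lt ha, zero_add]
  · intro n hn
    rw [mem_filter, mem_Icc, le_min_iff] at hn
    have h1 : n % q = a := by
      have := hn.2
      rwa [Nat.ModEq, Nat.mod_eq_of_lt ha] at this
    conv_rhs => rw [← Nat.mod_add_div n q, h1]
  · intro w _; rfl

lemma sum_Ico_int_eq_sum_range {β : Type*} [AddCommMonoid β] (X : ℕ) (f : ℤ → β) :
    ∑ w ∈ Ico (0 : ℤ) X, f w = ∑ w ∈ range X, f w := by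
  symm
  refine sum_bij (fun u _ => (u : ℤ)) ?_ ?_ ?_ ?_
  · intro u hu; simp only [mem_Ico, mem_range] at *; omega
  · intro a _ b _ h; exact_mod_cast h
  · intro x hx; simp only [mem_Ico] at hx; exact ⟨x.toNat, by simp; omega, by omega⟩
  · intro u _; rfl

lemma sum_progression_phase_le : ∃ C : ℝ, 0 < C ∧ ∀ (L M m Y : ℕ) (η H δ : ℝ), 0 < M → 0 < m → M * m ≤ L → 2 ≤ L →
    L / M < Y → 1 ≤ H → |η| * Y ≤ H → 0 < δ → δ ≤ 1 →
    ∑ v ∈ range M, ∑ i ∈ range m, ‖∑ w ∈ Ico (0 : ℤ) Y, classFn L M v (i + m * w) * ee (η * m * w)‖ ≤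
      C * H * L * ((M * m : ℕ) ^ 38 / (δ ^ 10 * Real.log L) + (M * m : ℕ) ^ 2 * δ) := by
  obtain ⟨C, hC, hcl⟩ := norm_sum_moebius_class_le
  refine ⟨17 * C, by positivity, fun L M m Y η H δ hM hm hML hL hY hH hη hδ hδ1 => ?_⟩
  obtain ⟨q, hq⟩ : ∃ q, q = M * m := ⟨_, rfl⟩
  have hq0 : 0 < q := by rw [hq]; exact Nat.mul_pos hM hm
  have hlog : 0 < Real.log L := Real.log_pos (by exact_mod_cast hL)
  set E : ℝ := C * L * (q ^ 37 / (δ ^ 10 * Real.log L) + q * δ) with hE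
  have hE0 : 0 ≤ E := by positivity
  set X := L / q + 1 with hX
  have hdiv : L / q = L / M / m := by rw [hq]; exact (Nat.div_div_eq_div_mul _ _ _).symm
  have hmL : m ≤ L / M := (Nat.le_div_iff_mul_le hM).2 (by rwa [mul_comm])
  have hmX : m * X ≤ 2 * Y := by
    rw [hX, hdiv, mul_add]
    have := Nat.mul_div_le (L / M) m
    omega
  have hXY : X ≤ Y := by
    rw [hX, hdiv]
    have := Nat.div_le_self (L / M) m
    omega
  have hterm : ∀ v ∈ range M, ∀ i ∈ range m,
      ‖∑ w ∈ Ico (0 : ℤ) Y, classFn L M v (i + m * w) * ee (η * m * w)‖ ≤ E * (17 * H) := by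
    intro v hv i hi
    rw [mem_range] at hv hi
    have haq : v + M * i < q := by
      rw [hq]
      calc v + M * i < M + M * i := by omega
        _ = M * (i + 1) := by ring
        _ ≤ M * m := Nat.mul_le_mul_left M hi
    have e1 : ∑ w ∈ Ico (0 : ℤ) Y, classFn L M v (i + m * w) * ee (η * m * w) =
        ∑ w ∈ range X, classFn L q (v + M * i) w * ee (η * m * w) := by
      have e2 := sum_Ico_int_eq_sum_range X (fun w : ℤ => classFn L q (v + M * i) w * ee (η * m * w))
      simp only [Int.cast_natCast] at e2
      rw [← e2]
      symm
      refine (sum_subset (Ico_subset_Ico_right (by exact_mod_cast hXY)) fun w _ hw => ?_).trans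
        (sum_congr rfl fun w _ => ?_)
      · rw [classFn_support L q _ haq w hw, zero_mul]
      · rw [hq, classFn_mul]
    rw [e1]
    refine (norm_sum_mul_slow_phase_le (fun w => classFn L q (v + M * i) w) (fun w : ℕ => ee (η * m * w)) E
      (2 * Real.pi * (|η| * m)) (fun T => ?_) (fun n => (norm_ee _).le) (fun n => ?_) X).trans ?_
    · rw [sum_range_classFn L q _ T haq]
      exact hcl q _ L _ δ hq0 (min_le_left _ _) hL hδ hδ1
    · refine (ee_sub_le _ _).trans (le_of_eq ?_)
      have : η * m * n - η * m * (n + 1 : ℕ) = -(η * m) := by push_cast; ring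
      rw [this, abs_neg, abs_mul, Nat.abs_cast]
    · refine mul_le_mul_of_nonneg_left ?_ hE0
      have h1 : (m * X : ℝ) ≤ 2 * Y := by exact_mod_cast hmX
      have h2 : |η| * (m * X) ≤ 2 * H := by
        calc |η| * (m * X) ≤ |η| * (2 * Y) := by gcongr
          _ = 2 * (|η| * Y) := by ring
          _ ≤ 2 * H := by gcongr
      have h3 : (X:ℝ) * (2 * Real.pi * (|η| * m)) = 2 * Real.pi * (|η| * (m * X)) := by ring
      rw [h3]
      have h4 : 2 * Real.pi * (|η| * (m * X)) ≤ 2 * 4 * (2 * H) := by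
        gcongr
        exact Real.pi_le_four
      linarith
  calc _ ≤ ∑ v ∈ range M, ∑ i ∈ range m, E * (17 * H) :=
        sum_le_sum fun v hv => sum_le_sum fun i hi => hterm v hv i hi
    _ = q * (E * (17 * H)) := by
        rw [hq]
        simp only [sum_const, card_range, nsmul_eq_mul]
        push_cast; ring
    _ = _ := by rw [hE, ← hq]; ring

/-! ### The energy bound -/

lemma exp_exp_le_div {Λ : ℝ} (hΛ : 2 ≤ Λ) (P B : ℕ) {N d : ℕ} (hd : 0 < d) (hdB : (d:ℝ) ≤ Real.exp (Λ ^ B))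
    (hN : Real.exp (Real.exp (Λ ^ (P + B + 2))) ≤ N) : Real.exp (Real.exp (Λ ^ P)) ≤ (N / d : ℕ) := by
  set u := Λ ^ P with hu
  set v := Λ ^ B with hv
  have hu1 : 1 ≤ u := one_le_pow₀ (by linarith)
  have hv1 : 1 ≤ v := one_le_pow₀ (by linarith)
  have h1 : u + v + 1 ≤ Λ ^ (P + B + 2) := by
    have : Λ ^ (P + B + 2) = u * v * Λ ^ 2 := by rw [hu, hv]; ring
    rw [this]
    have h0 : 0 ≤ (u - 1) * (v - 1) := mul_nonneg (by linarith) (by linarith)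
    have h2 : u * v * 4 ≤ u * v * Λ ^ 2 := mul_le_mul_of_nonneg_left (by nlinarith) (by positivity)
    nlinarith
  have hexp1 : (2:ℝ) ≤ Real.exp 1 := by linarith [Real.add_one_le_exp 1]
  have h2 : Real.exp u + v + 1 ≤ Real.exp (Λ ^ (P + B + 2)) := by
    refine le_trans ?_ (Real.exp_le_exp.2 h1)
    rw [Real.exp_add, Real.exp_add]
    have ha : 1 ≤ Real.exp u := Real.one_le_exp (by linarith)
    have hb : v + 1 ≤ Real.exp v := Real.add_one_le_exp v
    nlinarith [mul_nonneg (sub_nonneg.2 ha) (by linarith : (0:ℝ) ≤ Real.exp v - 1), mul_pos (Real.exp_pos u) (Real.exp_pos v)]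
  have h3 : Real.exp (Real.exp u) * Real.exp v * Real.exp 1 ≤ N := by
    rw [← Real.exp_add, ← Real.exp_add]
    exact (Real.exp_le_exp.2 h2).trans hN
  have hd0 : (0:ℝ) < d := by exact_mod_cast hd
  have h4 : Real.exp (Real.exp u) * 2 ≤ N / d := by
    rw [le_div_iff₀ hd0]
    calc Real.exp (Real.exp u) * 2 * d ≤ Real.exp (Real.exp u) * Real.exp 1 * Real.exp v := by gcongr
      _ ≤ N := by linarith
  have h5 : (N:ℝ) / d < (N / d : ℕ) + 1 := by
    rw [div_lt_iff₀ hd0]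
    have := Nat.lt_mul_div_succ N hd
    rw [mul_comm] at this
    exact_mod_cast this
  have h6 : 1 ≤ Real.exp (Real.exp u) := Real.one_le_exp (Real.exp_pos _).le
  linarith

lemma classEnergy_one_lt : ∃ A : ℕ, ∀ Λ : ℝ, A ≤ Λ → ∀ N M : ℕ, 0 < M → (M:ℝ) ≤ Real.exp Λ →
    Real.exp (Real.exp (Λ ^ A)) ≤ N → classEnergy 1 N M < 1 / Λ * M * (N / M + 1 : ℕ) ^ 3 := by
  obtain ⟨B, hB⟩ := exists_major_arc_of_energy 0
  obtain ⟨C, hC, hup⟩ := sum_progression_phase_le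
  obtain ⟨n₀, hn₀⟩ := exists_nat_gt (4 * C)
  set b := B + 1 with hb
  refine ⟨B + n₀ + b + b + 203, fun Λ hΛ N M hM hMΛ hN => ?_⟩
  push_cast at hΛ
  have hB0 : (0:ℝ) ≤ B := by positivity
  have hn0' : (0:ℝ) ≤ n₀ := by positivity
  have hb0 : (0:ℝ) ≤ b := by positivity
  have hΛ200 : 200 ≤ Λ := by linarith
  have hΛ1 : 1 ≤ Λ := by linarith
  set t := Λ ^ b with ht
  have hpow : ∀ i j : ℕ, i ≤ j → Λ ^ i ≤ Λ ^ j := fun i j hij => pow_le_pow_right₀ hΛ1 hij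
  have hΛt : Λ ≤ t := by simpa using hpow 1 b (by omega)
  have ht1 : 1 ≤ t := hΛ1.trans hΛt
  have hNB : Real.exp (Real.exp (Λ ^ B)) ≤ N :=
    (Real.exp_le_exp.2 (Real.exp_le_exp.2 (hpow _ _ (by omega)))).trans hN
  by_contra hcon
  rw [not_lt] at hcon
  obtain ⟨d, m, Y, η, hd, hdB, hm, hmB, hY, hη, hbig⟩ := hB Λ (by linarith) N M hM hMΛ hNB hcon
  set L := N / d with hL
  have hBt : Λ ^ B ≤ t := hpow _ _ (by omega)
  have hLbig : Real.exp (Real.exp (138 * t)) ≤ L := by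
    have h1 := exp_exp_le_div (by linarith : 2 ≤ Λ) (b + 1) B hd hdB
      ((Real.exp_le_exp.2 (Real.exp_le_exp.2 (hpow _ _ (by omega)))).trans hN)
    refine le_trans (Real.exp_le_exp.2 (Real.exp_le_exp.2 ?_)) h1
    rw [pow_succ, ← ht]; nlinarith
  have hqt : ((M * m : ℕ) : ℝ) ≤ Real.exp (2 * t) := by
    push_cast
    calc (M * m : ℝ) ≤ Real.exp t * Real.exp t := by
          refine mul_le_mul (hMΛ.trans (Real.exp_le_exp.2 hΛt)) (hmB.trans (Real.exp_le_exp.2 hBt)) (by positivity) (by positivity)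
      _ = _ := by rw [← Real.exp_add]; ring_nf
  have hE138 : 138 * t + 1 ≤ Real.exp (138 * t) := Real.add_one_le_exp _
  have hqL : M * m ≤ L := by
    have : ((M * m : ℕ) : ℝ) ≤ L := hqt.trans (le_trans (Real.exp_le_exp.2 (by linarith)) hLbig)
    exact_mod_cast this
  have hL2 : 2 ≤ L := by
    have h1 : (2:ℝ) ≤ L := by
      refine le_trans ?_ hLbig
      linarith [Real.add_one_le_exp (Real.exp (138 * t))]
    exact_mod_cast h1
  have hL0 : (0:ℝ) < L := by exact_mod_cast (by omega : 0 < L)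
  have hlogL : Real.exp (138 * t) ≤ Real.log L := (Real.le_log_iff_exp_le hL0).2 hLbig
  have hY0 : (0:ℝ) < Y := by exact_mod_cast lt_of_le_of_lt (Nat.zero_le _) hY
  have hηY : |η| * Y ≤ t := by
    rw [le_div_iff₀ hY0] at hη
    exact hη.trans hBt
  have hδ1 : Real.exp (-(6 * t)) ≤ 1 := Real.exp_le_one_iff.2 (by linarith)
  have hupper := hup L M m Y η t (Real.exp (-(6 * t))) hM hm hqL hL2 hY ht1 hηY (Real.exp_pos _) hδ1
  have hlower : (L:ℝ) / t ≤ 1 / Λ ^ B * M * Y ^ (0 + 1) := by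
    have h1 : L < M * Y := by
      rw [mul_comm]; exact (Nat.div_lt_iff_lt_mul hM).1 hY
    have h2 : (L:ℝ) ≤ M * Y := by exact_mod_cast h1.le
    have hΛB : 0 < Λ ^ B := by positivity
    calc (L:ℝ) / t ≤ (M * Y) / Λ ^ B := by gcongr
      _ = _ := by ring
  have hsum : (1 / Λ ^ B * M * Y ^ (0 + 1) : ℝ) ≤
      ∑ v ∈ range M, ∑ i ∈ range m, ‖∑ w ∈ Ico (0 : ℤ) Y, classFn L M v (i + m * w) * ee (η * m * w)‖ := by
    refine hbig.trans (le_of_eq (sum_congr rfl fun v _ => ?_))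
    rw [Fintype.piFinset_of_isEmpty, univ_unique, sum_singleton]
    rfl
  have hmain : (L:ℝ) / t ≤ C * t * L * (2 * Real.exp (-(2 * t))) := by
    refine (hlower.trans hsum).trans (hupper.trans ?_)
    refine mul_le_mul_of_nonneg_left ?_ (by positivity)
    have hq0 : (0:ℝ) ≤ ((M * m : ℕ) : ℝ) := by positivity
    have h1 : ((M * m : ℕ) : ℝ) ^ 38 / (Real.exp (-(6 * t)) ^ 10 * Real.log L) ≤ Real.exp (-(2 * t)) := by
      calc _ ≤ Real.exp (2 * t) ^ 38 / (Real.exp (-(6 * t)) ^ 10 * Real.exp (138 * t)) := by gcongr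
        _ = Real.exp (-(2 * t)) := by
            rw [← Real.exp_nat_mul, ← Real.exp_nat_mul, ← Real.exp_add, ← Real.exp_sub]
            congr 1; push_cast; ring
    have h2 : ((M * m : ℕ) : ℝ) ^ 2 * Real.exp (-(6 * t)) ≤ Real.exp (-(2 * t)) := by
      calc _ ≤ Real.exp (2 * t) ^ 2 * Real.exp (-(6 * t)) := by gcongr
        _ = Real.exp (-(2 * t)) := by
            rw [← Real.exp_nat_mul, ← Real.exp_add]
            congr 1; push_cast; ring
    linarith
  have h1 : 1 ≤ 2 * C * (t ^ 2 * Real.exp (-(2 * t))) := by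
    rw [div_le_iff₀ (by linarith)] at hmain
    refine le_of_mul_le_mul_left (a := (L:ℝ)) (le_trans (by linarith) (hmain.trans (le_of_eq (by ring)))) hL0
  have h2 : t ^ 2 * Real.exp (-(2 * t)) ≤ 1 / (2 * t) := by
    have h3 : t ^ 3 * 2 ≤ Real.exp (2 * t) := by
      have h4 := Real.pow_div_factorial_le_exp (2 * t) (by linarith) 3
      have e : (Nat.factorial 3 : ℝ) = 6 := by norm_num [Nat.factorial]
      rw [e] at h4
      have h5 := Real.quadratic_le_exp_of_nonneg (by linarith : 0 ≤ t)
      have h6 : Real.exp (2 * t) = Real.exp t * Real.exp t := by rw [← Real.exp_add]; ring_nf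
      have h7 : Real.exp t * Real.exp t ≥ (t ^ 2 / 2) * (t ^ 2 / 2) := by
        have : t ^ 2 / 2 ≤ Real.exp t := by linarith
        exact mul_le_mul this this (by positivity) (Real.exp_pos _).le
      have h8 : (t ^ 2 / 2) * (t ^ 2 / 2) = t ^ 3 * (t / 4) := by ring
      have h9 : t ^ 3 * 2 ≤ t ^ 3 * (t / 4) := mul_le_mul_of_nonneg_left (by linarith) (by positivity)
      linarith
    rw [Real.exp_neg, ← div_eq_mul_inv, div_le_div_iff₀ (Real.exp_pos _) (by linarith)]
    linarith
  have h3 : 2 * C * (t ^ 2 * Real.exp (-(2 * t))) ≤ 2 * C * (1 / (2 * t)) := by gcongr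
  have h4 : 2 * C * (1 / (2 * t)) < 1 := by
    rw [mul_one_div, div_lt_one (by linarith)]
    linarith
  linarith

/-- The Möbius function has small `U^{r+2}` energy on the residue classes of small moduli. -/
theorem classEnergy_lt (r : ℕ) : ∃ A : ℕ, ∀ Λ : ℝ, A ≤ Λ → ∀ N M : ℕ, 0 < M → (M:ℝ) ≤ Real.exp Λ →
    Real.exp (Real.exp (Λ ^ A)) ≤ N → classEnergy (r + 1) N M < 1 / Λ * M * (N / M + 1 : ℕ) ^ (r + 3) := by
  induction r with
  | zero => exact classEnergy_one_lt
  | succ s ih =>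
    obtain ⟨A, hA⟩ := ih
    obtain ⟨B, hB⟩ := exists_major_arc_of_energy (s + 1)
    obtain ⟨K, hK⟩ : ∃ K : ℕ, K = 2 ^ (s + 3) * 5 ^ (s + 1) := ⟨_, rfl⟩
    obtain ⟨e, he⟩ : ∃ e : ℕ, e = 2 * 2 ^ (s + 1) := ⟨_, rfl⟩
    obtain ⟨D, hD⟩ : ∃ D : ℕ, D = (B + 1) * e + B + 3 := ⟨_, rfl⟩
    refine ⟨A + B + K + 5 + (D * (A + 1) + B + 2), fun Λ hΛ N M hM hMΛ hN => ?_⟩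
    have hΛ' : (A:ℝ) + B + K + 5 ≤ Λ := by
      push_cast at hΛ
      have : (0:ℝ) ≤ D * (A + 1) + B + 2 := by positivity
      linarith
    have hA0 : (0:ℝ) ≤ A := by positivity
    have hB0 : (0:ℝ) ≤ B := by positivity
    have hK0 : (0:ℝ) ≤ K := by positivity
    have hΛ1 : 1 ≤ Λ := by linarith
    have hpow : ∀ i j : ℕ, i ≤ j → Λ ^ i ≤ Λ ^ j := fun i j hij => pow_le_pow_right₀ hΛ1 hij
    have hNB : Real.exp (Real.exp (Λ ^ B)) ≤ N :=
      (Real.exp_le_exp.2 (Real.exp_le_exp.2 (hpow _ _ (by omega)))).trans hN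
    by_contra hcon
    rw [not_lt] at hcon
    obtain ⟨d, m, Y, η, hd, hdB, hm, hmB, hY, _, hbig⟩ := hB Λ (by linarith) N M hM hMΛ hNB hcon
    set L := N / d with hL
    have hLbig : Real.exp (Real.exp (Λ ^ (D * (A + 1)))) ≤ L :=
      exp_exp_le_div (by linarith : 2 ≤ Λ) _ B hd hdB
        ((Real.exp_le_exp.2 (Real.exp_le_exp.2 (hpow _ _ (by omega)))).trans hN)
    have hqD : ((M * m : ℕ) : ℝ) ≤ Real.exp (Λ ^ D) := by
      push_cast
      calc (M * m : ℝ) ≤ Real.exp Λ * Real.exp (Λ ^ B) := mul_le_mul hMΛ hmB (by positivity) (by positivity)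
        _ = Real.exp (Λ + Λ ^ B) := by rw [← Real.exp_add]
        _ ≤ _ := by
            refine Real.exp_le_exp.2 ?_
            have h1 : Λ ≤ Λ ^ (B + 1) := by simpa using hpow 1 (B + 1) (by omega)
            have h2 : Λ ^ B ≤ Λ ^ (B + 1) := hpow _ _ (by omega)
            have h3 : Λ ^ (B + 2) = Λ ^ (B + 1) * Λ := pow_succ _ _
            have h4 : Λ ^ (B + 2) ≤ Λ ^ D := hpow _ _ (by omega)
            have h5 : 0 < Λ ^ (B + 1) := by positivity
            nlinarith
    have hDA : Λ ^ D ≤ Λ ^ (D * (A + 1)) := hpow _ _ (Nat.le_mul_of_pos_right D (by omega))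
    have hqL : M * m ≤ L := by
      have : ((M * m : ℕ) : ℝ) ≤ L := by
        refine hqD.trans (le_trans (Real.exp_le_exp.2 ?_) hLbig)
        refine hDA.trans ?_
        linarith [Real.add_one_le_exp (Λ ^ (D * (A + 1)))]
      exact_mod_cast this
    have hge := classEnergy_ge_of_progressions (s + 1) L M m Y (by omega) hM hm hqL hY η (1 / Λ ^ B) (by positivity) hbig
    have hIH := hA (Λ ^ D) ?_ L (M * m) (Nat.mul_pos hM hm) hqD ?_
    · have hcoef : 1 / Λ ^ D ≤ (1 / Λ ^ B / (2 ^ (s + 1 + 2) * 5 ^ (s + 1))) ^ (2 * 2 ^ (s + 1)) / 5 ^ (s + 1) := by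
        have hKr : (2:ℝ) ^ (s + 1 + 2) * 5 ^ (s + 1) = K := by rw [hK]; push_cast; ring
        rw [hKr, div_div, ← he, div_pow, one_pow, div_div]
        refine one_div_le_one_div_of_le (mul_pos (pow_pos (mul_pos (by positivity) ?_) _) (by positivity)) ?_
        · rw [← hKr]; positivity
        · have h5 : (5:ℝ) ^ (s + 1) ≤ Λ := by
            have : (5:ℝ) ^ (s + 1) ≤ K := by
              rw [← hKr]
              exact le_mul_of_one_le_left (by positivity) (one_le_pow₀ (by norm_num))
            linarith
          calc (Λ ^ B * K) ^ e * 5 ^ (s + 1) ≤ (Λ ^ B * Λ) ^ e * Λ := by gcongr; linarith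
            _ = Λ ^ ((B + 1) * e + 1) := by rw [← pow_succ, ← pow_mul, ← pow_succ]
            _ ≤ Λ ^ D := hpow _ _ (by omega)
      have h1 : 1 / Λ ^ D * ((M * m : ℕ) : ℝ) * ((L / (M * m) + 1 : ℕ) : ℝ) ^ (s + 3) ≤ classEnergy (s + 1) L (M * m) := by
        refine le_trans ?_ hge
        push_cast
        gcongr
      exact absurd hIH (not_lt.2 h1)
    · have : Λ ≤ Λ ^ D := by simpa using hpow 1 D (by omega)
      linarith
    · rw [← pow_mul]
      refine le_trans (Real.exp_le_exp.2 (Real.exp_le_exp.2 (hpow _ _ ?_))) hLbig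
      exact Nat.mul_le_mul_left D (by omega)

/-! ### Gowers norms and energies -/

lemma gowersProd_eq_cubeDeriv {G : Type*} [AddCommGroup G] (f : G → ℂ) (k : ℕ) (y : G) (h : Fin k → G) :
    gowersProd k f y h = cubeDeriv k h f y := by
  induction k generalizing y with
  | zero => simp [gowersProd, cubeDeriv]
  | succ k ih =>
    rw [cubeDeriv, ← ih (y := y), ← ih (y := y + h 0)]
    simp only [gowersProd]
    rw [← (Fin.consEquiv (fun _ : Fin (k + 1) => Bool)).prod_comp, Fintype.prod_prod_type, Fintype.prod_bool, mul_comm,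
      map_prod]
    congr 1
    · refine Fintype.prod_congr _ _ fun ω => ?_
      simp only [Fin.consEquiv_apply, Fin.card_filter_univ_succ, Fin.cons_zero, Fin.sum_univ_succ, Fin.cons_succ,
        Fin.tail]
      simp
    · refine Fintype.prod_congr _ _ fun ω => ?_
      simp only [Fin.consEquiv_apply, Fin.card_filter_univ_succ, Fin.cons_zero, Fin.sum_univ_succ, Fin.cons_succ,
        Fin.tail, if_true]
      rw [Function.iterate_succ_apply', add_assoc]

lemma tsum_gowersProd_eq_sum (X k : ℕ) (f : ℤ → ℂ) (hf : ∀ w, w ∉ Ico (0 : ℤ) X → f w = 0) :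
    ∑' nh : ℤ × (Fin k → ℤ), gowersProd k f nh.1 nh.2 =
      ∑ h ∈ Fintype.piFinset (fun _ : Fin k => Ioo (-X : ℤ) X), ∑ w ∈ Ico (0 : ℤ) X, cubeDeriv k h f w := by
  simp only [gowersProd_eq_cubeDeriv]
  rw [tsum_eq_sum (s := Ico (0 : ℤ) X ×ˢ Fintype.piFinset (fun _ : Fin k => Ioo (-X : ℤ) X)), sum_product, sum_comm]
  rintro ⟨w, h⟩ hwh
  rw [mem_product, not_and_or] at hwh
  rcases hwh with h1 | h1
  · exact cubeDeriv_eq_zero _ _ _ _ (hf _ h1)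
  · rw [Fintype.mem_piFinset] at h1
    push Not at h1
    obtain ⟨j, hj⟩ := h1
    exact cubeDeriv_eq_zero_of_large_step X f hf k h j hj w

lemma tsum_gowersProd_succ (X r : ℕ) (f : ℤ → ℂ) (hf : ∀ w, w ∉ Ico (0 : ℤ) X → f w = 0) :
    (∑' nh : ℤ × (Fin (r + 1) → ℤ), gowersProd (r + 1) f nh.1 nh.2).re =
      ∑ h ∈ Fintype.piFinset (fun _ : Fin r => Ioo (-X : ℤ) X), ‖∑ w ∈ Ico (0 : ℤ) X, cubeDeriv r h f w‖ ^ 2 := by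
  rw [tsum_gowersProd_eq_sum X (r + 1) f hf]
  have e1 : ∑ h ∈ Fintype.piFinset (fun _ : Fin (r + 1) => Ioo (-X : ℤ) X), ∑ w ∈ Ico (0 : ℤ) X, cubeDeriv (r + 1) h f w =
      ∑ h ∈ Fintype.piFinset (fun _ : Fin r => Ioo (-X : ℤ) X), ∑ h₀ ∈ Ioo (-X : ℤ) X,
        ∑ w ∈ Ico (0 : ℤ) X, cubeDeriv r h f w * conj (cubeDeriv r h f (w + h₀)) := by
    rw [← sum_product' (Fintype.piFinset (fun _ : Fin r => Ioo (-X : ℤ) X)) (Ioo (-X : ℤ) X)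
      (fun h h₀ => ∑ w ∈ Ico (0 : ℤ) X, cubeDeriv r h f w * conj (cubeDeriv r h f (w + h₀)))]
    refine sum_bij' (fun h _ => (Fin.tail h, h 0)) (fun p _ => Fin.cons p.2 p.1) ?_ ?_ ?_ ?_ ?_
    · intro h hh
      rw [Fintype.mem_piFinset] at hh
      rw [mem_product, Fintype.mem_piFinset]
      exact ⟨fun j => hh _, hh 0⟩
    · intro p hp
      rw [mem_product, Fintype.mem_piFinset] at hp
      rw [Fintype.mem_piFinset]
      intro j
      refine Fin.cases ?_ (fun j' => ?_) j
      · simpa using hp.2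
      · simpa using hp.1 j'
    · intro h _; simp
    · intro p _; simp
    · intro h _; rfl
  rw [e1, Complex.re_sum]
  refine sum_congr rfl fun h _ => ?_
  set g := cubeDeriv r h f with hg
  have hg0 : ∀ w, w ∉ Ico (0 : ℤ) X → g w = 0 := fun w hw => cubeDeriv_eq_zero _ _ _ _ (hf w hw)
  have e2 : ∑ h₀ ∈ Ioo (-X : ℤ) X, ∑ w ∈ Ico (0 : ℤ) X, g w * conj (g (w + h₀)) =
      (∑ w ∈ Ico (0 : ℤ) X, g w) * conj (∑ w ∈ Ico (0 : ℤ) X, g w) := by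
    rw [sum_comm, sum_mul]
    refine sum_congr rfl fun w hw => ?_
    rw [← mul_sum, map_sum]
    congr 1
    rw [mem_Ico] at hw
    have h1 : ∑ h₀ ∈ Ioo (-X : ℤ) X, conj (g (w + h₀)) = ∑ z ∈ (Ioo (-X : ℤ) X).image (fun h₀ => w + h₀), conj (g z) := by
      rw [sum_image fun a _ b _ hab => add_left_cancel hab]
    rw [h1]
    symm
    refine sum_subset ?_ fun z _ hz => by rw [hg0 z hz, map_zero]
    intro z hz
    rw [mem_Ico] at hz
    rw [mem_image]
    exact ⟨z - w, by rw [mem_Ioo]; omega, by ring⟩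
  rw [e2, Complex.mul_conj, Complex.ofReal_re, Complex.normSq_eq_norm_sq]

lemma cubeDeriv_zero_or_one {G : Type*} [AddCommGroup G] (f : G → ℂ) (hf : ∀ y, f y = 0 ∨ f y = 1) (r : ℕ) (h : Fin r → G)
    (y : G) : cubeDeriv r h f y = 0 ∨ cubeDeriv r h f y = 1 := by
  induction r generalizing y with
  | zero => exact hf y
  | succ r ih =>
    rw [cubeDeriv]
    rcases ih (Fin.tail h) y with h1 | h1
    · left; rw [h1, zero_mul]
    · rcases ih (Fin.tail h) (y + h 0) with h2 | h2
      · left; rw [h2, map_zero, mul_zero]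
      · right; rw [h1, h2, map_one, mul_one]

lemma cubeDeriv_eq_one (n : ℕ) (f : ℤ → ℂ) (hf : ∀ y : ℤ, 1 ≤ y → y ≤ n → f y = 1) (r : ℕ) (h : Fin r → ℤ)
    (hh : ∀ j, 0 ≤ h j) (y : ℤ) (hy : 1 ≤ y) (hyn : y + ∑ j, h j ≤ n) : cubeDeriv r h f y = 1 := by
  induction r generalizing y with
  | zero => exact hf y hy (by simpa using hyn)
  | succ r ih =>
    rw [Fin.sum_univ_succ] at hyn
    have h0 := hh 0
    rw [cubeDeriv, ih (Fin.tail h) (fun j => hh _) y hy (by simp only [Fin.tail]; omega),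
      ih (Fin.tail h) (fun j => hh _) (y + h 0) (by omega) (by simp only [Fin.tail]; omega), map_one, mul_one]

lemma tsum_gowersProd_one_ge (n k : ℕ) (hn : 1 ≤ n) (f : ℤ → ℂ) (hf : ∀ y : ℤ, f y = if 1 ≤ y ∧ y ≤ n then 1 else 0) :
    ((n : ℝ) / (k + 1)) ^ (k + 1) ≤ (∑' nh : ℤ × (Fin k → ℤ), gowersProd k f nh.1 nh.2).re := by
  obtain ⟨u, hu⟩ : ∃ u, u = (n - 1) / (k + 1) := ⟨_, rfl⟩
  have hun : (k + 1) * u + 1 ≤ n := by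
    have := Nat.mul_div_le (n - 1) (k + 1)
    rw [hu]; omega
  have hnu : n ≤ (k + 1) * (u + 1) := by
    have := Nat.lt_mul_div_succ (n - 1) (by omega : 0 < k + 1)
    rw [← hu] at this; omega
  have hsupp : ∀ w, w ∉ Ico (0 : ℤ) (n + 1 : ℕ) → f w = 0 := by
    intro w hw
    rw [hf, if_neg]
    rintro ⟨h1, h2⟩
    apply hw
    rw [mem_Ico]; push_cast; omega
  have h01 : ∀ y, f y = 0 ∨ f y = 1 := by
    intro y; rw [hf]; split_ifs <;> simp
  rw [tsum_gowersProd_eq_sum (n + 1) k f hsupp, ← sum_product', Complex.re_sum]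
  set S := Fintype.piFinset (fun _ : Fin k => Icc (0 : ℤ) u) ×ˢ Icc (1 : ℤ) (u + 1) with hS
  have hk1 : (k:ℤ) * u + u + 1 ≤ n := by
    have : ((k + 1) * u + 1 : ℤ) ≤ n := by exact_mod_cast hun
    linarith
  have hku : (0:ℤ) ≤ k * u := by positivity
  have hsub : S ⊆ Fintype.piFinset (fun _ : Fin k => Ioo (-((n + 1 : ℕ) : ℤ)) ((n + 1 : ℕ) : ℤ)) ×ˢ
      Ico (0 : ℤ) ((n + 1 : ℕ) : ℤ) := by
    rintro ⟨h, y⟩ hp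
    rw [hS, mem_product, Fintype.mem_piFinset, mem_Icc] at hp
    rw [mem_product, Fintype.mem_piFinset, mem_Ico]
    simp only at hp ⊢
    refine ⟨fun j => ?_, by omega, by push_cast; omega⟩
    have := hp.1 j
    rw [mem_Icc] at this
    rw [mem_Ioo]
    push_cast
    omega
  have hnn : ∀ p : (Fin k → ℤ) × ℤ, 0 ≤ (cubeDeriv k p.1 f p.2).re := by
    intro p
    rcases cubeDeriv_zero_or_one f h01 k p.1 p.2 with h | h <;> rw [h] <;> simp
  calc ((n : ℝ) / (k + 1)) ^ (k + 1) ≤ ((u : ℝ) + 1) ^ (k + 1) := by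
        refine pow_le_pow_left₀ (by positivity) ?_ _
        rw [div_le_iff₀ (by positivity)]
        have : (n:ℝ) ≤ (k + 1) * (u + 1) := by exact_mod_cast hnu
        linarith
    _ = ∑ p ∈ S, (1:ℝ) := by
        rw [sum_const, hS, card_product, Fintype.card_piFinset]
        simp only [Int.card_Icc, prod_const, card_univ, Fintype.card_fin]
        have e1 : ((u:ℤ) + 1 - 0).toNat = u + 1 := by omega
        have e2 : ((u:ℤ) + 1 + 1 - 1).toNat = u + 1 := by omega
        rw [e1, e2, nsmul_eq_mul]
        push_cast; ring
    _ ≤ ∑ p ∈ S, (cubeDeriv k p.1 f p.2).re := by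
        refine sum_le_sum fun p hp => ?_
        rw [hS, mem_product, Fintype.mem_piFinset, mem_Icc] at hp
        have hb : ∑ j, p.1 j ≤ k * u := by
          calc ∑ j, p.1 j ≤ ∑ _j : Fin k, (u:ℤ) := sum_le_sum fun j _ => (mem_Icc.1 (hp.1 j)).2
            _ = k * u := by simp
        rw [cubeDeriv_eq_one n f (fun y h1 h2 => by rw [hf, if_pos ⟨h1, h2⟩]) k p.1 (fun j => (mem_Icc.1 (hp.1 j)).1) p.2 hp.2.1
          (by omega)]
        simp
    _ ≤ _ := sum_le_sum_of_subset_of_nonneg hsub fun p _ _ => hnn p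

lemma energy_le (n r : ℕ) (Λ : ℝ) (hΛ : 0 < Λ)
    (h : classEnergy r n 1 ≤ 1 / Λ * (n + 1 : ℕ) ^ (r + 2)) :
    ∑ k ∈ Fintype.piFinset (fun _ : Fin r => Ioo (-(n + 1 : ℕ) : ℤ) (n + 1 : ℕ)),
      ‖∑ w ∈ Ico (0 : ℤ) (n + 1 : ℕ), cubeDeriv r k (muN n) w‖ ^ 2 ≤ 5 ^ r * (n + 1 : ℕ) ^ (r + 2) / √Λ := by
  obtain ⟨X, hX⟩ : ∃ X, X = n + 1 := ⟨_, rfl⟩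
  have hX0 : (1:ℝ) ≤ X := by rw [hX]; push_cast; linarith [(Nat.cast_nonneg n : (0:ℝ) ≤ n)]
  have hcl : classFn n 1 0 = muN n := by funext w; simp [classFn]
  have hsupp : ∀ w, w ∉ Ico (0 : ℤ) X → muN n w = 0 := by
    intro w hw
    rw [← hcl]
    exact classFn_support n 1 0 one_pos w (by rwa [Nat.div_one, ← hX])
  rw [← hX] at h ⊢
  set V := ∑ k : Fin r → ZMod (4 * X + 1), ‖∑ y, cubeDeriv r k (liftZ (4 * X + 1) (muN n)) y‖ with hV
  have hbox := sum_box_le_sum_zmod X (muN n) hsupp r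
  have hen : classEnergy r n 1 = ∑ k : Fin r → ZMod (4 * X + 1), ‖∑ y, cubeDeriv r k (liftZ (4 * X + 1) (muN n)) y‖ ^ 2 := by
    have hX' : X = n / 1 + 1 := by rw [hX, Nat.div_one]
    subst hX'
    rw [classEnergy, range_one, sum_singleton, hcl]
  have hV2 : V ^ 2 ≤ (5 ^ r * X ^ (r + 1)) ^ 2 / Λ := by
    calc V ^ 2 ≤ (4 * X + 1) ^ r * classEnergy r n 1 := by
          rw [hen, hV]
          refine sq_sum_le_card_mul_sum_sq.trans (le_of_eq ?_)
          rw [card_univ, Fintype.card_fun, ZMod.card, Fintype.card_fin]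
          push_cast; ring
      _ ≤ (5 * X) ^ r * (1 / Λ * X ^ (r + 2)) := by
          have h0 : 0 ≤ classEnergy r n 1 := sum_nonneg fun _ _ => sum_nonneg fun _ _ => by positivity
          refine mul_le_mul (pow_le_pow_left₀ (by positivity) (by linarith) r) h h0 (by positivity)
      _ = 5 ^ r * X ^ (2 * (r + 1)) / Λ := by rw [mul_pow]; ring
      _ ≤ (5 ^ r * X ^ (r + 1)) ^ 2 / Λ := by
          have : (5:ℝ) ^ r ≤ (5 ^ r) ^ 2 := le_self_pow₀ (one_le_pow₀ (by norm_num)) (by norm_num)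
          rw [mul_pow, ← pow_mul (X:ℝ), mul_comm (r + 1) 2]
          gcongr
  have hV1 : V ≤ 5 ^ r * X ^ (r + 1) / √Λ := by
    refine le_of_sq_le_sq (hV2.trans (le_of_eq ?_)) (by positivity)
    rw [div_pow, Real.sq_sqrt hΛ.le]
  have hin : ∀ k : Fin r → ℤ, ‖∑ w ∈ Ico (0 : ℤ) X, cubeDeriv r k (muN n) w‖ ≤ X := by
    intro k
    refine (norm_sum_le _ _).trans ((sum_le_sum fun w _ => norm_cubeDeriv_le r k (muN n) (norm_muN_le n) w).trans ?_)
    simp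
  calc _ ≤ ∑ k ∈ Fintype.piFinset (fun _ : Fin r => Ioo (-X : ℤ) X), X * ‖∑ w ∈ Ico (0 : ℤ) X, cubeDeriv r k (muN n) w‖ := by
        refine sum_le_sum fun k _ => ?_
        rw [sq]
        exact mul_le_mul_of_nonneg_right (hin k) (norm_nonneg _)
    _ ≤ X * V := by rw [← mul_sum]; gcongr
    _ ≤ X * (5 ^ r * X ^ (r + 1) / √Λ) := by gcongr
    _ = _ := by ring

lemma energy_le_trivial (n r : ℕ) :
    ∑ k ∈ Fintype.piFinset (fun _ : Fin r => Ioo (-(n + 1 : ℕ) : ℤ) (n + 1 : ℕ)),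
      ‖∑ w ∈ Ico (0 : ℤ) (n + 1 : ℕ), cubeDeriv r k (muN n) w‖ ^ 2 ≤ 5 ^ r * (n + 1 : ℕ) ^ (r + 2) := by
  obtain ⟨X, hX⟩ : ∃ X, X = n + 1 := ⟨_, rfl⟩
  rw [← hX]
  calc _ ≤ ∑ k ∈ Fintype.piFinset (fun _ : Fin r => Ioo (-X : ℤ) X), (X:ℝ) ^ 2 := by
        refine sum_le_sum fun k _ => pow_le_pow_left₀ (norm_nonneg _) ?_ 2
        refine (norm_sum_le _ _).trans ((sum_le_sum fun w _ => norm_cubeDeriv_le r k (muN n) (norm_muN_le n) w).trans ?_)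
        simp
    _ ≤ (5 * X) ^ r * X ^ 2 := by
        rw [sum_const, nsmul_eq_mul, Fintype.card_piFinset]
        simp only [Int.card_Ioo, prod_const, card_univ, Fintype.card_fin, Nat.cast_pow]
        gcongr
        have : ((X:ℤ) - -X - 1).toNat ≤ 5 * X := by omega
        exact_mod_cast this
    _ = _ := by rw [mul_pow]; ring

lemma gowersUN_moebius_le (r : ℕ) (N : ℝ) (hN : 1 ≤ N) (ε : ℝ)
    (h : ∑ k ∈ Fintype.piFinset (fun _ : Fin (r + 1) => Ioo (-(⌊N⌋₊ + 1 : ℕ) : ℤ) (⌊N⌋₊ + 1 : ℕ)),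
      ‖∑ w ∈ Ico (0 : ℤ) (⌊N⌋₊ + 1 : ℕ), cubeDeriv (r + 1) k (muN ⌊N⌋₊) w‖ ^ 2 ≤
        5 ^ (r + 1) * (⌊N⌋₊ + 1 : ℕ) ^ (r + 3) * ε) :
    gowersUN (r + 2) N (fun n => (ArithmeticFunction.moebius n.toNat : ℂ)) ≤
      (5 ^ (r + 1) * (2 * (r + 3)) ^ (r + 3) * ε) ^ ((1:ℝ) / 2 ^ (r + 2)) := by
  set n := ⌊N⌋₊ with hn
  have hn1 : 1 ≤ n := Nat.le_floor (by exact_mod_cast hN)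
  have hle : ∀ y : ℤ, (1 ≤ y ∧ (y:ℝ) ≤ N) ↔ (1 ≤ y ∧ y ≤ n) := by
    intro y
    refine and_congr_right fun hy => ?_
    rw [hn, Int.natCast_floor_eq_floor (by linarith), Int.le_floor]
  have e1 : truncN N (fun n => (ArithmeticFunction.moebius n.toNat : ℂ)) = muN n := by
    funext y
    simp only [truncN, muN, hle]
    rfl
  have e2 : ∀ y : ℤ, truncN N (fun _ => 1) y = if 1 ≤ y ∧ y ≤ n then 1 else 0 := by
    intro y
    simp only [truncN, hle]
  have hsupp : ∀ w, w ∉ Ico (0 : ℤ) (n + 1 : ℕ) → muN n w = 0 := by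
    intro w hw
    rw [muN, if_neg]
    rintro ⟨h1, h2⟩
    apply hw
    rw [mem_Ico]; push_cast; omega
  have hone := tsum_gowersProd_one_ge n (r + 2) hn1 _ e2
  rw [← tsum_gowersProd_succ (n + 1) (r + 1) (muN n) hsupp] at h
  have hU0 : 0 ≤ (∑' nh : ℤ × (Fin (r + 1 + 1) → ℤ), gowersProd (r + 1 + 1) (muN n) nh.1 nh.2).re := by
    rw [tsum_gowersProd_succ (n + 1) (r + 1) (muN n) hsupp]
    exact sum_nonneg fun _ _ => by positivity
  have hn1' : (1:ℝ) ≤ n := by exact_mod_cast hn1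
  have hone0 := lt_of_lt_of_le (by positivity) hone
  rw [gowersUN, gowersTildeU, gowersTildeU, e1, ← Real.div_rpow hU0 hone0.le]
  refine Real.rpow_le_rpow (div_nonneg hU0 hone0.le) ?_ (by positivity)
  have hε : 0 ≤ ε := by
    by_contra hε
    push Not at hε
    have : 5 ^ (r + 1) * ((n + 1 : ℕ) : ℝ) ^ (r + 3) * ε < 0 := mul_neg_of_pos_of_neg (by positivity) hε
    linarith
  rw [div_le_iff₀ hone0]
  refine h.trans (le_trans ?_ (mul_le_mul_of_nonneg_left hone (by positivity)))
  have e3 : (5:ℝ) ^ (r + 1) * (2 * (r + 3)) ^ (r + 3) * ε * ((n : ℝ) / ((r + 2 : ℕ) + 1)) ^ (r + 2 + 1) =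
      5 ^ (r + 1) * (2 * n) ^ (r + 3) * ε := by
    have : (2 * (n:ℝ)) = (2 * (r + 3)) * (n / ((r + 2 : ℕ) + 1)) := by
      push_cast
      field_simp
      ring
    rw [this, mul_pow (2 * ((r:ℝ) + 3)) ((n:ℝ) / ((r + 2 : ℕ) + 1)) (r + 3)]
    exact (mul_right_comm _ _ _).trans (by rw [mul_assoc (5 ^ (r + 1) : ℝ)])
  rw [e3]
  gcongr
  push_cast
  linarith

lemma exp_exp_half_le_floor (N : ℝ) (hN : 3 ≤ N) (hL : 2 ≤ Real.log (Real.log N)) :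
    Real.exp (Real.exp (Real.log (Real.log N) / 2)) ≤ ⌊N⌋₊ := by
  set s := Real.exp (Real.log (Real.log N) / 2) with hs
  have hlog : 0 < Real.log N := Real.log_pos (by linarith)
  have hs2 : s ^ 2 = Real.log N := by
    rw [hs, ← Real.exp_nat_mul]
    push_cast
    rw [mul_div_cancel₀ _ two_ne_zero, Real.exp_log hlog]
  have h2 : 2 ≤ s := by
    have := Real.add_one_le_exp (Real.log (Real.log N) / 2)
    linarith
  have hE : 2 ≤ Real.exp s := by
    have := Real.add_one_le_exp s
    linarith
  have hN' : Real.exp s * Real.exp s ≤ N := by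
    rw [← Real.exp_add, ← Real.exp_log (by linarith : 0 < N), ← hs2]
    exact Real.exp_le_exp.2 (by nlinarith)
  have := Nat.lt_floor_add_one N
  nlinarith

end

theorem mobius_doubly_logarithmic_gowers_uniformity (k : ℕ) (hk : 2 ≤ k) :
    ∃ c C : ℝ, 0 < c ∧ 0 < C ∧ ∀ N : ℝ, 3 ≤ N →
      gowersUN k N (fun n => (ArithmeticFunction.moebius n.toNat : ℂ)) ≤
        C * Real.log (Real.log N) ^ (-c) := by
  obtain ⟨r, rfl⟩ : ∃ r, k = r + 2 := ⟨k - 2, by omega⟩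
  obtain ⟨A, hA⟩ := classEnergy_lt r
  set K : ℝ := 5 ^ (r + 1) * (2 * (r + 3)) ^ (r + 3) with hK
  set e : ℝ := (1:ℝ) / 2 ^ (r + 2) with he
  set T : ℝ := 2 * ((A + 1 : ℕ) : ℝ) ^ (A + 1) with hT
  set c : ℝ := 1 / ((A + 1 : ℕ) : ℝ) * (1 / 2) * e with hc
  have hK0 : 0 < K := by positivity
  have he0 : 0 < e := by positivity
  have hc0 : 0 < c := by positivity
  have hA1 : (1:ℝ) ≤ ((A + 1 : ℕ) : ℝ) := by exact_mod_cast Nat.le_add_left 1 A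
  have hT2 : 2 ≤ T := by
    rw [hT]
    linarith [one_le_pow₀ hA1 (n := A + 1)]
  refine ⟨c, K ^ e * T ^ c, hc0, by positivity, fun N hN => ?_⟩
  have hlog1 : 1 < Real.log N := by
    rw [Real.lt_log_iff_exp_lt (by linarith)]
    linarith [Real.exp_one_lt_d9]
  have hL0 : 0 < Real.log (Real.log N) := Real.log_pos hlog1
  set L := Real.log (Real.log N) with hL
  by_cases hLT : L < T
  · refine (gowersUN_moebius_le r N (by linarith) 1 (by simpa using energy_le_trivial ⌊N⌋₊ (r + 1))).trans ?_
    rw [mul_one, mul_assoc, Real.rpow_neg hL0.le, ← div_eq_mul_inv, ← Real.div_rpow (by linarith) hL0.le]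
    refine le_mul_of_one_le_right (by positivity) (Real.one_le_rpow ?_ hc0.le)
    rw [one_le_div hL0]
    exact hLT.le
  · push Not at hLT
    set Λ : ℝ := (L / 2) ^ (1 / ((A + 1 : ℕ) : ℝ)) with hΛ
    have hΛp : Λ ^ (A + 1) = L / 2 := by
      rw [hΛ, one_div, Real.rpow_inv_natCast_pow (by positivity) (Nat.succ_ne_zero A)]
    have hΛ0 : 0 < Λ := by positivity
    have hΛA : ((A + 1 : ℕ) : ℝ) ≤ Λ := by
      refine le_of_pow_le_pow_left₀ (by omega : A + 1 ≠ 0) hΛ0.le ?_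
      rw [hΛp]
      linarith
    have hΛ1 : Λ ^ A ≤ L / 2 := by
      rw [← hΛp]
      exact pow_le_pow_right₀ (hA1.trans hΛA) (Nat.le_succ A)
    have hen := hA Λ (le_trans (by push_cast; linarith) hΛA) ⌊N⌋₊ 1 one_pos
      (by rw [Nat.cast_one]; exact Real.one_le_exp hΛ0.le)
      ((Real.exp_le_exp.2 (Real.exp_le_exp.2 hΛ1)).trans (exp_exp_half_le_floor N hN (hT2.trans hLT)))
    have h1 := energy_le ⌊N⌋₊ (r + 1) Λ hΛ0 (by simpa [Nat.div_one] using hen.le)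
    refine (gowersUN_moebius_le r N (by linarith) (1 / √Λ) (by rw [mul_one_div]; exact h1)).trans ?_
    rw [← hK, Real.mul_rpow hK0.le (by positivity), mul_assoc]
    refine mul_le_mul_of_nonneg_left ?_ (by positivity)
    have e1 : (1 / √Λ) ^ e = (L / 2) ^ (-c) := by
      rw [Real.sqrt_eq_rpow, hΛ, ← Real.rpow_mul (by positivity), one_div, ← Real.rpow_neg (by positivity),
        ← Real.rpow_mul (by positivity), hc]
      congr 1
      ring
    rw [e1, Real.div_rpow hL0.le two_pos.le, div_eq_inv_mul, Real.rpow_neg two_pos.le, inv_inv]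
    exact mul_le_mul_of_nonneg_right (Real.rpow_le_rpow two_pos.le hT2 hc0.le) (by positivity)
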